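/- Let n ≥ 1, s > 0, θ > 1/2, 0 ≤ a ≤ 1, and let p ∈ [1,∞], q ∈ (1,∞) satisfy max((1+2a−4s)/3, (1+a−4s)/2, min(a,1)/2) < 1/q < (1+a)/2, 1 − 2/q + a − 2s ≤ 1/p ≤ (1/2)(1 − 1/q), and 1/p < 1 − 2/q + a. Then there exist ε₀ > 0 and C such that: if A_0, f, φ are Schwartz M_n(ℂ)-valued functions on ℝ^{1+2} satisfying △A_0 = −∂_1[A_0,∂_2 f] + ∂_2[A_0,∂_1 f] + ∂_1[∂_1 f,φ] + ∂_2[∂_2 f,φ] pointwise and ‖∇f‖_{H^{s,θ}} ≤ ε₀, then ‖A_0‖_{L^p_t Ẇ^{a,q}_x} ≤ C·‖φ‖_{H^{s,θ}}·‖∇f‖_{H^{s,θ}}. -/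

import Mathlib

noncomputable section

open MeasureTheory Real
open scoped ENNReal RealInnerProductSpace

/-- The spatial domain `ℝ²`. -/
abbrev V2 : Type := EuclideanSpace ℝ (Fin 2)

/-- Space-time Fourier transform on `ℝ^{1+2}`, convention `e^{-i(tτ + x·ξ)}`. -/
def ftST (u : ℝ × V2 → ℂ) (τ : ℝ) (ξ : V2) : ℂ :=
  ∫ p : ℝ × V2, Complex.exp (-Complex.I * ((p.1 * τ + ⟪p.2, ξ⟫ : ℝ) : ℂ)) * u p

/-- The weight `(1+|ξ|²)^{s/2} (1+||τ|-|ξ||)^θ`. -/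
def wgt (s θ τ : ℝ) (ξ : V2) : ℝ :=
  (1 + ‖ξ‖ ^ 2) ^ (s / 2) * (1 + |(|τ| - ‖ξ‖)|) ^ θ

/-- The Wave–Sobolev norm `H^{s,θ}` on `ℝ^{1+2}`. -/
def HN (s θ : ℝ) (u : ℝ × V2 → ℂ) : ℝ≥0∞ :=
  (∫⁻ q : ℝ × V2, (ENNReal.ofReal (wgt s θ q.1 q.2) * (‖ftST u q.1 q.2‖₊ : ℝ≥0∞)) ^ (2 : ℕ)) ^
    ((1 : ℝ) / 2)

/-- Time derivative `∂ₜ u`. -/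
def dtime (u : ℝ × V2 → ℂ) : ℝ × V2 → ℂ :=
  fun p => fderiv ℝ u p ((1 : ℝ), (0 : V2))

/-- The norm of `𝓗^{s,θ}`: `‖u‖_{H^{s,θ}} + ‖∂ₜu‖_{H^{s-1,θ}}`. -/
def HHN (s θ : ℝ) (u : ℝ × V2 → ℂ) : ℝ≥0∞ :=
  HN s θ u + HN (s - 1) θ (dtime u)

/-- Spatial partial derivative `∂ⱼ u`, `j = 0, 1`. -/
def pdx (j : Fin 2) (u : ℝ × V2 → ℂ) : ℝ × V2 → ℂ :=
  fun p => fderiv ℝ u p ((0 : ℝ), EuclideanSpace.single j 1)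

/-- Inverse space-time Fourier transform. -/
def iftST (F : ℝ → V2 → ℂ) (t : ℝ) (x : V2) : ℂ :=
  ((((2 * π) ^ 3)⁻¹ : ℝ) : ℂ) *
    ∫ q : ℝ × V2, Complex.exp (Complex.I * ((t * q.1 + ⟪x, q.2⟫ : ℝ) : ℂ)) * F q.1 q.2

/-- The space-time Fourier multiplier with symbol `m`. -/
def mult (m : ℝ → V2 → ℂ) (u : ℝ × V2 → ℂ) : ℝ × V2 → ℂ :=
  fun p => iftST (fun τ ξ => m τ ξ * ftST u τ ξ) p.1 p.2

/-- Spatial Fourier transform on `ℝ²`, convention `e^{-i x·ξ}`. -/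
def ft2 (g : V2 → ℂ) (ξ : V2) : ℂ :=
  ∫ x : V2, Complex.exp (-Complex.I * ((⟪x, ξ⟫ : ℝ) : ℂ)) * g x

/-- Inverse spatial Fourier transform on `ℝ²`. -/
def ift2 (G : V2 → ℂ) (x : V2) : ℂ :=
  ((((2 * π) ^ 2)⁻¹ : ℝ) : ℂ) *
    ∫ ξ : V2, Complex.exp (Complex.I * ((⟪x, ξ⟫ : ℝ) : ℂ)) * G ξ

/-- The spatial Fourier multiplier `D_x^a` with symbol `|ξ|^a`, acting on functions
on space-time for each fixed time. -/
def DxA (a : ℝ) (u : ℝ × V2 → ℂ) : ℝ × V2 → ℂ :=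
  fun p => ift2 (fun ξ => ((‖ξ‖ ^ a : ℝ) : ℂ) * ft2 (fun y => u (p.1, y)) ξ) p.2

/-- Entrywise coercion of a Schwartz matrix-valued function to a matrix of functions. -/
def cF {n : ℕ} (A : Fin n → Fin n → SchwartzMap (ℝ × V2) ℂ) :
    Fin n → Fin n → (ℝ × V2 → ℂ) :=
  fun i k => ⇑(A i k)

/-- Entrywise commutator `[U,V] = UV - VU` of matrix-valued functions. -/
def mcomm {n : ℕ} (U V : Fin n → Fin n → (ℝ × V2 → ℂ)) (i k : Fin n) :
    ℝ × V2 → ℂ :=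
  fun p => (∑ l, U i l p * V l k p) - ∑ l, V i l p * U l k p

/-- The matrix `∂ⱼ f` of spatial partial derivatives of a Schwartz matrix-valued map. -/
def pdf {n : ℕ} (j : Fin 2) (f : Fin n → Fin n → SchwartzMap (ℝ × V2) ℂ) :
    Fin n → Fin n → (ℝ × V2 → ℂ) :=
  fun i k => pdx j ⇑(f i k)

/-- `H^{s,θ}` norm of a matrix-valued function, applied entrywise and summed. -/
def HNM {n : ℕ} (s θ : ℝ) (U : Fin n → Fin n → (ℝ × V2 → ℂ)) : ℝ≥0∞ :=
  ∑ i, ∑ k, HN s θ (U i k)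

/-- `‖∇f‖_{H^{s,θ}} = (‖∂₁f‖² + ‖∂₂f‖²)^{1/2}`. -/
def gradN {n : ℕ} (s θ : ℝ) (f : Fin n → Fin n → SchwartzMap (ℝ × V2) ℂ) : ℝ≥0∞ :=
  (HNM s θ (pdf 0 f) ^ (2 : ℕ) + HNM s θ (pdf 1 f) ^ (2 : ℕ)) ^ ((1 : ℝ) / 2)

/-- The elliptic equation
`△A₀ = -∂₁[A₀,∂₂f] + ∂₂[A₀,∂₁f] + ∂₁[∂₁f,φ] + ∂₂[∂₂f,φ]`, holding pointwise. -/
def EllipticEq {n : ℕ} (A0 f φ : Fin n → Fin n → SchwartzMap (ℝ × V2) ℂ) : Prop :=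
  ∀ (i k : Fin n) (p : ℝ × V2),
    pdx 0 (pdx 0 ⇑(A0 i k)) p + pdx 1 (pdx 1 ⇑(A0 i k)) p =
      -pdx 0 (mcomm (cF A0) (pdf 1 f) i k) p + pdx 1 (mcomm (cF A0) (pdf 0 f) i k) p +
        pdx 0 (mcomm (pdf 0 f) (cF φ) i k) p + pdx 1 (mcomm (pdf 1 f) (cF φ) i k) p

/-- Pointwise norm of a matrix of functions (entrywise and summed). -/
def mE {n : ℕ} (U : Fin n → Fin n → (ℝ × V2 → ℂ)) (p : ℝ × V2) : ℝ≥0∞ :=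
  ∑ i, ∑ k, (‖U i k p‖₊ : ℝ≥0∞)

/-- Entrywise application of the multiplier `D_x^a` to a matrix of functions. -/
def DxU {n : ℕ} (a : ℝ) (U : Fin n → Fin n → (ℝ × V2 → ℂ)) :
    Fin n → Fin n → (ℝ × V2 → ℂ) :=
  fun i k => DxA a (U i k)

/-- Spatial `L^q` norm of a matrix-valued function at fixed time `t`. -/
def LqAt {n : ℕ} (q : ℝ) (U : Fin n → Fin n → (ℝ × V2 → ℂ)) (t : ℝ) : ℝ≥0∞ :=
  (∫⁻ x : V2, mE U (t, x) ^ q) ^ q⁻¹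

/-- `L^p` norm in time, written in terms of `rp = 1/p ∈ [0,1]`; `rp = 0` is `L^∞`. -/
def LtR (rp : ℝ) (F : ℝ → ℝ≥0∞) : ℝ≥0∞ :=
  if rp = 0 then essSup F volume else (∫⁻ t : ℝ, F t ^ rp⁻¹) ^ rp

/-- `L^p` norm in time, `p` finite. -/
def Ltp (p : ℝ) (F : ℝ → ℝ≥0∞) : ℝ≥0∞ :=
  (∫⁻ t : ℝ, F t ^ p) ^ p⁻¹

section
open Set
open Complex.HadamardThreeLines (verticalClosedStrip)
open ENNReal (ofReal_lt_ofReal_iff_of_nonneg eq_top_of_forall_nnreal_le lintegral_mul_le_Lp_mul_Lq lintegral_mul_norm_pow_le ofReal_rpow_of_nonneg ofReal_le_ofReal_iff ofReal_rpow_of_pos mul_rpow_of_nonneg orderIsoRpow_apply ofReal_coe_nnreal zero_rpow_of_neg ofReal_le_ofReal zero_rpow_of_pos top_rpow_of_pos toReal_ofReal ofReal_le_one orderIsoRpow ofReal_mul' ofReal_mul ofReal_one ofReal_add top_mul mul_top ofReal)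
open MeasureTheory.Measure.prod (instIsAddHaarMeasure)
open Measurable (lintegral_prod_right')
open WithLp (prodContinuousLinearEquiv prod_inner_apply toLp)
open Continuous (aestronglyMeasurable stronglyMeasurable measurable rpow_const)
open Filter.Eventually (of_forall)
open PiLp (volume_preserving_toLp norm_apply_le)
open MeasurableEquiv (finTwoArrow)
open MeasureTheory.Measure (integral_comp_smul restrict_restrict volume_eq_prod prod_restrict ae_ne)
open SchwartzMap (fourierInv_coe fourier_coe)
open EuclideanSpace (norm_sq_eq norm_eq)
open Complex (normSq_eq_norm_sq measurable_ofReal continuous_conj abs_im_le_norm abs_re_le_norm normSq_apply conj_ofReal ofReal_zero re_le_norm ofReal_pow norm_real real_smul ofRealCLM ofReal_re ofReal_im mul_conj' norm_exp exp_conj sq_norm norm_I conj_I mul_re I_sq)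
open Filter.Tendsto (mul_const)
open Metric (ball_mem_nhds isOpen_ball closedBall)
open RCLike (enorm_conj norm_conj)
open Fin (sum_univ_two)
open Filter (Tendsto atTop)
open Nat (factorial)
open Prod (fst_swap snd_swap)
open Or (inl inr)
local notation "mitx" => Measurable.ite (measurableSet_lt (by fun_prop) (by fun_prop)) measurable_const measurable_const
local notation "mlt" => measurableSet_lt (by fun_prop) (by fun_prop)
local notation "Iop" => Ioi (0:ℝ)
local notation "lcmu" => lintegral_const_mul
local notation "onee" => ofReal_norm_eq_enorm
local notation "Erm" => ENNReal.rpow_mul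
local notation "Ert" => ENNReal.rpow_ne_top_of_nonneg
local notation "Emn" => ENNReal.mul_rpow_of_nonneg
local notation "ltgc" => lintegral_congr
local notation "eile" => enorm_integral_le_lintegral_enorm
local notation "ps" => (by positivity)
local notation "fp" => (by fun_prop)
local notation "nu" => (by norm_num)
local notation "la" => (by linarith)
local notation "hfr" => (1 / 2 : ℝ)
local notation "mth" => (-(3 / 2) : ℝ)
local notation "IC" => Complex.I
local notation "ENN" => ℝ≥0∞
local notation "SW" => SchwartzMap (ℝ × V2) ℂ
local notation "RV" => (ℝ × V2)
lemma pw_real (p A : ℝ) (hp : 0 < p) (hA : 0 ≤ A) :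
    ∫⁻ a in Ioo (0:ℝ) A, ofReal a ^ (p-1) = ofReal A ^ p * ofReal p⁻¹ := by
  have h1 : ∫⁻ a in Ioo (0:ℝ) A, ofReal a ^ (p-1)
      = ∫⁻ a in Ioo (0:ℝ) A, ofReal (a ^ (p-1)) :=
    setLIntegral_congr_fun measurableSet_Ioo fun a ha => by
      simp only [ofReal_rpow_of_pos ha.1]
  have hi := (intervalIntegral.intervalIntegrable_rpow' (a := 0) (b := A) (r := p-1) la)
  rw [intervalIntegrable_iff_integrableOn_Ioo_of_le hA] at hi
  rw [h1, ← ofReal_integral_eq_lintegral_ofReal hi, ← integral_Ioc_eq_integral_Ioo,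
    ← intervalIntegral.integral_of_le hA, integral_rpow (inl la),
    ofReal_rpow_of_nonneg hA hp.le, ← ofReal_mul ps]
  · congr 1
    rw [sub_add_cancel, zero_rpow hp.ne']; ring
  · filter_upwards [ae_restrict_mem measurableSet_Ioo] with a ha
    exact rpow_nonneg ha.1.le _

lemma pw_lt (p : ℝ) (hp : 0 < p) (c : ENN) :
    ∫⁻ a in Iop, ofReal a ^ (p-1) * (if ofReal a < c then 1 else 0)
      = c ^ p * ofReal p⁻¹ := by
  have key : ∀ A : ℝ, 0 ≤ A → ∫⁻ a in Iop, ofReal a ^ (p-1) *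
      (if ofReal a < ofReal A then 1 else 0)
      = ofReal A ^ p * ofReal p⁻¹ := by
    intro A hA
    rw [← pw_real p A hp hA, ← Ioi_inter_Iio, inter_comm, ← restrict_restrict measurableSet_Iio,
      ← lintegral_indicator measurableSet_Iio]
    refine setLIntegral_congr_fun measurableSet_Ioi fun a ha => ?_
    have : ofReal a < ofReal A ↔ a < A :=
      ofReal_lt_ofReal_iff_of_nonneg (le_of_lt ha)
    simp [indicator, this]
  by_cases hc : c = ⊤
  · subst hc
    rw [top_rpow_of_pos hp, top_mul (by simpa using hp)]
    refine eq_top_of_forall_nnreal_le fun r => ?_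
    have h := key ((r * p) ^ p⁻¹) ps
    rw [ofReal_rpow_of_nonneg ps hp.le, ← rpow_mul ps,
      inv_mul_cancel₀ hp.ne', rpow_one, ← ofReal_mul ps,
      mul_inv_cancel_right₀ hp.ne', ofReal_coe_nnreal] at h
    rw [← h]
    refine lintegral_mono fun a => mul_le_mul_right ?_ _
    split_ifs <;> simp_all
  · lift c to NNReal using hc
    simpa using key c c.2

lemma pw_gt (l : ℝ) (hl : 0 < l) (c : ENN) (hc : c ≠ ⊤) :
    ∫⁻ a in Iop, ofReal a ^ (-l-1) * (if c < ofReal a then 1 else 0)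
      = c ^ (-l) * ofReal l⁻¹ := by
  lift c to NNReal using hc
  have key : ∀ A : ℝ, 0 < A → ∫⁻ a in Iop, ofReal a ^ (-l-1) *
      (if ofReal A < ofReal a then 1 else 0)
      = ofReal A ^ (-l) * ofReal l⁻¹ := by
    intro A hA
    have e : ∫⁻ a in Iop, ofReal a ^ (-l-1) *
      (if ofReal A < ofReal a then 1 else 0)
       = ∫⁻ a in Ioi A, ofReal (a ^ (-l-1)) := by
      rw [show Ioi A = Ioi A ∩ Ioi 0 by rw [Ioi_inter_Ioi, sup_eq_left.2 hA.le],
        ← restrict_restrict (measurableSet_Ioi (a := A)),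
        ← lintegral_indicator (measurableSet_Ioi (a := A))]
      refine setLIntegral_congr_fun measurableSet_Ioi fun a ha => ?_
      have : ofReal A < ofReal a ↔ A < a :=
        ofReal_lt_ofReal_iff_of_nonneg hA.le
      simp [indicator, this, ofReal_rpow_of_pos (mem_Ioi.1 ha)]
    rw [e, ← ofReal_integral_eq_lintegral_ofReal (integrableOn_Ioi_rpow_of_lt la hA),
      integral_Ioi_rpow_of_lt la hA, ofReal_rpow_of_pos hA,
      ← ofReal_mul ps]
    · congr 1; rw [sub_add_cancel]; field_simp
    · filter_upwards [ae_restrict_mem measurableSet_Ioi] with a ha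
      exact rpow_nonneg (hA.trans ha).le _
  by_cases h0 : c = 0
  · subst h0
    rw [ENNReal.coe_zero, zero_rpow_of_neg la, top_mul (by simpa using hl)]
    refine eq_top_of_forall_nnreal_le fun r => ?_
    have h := key (((r+1) * l) ^ (-l⁻¹)) ps
    rw [ofReal_rpow_of_pos ps, ← rpow_mul ps,
      neg_mul_neg, inv_mul_cancel₀ hl.ne', rpow_one, ← ofReal_mul ps,
      mul_inv_cancel_right₀ hl.ne'] at h
    refine le_trans ?_ (h.symm.le.trans (lintegral_mono fun a => mul_le_mul_right ?_ _))
    · rw [← ofReal_coe_nnreal]; exact ofReal_le_ofReal la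
    split_ifs with h1 h2
    · rfl
    · exact absurd (bot_le.trans_lt h1) h2
    · exact bot_le
    · rfl
  · simpa using key c ps

section hls
variable {E : Type*} [MetricSpace E] [MeasurableSpace E] [BorelSpace E]
  [SecondCountableTopology E] (μ : Measure E) [SFinite μ]

lemma bath (d l : ℝ) (hl : 0 < l) (hld : l < d) (V : ENN) (hV : V ≠ ⊤)
    (hball : ∀ x : E, ∀ ρ : ℝ, 0 < ρ → μ (Metric.ball x ρ) ≤ V * ofReal ρ ^ d) :
    ∃ C : ENN, C ≠ ⊤ ∧ ∀ (x : E) (B : Set E), MeasurableSet B →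
      ∫⁻ y in B, edist x y ^ (-l) ∂μ ≤ C * μ B ^ (1 - l/d) := by
  have hd := hl.trans hld
  refine ⟨ofReal l * (V * ofReal (d-l)⁻¹ + ofReal l⁻¹), by finiteness, fun x B hB => ?_⟩
  have e0 : ∀ y, edist x y ^ (-l) = ofReal l * ∫⁻ c in Iop, ofReal c ^ (-l-1) *
      (if edist x y < ofReal c then 1 else 0) := fun y => by
    rw [pw_gt l hl _ (edist_ne_top x y), mul_comm, mul_assoc, ← ofReal_mul ps,
      inv_mul_cancel₀ hl.ne', ofReal_one, mul_one]
  have hm : Measurable fun q : E × ℝ => ofReal q.2 ^ (-l-1) *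
      (if edist x q.1 < ofReal q.2 then (1:ENN) else 0) :=
    (by fun_prop : Measurable fun q : E × ℝ => ofReal q.2 ^ (-l-1)).mul
      (mitx)
  by_cases hBt : μ B = ⊤
  · rw [hBt, top_rpow_of_pos (by rw [sub_pos, div_lt_one hd]; exact hld), mul_top]
    · exact le_top
    · have : ofReal l * ofReal l⁻¹ ≠ 0 := by
        simp [hl]
      intro h; apply this; rw [mul_add] at h; exact (add_eq_zero.1 h).2
  set T := μ B ^ (1/d) with hT
  calc ∫⁻ y in B, edist x y ^ (-l) ∂μ = ofReal l * ∫⁻ c in Iop, ofReal c ^ (-l-1) *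
      ∫⁻ y in B, (if edist x y < ofReal c then 1 else 0) ∂μ := by
        simp_rw [e0]
        rw [lcmu _ (Measurable.lintegral_prod_right hm),
          lintegral_lintegral_swap hm.aemeasurable]
        congr 1
        refine ltgc fun c => lcmu _ ?_
        exact mitx
    _ ≤ ofReal l * ∫⁻ c in Iop, (V * (ofReal c ^ (d-l-1) * (if ofReal c < T then 1 else 0))
        + μ B * (ofReal c ^ (-l-1) * (if T < ofReal c then 1 else 0))) := by
        gcongr 1
        refine lintegral_mono_ae ?_
        have : ∀ᵐ c ∂(volume.restrict (Iop)), c ≠ T.toReal :=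
          ae_restrict_of_ae (ae_ne volume _)
        filter_upwards [this, ae_restrict_mem measurableSet_Ioi] with c hc hc0
        have hTt : T ≠ ⊤ := by simp [hT, hBt, hd.le]
        have hc' : ofReal c ≠ T := fun h => hc (by rw [← h, toReal_ofReal (le_of_lt hc0)])
        rcases lt_or_gt_of_ne hc' with h | h
        · rw [if_pos h, if_neg h.not_gt, mul_zero, mul_zero, add_zero, mul_one]
          have h1 : ∫⁻ y in B, (if edist x y < ofReal c then 1 else 0) ∂μ ≤ V * ofReal c ^ d := by
            refine le_trans ?_ (hball x c hc0)
            refine (setLIntegral_le_lintegral _ _).trans ?_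
            rw [← lintegral_indicator_one isOpen_ball.measurableSet]
            refine lintegral_mono fun y => ?_
            rw [← Metric.eball_ofReal]
            simp [indicator, dist_comm x y]
          calc _ ≤ ofReal c ^ (-l-1) * (V * ofReal c ^ d) := by gcongr
            _ = V * (ofReal c ^ (-l-1) * ofReal c ^ d) := by ring
            _ = _ := by
              rw [← ENNReal.rpow_add _ _ (by simpa using hc0) (by simp)]; ring_nf
        · rw [if_neg h.not_gt, if_pos h, mul_zero, mul_zero, zero_add, mul_one, mul_comm]
          gcongr
          calc _ ≤ ∫⁻ y in B, 1 ∂μ := lintegral_mono fun y => by split_ifs <;> simp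
            _ = _ := by simp
    _ = ofReal l * (V * (T ^ (d-l) * ofReal (d-l)⁻¹) + μ B * (T ^ (-l) * ofReal l⁻¹)) := by
        rw [lintegral_add_left, lcmu, lcmu, pw_lt _ la, pw_gt _ hl]
        · simp [hT, hBt, hd.le]
        all_goals
          try refine Measurable.const_mul ?_ _
          refine Measurable.mul fp (mitx)
    _ ≤ _ := by
        by_cases h0 : μ B = 0
        · have h2 : (0:ℝ) < d - l := by linarith
          simp [hT, h0, hd, h2, -sub_pos]
        have e1 : T ^ (d-l) = μ B ^ (1-l/d) := by
          rw [hT, ← Erm]; congr 1; field_simp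
        have e2 : μ B * T ^ (-l) = μ B ^ (1-l/d) := by
          rw [hT, ← Erm]; nth_rw 1 [← ENNReal.rpow_one (μ B)]
          rw [← ENNReal.rpow_add _ _ h0 hBt]; congr 1; field_simp; ring
        rw [← mul_assoc (μ B), e1, e2]
        exact le_of_eq (by ring)

lemma half_hls (p r g : ℝ) (hp : 1 < p) (hr : 1 < r) (hg0 : 0 < g) (hg1 : g < 1) (hg : 1/p + 1/r = 1 + g) :
    ∃ C : ENN, C ≠ ⊤ ∧ ∀ (v w : ℝ → ENN), Measurable v → Measurable w →
      ∫⁻ a in Iop, ofReal a ^ (p-1) * v a ≤ 1 →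
      ∫⁻ a in Iop, ofReal a ^ (r-1) * w a ≤ 1 →
      ∫⁻ a in Iop, ∫⁻ b in Iop, (if b < a ^ (p/r) then v a * w b ^ g else 0) ≤ C := by
  have hrg : r * g < 1 := by
    have : g < 1/r := by
      have : 1/p < 1 := by rw [div_lt_one la]; exact hp
      linarith
    rw [lt_div_iff₀ la] at this; linarith
  set k := 1 - (r-1)*g/(1-g) with hk
  have hk0 : 0 < k := by
    rw [hk, sub_pos, div_lt_one la]; nlinarith
  refine ⟨ofReal k⁻¹ ^ (1-g), by have := hg1.le; finiteness, fun v w hv hw h1 h2 => ?_⟩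
  have inner : ∀ a ∈ Iop, ∫⁻ b in Iop, (if b < a ^ (p/r) then v a * w b ^ g else 0)
      ≤ ofReal k⁻¹ ^ (1-g) * (ofReal a ^ (p-1) * v a) := by
    intro a ha
    have ha' : (0:ℝ) < a := ha
    have hA : 0 < a ^ (p/r) := by positivity
    calc _ = v a * ∫⁻ b in Ioo (0:ℝ) (a ^ (p/r)), w b ^ g := by
          rw [← lcmu _ fp, ← Ioi_inter_Iio, inter_comm,
            ← restrict_restrict measurableSet_Iio, ← lintegral_indicator measurableSet_Iio]
          rfl
      _ ≤ v a * ((∫⁻ b in Ioo (0:ℝ) (a ^ (p/r)), ofReal b ^ (r-1) * w b) ^ g *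
            (∫⁻ b in Ioo (0:ℝ) (a ^ (p/r)), ofReal b ^ (k-1)) ^ (1-g)) := by
          gcongr
          refine le_trans (le_of_eq ?_) (lintegral_mul_norm_pow_le fp fp hg0.le
            la (by ring))
          refine setLIntegral_congr_fun measurableSet_Ioo fun b hb => ?_
          have hb0 : ofReal b ≠ 0 := by simpa using hb.1
          rw [Emn _ _ hg0.le, ← Erm, ← Erm, mul_right_comm,
            ← ENNReal.rpow_add _ _ hb0 (by simp)]
          have : (r-1)*g + (k-1)*(1-g) = 0 := by
            have : 1 - g ≠ 0 := by linarith
            rw [hk]; field_simp; ring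
          rw [this, ENNReal.rpow_zero, one_mul]
      _ ≤ v a * (1 ^ g * (ofReal (a ^ (p/r)) ^ k * ofReal k⁻¹) ^ (1-g)) := by
          rw [pw_real k _ hk0 hA.le]
          gcongr
          exact (lintegral_mono_set Ioo_subset_Ioi_self).trans h2
      _ = _ := by
          rw [ENNReal.one_rpow, one_mul, Emn _ _ la,
            ← ofReal_rpow_of_pos ha', ← Erm, ← Erm]
          have : p / r * (k * (1-g)) = p - 1 := by
            have h3 : 1 - g ≠ 0 := by linarith
            have h4 : g = 1/p+1/r-1 := by linarith
            have h5 : k * (1-g) = 1 - r*g := by rw [hk]; field_simp; ring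
            rw [h5, h4]; field_simp; ring
          rw [this]; ring
  calc _ ≤ ∫⁻ a in Iop, ofReal k⁻¹ ^ (1-g) * (ofReal a ^ (p-1) * v a) :=
        setLIntegral_mono' measurableSet_Ioi inner
    _ ≤ _ := by
        rw [lcmu _ fp]
        exact (mul_le_mul_right h1 _).trans_eq (mul_one _)

lemma layer {f g : E → ENN} (hf : Measurable f) (hg : Measurable g) :
    ∫⁻ x, f x * g x ∂μ = ∫⁻ a in Iop, ∫⁻ x in {x | ofReal a < f x}, g x ∂μ := by
  have e : ∀ x, f x * g x = ∫⁻ a in Iop, (if ofReal a < f x then g x else 0) := fun x => by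
    have := pw_lt 1 one_pos (f x)
    simp only [sub_self, ENNReal.rpow_zero, one_mul, ENNReal.rpow_one, inv_one, ofReal_one, mul_one] at this
    nth_rw 1 [← this]
    rw [← lintegral_mul_const _ (Measurable.ite (mlt) fp fp)]
    simp
  simp_rw [e]
  rw [lintegral_lintegral_swap]
  · refine ltgc fun a => ?_
    rw [← lintegral_indicator (measurableSet_lt fp hf)]
    exact ltgc fun x => by by_cases h : ofReal a < f x <;> simp [h]
  · exact (Measurable.ite (mlt) fp fp).aemeasurable

lemma meas_lvl {f : E → ENN} (hf : Measurable f) : Measurable fun a : ℝ => μ {x | ofReal a < f x} :=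
  measurable_measure_prodMk_left (s := {q : ℝ × E | ofReal q.1 < f q.2})
    (mlt)

lemma lvl_mass {f : E → ENN} (hf : Measurable f) (p : ℝ) (hp : 1 < p) (h : ∫⁻ x, f x ^ p ∂μ ≤ 1) :
    ∫⁻ a in Iop, ofReal a ^ (p-1) * μ {x | ofReal a < f x} ≤ 1 := by
  calc _ = ∫⁻ a in Iop, ∫⁻ x, ofReal a ^ (p-1) * (if ofReal a < f x then 1 else 0) ∂μ := by
        refine ltgc fun a => ?_
        rw [lcmu _ (Measurable.ite (mlt) fp fp),
          ← lintegral_indicator_one (measurableSet_lt fp hf)]; simp [indicator]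
    _ = ∫⁻ x, f x ^ p * ofReal p⁻¹ ∂μ := by
        rw [lintegral_lintegral_swap]
        · simp_rw [pw_lt p la]
        · exact (Measurable.mul fp (Measurable.ite (mlt)
            fp fp)).aemeasurable
    _ ≤ ∫⁻ x, f x ^ p ∂μ := lintegral_mono fun x => by
        refine (mul_le_mul_right ?_ _).trans_eq (mul_one _)
        rw [ofReal_le_one]; exact inv_le_one_of_one_le₀ hp.le
    _ ≤ 1 := h

theorem HLS (d l p r : ℝ) (hl : 0 < l) (hld : l < d) (hp : 1 < p) (hr : 1 < r)
    (hpr : 1/p + l/d + 1/r = 2) (V : ENN) (hV : V ≠ ⊤)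
    (hball : ∀ x : E, ∀ ρ : ℝ, 0 < ρ → μ (Metric.ball x ρ) ≤ V * ofReal ρ ^ d) :
    ∃ C : ENN, C ≠ ⊤ ∧ ∀ (f h : E → ENN), Measurable f → Measurable h →
      ∫⁻ x, f x * ∫⁻ y, h y * edist x y ^ (-l) ∂μ ∂μ ≤
        C * ((∫⁻ x, f x ^ p ∂μ) ^ (1/p) * (∫⁻ x, h x ^ r ∂μ) ^ (1/r)) := by
  have hd := hl.trans hld
  set g := 1 - l/d with hg
  have hg0 : 0 < g := by rw [hg, sub_pos, div_lt_one hd]; exact hld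
  have hg1 : g < 1 := by rw [hg]; linarith [div_pos hl hd]
  obtain ⟨C0, hC0, b0⟩ := bath μ d l hl hld V hV hball
  obtain ⟨C1, hC1, b1⟩ := half_hls p r g hp hr hg0 hg1 la
  obtain ⟨C2, hC2, b2⟩ := half_hls r p g hr hp hg0 hg1 la
  have km : Measurable fun q : E × E => edist q.1 q.2 ^ (-l) := by fun_prop
  have main : ∀ (f h : E → ENN), Measurable f → Measurable h → ∫⁻ x, f x ^ p ∂μ ≤ 1 →
      ∫⁻ x, h x ^ r ∂μ ≤ 1 → ∫⁻ x, f x * ∫⁻ y, h y * edist x y ^ (-l) ∂μ ∂μ ≤ C0 * (C1 + C2) := by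
    intro f h hf hh hf1 hh1
    set v := fun a : ℝ => μ {x | ofReal a < f x}
    set w := fun a : ℝ => μ {x | ofReal a < h x}
    have hv : Measurable v := meas_lvl μ hf
    have hw : Measurable w := meas_lvl μ hh
    have i1 := b1 v w hv hw (lvl_mass μ hf p hp hf1) (lvl_mass μ hh r hr hh1)
    have i2 := b2 w v hw hv (lvl_mass μ hh r hr hh1) (lvl_mass μ hf p hp hf1)
    have hm1 : Measurable fun q : ℝ × ℝ => if q.2 < q.1 ^ (p/r) then v q.1 * w q.2 ^ g else 0 :=
      Measurable.ite (mlt) fp fp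
    have hm2 : Measurable fun q : ℝ × ℝ => if q.2 < q.1 ^ (r/p) then w q.1 * v q.2 ^ g else 0 :=
      Measurable.ite (mlt) fp fp
    have i2' : ∫⁻ a in Iop, ∫⁻ b in Iop, (if a < b ^ (r/p) then w b * v a ^ g else 0) ≤ C2 := by
      rw [lintegral_lintegral_swap]
      · exact i2
      · exact (hm2.comp measurable_swap).aemeasurable
    calc _ = ∫⁻ a in Iop, ∫⁻ b in Iop, ∫⁻ x in {x | ofReal a < f x},
          ∫⁻ y in {y | ofReal b < h y}, edist x y ^ (-l) ∂μ ∂μ := by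
          rw [layer μ hf (lintegral_prod_right' (f := fun q : E × E => h q.2 * edist q.1 q.2 ^ (-l)) fp)]
          refine ltgc fun a => ?_
          symm
          rw [lintegral_lintegral_swap]
          · refine ltgc fun x => ?_
            rw [layer μ hh fp]
          · have e : ∀ (x : E) (b : ℝ), ∫⁻ y in {y | ofReal b < h y}, edist x y ^ (-l) ∂μ
               = ∫⁻ y, (if ofReal b < h y then edist x y ^ (-l) else 0) ∂μ := fun x b => by
              rw [← lintegral_indicator (measurableSet_lt fp hh)]; simp [indicator]
            simp only [Function.uncurry_def, e]
            refine (lintegral_prod_right' (f := fun q : (ℝ × E) × E =>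
              if ofReal q.1.1 < h q.2 then edist q.1.2 q.2 ^ (-l) else 0) ?_).aemeasurable
            exact Measurable.ite (mlt) fp fp
      _ ≤ ∫⁻ a in Iop, ∫⁻ b in Iop, C0 * ((if b < a ^ (p/r) then v a * w b ^ g else 0) +
            (if a < b ^ (r/p) then w b * v a ^ g else 0)) := by
          refine setLIntegral_mono' measurableSet_Ioi fun a (ha : 0 < a) => lintegral_mono_ae ?_
          filter_upwards [ae_restrict_mem measurableSet_Ioi,
            ae_restrict_of_ae (ae_ne volume (a ^ (p/r)))] with b (hb0 : 0 < b) hb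
          have hA : MeasurableSet {x | ofReal a < f x} := measurableSet_lt fp hf
          have hB : MeasurableSet {x | ofReal b < h x} := measurableSet_lt fp hh
          rcases lt_or_gt_of_ne hb with hb | hb
          · rw [if_pos hb]
            calc _ ≤ ∫⁻ x in {x | ofReal a < f x}, C0 * w b ^ g ∂μ := lintegral_mono fun x => b0 x _ hB
              _ = C0 * (v a * w b ^ g) := by simp [v]; ring
              _ ≤ _ := by gcongr; exact le_self_add
          · have hb' : a < b ^ (r/p) := by
              have h3 : (a ^ (p/r)) ^ (r/p) < b ^ (r/p) := rpow_lt_rpow ps hb ps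
              rwa [← rpow_mul ha.le, show p/r*(r/p) = 1 by field_simp, rpow_one] at h3
            rw [if_pos hb', lintegral_lintegral_swap fp]
            calc _ ≤ ∫⁻ y in {y | ofReal b < h y}, C0 * v a ^ g ∂μ := lintegral_mono fun y => by
                    simp_rw [edist_comm _ y]; exact b0 y _ hA
              _ = C0 * (w b * v a ^ g) := by simp [w]; ring
              _ ≤ _ := by gcongr; exact le_add_self
      _ ≤ _ := by
          have e2 : ∀ a : ℝ, ∫⁻ b in Iop, C0 * ((if b < a ^ (p/r) then v a * w b ^ g else 0) +
            (if a < b ^ (r/p) then w b * v a ^ g else 0)) = C0 * ((∫⁻ b in Iop, (if b < a ^ (p/r) then v a * w b ^ g else 0)) +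
            ∫⁻ b in Iop, (if a < b ^ (r/p) then w b * v a ^ g else 0)) := fun a => by
            rw [lcmu, lintegral_add_left]
            · exact hm1.comp (measurable_prodMk_left (x := a))
            · exact (hm1.comp (measurable_prodMk_left (x := a))).add (hm2.comp (measurable_prodMk_right (y := a)))
          simp_rw [e2]
          have hm1' : Measurable fun a => ∫⁻ b in Iop, (if b < a ^ (p/r) then v a * w b ^ g else 0) :=
            hm1.lintegral_prod_right'
          have hm2' : Measurable fun a => ∫⁻ b in Iop, (if a < b ^ (r/p) then w b * v a ^ g else 0) :=
            (hm2.comp measurable_swap).lintegral_prod_right'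
          rw [lcmu _ fp, lintegral_add_left hm1']
          gcongr
  refine ⟨C0 * (C1 + C2) + 1, by finiteness, fun f h hf hh => ?_⟩
  set P := (∫⁻ x, f x ^ p ∂μ) ^ (1/p) with hP
  set Q := (∫⁻ x, h x ^ r ∂μ) ^ (1/r) with hQ
  have z0 : ∀ (F : E → ENN) (q : ℝ), 1 < q → Measurable F → (∫⁻ x, F x ^ q ∂μ) ^ (1/q) = 0 → F =ᵐ[μ] 0 := by
    intro F q hq hF h
    rw [ENNReal.rpow_eq_zero_iff_of_pos ps, lintegral_eq_zero_iff fp] at h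
    filter_upwards [h] with x hx
    simpa [show 0 < q by linarith, show ¬ q < 0 by linarith] using hx
  have nrm : ∀ (F : E → ENN) (q : ℝ) (c : ENN), 1 < q → Measurable F → (∫⁻ x, F x ^ q ∂μ) ^ (1/q) = c → c ≠ 0 → c ≠ ⊤ →
     ∫⁻ x, (c⁻¹ * F x) ^ q ∂μ ≤ 1 := by
    intro F q c hq hF hc h0 ht
    simp_rw [Emn _ _ (show 0 ≤ q by linarith)]
    rw [lcmu _ fp]
    have : ∫⁻ x, F x ^ q ∂μ = c ^ q := by rw [← hc, ← Erm, one_div_mul_cancel la, ENNReal.rpow_one]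
    rw [this, ← Emn _ _ (show 0 ≤ q by linarith), ENNReal.inv_mul_cancel h0 ht, ENNReal.one_rpow]
  by_cases hP0 : P = 0
  · have := z0 f p hp hf hP0
    rw [lintegral_congr_ae (g := 0) (by filter_upwards [this] with x hx; simp [hx])]; simp
  by_cases hQ0 : Q = 0
  · have := z0 h r hr hh hQ0
    have : ∀ x, ∫⁻ y, h y * edist x y ^ (-l) ∂μ = 0 := fun x => by
      rw [lintegral_congr_ae (g := 0) (by filter_upwards [this] with x hx; simp [hx])]; simp
    simp [this]
  have hz : C0 * (C1 + C2) + 1 ≠ 0 := by simp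
  by_cases hPt : P = ⊤
  · rw [hPt, top_mul hQ0, mul_top hz]; exact le_top
  by_cases hQt : Q = ⊤
  · rw [hQt, mul_top hP0, mul_top hz]; exact le_top
  have := main (fun x => P⁻¹ * f x) (fun x => Q⁻¹ * h x) fp fp
    (nrm f p P hp hf rfl hP0 hPt) (nrm h r Q hr hh rfl hQ0 hQt)
  simp_rw [mul_assoc] at this
  have e3 : ∀ x, ∫⁻ y, Q⁻¹ * (h y * edist x y ^ (-l)) ∂μ = Q⁻¹ * ∫⁻ y, h y * edist x y ^ (-l) ∂μ := fun x =>
    lcmu _ fp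
  have hmm : Measurable fun x => ∫⁻ y, h y * edist x y ^ (-l) ∂μ :=
    lintegral_prod_right' (f := fun q : E × E => h q.2 * edist q.1 q.2 ^ (-l)) fp
  simp_rw [e3, mul_left_comm _ Q⁻¹] at this
  rw [lcmu _ fp, lcmu _ fp] at this
  calc _ = (P * Q) * (Q⁻¹ * (P⁻¹ * ∫⁻ x, f x * ∫⁻ y, h y * edist x y ^ (-l) ∂μ ∂μ)) := by
        rw [← mul_assoc, ← mul_assoc, mul_assoc P, ENNReal.mul_inv_cancel hQ0 hQt, mul_one,
          ENNReal.mul_inv_cancel hP0 hPt, one_mul]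
    _ ≤ (P * Q) * (C0 * (C1 + C2) + 1) := by gcongr; exact this.trans le_self_add
    _ = _ := mul_comm _ _
end hls

lemma LtR_mono {x : ℝ} (hx : 0 ≤ x) {F G : ℝ → ENN} (h : ∀ t, F t ≤ G t) : LtR x F ≤ LtR x G := by
  unfold LtR
  split_ifs
  · exact essSup_mono_ae (of_forall h)
  · gcongr with t; exact h t

lemma LtR_one (F : ℝ → ENN) : LtR 1 F = ∫⁻ t, F t := by simp [LtR]

lemma LtR_const_mul (x : ℝ) (hx : 0 ≤ x) (c : ENN) {F : ℝ → ENN} (hF : Measurable F) :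
    LtR x (fun t => c * F t) = c * LtR x F := by
  unfold LtR
  split_ifs with h
  · exact ENNReal.essSup_const_mul
  · have : 0 < x := lt_of_le_of_ne hx (Ne.symm h)
    simp_rw [Emn _ _ (inv_nonneg.2 hx)]
    rw [lcmu _ fp, Emn _ _ hx, ← Erm,
      inv_mul_cancel₀ h, ENNReal.rpow_one]

lemma HOLDT {x : ℝ} (hx0 : 0 ≤ x) (hx1 : x < 1) {F G : ℝ → ENN} (hF : Measurable F) (hG : Measurable G) :
    ∫⁻ t, F t * G t ≤ LtR x F * LtR (1-x) G := by
  rcases hx0.eq_or_lt with rfl | hx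
  · rw [sub_zero, LtR_one, LtR, if_pos rfl, ← lcmu _ hG]
    refine lintegral_mono_ae ?_
    filter_upwards [ENNReal.ae_le_essSup F] with t ht
    gcongr
  · rw [LtR, LtR, if_neg hx.ne', if_neg la]
    refine le_trans (le_of_eq ?_) (lintegral_mul_norm_pow_le fp fp hx0
            la (by ring))
    refine ltgc fun t => ?_
    rw [← Erm, ← Erm, inv_mul_cancel₀ hx.ne', inv_mul_cancel₀ la]
    simp

lemma DUAL_aux (x y : ℝ) (hx0 : 0 ≤ x) (hx1 : x < 1) (hy0 : 0 < y) (hy1 : y < 1)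
    (F : RV → ENN) (hF : Measurable F) (C : ENN) (n : ℕ) (hb : ∀ p, F p ≤ n)
    (hs1 : ∀ p, (n:ℝ) < |p.1| → F p = 0) (hs2 : ∀ p, (n:ℝ) < ‖p.2‖ → F p = 0)
    (H : ∀ w : RV → ENN, Measurable w → ∫⁻ t, ∫⁻ z, F (t,z) * w (t,z) ≤
      C * LtR (1-x) (fun t => (∫⁻ z, w (t,z) ^ (1-y)⁻¹) ^ (1-y))) :
    LtR x (fun t => (∫⁻ z, F (t,z) ^ y⁻¹) ^ y) ≤ C := by
  set N : ℝ → ENN := fun t => (∫⁻ z, F (t,z) ^ y⁻¹) ^ y with hN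
  clear_value N
  have hNm : Measurable N := by
    rw [hN]
    have : Measurable fun t => ∫⁻ z, F (t,z) ^ y⁻¹ := lintegral_prod_right' (f := fun p => F p ^ y⁻¹) fp
    fun_prop
  have hq : 1 < y⁻¹ := (one_lt_inv₀ hy0).2 hy1
  set M : ENN := ((n:ENN) ^ y⁻¹ * volume (closedBall (0:V2) n)) ^ y with hM
  have hMt : M ≠ ⊤ := by
    have : volume (closedBall (0:V2) n) ≠ ⊤ := measure_closedBall_lt_top.ne
    have h2 : (0:ℝ) ≤ y⁻¹ := by positivity
    have h3 : (n:ENN) ^ y⁻¹ ≠ ⊤ := by finiteness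
    finiteness
  have hNb : ∀ t, N t ≤ M := fun t => by
    simp only [hN, hM]
    gcongr
    calc _ ≤ ∫⁻ z, (closedBall (0:V2) n).indicator (fun _ => (n:ENN) ^ y⁻¹) z := by
          refine lintegral_mono fun z => ?_
          by_cases hz : z ∈ closedBall (0:V2) n
          · rw [indicator_of_mem hz]; gcongr; exact hb _
          · rw [indicator_of_notMem hz, hs2 (t,z) (by simpa using hz), zero_rpow_of_pos ps]
      _ = _ := by rw [lintegral_indicator measurableSet_closedBall]; simp
  have hNs : ∀ t, (n:ℝ) < |t| → N t = 0 := fun t ht => by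
    simp [hN, hs1 (t, _) ht, hy0]
  have step : ∀ h : ℝ → ENN, Measurable h → ∫⁻ t, N t * h t ≤ C * LtR (1-x) h := by
    intro h hh
    have := H (fun p => F p ^ (y⁻¹-1) * (N p.1 ^ (-(y⁻¹-1)) * h p.1)) fp
    calc ∫⁻ t, N t * h t = _ := ?_
      _ ≤ _ := this
      _ ≤ _ := ?_
    · refine ltgc fun t => ?_
      have e : ∀ z, F (t,z) * (F (t,z) ^ (y⁻¹-1) * (N t ^ (-(y⁻¹-1)) * h t)) = F (t,z) ^ y⁻¹ * (N t ^ (-(y⁻¹-1)) * h t) := by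
        intro z
        rw [← mul_assoc]; congr 1
        nth_rw 1 [← ENNReal.rpow_one (F (t,z))]
        rw [← ENNReal.rpow_add_of_nonneg _ _ zero_le_one la]; ring_nf
      simp_rw [e]
      rw [lintegral_mul_const _ fp, ← mul_assoc]; congr 1
      have e2 : ∫⁻ z, F (t,z) ^ y⁻¹ = N t ^ y⁻¹ := by
        simp only [hN]; rw [← Erm, mul_inv_cancel₀ hy0.ne', ENNReal.rpow_one]
      rw [e2]
      by_cases h0 : N t = 0
      · rw [h0, zero_rpow_of_pos ps, zero_mul]
      · rw [← ENNReal.rpow_add _ _ h0 ((hNb t).trans_lt hMt.lt_top).ne]; simp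
    · refine mul_le_mul_right (LtR_mono la fun t => ?_) _
      simp_rw [Emn _ _ (inv_nonneg.2 (by linarith : 0 ≤ 1-y)), ← Erm]
      have e3 : (y⁻¹-1) * (1-y)⁻¹ = y⁻¹ := by
        have : 1 - y ≠ 0 := by linarith
        field_simp
      rw [e3, lintegral_mul_const _ fp, Emn _ _ la,
        Emn _ _ la, ← Erm, ← Erm,
        mul_assoc, inv_mul_cancel₀ la, mul_one, ENNReal.rpow_one, ← mul_assoc]
      refine (mul_le_mul_left ?_ _).trans_eq (one_mul _)
      have e2 : (∫⁻ z, F (t,z) ^ y⁻¹) ^ (1-y) = N t ^ (y⁻¹-1) := by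
        simp only [hN]; rw [← Erm]; congr 1; field_simp
      rw [e2]
      by_cases h0 : N t = 0
      · rw [h0, zero_rpow_of_pos la, zero_mul]; exact bot_le
      · rw [← ENNReal.rpow_add _ _ h0 ((hNb t).trans_lt hMt.lt_top).ne]; simp
  rcases hx0.eq_or_lt with rfl | hx
  · rw [LtR, if_pos rfl]
    refine essSup_le_of_ae_le _ ?_
    refine ae_le_of_forall_setLIntegral_le_of_sigmaFinite hNm fun s hs _ => ?_
    have := step (s.indicator 1) (measurable_one.indicator hs)
    rw [sub_zero, LtR_one, lintegral_indicator_one hs] at this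
    calc _ = ∫⁻ t, N t * s.indicator 1 t := by
          rw [← lintegral_indicator hs]; congr 1; ext t; by_cases h : t ∈ s <;> simp [h]
      _ ≤ _ := by simpa using this
  · rw [LtR, if_neg hx.ne']
    set I := ∫⁻ t, N t ^ x⁻¹ with hI
    have hIt : I ≠ ⊤ := by
      refine ((?_ : I ≤ M ^ x⁻¹ * volume (Icc (-(n:ℝ)) n)).trans_lt ?_).ne
      · calc _ ≤ ∫⁻ z, (Icc (-(n:ℝ)) n).indicator (fun _ => M ^ x⁻¹) z := by
              refine lintegral_mono fun t => ?_
              by_cases hz : t ∈ Icc (-(n:ℝ)) n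
              · rw [indicator_of_mem hz]; gcongr; exact hNb _
              · rw [indicator_of_notMem hz, hNs t (by rw [mem_Icc, ← abs_le] at hz; linarith), zero_rpow_of_pos ps]
          _ = _ := by rw [lintegral_indicator measurableSet_Icc]; simp
      · have : (0:ℝ) ≤ x⁻¹ := by positivity
        have h3 : M ^ x⁻¹ ≠ ⊤ := by finiteness
        rw [volume_Icc]
        exact ENNReal.mul_lt_top h3.lt_top ENNReal.ofReal_lt_top
    have := step (fun t => N t ^ (x⁻¹-1)) fp
    have hx1' : 1 < x⁻¹ := (one_lt_inv₀ hx).2 hx1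
    have e1 : ∫⁻ t, N t * N t ^ (x⁻¹-1) = I := ltgc fun t => by
      nth_rw 1 [← ENNReal.rpow_one (N t)]
      rw [← ENNReal.rpow_add_of_nonneg _ _ zero_le_one la]; ring_nf
    have e2 : LtR (1-x) (fun t => N t ^ (x⁻¹-1)) = I ^ (1-x) := by
      rw [LtR, if_neg la]; congr 1
      refine ltgc fun t => ?_
      rw [← Erm]; congr 1
      have : 1 - x ≠ 0 := by linarith
      field_simp
    rw [e1, e2] at this
    by_cases h0 : I = 0
    · rw [h0, zero_rpow_of_pos hx]; exact bot_le
    calc I ^ x = I * I ^ (-(1-x)) := by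
          nth_rw 2 [← ENNReal.rpow_one I]; rw [← ENNReal.rpow_add _ _ h0 hIt]; ring_nf
      _ ≤ C * I ^ (1-x) * I ^ (-(1-x)) := by gcongr
      _ = C := by rw [mul_assoc, ← ENNReal.rpow_add _ _ h0 hIt]; simp

lemma DUAL (x y : ℝ) (hx0 : 0 ≤ x) (hx1 : x < 1) (hy0 : 0 < y) (hy1 : y < 1)
    (F : RV → ENN) (hF : Measurable F) (C : ENN)
    (H : ∀ w : RV → ENN, Measurable w → ∫⁻ t, ∫⁻ z, F (t,z) * w (t,z) ≤
      C * LtR (1-x) (fun t => (∫⁻ z, w (t,z) ^ (1-y)⁻¹) ^ (1-y))) :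
    LtR x (fun t => (∫⁻ z, F (t,z) ^ y⁻¹) ^ y) ≤ C := by
  set S : ℕ → Set RV := fun n => {p | |p.1| ≤ n} ∩ {p | ‖p.2‖ ≤ n}
  have hS : ∀ n, MeasurableSet (S n) := fun n =>
    (measurableSet_le fp fp).inter (measurableSet_le fp fp)
  set Fn : ℕ → ℝ × V2 → ENN := fun n => (S n).indicator fun p => min (F p) n with hFn
  have hFm : ∀ n, Measurable (Fn n) := fun n => Measurable.indicator fp (hS n)
  have hle : ∀ n p, Fn n p ≤ F p := fun n p => by
    refine (indicator_le_self' (fun _ _ => bot_le) p).trans (min_le_left _ _)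
  have hmono : ∀ p, Monotone fun n => Fn n p := fun p m n hmn => by
    have hc : (m:ℝ) ≤ n := by exact_mod_cast hmn
    by_cases h : p ∈ S m
    · have h' : p ∈ S n := ⟨h.1.trans hc, h.2.trans hc⟩
      simp only [hFn, indicator_of_mem h, indicator_of_mem h']
      exact min_le_min_left _ (by exact_mod_cast hmn)
    · simp only [hFn, indicator_of_notMem h]; exact bot_le
  have hsup : ∀ p, ⨆ n, Fn n p = F p := fun p => by
    refine le_antisymm (iSup_le fun n => hle n p) (le_of_forall_lt fun c hc => ?_)
    obtain ⟨n0, hn0⟩ := ENNReal.exists_nat_gt (hc.trans_le le_top).ne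
    obtain ⟨n1, hn1⟩ := exists_nat_ge |p.1|
    obtain ⟨n2, hn2⟩ := exists_nat_ge ‖p.2‖
    set n := max n0 (max n1 n2)
    have h : p ∈ S n := ⟨hn1.trans (by simp [n]), hn2.trans (by simp [n])⟩
    refine lt_of_lt_of_le ?_ (le_iSup _ n)
    simp only [hFn, indicator_of_mem h]
    exact lt_min hc (hn0.trans_le (by simp [n]))
  have hn : ∀ n, LtR x (fun t => (∫⁻ z, Fn n (t,z) ^ y⁻¹) ^ y) ≤ C := fun n => by
    refine DUAL_aux x y hx0 hx1 hy0 hy1 _ (hFm n) C n (fun p => ?_) (fun p hp => ?_) (fun p hp => ?_) fun w hw => ?_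
    · exact (indicator_le_self' (fun _ _ => bot_le) p).trans (min_le_right _ _)
    · exact indicator_of_notMem (fun h => absurd h.1 (not_le.2 hp)) _
    · exact indicator_of_notMem (fun h => absurd h.2 (not_le.2 hp)) _
    · refine le_trans ?_ (H w hw)
      gcongr with t z; exact hle n _
  have hN : ∀ t, (∫⁻ z, F (t,z) ^ y⁻¹) ^ y = ⨆ n, (∫⁻ z, Fn n (t,z) ^ y⁻¹) ^ y := fun t => by
    have := (orderIsoRpow y hy0).map_iSup (fun n => ∫⁻ z, Fn n (t,z) ^ y⁻¹)
    simp only [orderIsoRpow_apply] at this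
    rw [← this, ← lintegral_iSup (fun n => by have := hFm n; fun_prop)]
    · congr 2; ext z
      have h2 := (orderIsoRpow y⁻¹ ps).map_iSup (fun n => Fn n (t,z))
      simp only [orderIsoRpow_apply, hsup] at h2
      exact h2
    · intro m n hmn z; dsimp only; gcongr; exact hmono _ hmn
  have hNmono : ∀ t, Monotone fun n => (∫⁻ z, Fn n (t,z) ^ y⁻¹) ^ y := fun t m n hmn => by
    dsimp only; gcongr with z; exact hmono _ hmn
  have hNm : ∀ n, Measurable fun t => (∫⁻ z, Fn n (t,z) ^ y⁻¹) ^ y := fun n => by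
    have : Measurable fun t => ∫⁻ z, Fn n (t,z) ^ y⁻¹ :=
      lintegral_prod_right' (f := fun p => Fn n p ^ y⁻¹) (by have := hFm n; fun_prop)
    fun_prop
  simp_rw [hN]
  rcases hx0.eq_or_lt with rfl | hx
  · rw [LtR, if_pos rfl]
    refine essSup_le_of_ae_le _ ?_
    have : ∀ᵐ t, ∀ n, (∫⁻ z, Fn n (t,z) ^ y⁻¹) ^ y ≤ C := ae_all_iff.2 fun n => by
      have h := hn n
      rw [LtR, if_pos rfl] at h
      filter_upwards [ENNReal.ae_le_essSup fun t => (∫⁻ z, Fn n (t,z) ^ y⁻¹) ^ y] with t ht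
      exact ht.trans h
    filter_upwards [this] with t ht using iSup_le ht
  · simp only [LtR, if_neg hx.ne'] at hn ⊢
    have e : ∀ t, (⨆ n, (∫⁻ z, Fn n (t,z) ^ y⁻¹) ^ y) ^ x⁻¹ = ⨆ n, ((∫⁻ z, Fn n (t,z) ^ y⁻¹) ^ y) ^ x⁻¹ := fun t =>
      (orderIsoRpow x⁻¹ ps).map_iSup _
    simp_rw [e]
    rw [lintegral_iSup (fun n => by have := hNm n; fun_prop)]
    · have := (orderIsoRpow x hx).map_iSup (fun n => ∫⁻ t, ((∫⁻ z, Fn n (t,z) ^ y⁻¹) ^ y) ^ x⁻¹)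
      simp only [orderIsoRpow_apply] at this
      rw [this]; exact iSup_le hn
    · intro m n hmn t
      have := hNmono t hmn
      dsimp only at this ⊢; gcongr

def Kz (z : ℂ) (x : V2) : ℂ := ∫ ξ : V2, Complex.exp (-IC * ((⟪x, ξ⟫ : ℝ) : ℂ)) * Complex.exp (-z * (‖ξ‖ : ℂ))

lemma cre (z : ℂ) (b : ℝ) : z.re ≤ ‖z + IC * (b : ℂ)‖ := by
  refine le_trans ?_ (re_le_norm _); simp

lemma KM (z : ℂ) (hz : 0 < z.re) (p q : ℝ) :
    (∫ φ in (-π)..π, 1 / (z + IC * ((p * cos φ + q * sin φ : ℝ) : ℂ)) ^ 2) ^ 2 * (z ^ 2 + ((p^2+q^2 : ℝ) : ℂ)) ^ 3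
      = 4 * (π:ℂ) ^ 2 * z ^ 2 := by
  set b : ℝ → ℝ := fun φ => p * cos φ + q * sin φ with hb
  set b' : ℝ → ℝ := fun φ => -p * sin φ + q * cos φ with hb'
  have db : ∀ φ, HasDerivAt b (b' φ) φ := fun φ => by
    have := ((hasDerivAt_cos φ).const_mul p).add ((hasDerivAt_sin φ).const_mul q)
    exact this.congr_deriv (by simp [hb'])
  have db' : ∀ φ, HasDerivAt b' (-b φ) φ := fun φ => by
    have := ((hasDerivAt_sin φ).const_mul (-p)).add ((hasDerivAt_cos φ).const_mul q)
    exact this.congr_deriv (by simp [hb]; ring)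
  have hbc : Continuous b := by fun_prop
  set c : ℝ → ℝ → ℂ := fun s φ => z + IC * ((s * b φ : ℝ) : ℂ) with hc
  have hcn : ∀ s φ, z.re ≤ ‖c s φ‖ := fun s φ => cre z _
  have hc0 : ∀ s φ, c s φ ≠ 0 := fun s φ h => by have := hcn s φ; rw [h, norm_zero] at this; linarith
  have hcc : ∀ s, Continuous (c s) := fun s => by fun_prop
  set M : ℝ → ℂ := fun s => ∫ φ in (-π)..π, 1 / c s φ ^ 2 with hM
  set M' : ℝ → ℂ := fun s => ∫ φ in (-π)..π, -2 * IC * b φ / c s φ ^ 3 with hM'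
  have dM : ∀ s, HasDerivAt M (M' s) s := by
    intro s
    have hbB : ∀ φ, |b φ| ≤ |p| + |q| := fun φ => by
      refine (abs_add_le _ _).trans ?_
      rw [abs_mul, abs_mul]
      nlinarith [abs_cos_le_one φ, abs_sin_le_one φ, abs_nonneg p, abs_nonneg q]
    refine (intervalIntegral.hasDerivAt_integral_of_dominated_loc_of_deriv_le (F' := fun s φ => -2 * IC * b φ / c s φ ^ 3)
      (bound := fun _ => 2 * (|p|+|q|) / z.re ^ 3) Filter.univ_mem ?_ ?_ ?_ ?_ ?_ ?_).2
    · refine of_forall fun s => aestronglyMeasurable ?_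
      exact continuous_const.div ((hcc s).pow 2) fun φ => pow_ne_zero _ (hc0 s φ)
    · exact (continuous_const.div ((hcc s).pow 2) fun φ => pow_ne_zero _ (hc0 s φ)).intervalIntegrable _ _
    · exact (Continuous.div fp ((hcc s).pow 3) fun φ => pow_ne_zero _ (hc0 s φ)).aestronglyMeasurable
    · refine of_forall fun φ _ s _ => ?_
      rw [norm_div, norm_pow, norm_mul, norm_mul, norm_I, norm_real]
      have := hcn s φ
      have h2 := hbB φ
      simp only [norm_neg, Complex.norm_ofNat, mul_one, norm_eq_abs]
      gcongr
    · exact intervalIntegrable_const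
    · refine of_forall fun φ _ s _ => ?_
      have h1 : HasDerivAt (fun s => c s φ) (IC * (b φ : ℂ)) s := by
        have := (((hasDerivAt_id s).mul_const (b φ)).ofReal_comp.const_mul IC).const_add z
        simpa [hc] using this
      have h2 := (h1.pow 2).inv (pow_ne_zero _ (hc0 s φ))
      simp only [one_div]
      refine h2.congr_deriv ?_
      have := hc0 s φ
      simp only [Pi.pow_apply, id]
      field_simp
      simp; ring
  have ode : ∀ s : ℝ, M' s * (z^2 + ((s^2*(p^2+q^2) : ℝ):ℂ)) + 3 * s * ((p^2+q^2 : ℝ):ℂ) * M s = 0 := by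
    intro s
    have fd : ∀ φ, HasDerivAt (fun φ => IC * ((b' φ : ℂ) * (z / c s φ ^ 2 + 1 / c s φ)))
        ((-2 * IC * b φ / c s φ ^ 3) * (z^2 + ((s^2*(p^2+q^2) : ℝ):ℂ)) + (1 / c s φ ^ 2) * (3 * s * ((p^2+q^2 : ℝ):ℂ))) φ := by
      intro φ
      have h1 : HasDerivAt (c s) (IC * ((s * b' φ : ℝ) : ℂ)) φ := by
        have := (((db φ).const_mul s).ofReal_comp.const_mul IC).const_add z
        simpa [hc] using this
      have h2 := ((h1.pow 2).inv (pow_ne_zero _ (hc0 s φ))).const_mul z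
      have h3 := h1.inv (hc0 s φ)
      have h4 := (((db' φ).ofReal_comp).mul (h2.add h3)).const_mul IC
      have hcz := hc0 s φ
      have hbb : ((b' φ : ℂ)) ^ 2 = ((p^2+q^2 : ℝ):ℂ) - (b φ : ℂ) ^ 2 := by
        rw [← ofReal_pow, ← ofReal_pow, ← Complex.ofReal_sub]; congr 1
        simp only [hb, hb']; nlinarith [sin_sq_add_cos_sq φ]
      refine (h4.congr_deriv ?_).congr_of_eventuallyEq (of_forall fun φ => ?_)
      · simp only [Pi.pow_apply, Pi.add_apply, Pi.inv_apply]
        have hce : c s φ = z + IC * (s * b φ) := by simp [hc]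
        generalize hR : ((p^2+q^2 : ℝ):ℂ) = R at hbb ⊢
        have hI : IC ^ 2 = -1 := I_sq
        push_cast
        push_cast at hR
        rw [hR]
        field_simp
        have hB : (b φ : ℂ) * s * IC = c s φ - z := by rw [hce]; ring
        rw [hce]
        linear_combination (-(3*IC^2*z*s+IC^3*b φ*s^2)) * hbb - (3*z*s+IC*b φ*s^2)*R*hI
      · simp [div_eq_mul_inv]
    have := intervalIntegral.integral_eq_sub_of_hasDerivAt (fun φ _ => fd φ) (a := -π) (b := π) (by
      refine Continuous.intervalIntegrable ?_ _ _
      exact ((Continuous.div fp ((hcc s).pow 3) fun φ => pow_ne_zero _ (hc0 s φ)).mul continuous_const).add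
        ((continuous_const.div ((hcc s).pow 2) fun φ => pow_ne_zero _ (hc0 s φ)).mul continuous_const))
    rw [intervalIntegral.integral_add, intervalIntegral.integral_mul_const, intervalIntegral.integral_mul_const] at this
    · rw [mul_comm _ (M s), hM, hM']
      refine this.trans ?_
      simp [hc, hb, hb']
    · exact ((Continuous.div fp ((hcc s).pow 3) fun φ => pow_ne_zero _ (hc0 s φ)).mul continuous_const).intervalIntegrable _ _
    · exact ((continuous_const.div ((hcc s).pow 2) fun φ => pow_ne_zero _ (hc0 s φ)).mul continuous_const).intervalIntegrable _ _
  have dG : ∀ s : ℝ, HasDerivAt (fun s : ℝ => M s ^ 2 * (z^2 + ((s^2*(p^2+q^2) : ℝ):ℂ)) ^ 3) 0 s := by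
    intro s
    have h1 : HasDerivAt (fun s : ℝ => z^2 + ((s^2*(p^2+q^2) : ℝ):ℂ)) ((2*s*(p^2+q^2) : ℝ):ℂ) s := by
      have := (((hasDerivAt_pow 2 s).mul_const (p^2+q^2)).ofReal_comp).const_add (z^2)
      simpa using this
    refine (((dM s).pow 2).mul (h1.pow 3)).congr_deriv ?_
    have := ode s
    simp only [Pi.pow_apply]
    push_cast at this ⊢
    linear_combination (2 * M s * (z^2 + (s:ℂ)^2*((p:ℂ)^2+q^2)) ^ 2) * this
  have := is_const_of_deriv_eq_zero (fun s => (dG s).differentiableAt) (fun s => (dG s).deriv) 1 0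
  have hz0 : z ≠ 0 := fun h => by simp [h] at hz
  simp only [hM, hc, hb] at this
  simp only [one_mul, one_pow] at this
  rw [this]
  simp
  field_simp
  ring

lemma V2_integral (f : V2 → ℂ) : ∫ x, f x = ∫ p in polarCoord.target, (p.1:ℂ) * f (!₂[p.1 * cos p.2, p.1 * sin p.2]) := by
  have h1 : ∫ x, f x = ∫ y : Fin 2 → ℝ, f (toLp 2 y) :=
    ((volume_preserving_toLp (Fin 2)).integral_comp (MeasurableEquiv.toLp 2 _).measurableEmbedding f).symm
  have h2 : ∫ y : Fin 2 → ℝ, f (toLp 2 y) = ∫ q : ℝ × ℝ, f (!₂[q.1, q.2]) :=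
    ((volume_preserving_finTwoArrow ℝ).symm.integral_comp
      (finTwoArrow).symm.measurableEmbedding (fun y => f (toLp 2 y))).symm
  rw [h1, h2, ← integral_comp_polarCoord_symm]
  simp only [polarCoord_symm_apply, real_smul]

lemma exp_norm_integrable (e : ℝ) (he : 0 < e) : Integrable fun ξ : V2 => exp (-e * ‖ξ‖) := by
  have h := (integrable_one_add_norm (E := V2) (μ := volume) (r := 3) (by simp; norm_num)).const_mul (exp e * 6 / e ^ 3)
  refine h.mono' fp (of_forall fun ξ => ?_)
  have h1 := pow_div_factorial_le_exp (e * (1 + ‖ξ‖)) ps 3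
  have h0 : (0:ℝ) < 1 + ‖ξ‖ := by positivity
  rw [norm_eq_abs, abs_of_pos (exp_pos _), rpow_neg h0.le]
  have : exp (-e * ‖ξ‖) = exp e / exp (e * (1 + ‖ξ‖)) := by rw [← exp_sub]; congr 1; ring
  rw [this, show ((1 + ‖ξ‖) ^ (3:ℝ)) = (1 + ‖ξ‖)^3 by norm_cast]
  rw [show (factorial 3 : ℝ) = 6 by norm_num [factorial]] at h1
  rw [div_le_iff₀ (exp_pos _)]
  calc exp e = exp e * 6 / e ^ 3 * ((1 + ‖ξ‖)^3)⁻¹ * ((e * (1 + ‖ξ‖))^3/6) := by field_simp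
    _ ≤ _ := by gcongr

lemma norm_cexp_neg (z : ℂ) (r : ℝ) : ‖Complex.exp (-z * (r : ℂ))‖ = exp (-z.re * r) := by
  rw [norm_exp]; simp

lemma norm_cexp_I (r : ℝ) : ‖Complex.exp (-IC * (r : ℂ))‖ = 1 := by
  rw [norm_exp]; simp

lemma Kz_integrable (z : ℂ) (hz : 0 < z.re) : Integrable fun ξ : V2 => Complex.exp (-z * (‖ξ‖ : ℂ)) := by
  refine (exp_norm_integrable z.re hz).mono' fp (of_forall fun ξ => ?_)
  rw [norm_cexp_neg]

lemma lap_int (c : ℂ) (hc : 0 < c.re) : IntegrableOn (fun r : ℝ => (r:ℂ) * Complex.exp (-c * r)) (Ioi 0) := by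
  have h := integrableOn_rpow_mul_exp_neg_mul_rpow (s := 1) (p := 1) (b := c.re) nu nu hc
  simp only [rpow_one] at h
  refine h.mono' fp ?_
  refine (ae_restrict_mem measurableSet_Ioi).mono fun r hr => ?_
  rw [norm_mul, norm_cexp_neg, norm_real, norm_eq_abs, abs_of_pos hr]

lemma lap_eq (c : ℂ) (hc : 0 < c.re) : ∫ r in Iop, (r:ℂ) * Complex.exp (-c * r) = 1 / c ^ 2 := by
  have hc0 : c ≠ 0 := fun h => by simp [h] at hc
  have hd : ∀ r : ℝ, HasDerivAt (fun r : ℝ => -((r:ℂ)/c + 1/c^2) * Complex.exp (-c * r)) ((r:ℂ) * Complex.exp (-c * r)) r := by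
    intro r
    have h0 : HasDerivAt (fun r : ℝ => (r:ℂ)) 1 r := ofRealCLM.hasDerivAt
    have h1 := (((h0.div_const c).add_const (1/c^2)).neg).mul ((h0.const_mul (-c)).cexp)
    refine h1.congr_deriv ?_
    simp only [mul_one, Pi.neg_apply]; field_simp; ring
  have := integral_Ioi_of_hasDerivAt_of_tendsto (a := 0) (m := 0) (hd 0).continuousAt.continuousWithinAt (fun r _ => hd r) (lap_int c hc) ?_
  · rw [this]; simp
  · rw [tendsto_zero_iff_norm_tendsto_zero]
    have e1 : Tendsto (fun r : ℝ => (r ^ 1 * exp (-c.re * r)) * (1/‖c‖) + (r^0 * exp (-c.re * r)) * (1/‖c‖^2)) atTop (nhds (0 * (1/‖c‖) + 0 * (1/‖c‖^2))) := by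
      have := fun n => tendsto_pow_mul_exp_neg_atTop_nhds_zero n
      refine Tendsto.add (mul_const _ ?_) (mul_const _ ?_)
      · simpa using tendsto_rpow_mul_exp_neg_mul_atTop_nhds_zero 1 c.re hc
      · simpa using tendsto_rpow_mul_exp_neg_mul_atTop_nhds_zero 0 c.re hc
    simp only [zero_mul, add_zero] at e1
    refine squeeze_zero' (of_forall fun _ => norm_nonneg _) ?_ e1
    filter_upwards [Filter.eventually_ge_atTop 0] with r hr
    rw [norm_mul, norm_cexp_neg, norm_neg]
    have : ‖(r:ℂ)/c + 1/c^2‖ ≤ r/‖c‖ + 1/‖c‖^2 := by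
      refine (norm_add_le _ _).trans ?_
      simp [abs_of_nonneg hr]
    calc _ ≤ (r/‖c‖ + 1/‖c‖^2) * exp (-c.re * r) := by gcongr
      _ = _ := by ring

lemma Kz_eq (z : ℂ) (hz : 0 < z.re) (x : V2) :
    Kz z x = ∫ φ in (-π)..π, 1 / (z + IC * ((x 0 * cos φ + x 1 * sin φ : ℝ) : ℂ)) ^ 2 := by
  have key : ∀ p : ℝ × ℝ, p ∈ polarCoord.target → (p.1:ℂ) * (Complex.exp (-IC * ((⟪x, !₂[p.1 * cos p.2, p.1 * sin p.2]⟫ : ℝ) : ℂ)) * Complex.exp (-z * (‖(!₂[p.1 * cos p.2, p.1 * sin p.2] : V2)‖ : ℂ))) =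
      (p.1:ℂ) * Complex.exp (-(z + IC * ((x 0 * cos p.2 + x 1 * sin p.2 : ℝ) : ℂ)) * p.1) := by
    rintro ⟨r, φ⟩ ⟨hr, -⟩
    simp only [mem_Ioi] at hr
    have hn : ‖(!₂[r * cos φ, r * sin φ] : V2)‖ = r := by
      rw [norm_eq]; simp
      rw [show (r * cos φ)^2 + (r * sin φ)^2 = r^2 by nlinarith [sin_sq_add_cos_sq φ], sqrt_sq hr.le]
    have hi : (⟪x, !₂[r * cos φ, r * sin φ]⟫ : ℝ) = r * (x 0 * cos φ + x 1 * sin φ) := by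
      simp [PiLp.inner_apply, sum_univ_two]; ring
    simp only [hn, hi]
    rw [← Complex.exp_add]; congr 2; push_cast; ring
  have hmeas : MeasurableSet polarCoord.target := polarCoord.open_target.measurableSet
  rw [Kz, V2_integral, setIntegral_congr_fun hmeas key, polarCoord_target, volume_eq_prod, ← setIntegral_prod_swap]
  simp only [fst_swap, snd_swap]
  rw [setIntegral_prod, intervalIntegral.integral_of_le (by linarith [pi_pos]), integral_Ioc_eq_integral_Ioo]
  · refine setIntegral_congr_fun measurableSet_Ioo fun φ _ => ?_
    exact lap_eq (z + IC * ((x 0 * cos φ + x 1 * sin φ : ℝ) : ℂ)) (by simpa using hz)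
  · rw [IntegrableOn, ← prod_restrict]
    have h1 : Integrable (fun r : ℝ => (r:ℂ) * Complex.exp (-(z.re:ℂ) * r)) (volume.restrict (Ioi 0)) := lap_int z.re (by simpa using hz)
    have h2 : Integrable (fun _ : ℝ => (1:ℂ)) (volume.restrict (Ioo (-π) π)) := by
      rw [integrable_const_iff]; right; constructor; simp
    refine (h2.mul_prod h1).mono (aestronglyMeasurable fp) (of_forall fun p => ?_)
    simp only [norm_mul]
    rw [norm_cexp_neg, norm_cexp_neg]; simp

lemma Kz_norm (z : ℂ) (hz : 0 < z.re) (x : V2) :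
    ‖Kz z x‖ ^ 2 * (‖z + IC * ‖x‖‖ * ‖z - IC * ‖x‖‖) ^ 3 = 4 * π ^ 2 * ‖z‖ ^ 2 := by
  have h := congrArg norm (KM z hz (x 0) (x 1))
  rw [← Kz_eq z hz] at h
  have hx : (x 0)^2 + (x 1)^2 = ‖x‖^2 := by
    rw [norm_sq_eq]; simp [sum_univ_two]
  rw [hx, show z ^ 2 + ((‖x‖^2 : ℝ) : ℂ) = (z + IC * ‖x‖) * (z - IC * ‖x‖) by push_cast; linear_combination ((‖x‖:ℂ)^2) * I_sq] at h
  simp only [norm_mul, norm_pow, norm_real, Complex.norm_ofNat, norm_eq_abs, abs_of_pos pi_pos] at h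
  exact h

lemma scl (E : Type*) [NormedAddCommGroup E] [NormedSpace ℝ E] [FiniteDimensional ℝ E] [MeasurableSpace E] [BorelSpace E]
    (μ : Measure E) [μ.IsAddHaarMeasure] (m : ℝ) (hm : (Module.finrank ℝ E : ℝ) < m) :
    ∃ C : ℝ, 0 ≤ C ∧ ∀ ε : ℝ, 0 < ε → ∫⁻ x, ofReal ((ε^2 + ‖x‖^2) ^ (-m/2)) ∂μ = ofReal (C * ε ^ (Module.finrank ℝ E - m)) := by
  have hi := integrable_rpow_neg_one_add_norm_sq (μ := μ) hm
  refine ⟨∫ x, (1 + ‖x‖^2) ^ (-m/2) ∂μ, integral_nonneg fun x => by positivity, fun ε hε => ?_⟩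
  have e1 : ∀ x : E, (ε^2 + ‖x‖^2) ^ (-m/2) = ε ^ (-m) * (1 + ‖ε⁻¹ • x‖^2) ^ (-m/2) := by
    intro x
    rw [norm_smul, norm_eq_abs, abs_of_pos (inv_pos.2 hε)]
    rw [show ε ^ (-m) = (ε^2) ^ (-m/2) by rw [← rpow_natCast, ← rpow_mul hε.le]; congr 1; push_cast; ring]
    rw [← mul_rpow ps ps]
    congr 1; field_simp
  simp_rw [e1]
  rw [← ofReal_integral_eq_lintegral_ofReal]
  · rw [integral_const_mul, integral_comp_smul (μ := μ) (fun x : E => (1 + ‖x‖^2) ^ (-m/2)), abs_of_pos ps, smul_eq_mul]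
    congr 1
    rw [rpow_sub hε, rpow_neg hε.le, rpow_natCast, inv_pow, inv_inv]; field_simp
  · exact (hi.comp_smul (inv_ne_zero hε.ne')).const_mul _
  · exact of_forall fun x => by positivity

lemma nsq (z : ℂ) (r : ℝ) : ‖z + IC * r‖^2 = z.re^2 + (z.im + r)^2 := by
  rw [sq_norm, normSq_apply]; simp; ring

lemma nsq' (z : ℂ) (r : ℝ) : ‖z - IC * r‖^2 = z.re^2 + (z.im - r)^2 := by
  rw [sq_norm, normSq_apply]; simp; ring

lemma Kz_le (z : ℂ) (hz : 0 < z.re) (x : V2) :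
    ‖Kz z x‖ ≤ 2 * π * ‖z‖ ^ (-(1/2) : ℝ) * (z.re^2 + (|z.im| - ‖x‖)^2) ^ (-(3/2)/2 : ℝ) := by
  have h := Kz_norm z hz x
  set A := ‖z + IC * ‖x‖‖
  set B := ‖z - IC * ‖x‖‖
  have hz0 : 0 < ‖z‖ := norm_pos_iff.2 fun h => by simp [h] at hz
  have hA : A^2 = z.re^2 + (z.im + ‖x‖)^2 := nsq z _
  have hB : B^2 = z.re^2 + (z.im - ‖x‖)^2 := nsq' z _
  have hzz : ‖z‖^2 = z.re^2 + z.im^2 := by simpa using nsq z 0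
  have hx := norm_nonneg x
  set q := z.re^2 + (|z.im| - ‖x‖)^2 with hq
  have hq0 : 0 < q := by positivity
  have hP : ‖z‖ ^ 2 * q ≤ (A * B)^2 := by
    rw [mul_pow, hA, hB, hzz, hq]
    rcases abs_cases z.im with ⟨h1, h2⟩ | ⟨h1, h2⟩ <;> rw [h1]
    · gcongr; nlinarith
    · rw [mul_comm (z.re^2 + (z.im + ‖x‖)^2)]; gcongr ?_ * ?_ <;> nlinarith
  have hP2 : ‖z‖ * √q ≤ A * B := by
    refine le_of_sq_le_sq ?_ ps
    rw [mul_pow, sq_sqrt hq0.le]; exact hP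
  have h2 : ‖Kz z x‖^2 * (‖z‖ * √q)^3 ≤ 4 * π^2 * ‖z‖^2 := by
    rw [← h]; gcongr
  have hsq : 0 < √q := sqrt_pos.2 hq0
  refine le_of_sq_le_sq ?_ ps
  have e1 : (‖z‖ ^ (-(1/2) : ℝ))^2 = ‖z‖⁻¹ := by
    rw [← rpow_natCast, ← rpow_mul hz0.le]; norm_num [rpow_neg_one]
  have e2 : (q ^ (-(3/2)/2 : ℝ))^2 = (√q^3)⁻¹ := by
    rw [← rpow_natCast, ← rpow_mul hq0.le, sqrt_eq_rpow, ← rpow_natCast, ← rpow_mul hq0.le, ← rpow_neg hq0.le]; norm_num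
  rw [mul_pow, mul_pow, e1, e2]
  calc ‖Kz z x‖^2 = ‖Kz z x‖^2 * (‖z‖ * √q)^3 * (‖z‖ * √q)⁻¹^3 := by field_simp
    _ ≤ 4 * π^2 * ‖z‖^2 * (‖z‖ * √q)⁻¹^3 := by gcongr
    _ = _ := by field_simp; norm_num

lemma K2 (z : ℂ) (hz : 0 < z.re) (x : V2) : ‖Kz z x‖ ≤ 2 * π * ‖z‖ ^ (-(1/2) : ℝ) * z.re ^ mth := by
  refine (Kz_le z hz x).trans ?_
  gcongr
  rw [show z.re ^ mth = (z.re^2) ^ (-(3/2)/2 : ℝ) by rw [← rpow_natCast, ← rpow_mul hz.le]; norm_num]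
  exact rpow_le_rpow_of_nonpos ps (by nlinarith [sq_nonneg (|z.im| - ‖x‖)]) nu

lemma K1 : ∃ C : ℝ, 0 ≤ C ∧ ∀ ε : ℝ, 0 < ε → ∫⁻ x : V2, ‖Kz ε x‖ₑ ≤ ofReal C := by
  obtain ⟨C, hC, h⟩ := scl V2 volume 3 (by simp; norm_num)
  refine ⟨2 * π * C, by positivity, fun ε hε => ?_⟩
  have : ∀ x : V2, ‖Kz ε x‖ₑ ≤ ofReal (2 * π * ε) * ofReal ((ε^2+‖x‖^2)^(-3/2:ℝ)) := by
    intro x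
    rw [← ofReal_mul ps, ← onee]
    refine ofReal_le_ofReal (le_of_sq_le_sq ?_ ps)
    have h := Kz_norm ε (by simpa using hε) x
    have hA := nsq ε ‖x‖
    have hB := nsq' ε ‖x‖
    simp only [ofReal_re, ofReal_im, zero_add, zero_sub, neg_sq] at hA hB
    set q := ε^2+‖x‖^2 with hq
    have hq0 : 0 < q := by positivity
    have e : ‖(ε:ℂ) + IC * ‖x‖‖ * ‖(ε:ℂ) - IC * ‖x‖‖ = q := by
      refine (sq_eq_sq₀ ps hq0.le).1 ?_
      rw [mul_pow, hA, hB]; ring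
    rw [e] at h
    have e2 : (q ^ (-3/2 : ℝ))^2 = (q^3)⁻¹ := by
      rw [← rpow_natCast, ← rpow_mul hq0.le, ← rpow_natCast, ← rpow_neg hq0.le]; norm_num
    rw [mul_pow, e2, ← div_eq_mul_inv, le_div_iff₀ ps, h]
    simp; rw [mul_pow, mul_pow]; norm_num
  refine (lintegral_mono this).trans ?_
  rw [lintegral_const_mul' _ _ (by finiteness), h ε hε, ← ofReal_mul ps]
  refine ofReal_le_ofReal (le_of_eq ?_)
  have : ε ^ ((Module.finrank ℝ V2 : ℝ) - 3) = ε⁻¹ := by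
    rw [← rpow_neg_one]; congr 1; simp; norm_num
  rw [this]; field_simp

lemma V2_lint (f : V2 → ENN) (hf : Measurable f) : ∫⁻ x, f x = ∫⁻ a : ℝ, ∫⁻ b : ℝ, f !₂[a, b] := by
  have h1 : ∫⁻ x, f x = ∫⁻ y : Fin 2 → ℝ, f (toLp 2 y) :=
    ((volume_preserving_toLp (Fin 2)).lintegral_comp hf).symm
  have hf2 : Measurable fun y : Fin 2 → ℝ => f (toLp 2 y) := hf.comp (volume_preserving_toLp (Fin 2)).measurable
  have h2 : ∫⁻ y : Fin 2 → ℝ, f (toLp 2 y) = ∫⁻ q : ℝ × ℝ, f (!₂[q.1, q.2]) :=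
    ((volume_preserving_finTwoArrow ℝ).symm.lintegral_comp hf2).symm
  rw [h1, h2, volume_eq_prod, lintegral_prod]
  exact (hf2.comp (finTwoArrow).symm.measurable).aemeasurable

lemma slice_ineq (T a b : ℝ) (hT : 0 ≤ T) (hab : |b| ≤ |a|) :
    (|a| - √(T^2 - b^2))^2 ≤ 9 * (T - √(a^2+b^2))^2 := by
  set r := √(a^2+b^2)
  have hr : r^2 = a^2+b^2 := sq_sqrt ps
  have hr0 : 0 ≤ r := sqrt_nonneg _
  have ha := abs_nonneg a
  have hb := abs_nonneg b
  have ha2 := sq_abs a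
  have hb2 := sq_abs b
  have hra : |a| ≤ r := by refine le_sqrt_of_sq_le ?_; nlinarith
  have hr2 : r ≤ 3/2 * |a| := by
    refine sqrt_le_iff.2 ⟨by positivity, ?_⟩; nlinarith [mul_self_le_mul_self hb hab]
  rw [show 9 * (T - r)^2 = (3 * (T - r))^2 by ring, sq_le_sq]
  by_cases h : b^2 ≤ T^2
  · set τ := √(T^2 - b^2)
    have hτ : τ^2 = T^2 - b^2 := sq_sqrt la
    have hτ0 : 0 ≤ τ := sqrt_nonneg _
    have h1 : (|a| - τ) * (|a| + τ) = (r - T) * (r + T) := by nlinarith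
    have hT2 : T ≤ |b| + τ := by
      refine le_of_sq_le_sq ?_ ps; nlinarith
    have h2 := congrArg abs h1
    rw [abs_mul, abs_mul, abs_of_nonneg (by positivity : 0 ≤ |a| + τ), abs_of_nonneg (by positivity : 0 ≤ r + T)] at h2
    rw [abs_mul, abs_sub_comm T, abs_of_pos (by norm_num : (0:ℝ) < 3)]
    have h3 : r + T ≤ 3 * (|a| + τ) := by linarith
    rcases (by positivity : 0 ≤ |a| + τ).eq_or_lt with h0 | h0
    · have : |a| = 0 := by linarith
      have : τ = 0 := by linarith
      rw [‹|a| = 0›, ‹τ = 0›, sub_zero, abs_zero]; positivity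
    · refine le_of_mul_le_mul_right ?_ h0
      rw [h2]
      nlinarith [abs_nonneg (r - T)]
  · rw [sqrt_eq_zero_of_nonpos la, sub_zero, abs_abs, abs_mul, abs_of_pos (by norm_num : (0:ℝ) < 3)]
    have hTb : T ≤ |b| := by refine le_of_sq_le_sq ?_ hb; nlinarith
    rw [abs_sub_comm]
    refine le_trans ?_ (mul_le_mul_of_nonneg_left (le_abs_self _) nu)
    nlinarith

set_option maxHeartbeats 400000 in
lemma K3 : ∃ C : ℝ, 0 ≤ C ∧ ∀ (z : ℂ) (y : V2) (R : ℝ), 0 < z.re → z.im ≠ 0 → 0 < R →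
    ∫⁻ x in Metric.ball y R, ‖Kz z x‖ₑ ≤ ofReal (C * (R * (z.re * |z.im|) ^ (-(1/2) : ℝ))) := by
  obtain ⟨C, hC, h⟩ := scl ℝ volume (3/2) (by simp; norm_num)
  refine ⟨2 * π * 9^(3/2/2:ℝ) * (8 * C), by positivity, fun z y R hz hi hR => ?_⟩
  set ε := z.re
  set T := |z.im|
  have hT : 0 < T := abs_pos.2 hi
  set m : ℝ := -(3/2)/2 with hm
  set G : ℝ → ℝ → ENN := fun u τ => ofReal ((ε^2 + (|u| - τ)^2) ^ m) with hG
  have hGm : Measurable fun q : ℝ × ℝ => G q.1 q.2 := by fun_prop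
  have hGi : ∀ τ, ∫⁻ u, G u τ ≤ ofReal (2 * C * ε ^ (-(1/2):ℝ)) := by
    intro τ
    have e : (Module.finrank ℝ ℝ : ℝ) - 3/2 = -(1/2) := by simp; norm_num
    have h1 := h ε hz
    rw [e] at h1
    calc ∫⁻ u, G u τ ≤ ∫⁻ u, (ofReal ((ε^2 + ‖u - τ‖^2) ^ m) + ofReal ((ε^2 + ‖u + τ‖^2) ^ m)) := by
          refine lintegral_mono fun u => ?_
          simp only [hG, norm_eq_abs, sq_abs]
          rcases abs_cases u with ⟨h1, -⟩ | ⟨h1, -⟩ <;> rw [h1]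
          · exact le_self_add
          · rw [show -u - τ = -(u + τ) by ring, neg_sq]; exact le_add_self
      _ = ofReal (C * ε ^ (-(1/2):ℝ)) + ofReal (C * ε ^ (-(1/2):ℝ)) := by
          rw [lintegral_add_left fp, lintegral_sub_right_eq_self (fun u => ofReal ((ε^2 + ‖u‖^2) ^ m)) τ,
            lintegral_add_right_eq_self (fun u => ofReal ((ε^2 + ‖u‖^2) ^ m)) τ, h1]
      _ = _ := by rw [← ofReal_add ps ps]; congr 1; ring
  set c : ℝ := 2 * π * ‖z‖ ^ (-(1/2) : ℝ) * 9^(3/2/2:ℝ) with hc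
  have hc0 : 0 ≤ c := by positivity
  set S : Fin 2 → Set ℝ := fun j => Ioo (y j - R) (y j + R) with hS
  set F : V2 → ENN := fun x => (S 1).indicator 1 (x 1) * G (x 0) √(T^2 - (x 1)^2) + (S 0).indicator 1 (x 0) * G (x 1) √(T^2 - (x 0)^2) with hF
  have hpt : ∀ x ∈ Metric.ball y R, ‖Kz z x‖ₑ ≤ ofReal c * F x := by
    intro x hx
    have hxj : ∀ j, x j ∈ S j := by
      intro j
      have : |x j - y j| < R := by
        have h1 := norm_apply_le (x - y) j
        rw [mem_ball_iff_norm] at hx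
        simp only [PiLp.sub_apply, norm_eq_abs] at h1
        linarith
      rw [abs_lt] at this; constructor <;> linarith [this.1, this.2]
    have hxn : ‖x‖ = √((x 0)^2 + (x 1)^2) := by rw [norm_eq]; simp [sum_univ_two]
    have key : ∀ u v : ℝ, |v| ≤ |u| → ‖x‖ = √(u^2+v^2) → ‖Kz z x‖ₑ ≤ ofReal c * G u √(T^2 - v^2) := by
      intro u v huv hx2
      rw [← ofReal_mul hc0, ← onee]
      refine ofReal_le_ofReal ((Kz_le z hz x).trans ?_)
      have h1 := slice_ineq T u v hT.le huv
      rw [hc, mul_assoc (2 * π * ‖z‖ ^ (-(1/2) : ℝ))]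
      gcongr
      rw [hx2]
      calc (ε^2 + (T - √(u^2+v^2))^2) ^ (-(3/2)/2:ℝ) ≤ (9⁻¹ * (ε^2 + (|u| - √(T^2-v^2))^2)) ^ (-(3/2)/2:ℝ) := by
            refine rpow_le_rpow_of_nonpos ps ?_ nu
            nlinarith [sq_nonneg ε]
        _ = _ := by
            rw [mul_rpow ps ps, inv_rpow nu, ← rpow_neg nu]
            norm_num [hm]
    simp only [hF, indicator_of_mem (hxj _), Pi.one_apply, one_mul]
    rcases le_total |x 1| |x 0| with h1 | h1
    · exact (key _ _ h1 hxn).trans (by gcongr; exact le_self_add)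
    · exact (key _ _ h1 (by rw [hxn, add_comm])).trans (by gcongr; exact le_add_self)
  have hSm : ∀ j, Measurable ((S j).indicator (1 : ℝ → ENN)) := fun j => measurable_one.indicator measurableSet_Ioo
  have hSi : ∀ j, ∫⁻ b, (S j).indicator (1 : ℝ → ENN) b = ofReal (2 * R) := by
    intro j
    rw [lintegral_indicator_one measurableSet_Ioo, volume_Ioo]; congr 1; ring
  clear_value G S
  have hp : ∀ j, Measurable fun x : V2 => x j := fun j => by fun_prop
  have hq : Measurable fun b : ℝ => √(T^2 - b^2) := by fun_prop
  have gm : ∀ {α : Type} [MeasurableSpace α] {g h : α → ℝ}, Measurable g → Measurable h → Measurable fun x => G (g x) √(T^2 - (h x)^2) :=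
    fun hg hh => hGm.comp (hg.prodMk (hq.comp hh))
  have sm : ∀ {α : Type} [MeasurableSpace α] {g : α → ℝ} (j), Measurable g → Measurable fun x => (S j).indicator (1 : ℝ → ENN) (g x) :=
    fun j hg => (hSm j).comp hg
  have m1 : Measurable fun x : V2 => (S 1).indicator (1 : ℝ → ENN) (x 1) * G (x 0) √(T^2 - (x 1)^2) :=
    (sm 1 (hp 1)).mul (gm (hp 0) (hp 1))
  have m2 : Measurable fun x : V2 => (S 0).indicator (1 : ℝ → ENN) (x 0) * G (x 1) √(T^2 - (x 0)^2) :=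
    (sm 0 (hp 0)).mul (gm (hp 1) (hp 0))
  have hFi : ∫⁻ x, F x ≤ ofReal (8 * C * R * ε ^ (-(1/2):ℝ)) := by
    have i2 : ∀ j, ∫⁻ b, (S j).indicator (1 : ℝ → ENN) b * ∫⁻ a, G a √(T^2 - b^2) ≤ ofReal (4 * C * R * ε ^ (-(1/2):ℝ)) := by
      intro j
      calc _ ≤ ∫⁻ b, (S j).indicator (1 : ℝ → ENN) b * ofReal (2 * C * ε ^ (-(1/2):ℝ)) := by
            gcongr; exact hGi _
        _ = _ := by
            rw [lintegral_mul_const _ (hSm j), hSi, ← ofReal_mul ps]; congr 1; ring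
    rw [hF, lintegral_add_left m1, V2_lint _ m1, V2_lint _ m2]
    have s1 : ∫⁻ a : ℝ, ∫⁻ b : ℝ, (S 1).indicator (1 : ℝ → ENN) ((!₂[a,b] : V2) 1) * G ((!₂[a,b] : V2) 0) √(T^2 - ((!₂[a,b] : V2) 1)^2)
        = ∫⁻ b, (S 1).indicator (1 : ℝ → ENN) b * ∫⁻ a, G a √(T^2 - b^2) := by
      rw [lintegral_lintegral_swap]
      · refine ltgc fun b => ?_
        exact lintegral_const_mul (μ := volume) (f := fun a => G a √(T^2 - b^2)) ((S 1).indicator 1 b) (gm (g := fun a => a) (h := fun _ => b) measurable_id measurable_const)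
      · exact ((sm 1 measurable_snd).mul (gm measurable_fst measurable_snd)).aemeasurable
    have s2 : ∫⁻ a : ℝ, ∫⁻ b : ℝ, (S 0).indicator (1 : ℝ → ENN) ((!₂[a,b] : V2) 0) * G ((!₂[a,b] : V2) 1) √(T^2 - ((!₂[a,b] : V2) 0)^2)
        = ∫⁻ b, (S 0).indicator (1 : ℝ → ENN) b * ∫⁻ a, G a √(T^2 - b^2) := by
      refine ltgc fun b => ?_
      exact lintegral_const_mul (μ := volume) (f := fun a => G a √(T^2 - b^2)) ((S 0).indicator 1 b) (gm (g := fun a => a) (h := fun _ => b) measurable_id measurable_const)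
    rw [s1, s2]
    refine (add_le_add (i2 1) (i2 0)).trans ?_
    rw [← ofReal_add ps ps]
    exact ofReal_le_ofReal la
  calc _ ≤ ∫⁻ x in Metric.ball y R, ofReal c * F x := setLIntegral_mono' measurableSet_ball hpt
    _ ≤ ∫⁻ x, ofReal c * F x := setLIntegral_le_lintegral _ _
    _ = ofReal c * ∫⁻ x, F x := lintegral_const_mul' _ _ (by finiteness)
    _ ≤ ofReal c * ofReal (8 * C * R * ε ^ (-(1/2):ℝ)) := by gcongr
    _ ≤ _ := by
      rw [← ofReal_mul hc0]
      refine ofReal_le_ofReal ?_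
      rw [hc, mul_rpow hz.le hT.le]
      have : ‖z‖ ^ (-(1/2) : ℝ) ≤ T ^ (-(1/2) : ℝ) := rpow_le_rpow_of_nonpos hT (abs_im_le_norm z) nu
      calc 2 * π * ‖z‖ ^ (-(1/2) : ℝ) * 9^(3/2/2:ℝ) * (8 * C * R * ε ^ (-(1/2):ℝ)) ≤ 2 * π * T ^ (-(1/2) : ℝ) * 9^(3/2/2:ℝ) * (8 * C * R * ε ^ (-(1/2):ℝ)) := by gcongr
        _ = _ := by ring

lemma CS2 {α : Type*} [MeasurableSpace α] (μ : Measure α) {f g : α → ENN} (hf : AEMeasurable f μ) (hg : AEMeasurable g μ) :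
    ∫⁻ x, f x * g x ∂μ ≤ (∫⁻ x, f x ^ 2 ∂μ) ^ hfr * (∫⁻ x, g x ^ 2 ∂μ) ^ hfr := by
  have := lintegral_mul_le_Lp_mul_Lq μ Real.HolderConjugate.two_two hf hg
  simpa only [ENNReal.rpow_two, Pi.mul_apply] using this

lemma SCHUR {X Y : Type*} [MeasurableSpace X] [MeasurableSpace Y] {μ : Measure X} {ν : Measure Y} [SFinite μ] [SFinite ν]
    {k : X × Y → ENN} (hk : Measurable k) {f o1 : X → ENN} {g o2 : Y → ENN} (hf : Measurable f) (hg : Measurable g)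
    (ho1 : Measurable o1) (ho2 : Measurable o2) {D1 D2 : ENN} (h2 : ∀ x, ∫⁻ y, k (x, y) * o2 y ^ 2 ∂ν ≤ D2)
    (h1 : ∀ y, ∫⁻ x, k (x, y) * o1 x ^ 2 ∂μ ≤ D1) :
    ∫⁻ p, k p * ((f p.1 * o1 p.1) * (g p.2 * o2 p.2)) ∂(μ.prod ν) ≤
      (D1 * D2) ^ hfr * ((∫⁻ x, f x ^ 2 ∂μ) ^ hfr * (∫⁻ y, g y ^ 2 ∂ν) ^ hfr) := by
  have hs : ∀ c : ENN, c ^ hfr * c ^ hfr = c := fun c => by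
    rw [← ENNReal.rpow_add_of_nonneg _ _ nu nu]; norm_num
  have m1 : Measurable fun p : X × Y => k p ^ hfr * (f p.1 * o2 p.2) := by fun_prop
  have m2 : Measurable fun p : X × Y => k p ^ hfr * (g p.2 * o1 p.1) := by fun_prop
  have e : ∀ p : X × Y, k p * ((f p.1 * o1 p.1) * (g p.2 * o2 p.2)) = (k p ^ hfr * (f p.1 * o2 p.2)) * (k p ^ hfr * (g p.2 * o1 p.1)) := by
    intro p; nth_rw 1 [← hs (k p)]; ring
  have q1 : ∫⁻ p, (k p ^ hfr * (f p.1 * o2 p.2)) ^ 2 ∂(μ.prod ν) ≤ D2 * ∫⁻ x, f x ^ 2 ∂μ := by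
    rw [lintegral_prod _ fp, ← lcmu _ fp]
    refine lintegral_mono fun x => ?_
    calc _ = ∫⁻ y, f x ^ 2 * (k (x, y) * o2 y ^ 2) ∂ν := by
          refine ltgc fun y => ?_
          nth_rw 2 [← hs (k (x,y))]; ring
      _ = f x ^ 2 * ∫⁻ y, (k (x, y) * o2 y ^ 2) ∂ν := lcmu _ fp
      _ ≤ f x ^ 2 * D2 := by gcongr; exact h2 x
      _ = _ := mul_comm _ _
  have q2 : ∫⁻ p, (k p ^ hfr * (g p.2 * o1 p.1)) ^ 2 ∂(μ.prod ν) ≤ D1 * ∫⁻ y, g y ^ 2 ∂ν := by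
    rw [lintegral_prod_symm _ fp, ← lcmu _ fp]
    refine lintegral_mono fun y => ?_
    calc _ = ∫⁻ x, g y ^ 2 * (k (x, y) * o1 x ^ 2) ∂μ := by
          refine ltgc fun x => ?_
          nth_rw 2 [← hs (k (x,y))]; ring
      _ = g y ^ 2 * ∫⁻ x, (k (x, y) * o1 x ^ 2) ∂μ := lcmu _ fp
      _ ≤ g y ^ 2 * D1 := by gcongr; exact h1 y
      _ = _ := mul_comm _ _
  rw [ltgc e]
  refine (CS2 _ m1.aemeasurable m2.aemeasurable).trans ?_
  refine (mul_le_mul' (ENNReal.rpow_le_rpow q1 nu) (ENNReal.rpow_le_rpow q2 nu)).trans (le_of_eq ?_)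
  simp only [Emn _ _ (by norm_num : (0:ℝ) ≤ 1/2)]
  ring

lemma Kz_meas (z : ℂ) : Measurable (Kz z) := by
  have : StronglyMeasurable fun p : V2 × V2 => Complex.exp (-IC * ((⟪p.1, p.2⟫ : ℝ) : ℂ)) * Complex.exp (-z * (‖p.2‖ : ℂ)) :=
    stronglyMeasurable fp
  exact this.integral_prod_right'.measurable

lemma Kz_fin (z : ℂ) (hz : 0 < z.re) : ∃ M : ℝ, 0 ≤ M ∧ ∫⁻ x, ‖Kz z x‖ₑ ≤ ofReal M := by
  obtain ⟨C, hC, h⟩ := scl V2 volume 3 (by simp; norm_num)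
  set c : ℝ := 2 + 2 * |z.im|^2 / z.re^2 with hc
  have hc0 : 0 < c := by positivity
  refine ⟨2 * π * ‖z‖ * c^(3/2:ℝ) * (C * z.re ^ ((Module.finrank ℝ V2 : ℝ) - 3)), by positivity, (lintegral_mono (g := fun x => ofReal (2 * π * ‖z‖ * c^(3/2:ℝ)) * ofReal ((z.re^2+‖x‖^2)^(-3/2:ℝ))) fun x => ?_).trans (le_of_eq ?_)⟩
  rotate_left
  · rw [lintegral_const_mul' _ _ (by finiteness), h _ hz, ← ofReal_mul ps]
  beta_reduce
  rw [← ofReal_mul ps, ← onee]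
  refine ofReal_le_ofReal (le_of_sq_le_sq ?_ ps)
  have h := Kz_norm z hz x
  have hA := nsq z ‖x‖
  have hB := nsq' z ‖x‖
  set A := ‖z + IC * ‖x‖‖
  set B := ‖z - IC * ‖x‖‖
  set q := z.re^2+‖x‖^2 with hq
  have hq0 : 0 < q := by positivity
  have hx := norm_nonneg x
  have key : ∀ v : ℝ, v^2 = |z.im|^2 → q ≤ c * (z.re^2 + (v + ‖x‖)^2) := by
    intro v hv
    rw [hc]
    have : 2 * |z.im|^2 ≤ 2 * |z.im|^2 / z.re^2 * (z.re^2 + (v + ‖x‖)^2) := by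
      rw [div_mul_eq_mul_div, le_div_iff₀ ps]
      gcongr; nlinarith [sq_nonneg (v + ‖x‖)]
    nlinarith [sq_nonneg (v + ‖x‖ + v), sq_nonneg (v + ‖x‖), sq_nonneg z.re]
  have e : q / c ≤ A * B := by
    refine le_of_sq_le_sq ?_ ps
    rw [mul_pow, hA, hB, sq]
    have k1 := key z.im (sq_abs _).symm
    have k2 := key (-z.im) (by rw [neg_sq, sq_abs])
    gcongr
    · rw [div_le_iff₀ hc0, mul_comm]; exact k1
    · rw [div_le_iff₀ hc0, mul_comm]; rw [show (z.im-‖x‖)^2 = (-z.im+‖x‖)^2 by ring]; exact k2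
  have h2 : ‖Kz z x‖^2 * (q / c)^3 ≤ 4 * π^2 * ‖z‖^2 := by rw [← h]; gcongr
  have e2 : (q ^ (-3/2 : ℝ))^2 = (q^3)⁻¹ := by
    rw [← rpow_natCast, ← rpow_mul hq0.le, ← rpow_natCast, ← rpow_neg hq0.le]; norm_num
  have e3 : (c ^ (3/2 : ℝ))^2 = c^3 := by
    rw [← rpow_natCast, ← rpow_mul hc0.le, ← rpow_natCast]; norm_num
  rw [mul_pow, mul_pow, mul_pow, e2, e3]
  calc ‖Kz z x‖^2 = ‖Kz z x‖^2 * (q / c)^3 * (c / q)^3 := by field_simp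
    _ ≤ 4 * π^2 * ‖z‖^2 * (c / q)^3 := by gcongr
    _ = _ := by field_simp; ring

structure Nice (H : V2 → ℂ) : Prop where
  m : Measurable H
  i : Integrable H
  b : ∃ M : ℝ, ∀ x, ‖H x‖ ≤ M

lemma Nice.mul {H : V2 → ℂ} (h : Nice H) {g : V2 → ℂ} (hg : Measurable g) {M : ℝ} (hM : ∀ x, ‖g x‖ ≤ M) : Nice fun x => H x * g x := by
  refine ⟨h.m.mul hg, ?_, ?_⟩
  · have := h.i.bdd_mul hg.aestronglyMeasurable (of_forall hM)
    exact this.congr (of_forall fun x => mul_comm _ _)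
  · obtain ⟨N, hN⟩ := h.b
    refine ⟨N * M, fun x => ?_⟩
    rw [norm_mul]
    exact mul_le_mul (hN x) (hM x) (norm_nonneg _) ((norm_nonneg _).trans (hN x))

lemma Nice.conj {H : V2 → ℂ} (h : Nice H) : Nice fun x => starRingEnd ℂ (H x) :=
  ⟨continuous_conj.measurable.comp h.m, (h.i.norm.mono' (continuous_conj.measurable.comp h.m).aestronglyMeasurable (of_forall fun x => by simp)), h.b.imp fun M hM x => by simpa using hM x⟩

def Bz (z : ℂ) (H1 H2 : V2 → ℂ) : ℂ := ∫ ξ : V2, Complex.exp (-z * (‖ξ‖ : ℂ)) * (ft2 H1 ξ * starRingEnd ℂ (ft2 H2 ξ))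

lemma Bz_kernel (z : ℂ) (hz : 0 < z.re) {H1 H2 : V2 → ℂ} (h1 : Nice H1) (h2 : Nice H2) :
    Integrable (fun p : V2 × V2 => Kz z (p.1 - p.2) * (H1 p.1 * starRingEnd ℂ (H2 p.2))) ∧
    Bz z H1 H2 = ∫ p : V2 × V2, Kz z (p.1 - p.2) * (H1 p.1 * starRingEnd ℂ (H2 p.2)) := by
  have hP : Integrable (fun p : V2 × V2 => H1 p.1 * starRingEnd ℂ (H2 p.2)) := h1.i.mul_prod h2.conj.i
  have hT : Integrable (fun q : (V2 × V2) × V2 => (H1 q.1.1 * starRingEnd ℂ (H2 q.1.2)) * Complex.exp (-z * (‖q.2‖ : ℂ))) := hP.mul_prod (Kz_integrable z hz)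
  have hT2 : Integrable (fun q : (V2 × V2) × V2 => Complex.exp (-IC * ((⟪q.1.1 - q.1.2, q.2⟫ : ℝ) : ℂ)) * ((H1 q.1.1 * starRingEnd ℂ (H2 q.1.2)) * Complex.exp (-z * (‖q.2‖ : ℂ)))) := by
    refine hT.bdd_mul (c := 1) (aestronglyMeasurable fp) (of_forall fun q => ?_)
    rw [norm_cexp_I]
  have e1 : ∀ p : V2 × V2, ∫ ξ : V2, Complex.exp (-IC * ((⟪p.1 - p.2, ξ⟫ : ℝ) : ℂ)) * ((H1 p.1 * starRingEnd ℂ (H2 p.2)) * Complex.exp (-z * (‖ξ‖ : ℂ))) = Kz z (p.1 - p.2) * (H1 p.1 * starRingEnd ℂ (H2 p.2)) := by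
    intro p
    rw [Kz, ← integral_mul_const]
    congr 1; ext ξ; ring
  have i1 := hT2.integral_prod_left
  simp only [e1] at i1
  refine ⟨i1, ?_⟩
  rw [← integral_congr_ae (of_forall e1)]
  rw [integral_integral_swap hT2, Bz]
  congr 1; ext ξ
  have : ∀ p : V2 × V2, Complex.exp (-IC * ((⟪p.1 - p.2, ξ⟫ : ℝ) : ℂ)) * ((H1 p.1 * starRingEnd ℂ (H2 p.2)) * Complex.exp (-z * (‖ξ‖ : ℂ))) =
      Complex.exp (-z * (‖ξ‖ : ℂ)) * ((Complex.exp (-IC * ((⟪p.1, ξ⟫ : ℝ) : ℂ)) * H1 p.1) * starRingEnd ℂ (Complex.exp (-IC * ((⟪p.2, ξ⟫ : ℝ) : ℂ)) * H2 p.2)) := by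
    intro p
    rw [map_mul, ← exp_conj, inner_sub_left]
    simp only [map_mul, map_neg, conj_I, conj_ofReal, neg_neg]
    rw [show -IC * (((⟪p.1, ξ⟫ - ⟪p.2, ξ⟫ : ℝ)) : ℂ) = -IC * ((⟪p.1, ξ⟫ : ℝ) : ℂ) + IC * ((⟪p.2, ξ⟫ : ℝ) : ℂ) by push_cast; ring, Complex.exp_add]
    ring
  simp only [this]
  rw [integral_const_mul]
  congr 1
  rw [volume_eq_prod, integral_prod_mul (fun x => Complex.exp (-IC * ((⟪x, ξ⟫ : ℝ) : ℂ)) * H1 x) (fun y => starRingEnd ℂ (Complex.exp (-IC * ((⟪y, ξ⟫ : ℝ) : ℂ)) * H2 y)), integral_conj]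
  rfl

lemma ft2_meas {H : V2 → ℂ} (h : Nice H) : Measurable (ft2 H) := by
  have hm := h.m
  have : StronglyMeasurable fun p : V2 × V2 => Complex.exp (-IC * ((⟪p.2, p.1⟫ : ℝ) : ℂ)) * H p.2 :=
    ((measurable fp).mul (hm.comp measurable_snd)).stronglyMeasurable
  exact this.integral_prod_right'.measurable

lemma ft2_le {H : V2 → ℂ} (ξ : V2) : ‖ft2 H ξ‖ ≤ ∫ x, ‖H x‖ := by
  refine (norm_integral_le_integral_norm _).trans (le_of_eq ?_)
  congr 1; ext x; rw [norm_mul, norm_cexp_I, one_mul]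

lemma sub_lint (f : V2 → ENN) (x : V2) : ∫⁻ y, f (x - y) = ∫⁻ y, f y := lintegral_sub_left_eq_self f x

lemma K_schur {z : ℂ} {D : ENN} (hD : ∫⁻ x, ‖Kz z x‖ₑ ≤ D) {f g : V2 → ENN} (hf : Measurable f) (hg : Measurable g) :
    ∫⁻ p : V2 × V2, ‖Kz z (p.1 - p.2)‖ₑ * (f p.1 * g p.2) ≤ D * ((∫⁻ x, f x ^ 2) ^ hfr * (∫⁻ y, g y ^ 2) ^ hfr) := by
  have hk : Measurable fun p : V2 × V2 => ‖Kz z (p.1 - p.2)‖ₑ := ((Kz_meas z).comp (measurable_fst.sub measurable_snd)).enorm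
  have := SCHUR (μ := volume) (ν := volume) hk hf hg (o1 := fun _ => 1) (o2 := fun _ => 1) measurable_const measurable_const (D1 := D) (D2 := D) ?_ ?_
  · simp only [mul_one] at this
    rw [volume_eq_prod]
    refine this.trans (le_of_eq ?_)
    rw [Emn _ _ nu, ← ENNReal.rpow_add_of_nonneg _ _ nu nu]
    norm_num
  · intro x; simp only [one_pow, mul_one]; rw [sub_lint (fun y => ‖Kz z y‖ₑ)]; exact hD
  · intro y; simp only [one_pow, mul_one]; rw [lintegral_sub_right_eq_self (fun y => ‖Kz z y‖ₑ)]; exact hD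

lemma EN1 {C : ℝ} (hC : ∀ ε : ℝ, 0 < ε → ∫⁻ x : V2, ‖Kz ε x‖ₑ ≤ ofReal C) {ε : ℝ} (hε : 0 < ε) {H : V2 → ℂ} (h : Nice H) :
    ∫⁻ ξ, ofReal (exp (-ε * ‖ξ‖)) * ‖ft2 H ξ‖ₑ ^ 2 ≤ ofReal C * ∫⁻ x, ‖H x‖ₑ ^ 2 := by
  have hz : 0 < ((ε:ℂ)).re := by simpa
  obtain ⟨hi, he⟩ := Bz_kernel ε hz h h
  have e1 : Bz ε H H = ((∫ ξ, exp (-ε * ‖ξ‖) * ‖ft2 H ξ‖^2 : ℝ) : ℂ) := by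
    rw [Bz, ← integral_complex_ofReal]
    congr 1; ext ξ
    rw [Complex.mul_conj, normSq_eq_norm_sq]; push_cast; rfl
  have e2 : ∫⁻ ξ, ofReal (exp (-ε * ‖ξ‖)) * ‖ft2 H ξ‖ₑ ^ 2 = ‖Bz ε H H‖ₑ := by
    rw [e1, ← onee, norm_real, norm_of_nonneg (integral_nonneg fun ξ => by positivity), ofReal_integral_eq_lintegral_ofReal]
    · refine ltgc fun ξ => ?_
      rw [ofReal_mul ps, ENNReal.ofReal_pow (norm_nonneg _), onee]
    · have := (exp_norm_integrable ε hε).bdd_mul (c := (∫ x, ‖H x‖)^2) ((ft2_meas h).norm.pow_const 2).aestronglyMeasurable (of_forall fun ξ => ?_)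
      · exact this.congr (of_forall fun x => mul_comm _ _)
      · rw [norm_pow, norm_norm]; gcongr; exact ft2_le ξ
    · exact of_forall fun ξ => by positivity
  rw [e2, he]
  refine (eile _).trans ?_
  simp only [enorm_mul, enorm_conj]
  refine (K_schur (hC ε hε) h.m.enorm h.m.enorm).trans (le_of_eq ?_)
  rw [← ENNReal.rpow_add_of_nonneg _ _ nu nu]
  norm_num

lemma EN {C : ℝ} (hC : ∀ ε : ℝ, 0 < ε → ∫⁻ x : V2, ‖Kz ε x‖ₑ ≤ ofReal C) {z : ℂ} (hz : 0 < z.re) {H1 H2 : V2 → ℂ} (h1 : Nice H1) (h2 : Nice H2) :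
    ‖Bz z H1 H2‖ₑ ≤ ofReal C * ((∫⁻ x, ‖H1 x‖ₑ ^ 2) ^ hfr * (∫⁻ x, ‖H2 x‖ₑ ^ 2) ^ hfr) := by
  set ex : V2 → ENN := fun ξ => ofReal (exp (-(z.re/2) * ‖ξ‖)) with hex
  have hexx : ∀ ξ : V2, ex ξ * ex ξ = ofReal (exp (-z.re * ‖ξ‖)) := fun ξ => by
    rw [hex, ← ofReal_mul ps, ← exp_add]; congr 2; ring
  have hexm : Measurable ex := by fun_prop
  have m1 := ft2_meas h1
  have m2 := ft2_meas h2
  rw [Bz]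
  calc _ ≤ ∫⁻ ξ, (ex ξ * ‖ft2 H1 ξ‖ₑ) * (ex ξ * ‖ft2 H2 ξ‖ₑ) := by
        refine (eile _).trans (lintegral_mono fun ξ => le_of_eq ?_)
        rw [enorm_mul, enorm_mul, enorm_conj, ← onee (Complex.exp _), norm_cexp_neg, ← hexx]; ring
    _ ≤ _ := CS2 _ (hexm.mul m1.enorm).aemeasurable (hexm.mul m2.enorm).aemeasurable
    _ ≤ (ofReal C * ∫⁻ x, ‖H1 x‖ₑ ^ 2) ^ hfr * (ofReal C * ∫⁻ x, ‖H2 x‖ₑ ^ 2) ^ hfr := by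
        gcongr
        · simp only [mul_pow, sq (ex _), hexx]; exact EN1 hC hz h1
        · simp only [mul_pow, sq (ex _), hexx]; exact EN1 hC hz h2
    _ = (ofReal C ^ hfr * ofReal C ^ hfr) * ((∫⁻ x, ‖H1 x‖ₑ ^ 2) ^ hfr * (∫⁻ x, ‖H2 x‖ₑ ^ 2) ^ hfr) := by
        simp only [Emn _ _ (by norm_num : (0:ℝ) ≤ 1/2)]; ring
    _ = _ := by
        rw [← ENNReal.rpow_add_of_nonneg _ _ nu nu]; norm_num

lemma exp_entire {α : Type*} [MeasurableSpace α] {μ : Measure α} {φ : α → ℂ} (hφ : Integrable φ μ) {L : α → ℝ} (hL : Measurable L)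
    {M : ℝ} (hM0 : 0 ≤ M) (hM : ∀ p, |L p| ≤ M) : Differentiable ℂ fun ζ : ℂ => ∫ p, φ p * Complex.exp (ζ * L p) ∂μ := by
  intro ζ0
  have hb : ∀ ζ : ℂ, ∀ p, ‖Complex.exp (ζ * L p)‖ ≤ exp (‖ζ‖ * M) := fun ζ p => by
    rw [norm_exp]
    refine exp_le_exp.2 ?_
    simp only [mul_re, ofReal_re, ofReal_im, mul_zero, sub_zero]
    refine (le_abs_self _).trans ?_
    rw [abs_mul]; gcongr
    · exact abs_re_le_norm ζ
    · exact hM p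
  have hme : ∀ ζ : ℂ, Measurable fun p => Complex.exp (ζ * L p) := fun ζ => by fun_prop
  refine (hasDerivAt_integral_of_dominated_loc_of_deriv_le (F' := fun ζ p => φ p * (Complex.exp (ζ * L p) * L p))
    (bound := fun p => ‖φ p‖ * (exp ((‖ζ0‖ + 1) * M) * M)) (ball_mem_nhds ζ0 one_pos) ?_ ?_ ?_ ?_ ?_ ?_).2.differentiableAt
  · exact of_forall fun ζ => hφ.aestronglyMeasurable.mul (hme ζ).aestronglyMeasurable
  · have := hφ.bdd_mul (hme ζ0).aestronglyMeasurable (of_forall (hb ζ0))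
    exact this.congr (of_forall fun x => mul_comm _ _)
  · exact hφ.aestronglyMeasurable.mul ((hme ζ0).mul fp).aestronglyMeasurable
  · refine of_forall fun p ζ hζ => ?_
    rw [norm_mul, norm_mul, norm_real, norm_eq_abs]
    have : ‖ζ‖ ≤ ‖ζ0‖ + 1 := by
      have := norm_sub_norm_le ζ ζ0
      rw [mem_ball_iff_norm] at hζ; linarith
    gcongr
    · exact (hb ζ p).trans (exp_le_exp.2 (by gcongr))
    · exact hM p
  · exact hφ.norm.mul_const _
  · refine of_forall fun p ζ _ => ?_
    have h1 : HasDerivAt (fun ζ : ℂ => ζ * L p) (L p) ζ := by simpa using (hasDerivAt_id ζ).mul_const (L p : ℂ)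
    exact (h1.cexp).const_mul _

lemma INTη {C1 : ℝ} (hC0 : 0 ≤ C1) (hC : ∀ ε : ℝ, 0 < ε → ∫⁻ x : V2, ‖Kz ε x‖ₑ ≤ ofReal C1) {z : ℂ} (hz : 0 < z.re)
    {H1 H2 : V2 → ℂ} (h1 : Nice H1) (h2 : Nice H2) {Ω1 Ω2 : V2 → ℝ} (m1 : Measurable Ω1) (m2 : Measurable Ω2) {η M : ℝ} (hη : 0 < η)
    (p1 : ∀ x, η ≤ Ω1 x) (p2 : ∀ x, η ≤ Ω2 x) (b1 : ∀ x, Ω1 x ≤ M) (b2 : ∀ x, Ω2 x ≤ M)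
    {G1 G2 : V2 → ℝ} (n1 : Measurable G1) (n2 : Measurable G2) (β : ℝ) (hβ0 : 0 ≤ β) (hβ1 : β ≤ 1)
    (q1 : ∀ x, ‖H1 x‖ ≤ Ω1 x ^ (β/2) * G1 x) (q2 : ∀ x, ‖H2 x‖ ≤ Ω2 x ^ (β/2) * G2 x)
    {g1 g2 D1 D2 : ℝ} (hg1 : 0 ≤ g1) (hg2 : 0 ≤ g2) (hD1 : 0 ≤ D1) (hD2 : 0 ≤ D2)
    (r1 : ∫⁻ x, ofReal (G1 x) ^ 2 ≤ ofReal (g1^2)) (r2 : ∫⁻ x, ofReal (G2 x) ^ 2 ≤ ofReal (g2^2))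
    (s1 : ∀ y, ∫⁻ x, ‖Kz z (x - y)‖ₑ * ofReal (Ω1 x) ≤ ofReal D1)
    (s2 : ∀ x, ∫⁻ y, ‖Kz z (x - y)‖ₑ * ofReal (Ω2 y) ≤ ofReal D2) :
    ‖Bz z H1 H2‖ ≤ (C1 * (g1 * g2)) ^ (1 - β) * ((D1 * D2) ^ hfr * (g1 * g2)) ^ β := by
  have hsq : ∀ {G : V2 → ℝ} {g : ℝ}, 0 ≤ g → ∫⁻ x, ofReal (G x) ^ 2 ≤ ofReal (g^2) → (∫⁻ x, ofReal (G x) ^ 2) ^ hfr ≤ ofReal g := by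
    intro G g hg h
    refine (ENNReal.rpow_le_rpow h nu).trans (le_of_eq ?_)
    rw [ofReal_rpow_of_nonneg ps nu, ← sqrt_eq_rpow, sqrt_sq hg]
  obtain ⟨Λ, hΛ0, hΛ⟩ : ∃ Λ : ℝ, 0 ≤ Λ ∧ ∀ v, η ≤ v → v ≤ M → |log v / 2| ≤ Λ := by
    refine ⟨|log η| + |log M|, by positivity, fun v h h' => ?_⟩
    have := log_le_log hη h
    have := log_le_log (hη.trans_le h) h'
    rw [abs_le]
    constructor <;> linarith [le_abs_self (log M), neg_abs_le (log η), abs_nonneg (log M), abs_nonneg (log η)]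
  set l1 : V2 → ℝ := fun x => log (Ω1 x) / 2
  set l2 : V2 → ℝ := fun x => log (Ω2 x) / 2
  have lm1 : Measurable l1 := by fun_prop
  have lm2 : Measurable l2 := by fun_prop
  have lb1 : ∀ x, |l1 x| ≤ Λ := fun x => hΛ _ (p1 x) (b1 x)
  have lb2 : ∀ x, |l2 x| ≤ Λ := fun x => hΛ _ (p2 x) (b2 x)
  obtain ⟨hi, he⟩ := Bz_kernel z hz h1 h2
  set φ : V2 × V2 → ℂ := fun p => Kz z (p.1 - p.2) * (H1 p.1 * starRingEnd ℂ (H2 p.2)) with hφ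
  set L : V2 × V2 → ℝ := fun p => l1 p.1 + l2 p.2 with hL
  have Lm : Measurable L := (lm1.comp measurable_fst).add (lm2.comp measurable_snd)
  have Lb : ∀ p, |L p| ≤ 2 * Λ := fun p => (abs_add_le _ _).trans (by linarith [lb1 p.1, lb2 p.2])
  set F0 : ℂ → ℂ := fun ζ => ∫ p, φ p * Complex.exp (ζ * L p) with hF0
  have hd := exp_entire hi Lm ps Lb
  set e1 : ℂ → V2 → ℂ := fun ζ x => H1 x * Complex.exp (ζ * l1 x) with he1
  set e2 : ℂ → V2 → ℂ := fun ζ x => H2 x * Complex.exp (starRingEnd ℂ ζ * l2 x) with he2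
  have hnn : ∀ {l : V2 → ℝ} (ζ : ℂ) (_ : ∀ x, |l x| ≤ Λ) (x : V2), ‖Complex.exp (ζ * l x)‖ ≤ exp (‖ζ‖ * Λ) := fun ζ hl x => by
    rw [norm_exp]
    refine exp_le_exp.2 ?_
    simp only [mul_re, ofReal_re, ofReal_im, mul_zero, sub_zero]
    refine (le_abs_self _).trans ?_
    rw [abs_mul]; gcongr
    · exact abs_re_le_norm ζ
    · exact hl x
  have N1 : ∀ ζ, Nice (e1 ζ) := fun ζ => h1.mul fp (hnn ζ lb1)
  have N2 : ∀ ζ, Nice (e2 ζ) := fun ζ => h2.mul fp (hnn _ lb2)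
  have hFB : ∀ ζ, F0 ζ = Bz z (e1 ζ) (e2 ζ) := by
    intro ζ
    rw [(Bz_kernel z hz (N1 ζ) (N2 ζ)).2, hF0]
    refine integral_congr_ae (of_forall fun p => ?_)
    beta_reduce
    simp only [hφ, he1, he2, hL, map_mul, ← exp_conj, Complex.conj_conj, conj_ofReal]
    push_cast
    rw [mul_add, Complex.exp_add]; ring
  have key : ∀ {H : V2 → ℂ} {Ω G : V2 → ℝ} {x : V2} (ζ : ℂ), η ≤ Ω x → ‖H x‖ ≤ Ω x ^ (β/2) * G x →
      ‖H x * Complex.exp (ζ * ((log (Ω x) / 2 : ℝ) : ℂ))‖ ≤ G x * Ω x ^ ((ζ.re + β)/2) := by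
    intro H Ω G x ζ hΩ hH
    have hp : 0 < Ω x := hη.trans_le hΩ
    rw [norm_mul, norm_exp]
    simp only [mul_re, ofReal_re, ofReal_im, mul_zero, sub_zero]
    rw [show exp (ζ.re * (log (Ω x) / 2)) = Ω x ^ (ζ.re / 2) by rw [rpow_def_of_pos hp]; congr 1; ring]
    calc _ ≤ Ω x ^ (β/2) * G x * Ω x ^ (ζ.re / 2) := by gcongr
      _ = G x * Ω x ^ ((ζ.re + β)/2) := by rw [add_div, rpow_add hp]; ring
  have k1 : ∀ ζ x, ‖e1 ζ x‖ ≤ G1 x * Ω1 x ^ ((ζ.re + β)/2) := fun ζ x => key ζ (p1 x) (q1 x)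
  have k2 : ∀ ζ x, ‖e2 ζ x‖ ≤ G2 x * Ω2 x ^ ((ζ.re + β)/2) := fun ζ x => (key (starRingEnd ℂ ζ) (p2 x) (q2 x)).trans_eq (by rw [Complex.conj_re])
  have left : ∀ ζ : ℂ, ζ.re = -β → ‖F0 ζ‖ ≤ C1 * (g1 * g2) := by
    intro ζ hζ
    have en : ∀ {e : V2 → ℂ} {Ω G : V2 → ℝ}, (∀ x, ‖e x‖ ≤ G x * Ω x ^ ((ζ.re + β)/2)) → ∫⁻ x, ‖e x‖ₑ^2 ≤ ∫⁻ x, ofReal (G x) ^ 2 := by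
      intro e Ω G h
      refine lintegral_mono fun x => ?_
      have := h x
      rw [hζ, neg_add_cancel, zero_div, rpow_zero, mul_one] at this
      beta_reduce
      rw [← onee]; gcongr
    rw [hFB, ← ofReal_le_ofReal_iff ps, onee]
    refine (EN hC hz (N1 ζ) (N2 ζ)).trans ?_
    rw [ofReal_mul hC0, ofReal_mul hg1]
    gcongr
    · exact (ENNReal.rpow_le_rpow (en (k1 ζ)) nu).trans (hsq hg1 r1)
    · exact (ENNReal.rpow_le_rpow (en (k2 ζ)) nu).trans (hsq hg2 r2)
  have right : ∀ ζ : ℂ, ζ.re = 1 - β → ‖F0 ζ‖ ≤ (D1 * D2) ^ hfr * (g1 * g2) := by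
    intro ζ hζ
    have hk : Measurable fun p : V2 × V2 => ‖Kz z (p.1 - p.2)‖ₑ := ((Kz_meas z).comp (measurable_fst.sub measurable_snd)).enorm
    have en : ∀ {e : V2 → ℂ} {Ω G : V2 → ℝ} {x : V2}, η ≤ Ω x → ‖e x‖ ≤ G x * Ω x ^ ((ζ.re + β)/2) → ‖e x‖ₑ ≤ ofReal (G x) * ofReal (Ω x ^ hfr) := by
      intro e Ω G x hΩ h
      have hp : 0 < Ω x := hη.trans_le hΩ
      rw [hζ, sub_add_cancel] at h
      rw [← ofReal_mul' ps, ← onee]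
      exact ofReal_le_ofReal h
    have o2 : ∀ {Ω : V2 → ℝ} {x : V2}, η ≤ Ω x → ofReal (Ω x ^ hfr) ^ 2 = ofReal (Ω x) := by
      intro Ω x h
      have hp : 0 < Ω x := hη.trans_le h
      rw [← ENNReal.ofReal_pow ps, ← sqrt_eq_rpow, sq_sqrt hp.le]
    have S := SCHUR (μ := volume) (ν := volume) hk (f := fun x => ofReal (G1 x)) (g := fun x => ofReal (G2 x))
      (o1 := fun x => ofReal (Ω1 x ^ hfr)) (o2 := fun x => ofReal (Ω2 x ^ hfr)) fp fp fp fp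
      (D1 := ofReal D1) (D2 := ofReal D2) (fun x => by simp only [o2 (p2 _)]; exact s2 x) (fun y => by simp only [o2 (p1 _)]; exact s1 y)
    rw [← ofReal_le_ofReal_iff ps, onee, hFB, (Bz_kernel z hz (N1 ζ) (N2 ζ)).2]
    refine (eile _).trans (le_trans ?_ (S.trans ?_))
    · rw [volume_eq_prod]
      refine lintegral_mono fun p => ?_
      simp only [enorm_mul, enorm_conj]
      gcongr
      · exact en (p1 _) (k1 ζ _)
      · exact en (p2 _) (k2 ζ _)
    · rw [ofReal_mul ps, ofReal_mul hg1, ← ofReal_mul hD1, ofReal_rpow_of_nonneg ps nu]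
      gcongr
      · exact hsq hg1 r1
      · exact hsq hg2 r2
  have fin := Complex.HadamardThreeLines.norm_le_interp_of_mem_verticalClosedStrip' (f := F0) (z := 0) (l := -β) (u := 1 - β) la
    (by simp [verticalClosedStrip, hβ0, hβ1]) hd.diffContOnCl ?_ (fun ζ h => left ζ h) (fun ζ h => right ζ h)
  · have e0 : F0 0 = Bz z H1 H2 := by rw [hFB]; simp [he1, he2]
    rw [e0] at fin
    convert fin using 2 <;> simp
  · refine ⟨(∫ p, ‖φ p‖) * exp (2 * Λ), ?_⟩
    rintro _ ⟨ζ, hζ, rfl⟩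
    simp only [verticalClosedStrip, mem_preimage, mem_Icc] at hζ
    have hi2 := (hi.norm.mul_const (exp (2 * Λ)))
    rw [← integral_mul_const]
    refine norm_integral_le_of_norm_le hi2 (of_forall fun p => ?_)
    rw [norm_mul, norm_exp]
    gcongr
    simp only [mul_re, ofReal_re, ofReal_im, mul_zero, sub_zero]
    refine (le_abs_self _).trans ?_
    rw [abs_mul]
    have : |ζ.re| ≤ 1 := abs_le.2 ⟨by linarith, by linarith⟩
    nlinarith [Lb p, abs_nonneg (L p), abs_nonneg ζ.re]

lemma INT {C1 : ℝ} (hC0 : 0 ≤ C1) (hC : ∀ ε : ℝ, 0 < ε → ∫⁻ x : V2, ‖Kz ε x‖ₑ ≤ ofReal C1) {z : ℂ} (hz : 0 < z.re)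
    {H1 H2 : V2 → ℂ} (h1 : Nice H1) (h2 : Nice H2) {Ω1 Ω2 : V2 → ℝ} (m1 : Measurable Ω1) (m2 : Measurable Ω2) {M : ℝ}
    (p1 : ∀ x, 0 ≤ Ω1 x) (p2 : ∀ x, 0 ≤ Ω2 x) (b1 : ∀ x, Ω1 x ≤ M) (b2 : ∀ x, Ω2 x ≤ M)
    {G1 G2 : V2 → ℝ} (n1 : Measurable G1) (n2 : Measurable G2) (t1 : ∀ x, 0 ≤ G1 x) (t2 : ∀ x, 0 ≤ G2 x) (β : ℝ) (hβ0 : 0 ≤ β) (hβ1 : β ≤ 1)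
    (q1 : ∀ x, ‖H1 x‖ ≤ Ω1 x ^ (β/2) * G1 x) (q2 : ∀ x, ‖H2 x‖ ≤ Ω2 x ^ (β/2) * G2 x)
    {g1 g2 D1 D2 : ℝ} (hg1 : 0 ≤ g1) (hg2 : 0 ≤ g2) (hD1 : 0 ≤ D1) (hD2 : 0 ≤ D2)
    (r1 : ∫⁻ x, ofReal (G1 x) ^ 2 ≤ ofReal (g1^2)) (r2 : ∫⁻ x, ofReal (G2 x) ^ 2 ≤ ofReal (g2^2))
    (s1 : ∀ y, ∫⁻ x, ‖Kz z (x - y)‖ₑ * ofReal (Ω1 x) ≤ ofReal D1)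
    (s2 : ∀ x, ∫⁻ y, ‖Kz z (x - y)‖ₑ * ofReal (Ω2 y) ≤ ofReal D2) :
    ‖Bz z H1 H2‖ ≤ C1 ^ (1 - β) * (D1 * D2) ^ (β/2) * (g1 * g2) := by
  obtain ⟨K, hK0, hK⟩ := Kz_fin z hz
  have step : ∀ η : ℝ, 0 < η → ‖Bz z H1 H2‖ ≤ (C1 * (g1 * g2)) ^ (1 - β) * (((D1 + η * K) * (D2 + η * K)) ^ hfr * (g1 * g2)) ^ β := by
    intro η hη
    have qq : ∀ {H : V2 → ℂ} {Ω G : V2 → ℝ} {x : V2}, 0 ≤ Ω x → 0 ≤ G x → ‖H x‖ ≤ Ω x ^ (β/2) * G x → ‖H x‖ ≤ (Ω x + η) ^ (β/2) * G x := by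
      intro H Ω G x h0 hg h
      refine h.trans ?_
      gcongr; linarith
    have km : ∀ f : V2 → V2, Measurable f → Measurable fun x => ‖Kz z (f x)‖ₑ := fun f hf => ((Kz_meas z).comp hf).enorm
    have ss : ∀ {f : V2 → V2} {Ω : V2 → ℝ} {D : ℝ}, Measurable f → Measurable Ω → (∀ x, 0 ≤ Ω x) → 0 ≤ D → ∫⁻ x, ‖Kz z (f x)‖ₑ = ∫⁻ x, ‖Kz z x‖ₑ → ∫⁻ x, ‖Kz z (f x)‖ₑ * ofReal (Ω x) ≤ ofReal D →
        ∫⁻ x, ‖Kz z (f x)‖ₑ * ofReal (Ω x + η) ≤ ofReal (D + η * K) := by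
      intro f Ω D hf hΩ h0 hD he h
      simp only [ofReal_add (h0 _) hη.le, mul_add]
      have hm : Measurable fun x => ‖Kz z (f x)‖ₑ * ofReal (Ω x) := (km f hf).mul hΩ.ennreal_ofReal
      rw [lintegral_add_left hm, lintegral_mul_const _ (km f hf), he, ofReal_add hD ps, ofReal_mul hη.le, mul_comm (∫⁻ x, _)]
      gcongr
    exact INTη hC0 hC hz h1 h2 (m1.add_const η) (m2.add_const η) hη (fun x => by linarith [p1 x]) (fun x => by linarith [p2 x]) (M := M + η)
      (fun x => by linarith [b1 x]) (fun x => by linarith [b2 x]) n1 n2 β hβ0 hβ1 (fun x => qq (p1 x) (t1 x) (q1 x)) (fun x => qq (p2 x) (t2 x) (q2 x))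
      hg1 hg2 ps ps r1 r2
      (fun y => ss (measurable_id.sub_const y) m1 p1 hD1 (lintegral_sub_right_eq_self (fun x => ‖Kz z x‖ₑ) y) (s1 y))
      (fun x => ss (measurable_id.const_sub x) m2 p2 hD2 (sub_lint (fun x => ‖Kz z x‖ₑ) x) (s2 x))
  have lim : ‖Bz z H1 H2‖ ≤ (C1 * (g1 * g2)) ^ (1 - β) * (((D1 + 0 * K) * (D2 + 0 * K)) ^ hfr * (g1 * g2)) ^ β := by
    have hc : Continuous fun η : ℝ => (C1 * (g1 * g2)) ^ (1 - β) * (((D1 + η * K) * (D2 + η * K)) ^ hfr * (g1 * g2)) ^ β := by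
      refine continuous_const.mul (rpow_const (Continuous.mul (rpow_const fp fun _ => inr nu) continuous_const) fun _ => inr hβ0)
    refine ge_of_tendsto ((hc.tendsto 0).mono_left (nhdsWithin_le_nhds (s := Ioi 0))) ?_
    filter_upwards [self_mem_nhdsWithin] with η hη using step η hη
  refine lim.trans (le_of_eq ?_)
  rw [zero_mul, add_zero, add_zero, mul_rpow hC0 ps, mul_rpow (x := (D1 * D2)^hfr) (y := g1 * g2) ps ps, ← rpow_mul ps]
  have : (g1 * g2) ^ (1 - β) * (g1 * g2) ^ β = g1 * g2 := by
    rw [← rpow_add_of_nonneg ps la hβ0]; simp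
  rw [show (1/2 * β) = β/2 by ring]
  linear_combination (C1 ^ (1 - β) * (D1 * D2) ^ (β/2)) * this

abbrev E3 := WithLp 2 RV

lemma INV0 (u : SW) :
    Integrable (fun w : RV => ftST u (2 * π * w.1) ((2 * π) • w.2)) ∧
    ∀ p, u p = ∫ w : RV, Complex.exp (IC * ((p.1 * (2 * π * w.1) + ⟪p.2, (2 * π) • w.2⟫ : ℝ) : ℂ)) * ftST u (2 * π * w.1) ((2 * π) • w.2) := by
  have mp := WithLp.volume_preserving_ofLp ℝ V2
  have me : MeasurableEmbedding (WithLp.ofLp : E3 → ℝ × V2) := (prodContinuousLinearEquiv 2 ℝ ℝ V2).toHomeomorph.measurableEmbedding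
  set g : SchwartzMap E3 ℂ := SchwartzMap.compCLMOfContinuousLinearEquiv ℂ (prodContinuousLinearEquiv 2 ℝ ℝ V2) u with hg
  have gv : ∀ v, g v = u v.ofLp := fun v => rfl
  have hF : ∀ w : E3, FourierTransform.fourier g w = ftST u (2 * π * w.ofLp.1) ((2 * π) • w.ofLp.2) := by
    intro w
    rw [fourier_coe, fourier_eq']
    rw [ftST, ← mp.integral_comp me]
    refine integral_congr_ae (of_forall fun v => ?_)
    simp only [prod_inner_apply, smul_eq_mul, gv, inner_smul_right]
    congr 2
    simp only [RCLike.inner_apply, conj_trivial]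
    push_cast; ring
  constructor
  · rw [← mp.integrable_comp_emb me]
    have := (FourierTransform.fourier g).integrable (μ := volume)
    refine this.congr (of_forall fun w => ?_)
    exact hF w
  · intro p
    have := congrArg (fun h : SchwartzMap E3 ℂ => h (toLp 2 p)) (FourierTransform.fourierInv_fourier_eq (F := SchwartzMap E3 ℂ) g)
    rw [← mp.integral_comp me]
    simp only [fourierInv_coe, gv] at this
    rw [← this, fourierInv_eq']
    refine integral_congr_ae (of_forall fun w => ?_)
    simp only [prod_inner_apply, smul_eq_mul, inner_smul_right, hF]
    congr 2
    simp only [RCLike.inner_apply, conj_trivial, real_inner_comm]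
    push_cast; ring

lemma ft_swap {H : RV → ℂ} (τ : ℝ) (ξ : V2) : starRingEnd ℂ (ftST H τ ξ) =
    ∫ p : RV, Complex.exp (IC * ((p.1 * τ + ⟪p.2, ξ⟫ : ℝ) : ℂ)) * starRingEnd ℂ (H p) := by
  rw [ftST, ← integral_conj]
  refine integral_congr_ae (of_forall fun v => ?_)
  simp only [map_mul, ← exp_conj, map_neg, conj_I, conj_ofReal, neg_neg]

lemma ftST_meas {H : RV → ℂ} (h : Measurable H) : Measurable fun q : RV => ftST H q.1 q.2 := by
  have : StronglyMeasurable fun p : RV × RV => Complex.exp (-IC * ((p.2.1 * p.1.1 + ⟪p.2.2, p.1.2⟫ : ℝ) : ℂ)) * H p.2 :=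
    ((measurable fp).mul (h.comp measurable_snd)).stronglyMeasurable
  exact this.integral_prod_right'.measurable

lemma scale_lint {f : RV → ENN} (hf : Measurable f) : ∫⁻ w : RV, f (2 * π * w.1, (2 * π) • w.2) ≤ ∫⁻ q, f q := by
  have h0 : (2 * π : ℝ) ≠ 0 := by positivity
  haveI : (volume : Measure RV).IsAddHaarMeasure := instIsAddHaarMeasure _ _
  have hm : Measurable fun w : RV => (2 * π) • w := measurable_const_smul _
  change ∫⁻ w : RV, f ((2 * π) • w) ≤ _
  rw [← lintegral_map hf hm, Measure.map_addHaar_smul _ h0, lintegral_smul_measure, smul_eq_mul]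
  refine mul_le_of_le_one_left bot_le ?_
  rw [← ofReal_one]
  refine ofReal_le_ofReal ?_
  rw [abs_inv, abs_of_pos ps]
  exact inv_le_one_of_one_le₀ (one_le_pow₀ (by linarith [pi_gt_three]))

lemma INV (u : SW) {H : RV → ℂ} (hm : Measurable H) (hi : Integrable H) :
    ‖∫ p, u p * starRingEnd ℂ (H p)‖ₑ ≤ ∫⁻ q : RV, ‖ftST u q.1 q.2‖ₑ * ‖ftST H q.1 q.2‖ₑ := by
  obtain ⟨h1, h2⟩ := INV0 u
  have hu : Measurable u := u.continuous.measurable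
  set U : RV → ℂ := fun w => ftST u (2 * π * w.1) ((2 * π) • w.2) with hU
  have hic : Integrable fun p => starRingEnd ℂ (H p) := by
    refine hi.norm.mono fp (of_forall fun p => ?_); simp
  have e : ∫ p, u p * starRingEnd ℂ (H p) = ∫ w, U w * starRingEnd ℂ (ftST H (2 * π * w.1) ((2 * π) • w.2)) := by
    calc _ = ∫ p, ∫ w, Complex.exp (IC * ((p.1 * (2 * π * w.1) + ⟪p.2, (2 * π) • w.2⟫ : ℝ) : ℂ)) * (starRingEnd ℂ (H p) * U w) := by
          refine integral_congr_ae (of_forall fun p => ?_)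
          beta_reduce
          rw [h2 p, ← integral_mul_const]
          refine integral_congr_ae (of_forall fun w => ?_)
          simp only [hU]; ring
      _ = ∫ w, ∫ p, Complex.exp (IC * ((p.1 * (2 * π * w.1) + ⟪p.2, (2 * π) • w.2⟫ : ℝ) : ℂ)) * (starRingEnd ℂ (H p) * U w) := by
          refine integral_integral_swap ?_
          refine (hic.mul_prod h1).bdd_mul (c := 1) (aestronglyMeasurable fp) (of_forall fun z => ?_)
          rw [norm_exp]; simp
      _ = _ := by
          refine integral_congr_ae (of_forall fun w => ?_)
          beta_reduce
          rw [ft_swap, ← integral_const_mul]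
          refine integral_congr_ae (of_forall fun p => ?_)
          beta_reduce; ring
  rw [e]
  refine (eile _).trans ?_
  simp only [enorm_mul, enorm_conj, hU]
  exact scale_lint (f := fun q : RV => ‖ftST u q.1 q.2‖ₑ * ‖ftST H q.1 q.2‖ₑ) ((ftST_meas hu).enorm.mul (ftST_meas hm).enorm)

def PH (θ t : ℝ) : ℂ := ∫ l : ℝ, Complex.exp (-IC * ((t * l : ℝ) : ℂ)) * (((1 + l^2) ^ (-θ) : ℝ) : ℂ)

lemma PH_int {θ : ℝ} (hθ : 1/2 < θ) : Integrable fun l : ℝ => (1 + l^2 : ℝ) ^ (-θ) := by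
  have := integrable_rpow_neg_one_add_norm_sq (E := ℝ) (μ := volume) (r := 2 * θ) (by simp; linarith)
  refine this.congr (of_forall fun l => ?_)
  simp only [norm_eq_abs, sq_abs]; congr 1; ring

lemma PH_le {θ : ℝ} (hθ : 1/2 < θ) : ∃ C : ℝ, 0 ≤ C ∧ ∀ k : ℝ, 0 ≤ k → k ≤ 1 → ∀ t : ℝ, t ≠ 0 → ‖PH θ t‖ ≤ C * |t| ^ (-k) := by
  set f : ℝ → ℂ := fun l => (((1 + l^2) ^ (-θ) : ℝ) : ℂ)
  have hd : ∀ l : ℝ, HasDerivAt f (((-2 * θ * l * (1 + l^2) ^ (-θ-1) : ℝ) : ℂ)) l := by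
    intro l
    have h1 : HasDerivAt (fun l : ℝ => 1 + l^2) (2 * l) l := by simpa using (hasDerivAt_pow 2 l).const_add 1
    have := (h1.rpow_const (p := -θ) (inl ps)).ofReal_comp
    convert this using 2; ring
  have fi : Integrable f := (PH_int hθ).ofReal
  have di : Integrable (deriv f) := by
    have e : deriv f = fun l => (((-2 * θ * l * (1 + l^2) ^ (-θ-1) : ℝ) : ℂ)) := funext fun l => (hd l).deriv
    rw [e]
    refine ((PH_int hθ).const_mul (2 * θ)).mono (Measurable.aestronglyMeasurable fp) (of_forall fun l => ?_)
    have hp : (0:ℝ) < (1 + l^2) ^ (-θ) := by positivity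
    rw [norm_real, norm_eq_abs, norm_eq_abs, rpow_sub_one ps, abs_of_pos (show 0 < 2 * θ * (1 + l^2) ^ (-θ) by positivity)]
    rw [show -2 * θ * l * ((1 + l^2) ^ (-θ) / (1 + l^2)) = -(2 * θ * (1 + l^2) ^ (-θ)) * (l / (1 + l^2)) by ring, abs_mul, abs_neg, abs_of_pos (show 0 < 2 * θ * (1 + l^2) ^ (-θ) by positivity)]
    refine mul_le_of_le_one_right ps ?_
    rw [abs_div, abs_of_pos (show (0:ℝ) < 1 + l^2 by positivity), div_le_one ps]
    nlinarith [sq_abs l, sq_nonneg (|l| - 1), abs_nonneg l]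
  have hP : ∀ t, PH θ t = FourierTransform.fourier f (t / (2 * π)) := by
    intro t
    rw [fourier_eq', PH]
    refine integral_congr_ae (of_forall fun l => ?_)
    simp only [RCLike.inner_apply, conj_trivial, smul_eq_mul]
    congr 2
    rw [show -2 * π * (t / (2 * π) * l) = -(t * l) by field_simp]
    push_cast; ring
  have nF : ∀ (h : ℝ → ℂ) t, ‖FourierTransform.fourier h t‖ ≤ ∫ l, ‖h l‖ := fun h t => VectorFourier.norm_fourierIntegral_le_integral_norm _ _ _ _ _
  have b0 : ∀ t, ‖PH θ t‖ ≤ ∫ l, ‖f l‖ := fun t => by rw [hP]; exact nF _ _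
  have b1 : ∀ t, |t| * ‖PH θ t‖ ≤ ∫ l, ‖deriv f l‖ := fun t => by
    have h := fourier_deriv fi (fun l => (hd l).differentiableAt) di
    have := nF (deriv f) (t / (2 * π))
    rw [h] at this
    simp only [smul_eq_mul, norm_mul, norm_I, norm_real, Complex.norm_ofNat, norm_eq_abs, abs_div, abs_of_pos pi_pos, abs_mul, Complex.norm_div] at this
    rw [hP]
    convert this using 2
    simp; field_simp
  refine ⟨max (∫ l, ‖f l‖) (∫ l, ‖deriv f l‖), le_max_of_le_left ps, fun k hk0 hk1 t ht => ?_⟩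
  set M := max (∫ l, ‖f l‖) (∫ l, ‖deriv f l‖)
  have h0 : ‖PH θ t‖ ≤ M := (b0 t).trans (le_max_left _ _)
  have h1 : |t| * ‖PH θ t‖ ≤ M := (b1 t).trans (le_max_right _ _)
  have hp : 0 < |t| := abs_pos.2 ht
  rw [rpow_neg hp.le, ← div_eq_mul_inv, le_div_iff₀ ps]
  have : |t| ^ k ≤ max 1 |t| := by
    rcases le_total |t| 1 with h | h
    · exact (rpow_le_one hp.le h hk0).trans (le_max_left _ _)
    · exact (rpow_le_rpow_of_exponent_le h hk1).trans (by rw [rpow_one]; exact le_max_right _ _)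
  calc _ ≤ ‖PH θ t‖ * max 1 |t| := by gcongr
    _ ≤ M := by rcases max_cases 1 |t| with h | h <;> rw [h.1] <;> linarith

lemma norm_cexp_I' (r : ℝ) : ‖Complex.exp (IC * r)‖ = 1 := by
  rw [norm_exp]; simp

lemma sl_meas {H : RV → ℂ} (hm : Measurable H) : Measurable fun p : RV => ft2 (fun y => H (p.1, y)) p.2 := by
  have : StronglyMeasurable fun p : RV × V2 => Complex.exp (-IC * ((⟪p.2, p.1.2⟫ : ℝ) : ℂ)) * H (p.1.1, p.2) :=
    ((measurable fp).mul (hm.comp fp)).stronglyMeasurable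
  exact this.integral_prod_right'.measurable

lemma ftST_sl {H : RV → ℂ} (hi : Integrable H) (τ : ℝ) (ξ : V2) :
    ftST H τ ξ = ∫ t : ℝ, Complex.exp (-IC * ((t * τ : ℝ) : ℂ)) * ft2 (fun y => H (t, y)) ξ := by
  rw [ftST, volume_eq_prod, integral_prod]
  · refine integral_congr_ae (of_forall fun t => ?_)
    beta_reduce
    rw [ft2, ← integral_const_mul]
    refine integral_congr_ae (of_forall fun y => ?_)
    beta_reduce
    rw [← mul_assoc, ← Complex.exp_add]; congr 2; push_cast; ring
  · rw [← volume_eq_prod]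
    exact hi.bdd_mul (c := 1) (aestronglyMeasurable fp) (of_forall fun p => (norm_cexp_I _).le)

set_option maxHeartbeats 600000 in
lemma JB {θ : ℝ} (hθ : 1/2 < θ) {H : RV → ℂ} (hm : Measurable H) (hi : Integrable H) (hn : ∀ t, Nice fun y => H (t, y)) {ε : ℝ} (hε : 0 < ε) (σ : ℝ) :
    ∫⁻ q : RV, ‖ftST H q.1 q.2‖ₑ^2 * ofReal ((1 + (q.1 - σ * ‖q.2‖)^2) ^ (-θ) * exp (-ε * ‖q.2‖)) ≤
      ∫⁻ p : ℝ × ℝ, ‖PH θ (p.1 - p.2)‖ₑ * ‖Bz (ε + (σ * (p.1 - p.2) : ℝ) * IC) (fun y => H (p.1, y)) (fun y => H (p.2, y))‖ₑ := by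
  set w : RV → ℝ := fun q => (1 + (q.1 - σ * ‖q.2‖)^2) ^ (-θ) * exp (-ε * ‖q.2‖) with hw
  set h : ℝ → V2 → ℂ := fun t ξ => ft2 (fun y => H (t, y)) ξ with hh
  set N : ℝ → ℝ := fun t => ∫ y, ‖H (t, y)‖ with hN
  have hmm : Measurable fun p : RV => h p.1 p.2 := sl_meas hm
  have hb : ∀ t ξ, ‖h t ξ‖ ≤ N t := fun t ξ => ft2_le ξ
  have Ni : Integrable N := by
    have := hi; rw [volume_eq_prod] at this
    exact this.integral_norm_prod_left
  have N0 : ∀ t, 0 ≤ N t := fun t => by positivity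
  have w0 : ∀ q, 0 ≤ w q := fun q => by positivity
  have wm : Measurable w := by fun_prop
  have wi : Integrable w := by
    rw [volume_eq_prod, integrable_prod_iff' wm.aestronglyMeasurable]
    constructor
    · exact of_forall fun ξ => ((PH_int hθ).comp_sub_right (σ * ‖ξ‖)).mul_const (exp (-ε * ‖ξ‖))
    · refine ((exp_norm_integrable ε hε).const_mul (∫ l : ℝ, (1 + l^2) ^ (-θ))).congr (of_forall fun ξ => ?_)
      simp only [norm_of_nonneg (w0 _)]
      simp only [hw]
      rw [integral_mul_const, integral_sub_right_eq_self (fun l : ℝ => (1 + l^2) ^ (-θ))]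
  set Hh : RV → ℂ := fun q => ftST H q.1 q.2 with hHh
  have Hm : Measurable Hh := ftST_meas hm
  have Hb : ∀ q, ‖Hh q‖ ≤ ∫ t, N t := fun q => by
    simp only [hHh]; rw [ftST_sl hi]
    refine norm_integral_le_of_norm_le Ni (of_forall fun t => ?_)
    rw [norm_mul, norm_cexp_I, one_mul]; exact hb _ _
  set g : RV → ℝ := fun q => w q * ‖Hh q‖^2 with hg
  have gi : Integrable g := by
    refine (wi.mul_const ((∫ t, N t)^2)).mono (wm.mul (Hm.norm.pow_const 2)).aestronglyMeasurable (of_forall fun q => ?_)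
    rw [norm_of_nonneg (mul_nonneg (w0 q) ps), norm_of_nonneg (mul_nonneg (w0 q) ps)]
    have := Hb q; have := w0 q
    gcongr
  have l1 : ∫⁻ q, ‖Hh q‖ₑ^2 * ofReal (w q) = ‖∫ q, ((g q : ℝ) : ℂ)‖ₑ := by
    rw [integral_complex_ofReal, ← onee, norm_real, norm_of_nonneg (integral_nonneg fun q => mul_nonneg (w0 q) ps),
      ofReal_integral_eq_lintegral_ofReal gi (of_forall fun q => mul_nonneg (w0 q) ps)]
    refine ltgc fun q => ?_
    rw [ofReal_mul (w0 q), ENNReal.ofReal_pow (norm_nonneg _), onee, mul_comm]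
  set Ψ : RV → ℝ × ℝ → ℂ := fun q p => (w q : ℂ) * ((Complex.exp (-IC * ((p.1 * q.1 : ℝ) : ℂ)) * h p.1 q.2) * starRingEnd ℂ (Complex.exp (-IC * ((p.2 * q.1 : ℝ) : ℂ)) * h p.2 q.2)) with hΨ
  have Ψb : ∀ q p, ‖Ψ q p‖ ≤ w q * (N p.1 * N p.2) := fun q p => by
    simp only [hΨ, norm_mul, norm_conj, norm_cexp_I, one_mul, norm_real, norm_of_nonneg (w0 q)]
    have := w0 q; have := N0 p.1; have := N0 p.2
    gcongr <;> exact hb _ _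
  have Ψm : Measurable (Function.uncurry Ψ) := by
    have m1 : ∀ f : RV × ℝ × ℝ → ℝ, Measurable f → Measurable fun z : RV × ℝ × ℝ => h (f z) z.1.2 := fun f hf => hmm.comp (hf.prodMk fp)
    have m2 := m1 (fun z => z.2.1) fp
    have m3 := m1 (fun z => z.2.2) fp
    have m4 : Measurable fun z : RV × ℝ × ℝ => (w z.1 : ℂ) := measurable_ofReal.comp (wm.comp measurable_fst)
    have m5 : Measurable fun z : RV × ℝ × ℝ => Complex.exp (-IC * ((z.2.1 * z.1.1 : ℝ) : ℂ)) := by fun_prop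
    have m6 : Measurable fun z : RV × ℝ × ℝ => Complex.exp (-IC * ((z.2.2 * z.1.1 : ℝ) : ℂ)) := by fun_prop
    have m7 := RCLike.continuous_conj (K := ℂ) |>.measurable
    exact m4.mul ((m5.mul m2).mul (m7.comp (m6.mul m3)))
  have l2 : ∫ q, ((g q : ℝ) : ℂ) = ∫ q, ∫ p, Ψ q p := by
    refine integral_congr_ae (of_forall fun q => ?_)
    simp only [hΨ, hg]
    rw [integral_const_mul, volume_eq_prod ℝ ℝ, integral_prod_mul (fun t : ℝ => Complex.exp (-IC * ((t * q.1 : ℝ) : ℂ)) * h t q.2) (fun t : ℝ => starRingEnd ℂ (Complex.exp (-IC * ((t * q.1 : ℝ) : ℂ)) * h t q.2)), integral_conj, ← ftST_sl hi, mul_conj']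
    push_cast; rfl
  have l3 : ∫ q, ∫ p, Ψ q p = ∫ p, ∫ q, Ψ q p := by
    refine integral_integral_swap ((wi.mul_prod (Ni.mul_prod Ni)).mono Ψm.aestronglyMeasurable (of_forall fun z => ?_))
    refine (Ψb z.1 z.2).trans (le_abs_self _)
  have l4 : ∀ p : ℝ × ℝ, ∫ q, Ψ q p = PH θ (p.1 - p.2) * Bz (ε + (σ * (p.1 - p.2) : ℝ) * IC) (fun y => H (p.1, y)) (fun y => H (p.2, y)) := by
    intro p
    rw [volume_eq_prod, integral_prod_symm]
    · rw [Bz, ← integral_const_mul]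
      refine integral_congr_ae (of_forall fun ξ => ?_)
      beta_reduce
      have e1 : ∀ τ : ℝ, Ψ (τ, ξ) p = (Complex.exp (-IC * (((p.1 - p.2) * (τ - σ * ‖ξ‖) : ℝ) : ℂ)) * (((1 + (τ - σ * ‖ξ‖)^2) ^ (-θ) : ℝ) : ℂ)) *
          (Complex.exp (-(ε + (σ * (p.1 - p.2) : ℝ) * IC) * ‖ξ‖) * (h p.1 ξ * starRingEnd ℂ (h p.2 ξ))) := by
        intro τ
        simp only [hΨ, hw, map_mul, ← exp_conj, map_neg, conj_I, conj_ofReal]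
        push_cast
        have : Complex.exp (-IC * ((p.1 - p.2) * (τ - σ * ‖ξ‖))) * Complex.exp (-(ε + σ * (p.1 - p.2) * IC) * ‖ξ‖) = Complex.exp (-ε * ‖ξ‖) * (Complex.exp (-IC * (p.1 * τ)) * Complex.exp (-(-IC) * (p.2 * τ))) := by
          rw [← Complex.exp_add, ← Complex.exp_add, ← Complex.exp_add]; congr 1; ring
        linear_combination (-(((1 + (τ - σ * ‖ξ‖)^2) ^ (-θ) : ℝ) : ℂ) * h p.1 ξ * starRingEnd ℂ (h p.2 ξ)) * this
      simp only [e1]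
      rw [integral_mul_const, integral_sub_right_eq_self (fun l : ℝ => Complex.exp (-IC * (((p.1 - p.2) * l : ℝ) : ℂ)) * (((1 + l^2) ^ (-θ) : ℝ) : ℂ))]
      rfl
    · rw [← volume_eq_prod]
      refine (wi.mul_const (N p.1 * N p.2)).mono (Ψm.comp (measurable_id.prodMk measurable_const)).aestronglyMeasurable (of_forall fun q => ?_)
      exact (Ψb q p).trans (le_abs_self _)
  rw [l1, l2, l3]
  refine (eile _).trans (le_of_eq ?_)
  simp only [l4, enorm_mul]

lemma sq_half (c : ENN) : (c ^ hfr) ^ 2 = c := by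
  rw [← ENNReal.rpow_two, ← Erm]; norm_num

lemma half_half (c : ENN) : c ^ hfr * c ^ hfr = c := by rw [← sq, sq_half]

lemma TIME (x : ℝ) (hx0 : 0 ≤ x) (hx1 : x < 1) : ∃ C : ENN, C ≠ ⊤ ∧ ∀ ρ g : ℝ → ENN, Measurable ρ → Measurable g →
    ∫⁻ t, ∫⁻ t', edist t t' ^ (-x) * ((ρ t ^ hfr * g t) * (ρ t' ^ hfr * g t')) ≤ C * (LtR (1 - x) ρ * ∫⁻ t, g t ^ 2) := by
  rcases hx0.eq_or_lt with rfl | hx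
  · refine ⟨1, by simp, fun ρ g hρ hg => ?_⟩
    simp only [neg_zero, ENNReal.rpow_zero, one_mul, sub_zero, LtR_one]
    have hf : Measurable fun t => ρ t ^ hfr * g t := by fun_prop
    simp_rw [lcmu _ hf]
    rw [lintegral_mul_const _ hf]
    have := CS2 volume (f := fun t => ρ t ^ hfr) (g := g) fp hg.aemeasurable
    simp only [sq_half] at this
    refine (mul_le_mul' this this).trans (le_of_eq ?_)
    rw [mul_mul_mul_comm, half_half, half_half]
  · obtain ⟨C, hC, h⟩ := HLS (volume : Measure ℝ) 1 x (1 - x/2)⁻¹ (1 - x/2)⁻¹ hx hx1 (by rw [one_lt_inv₀ la]; linarith) (by rw [one_lt_inv₀ la]; linarith)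
      (by rw [one_div, inv_inv]; ring) 2 (by simp) (fun t r hr => by rw [volume_ball, ENNReal.rpow_one, ofReal_mul nu]; simp)
    refine ⟨C, hC, fun ρ g hρ hg => ?_⟩
    set f : ℝ → ENN := fun t => ρ t ^ hfr * g t with hf
    have hfm : Measurable f := by fun_prop
    calc _ = ∫⁻ t, f t * ∫⁻ t', f t' * edist t t' ^ (-x) := by
          refine ltgc fun t => ?_
          rw [← lcmu _ fp]
          refine ltgc fun t' => ?_
          simp only [hf]; ring
      _ ≤ C * ((∫⁻ t, f t ^ (1 - x/2)⁻¹) ^ (1 / (1 - x/2)⁻¹) * (∫⁻ t, f t ^ (1 - x/2)⁻¹) ^ (1 / (1 - x/2)⁻¹)) := h f f hfm hfm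
      _ ≤ _ := by
        refine mul_le_mul_right ?_ C
        have h2 : (2 - x) ≠ 0 := by linarith
        have h1 : (1 - x) ≠ 0 := by linarith
        have H := lintegral_mul_norm_pow_le (μ := volume) (f := fun t => ρ t ^ (1 - x)⁻¹) (g := fun t => g t ^ 2) (p := (1-x)/(2-x)) (q := 1/(2-x)) fp fp
          (by apply div_nonneg <;> linarith) (by apply div_nonneg <;> linarith) (by field_simp; ring)
        have e : ∀ t, (ρ t ^ (1 - x)⁻¹) ^ ((1-x)/(2-x)) * (g t ^ 2) ^ (1/(2-x)) = f t ^ (1 - x/2)⁻¹ := by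
          intro t
          simp only [hf]
          have hh : 0 ≤ (1 - x/2)⁻¹ := by rw [inv_nonneg]; linarith
          rw [Emn _ _ hh, ← Erm, ← Erm, ← ENNReal.rpow_two, ← Erm]
          have : 1 - x/2 ≠ 0 := by linarith
          congr 2
          · field_simp
          · field_simp
        simp only [e] at H
        rw [← ENNReal.rpow_add_of_nonneg _ _ (by rw [one_div, inv_inv]; linarith) (by rw [one_div, inv_inv]; linarith), one_div, inv_inv]
        refine (ENNReal.rpow_le_rpow H la).trans (le_of_eq ?_)
        rw [Emn _ _ la, ← Erm, ← Erm, LtR, if_neg h1]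
        rw [show (1 - x) / (2 - x) * (1 - x/2 + (1 - x/2)) = 1 - x by field_simp; ring, show 1 / (2 - x) * (1 - x/2 + (1 - x/2)) = 1 by field_simp; ring, ENNReal.rpow_one]

structure Wok (W : RV → ℝ) : Prop where
  m : Measurable W
  z : ∀ p, 0 ≤ W p
  b : ∃ M : ℝ, (∀ p, W p ≤ M) ∧ ∀ p : RV, M < |p.1| ∨ M < ‖p.2‖ → W p = 0

def uW (u : SW) (W : RV → ℝ) (p : RV) : ℂ := u p * (W p : ℂ)

def gW (u : SW) (W : RV → ℝ) (t : ℝ) : ENN := (∫⁻ y, ‖u (t, y)‖ₑ^2 * ofReal (W (t, y))) ^ hfr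

lemma uW_nice (u : SW) {W : RV → ℝ} (hW : Wok W) : Measurable (uW u W) ∧ Integrable (uW u W) ∧ ∀ t, Nice fun y => uW u W (t, y) := by
  obtain ⟨M, hM, hs⟩ := hW.b
  have hu : Measurable u := u.continuous.measurable
  have hm : Measurable (uW u W) := hu.mul (measurable_ofReal.comp hW.m)
  obtain ⟨K, hK⟩ : ∃ K, ∀ p, ‖u p‖ ≤ K := ⟨_, fun p => u.norm_le_seminorm ℝ p⟩
  have hWa : ∀ p, ‖(W p : ℂ)‖ ≤ M := fun p => by rw [norm_real, norm_of_nonneg (hW.z p)]; exact hM p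
  have hb : ∀ p, ‖uW u W p‖ ≤ K * M := fun p => by
    rw [uW, norm_mul]; exact mul_le_mul (hK p) (hWa p) (norm_nonneg _) ((norm_nonneg _).trans (hK p))
  refine ⟨hm, ?_, fun t => ⟨hm.comp (measurable_const.prodMk measurable_id), ?_, K * M, fun y => hb _⟩⟩
  · haveI : (volume : Measure RV).IsAddHaarMeasure := instIsAddHaarMeasure _ _
    have := (u.integrable (μ := volume)).bdd_mul (c := M) (measurable_ofReal.comp hW.m).aestronglyMeasurable (of_forall hWa)
    exact this.congr (of_forall fun p => mul_comm _ _)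
  · refine (Measure.integrableOn_of_bounded (s := closedBall (0:V2) M) (M := K * M) measure_closedBall_lt_top.ne (hm.comp (measurable_const.prodMk measurable_id)).aestronglyMeasurable (of_forall fun y => hb _)).integrable_of_forall_notMem_eq_zero ?_
    intro y hy
    simp only [mem_closedBall_zero_iff, not_le] at hy
    simp only [Function.comp, uW, hs (t, id y) (inr hy), ofReal_zero, mul_zero]

lemma Bz_meas0 {h : RV → ℂ} (hm : Measurable h) (σ : ℝ) : Measurable fun e : (ℝ × ℝ) × ℝ => ‖∫ ξ : V2, Complex.exp (-(e.2 + (σ * (e.1.1 - e.1.2) : ℝ) * IC) * (‖ξ‖ : ℂ)) * (h (e.1.1, ξ) * starRingEnd ℂ (h (e.1.2, ξ)))‖ₑ := by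
  have m7 : Measurable (starRingEnd ℂ) := RCLike.continuous_conj (K := ℂ) |>.measurable
  have m4 : Measurable fun z : ((ℝ × ℝ) × ℝ) × V2 => Complex.exp (-(z.1.2 + (σ * (z.1.1.1 - z.1.1.2) : ℝ) * IC) * (‖z.2‖ : ℂ)) * (h (z.1.1.1, z.2) * starRingEnd ℂ (h (z.1.1.2, z.2))) := by fun_prop
  exact m4.stronglyMeasurable.integral_prod_right'.measurable.enorm

lemma Bz_meas {H : RV → ℂ} (hm : Measurable H) (σ : ℝ) : Measurable fun e : (ℝ × ℝ) × ℝ => ‖Bz (e.2 + (σ * (e.1.1 - e.1.2) : ℝ) * IC) (fun y => H (e.1.1, y)) (fun y => H (e.1.2, y))‖ₑ := 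
  Bz_meas0 (sl_meas hm) σ

set_option maxHeartbeats 600000 in
lemma MAIN {θ : ℝ} (hθ : 1/2 < θ) {x x' : ℝ} (hx' : 0 ≤ x') (hxx : x' ≤ x) (hx1 : x < 1) : ∃ C : ENN, C ≠ ⊤ ∧ ∀ (u : SW) (W : RV → ℝ), Wok W →
    ∀ (ν : ℝ → ENN) (ω : V2 → ENN) (ρ : ℝ → ENN) (Λ : ENN), Measurable ν → Measurable ω → Measurable ρ →
    (∀ ξ, ξ ≠ 0 → 1 ≤ ω ξ * ∫⁻ ε in Ioi 0, ν ε * ofReal (exp (-ε * ‖ξ‖))) →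
    (∀ t t' v : ℝ, v ≠ 0 → |v| = |t - t'| → ∫⁻ ε in Ioi 0, ν ε * ‖Bz (ε + v * IC) (fun y => uW u W (t, y)) (fun y => uW u W (t', y))‖ₑ ≤
      Λ * ofReal |v| ^ (-x') * ((ρ t ^ hfr * gW u W t) * (ρ t' ^ hfr * gW u W t'))) →
    ∫⁻ p, ‖u p‖ₑ^2 * ofReal (W p) ≤ C * (Λ * LtR (1 - x) ρ) *
      ∫⁻ q : RV, ‖ftST u q.1 q.2‖ₑ^2 * (ofReal ((1 + |(|q.1| - ‖q.2‖)|) ^ (2 * θ)) * ω q.2) := by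
  obtain ⟨C1, hC10, hC1⟩ := PH_le hθ
  obtain ⟨C2, hC2, hT⟩ := TIME x (hx'.trans hxx) hx1
  refine ⟨2 * (ofReal C1 * C2), by finiteness, fun u W hW ν ω ρ Λ hν hω hρ h1 hB => ?_⟩
  obtain ⟨Hm, Hi, Hn⟩ := uW_nice u hW
  set H := uW u W with hH
  have hu : Measurable u := u.continuous.measurable
  have Wm := hW.m
  set X := ∫⁻ p, ‖u p‖ₑ^2 * ofReal (W p) with hX
  have hr : ∀ p, u p * starRingEnd ℂ (H p) = ((‖u p‖^2 * W p : ℝ) : ℂ) := fun p => by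
    rw [hH, uW, map_mul, conj_ofReal, ← mul_assoc, mul_conj']; push_cast; rfl
  obtain ⟨K, hK⟩ : ∃ K, ∀ p, ‖u p‖ ≤ K := ⟨_, fun p => u.norm_le_seminorm ℝ p⟩
  have ri : Integrable fun p => ‖u p‖^2 * W p := by
    refine (Hi.norm.const_mul K).mono fp (of_forall fun p => ?_)
    have h0 := hW.z p
    have hK0 := (norm_nonneg _).trans (hK p)
    rw [norm_of_nonneg ps, norm_of_nonneg ps, hH, uW, norm_mul, norm_real, norm_of_nonneg h0, ← mul_assoc, sq]
    gcongr; exact hK p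
  have Xe : X = ofReal (∫ p, ‖u p‖^2 * W p) := by
    rw [ofReal_integral_eq_lintegral_ofReal ri (of_forall fun p => mul_nonneg ps (hW.z p))]
    refine ltgc fun p => ?_
    rw [ofReal_mul ps, ENNReal.ofReal_pow (norm_nonneg _), onee]
  have Xf : X ≠ ⊤ := by rw [Xe]; finiteness
  set m : RV → ℝ := fun q => 1 + |(|q.1| - ‖q.2‖)| with hm
  have m0 : ∀ q, 0 < m q := fun q => by positivity
  have mm : Measurable m := by fun_prop
  set N : V2 → ENN := fun ξ => ∫⁻ ε in Ioi 0, ν ε * ofReal (exp (-ε * ‖ξ‖)) with hN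
  have Nm : Measurable N := by
    have : Measurable fun z : V2 × ℝ => ν z.2 * ofReal (exp (-z.2 * ‖z.1‖)) := by fun_prop
    exact this.lintegral_prod_right'
  set A := ∫⁻ q : RV, ‖ftST u q.1 q.2‖ₑ^2 * (ofReal (m q ^ (2 * θ)) * ω q.2) with hA
  set Q := ∫⁻ q : RV, ‖ftST H q.1 q.2‖ₑ^2 * (ofReal (m q ^ (-(2 * θ))) * N q.2) with hQ
  have um := ftST_meas hu
  have Hfm := ftST_meas Hm
  have XAQ : X ≤ A ^ hfr * Q ^ hfr := by
    have i1 := INV u Hm Hi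
    simp only [hr] at i1
    rw [integral_complex_ofReal, ← onee, norm_real, norm_of_nonneg (integral_nonneg fun p => mul_nonneg ps (hW.z p)), ← Xe] at i1
    refine i1.trans (le_trans ?_ ((CS2 volume (f := fun q : RV => ‖ftST u q.1 q.2‖ₑ * (ofReal (m q ^ (2 * θ)) * ω q.2) ^ hfr) (g := fun q : RV => ‖ftST H q.1 q.2‖ₑ * (ofReal (m q ^ (-(2 * θ))) * N q.2) ^ hfr) fp fp).trans (le_of_eq ?_)))
    · refine lintegral_mono_ae ?_
      have : ∀ᵐ q : RV, q.2 ≠ 0 := by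
        rw [volume_eq_prod]
        exact Measure.quasiMeasurePreserving_snd.ae (ae_ne volume 0)
      filter_upwards [this] with q hq
      have h2 : 1 ≤ (ofReal (m q ^ (2 * θ)) * ω q.2) ^ hfr * (ofReal (m q ^ (-(2 * θ))) * N q.2) ^ hfr := by
        rw [← Emn _ _ nu, mul_mul_mul_comm, ← ofReal_mul (by have := m0 q; positivity), ← rpow_add (m0 q), add_neg_cancel, rpow_zero, ofReal_one, one_mul]
        exact ENNReal.one_le_rpow (h1 _ hq) nu
      calc _ = ‖ftST u q.1 q.2‖ₑ * ‖ftST H q.1 q.2‖ₑ * 1 := by rw [mul_one]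
        _ ≤ _ := mul_le_mul_right h2 _
        _ = _ := by ring
    · simp only [mul_pow, sq_half]; rfl
  have Jσ : ∀ σ : ℝ, |σ| = 1 → ∫⁻ q : RV, ‖ftST H q.1 q.2‖ₑ^2 * (ofReal ((1 + (q.1 - σ * ‖q.2‖)^2) ^ (-θ)) * N q.2) ≤ ofReal C1 * Λ * (C2 * (LtR (1 - x) ρ * X)) := by
    intro σ hσ
    have s1 : ∫⁻ q : RV, ‖ftST H q.1 q.2‖ₑ^2 * (ofReal ((1 + (q.1 - σ * ‖q.2‖)^2) ^ (-θ)) * N q.2) =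
        ∫⁻ ε in Ioi 0, ν ε * ∫⁻ q : RV, ‖ftST H q.1 q.2‖ₑ^2 * ofReal ((1 + (q.1 - σ * ‖q.2‖)^2) ^ (-θ) * exp (-ε * ‖q.2‖)) := by
      have hj : Measurable fun z : RV × ℝ => ‖ftST H z.1.1 z.1.2‖ₑ^2 * ofReal ((1 + (z.1.1 - σ * ‖z.1.2‖)^2) ^ (-θ) * exp (-z.2 * ‖z.1.2‖)) := by
        refine Measurable.mul ((Hfm.comp measurable_fst).enorm.pow_const 2) fp
      have hk : ∀ ε : ℝ, Measurable fun q : RV => ‖ftST H q.1 q.2‖ₑ^2 * ofReal ((1 + (q.1 - σ * ‖q.2‖)^2) ^ (-θ) * exp (-ε * ‖q.2‖)) := fun ε => by fun_prop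
      simp_rw [← lcmu _ (hk _)]
      rw [← lintegral_lintegral_swap]
      · refine ltgc fun q => ?_
        simp only [hN]
        rw [← lcmu _ fp, ← lcmu _ fp]
        refine ltgc fun ε => ?_
        rw [ofReal_mul ps]; ring
      · exact (Measurable.mul fp hj).aemeasurable
    have PHm : Measurable fun p : ℝ × ℝ => ‖PH θ (p.1 - p.2)‖ₑ := by
      have : Measurable (PH θ) := by
        have : StronglyMeasurable fun p : ℝ × ℝ => Complex.exp (-IC * ((p.1 * p.2 : ℝ) : ℂ)) * (((1 + p.2^2) ^ (-θ) : ℝ) : ℂ) := Measurable.stronglyMeasurable fp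
        exact this.integral_prod_right'.measurable
      exact (this.comp fp).enorm
    have Bm := Bz_meas Hm σ
    set BB : (ℝ × ℝ) × ℝ → ENN := fun e => ‖Bz (e.2 + (σ * (e.1.1 - e.1.2) : ℝ) * IC) (fun y => H (e.1.1, y)) (fun y => H (e.1.2, y))‖ₑ with hBB
    set PP : ℝ × ℝ → ENN := fun p => ‖PH θ (p.1 - p.2)‖ₑ with hPP
    have s2 : ∫⁻ ε in Ioi 0, ν ε * ∫⁻ q : RV, ‖ftST H q.1 q.2‖ₑ^2 * ofReal ((1 + (q.1 - σ * ‖q.2‖)^2) ^ (-θ) * exp (-ε * ‖q.2‖)) ≤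
        ∫⁻ ε in Ioi 0, ν ε * ∫⁻ p, PP p * BB (p, ε) := by
      refine setLIntegral_mono' measurableSet_Ioi fun ε hε => ?_
      gcongr
      exact JB hθ Hm Hi Hn hε σ
    have s3 : ∫⁻ ε in Ioi 0, ν ε * ∫⁻ p, PP p * BB (p, ε) = ∫⁻ p, PP p * ∫⁻ ε in Ioi 0, ν ε * BB (p, ε) := by
      clear_value BB PP
      have hj : Measurable fun z : (ℝ × ℝ) × ℝ => PP z.1 * (ν z.2 * BB z) := (PHm.comp measurable_fst).mul ((hν.comp measurable_snd).mul Bm)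
      calc _ = ∫⁻ ε in Ioi 0, ∫⁻ p, PP p * (ν ε * BB (p, ε)) := by
            refine ltgc fun ε => ?_
            have hk : Measurable fun p => PP p * BB (p, ε) := by fun_prop
            rw [← lcmu _ hk]
            refine ltgc fun p => ?_
            ring
        _ = ∫⁻ p, ∫⁻ ε in Ioi 0, PP p * (ν ε * BB (p, ε)) := by
            rw [lintegral_lintegral_swap]; exact (hj.comp measurable_swap).aemeasurable
        _ = _ := by
            refine ltgc fun p => ?_
            have hk : Measurable fun ε => ν ε * BB (p, ε) := by fun_prop
            rw [lcmu _ hk]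
    have gm : Measurable (gW u W) := by
      have : Measurable fun z : RV => ‖u z‖ₑ^2 * ofReal (W z) := by fun_prop
      exact this.lintegral_prod_right'.pow_const _
    have gX : ∫⁻ t, gW u W t ^ 2 = X := by
      simp only [gW, sq_half]; rw [hX, volume_eq_prod, lintegral_prod _ fp]
    rw [s1]
    refine s2.trans ?_
    rw [s3, volume_eq_prod, lintegral_prod _ ?_, ← gX]
    swap
    · clear_value BB PP
      have hj : Measurable fun z : (ℝ × ℝ) × ℝ => ν z.2 * BB z := (hν.comp measurable_snd).mul Bm
      exact (PHm.mul hj.lintegral_prod_right').aemeasurable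
    refine le_trans ?_ (mul_le_mul_right (hT ρ (gW u W) hρ gm) _)
    rw [← lcmu _ (by apply lintegral_prod_right' (f := fun p : ℝ × ℝ => edist p.1 p.2 ^ (-x) * ((ρ p.1 ^ hfr * gW u W p.1) * (ρ p.2 ^ hfr * gW u W p.2))); fun_prop)]
    refine lintegral_mono fun t => ?_
    rw [← lcmu _ fp]
    refine lintegral_mono_ae ?_
    filter_upwards [ae_ne volume t] with t' ht
    have hv : t - t' ≠ 0 := sub_ne_zero.2 ht.symm
    have hσ0 : σ ≠ 0 := by rintro rfl; simp at hσ
    have hva : |σ * (t - t')| = |t - t'| := by rw [abs_mul, hσ, one_mul]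
    have b1 := hB t t' (σ * (t - t')) (mul_ne_zero hσ0 hv) hva
    have b2 : PP (t, t') ≤ ofReal C1 * ofReal |t - t'| ^ (-(x - x')) := by
      rw [ofReal_rpow_of_pos (abs_pos.2 hv), ← ofReal_mul hC10, hPP]
      beta_reduce
      rw [← onee]
      exact ofReal_le_ofReal (hC1 _ la la _ hv)
    refine (mul_le_mul' b2 b1).trans (le_of_eq ?_)
    have ed : edist t t' ^ (-x) = ofReal |t - t'| ^ (-(x - x')) * ofReal |t - t'| ^ (-x') := by
      rw [← ENNReal.rpow_add _ _ (by simpa using hv) (by finiteness), edist_dist, Real.dist_eq]; congr 1; ring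
    rw [ed, hva]; ring
  have Qle : Q ≤ 2 * (ofReal C1 * Λ * (C2 * (LtR (1 - x) ρ * X))) := by
    rw [two_mul]
    refine le_trans ?_ (add_le_add (Jσ 1 (by simp)) (Jσ (-1) (by simp)))
    rw [← lintegral_add_left fp]
    refine lintegral_mono fun q => ?_
    beta_reduce
    rw [← mul_add, ← add_mul, ← ofReal_add ps ps]
    gcongr
    have key : ∀ y : ℝ, (1 + |y|) ^ (-(2 * θ)) ≤ (1 + y^2) ^ (-θ) := fun y => by
      rw [show -(2*θ) = 2 * (-θ) by ring, rpow_mul ps, Real.rpow_two]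
      exact rpow_le_rpow_of_nonpos ps (by nlinarith [sq_abs y, abs_nonneg y]) la
    simp only [hm]
    refine (key _).trans ?_
    rcases abs_cases q.1 with h | h
    · rw [h.1, one_mul]; exact le_add_of_nonneg_right ps
    · rw [h.1, show (-q.1 - ‖q.2‖)^2 = (q.1 - -1 * ‖q.2‖)^2 by ring]; exact le_add_of_nonneg_left ps
  rcases eq_or_ne X 0 with h0 | h0
  · rw [h0]; exact bot_le
  have sqX : X * X ≤ (2 * (ofReal C1 * C2) * (Λ * LtR (1 - x) ρ) * A) * X := by
    calc X * X ≤ (A ^ hfr * Q ^ hfr) * (A ^ hfr * Q ^ hfr) := mul_le_mul' XAQ XAQ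
      _ = A * Q := by rw [mul_mul_mul_comm, half_half, half_half]
      _ ≤ A * (2 * (ofReal C1 * Λ * (C2 * (LtR (1 - x) ρ * X)))) := by gcongr
      _ = _ := by ring
  exact (ENNReal.mul_le_mul_iff_left h0 Xf).1 sqX

lemma Kz_even (z : ℂ) (x : V2) : Kz z (-x) = Kz z x := by
  unfold Kz
  rw [← integral_neg_eq_self]
  refine integral_congr_ae (of_forall fun ξ => ?_)
  simp

lemma gW_fin (u : SW) {W : RV → ℝ} (hW : Wok W) (t : ℝ) : gW u W t ≠ ⊤ := by
  obtain ⟨M, hM, hs⟩ := hW.b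
  obtain ⟨K, hK⟩ : ∃ K, ∀ p, ‖u p‖ ≤ K := ⟨_, fun p => u.norm_le_seminorm ℝ p⟩
  refine Ert nu (ne_top_of_le_ne_top (b := ofReal K ^ 2 * ofReal M * volume (closedBall (0:V2) M)) ?_ ?_)
  · have : volume (closedBall (0:V2) M) ≠ ⊤ := measure_closedBall_lt_top.ne
    finiteness
  · rw [← lintegral_indicator_const Metric.isClosed_closedBall.measurableSet]
    refine lintegral_mono fun y => ?_
    by_cases hy : y ∈ closedBall (0:V2) M
    · rw [indicator_of_mem hy, ← onee]
      gcongr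
      exacts [hK _, hM _]
    · rw [hs (t, y) (inr (by simpa using hy))]; simp

lemma SL {C1 : ℝ} (hC0 : 0 ≤ C1) (hC : ∀ ε : ℝ, 0 < ε → ∫⁻ x : V2, ‖Kz ε x‖ₑ ≤ ofReal C1) {z : ℂ} (hz : 0 < z.re)
    (u : SW) {W Ω : RV → ℝ} (hW : Wok W) (mΩ : Measurable Ω) (pΩ : ∀ p, 0 ≤ Ω p) {M : ℝ} (bΩ : ∀ p, Ω p ≤ M)
    {P D : ℝ → ℝ} (hP : ∀ t, 0 ≤ P t) (hD : ∀ t, 0 ≤ D t) {β : ℝ} (hβ0 : 0 ≤ β) (hβ1 : β ≤ 1)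
    (hWΩ : ∀ t y, W (t, y) ≤ P t * Ω (t, y) ^ β) (hK : ∀ t y, ∫⁻ x, ‖Kz z (x - y)‖ₑ * ofReal (Ω (t, x)) ≤ ofReal (D t)) (t t' : ℝ) :
    ‖Bz z (fun y => uW u W (t, y)) (fun y => uW u W (t', y))‖ₑ ≤ ofReal (C1 ^ (1 - β) * (D t * D t') ^ (β/2) * (P t ^ hfr * P t' ^ hfr)) * (gW u W t * gW u W t') := by
  obtain ⟨Hm, Hi, Hn⟩ := uW_nice u hW
  have hu : Measurable u := u.continuous.measurable
  have Wm := hW.m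
  have tri : ∀ t y, ‖uW u W (t, y)‖ ≤ Ω (t, y) ^ (β/2) * (‖u (t, y)‖ * W (t, y) ^ hfr * P t ^ hfr) := by
    intro t y
    have h0 := hW.z (t, y)
    rw [uW, norm_mul, norm_real, norm_of_nonneg h0]
    have e1 : W (t, y) = W (t, y) ^ hfr * W (t, y) ^ hfr := by rw [← rpow_add_of_nonneg h0 nu nu]; norm_num
    have e2 : W (t, y) ^ hfr ≤ P t ^ hfr * Ω (t, y) ^ (β/2) := by
      refine (Real.rpow_le_rpow h0 (hWΩ t y) nu).trans (le_of_eq ?_)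
      rw [mul_rpow (hP t) (Real.rpow_nonneg (pΩ _) _), ← rpow_mul (pΩ _)]; congr 2; ring
    calc _ = ‖u (t, y)‖ * W (t, y) ^ hfr * W (t, y) ^ hfr := by rw [mul_assoc, ← e1]
      _ ≤ ‖u (t, y)‖ * W (t, y) ^ hfr * (P t ^ hfr * Ω (t, y) ^ (β/2)) := by gcongr
      _ = _ := by ring
  have rr : ∀ t, ∫⁻ y, ofReal (‖u (t, y)‖ * W (t, y) ^ hfr * P t ^ hfr) ^ 2 ≤ ofReal (((gW u W t).toReal * P t ^ hfr)^2) := by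
    intro t
    rw [mul_pow, ofReal_mul ps, ENNReal.ofReal_pow ENNReal.toReal_nonneg, ENNReal.ofReal_toReal (gW_fin u hW t), gW, sq_half, ← lintegral_mul_const _ fp]
    refine lintegral_mono fun y => le_of_eq ?_
    have h0 := hW.z (t, y)
    have h1 := hP t
    rw [← ENNReal.ofReal_pow ps, mul_pow, mul_pow, ofReal_mul ps, ofReal_mul ps, ENNReal.ofReal_pow (norm_nonneg _), onee, ← rpow_natCast (W (t, y) ^ hfr), ← rpow_mul h0]
    norm_num
  have := INT hC0 hC hz (Hn t) (Hn t') (Ω1 := fun y => Ω (t, y)) (Ω2 := fun y => Ω (t', y)) fp fp (M := M) (fun y => pΩ _) (fun y => pΩ _) (fun y => bΩ _) (fun y => bΩ _)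
    (G1 := fun y => ‖u (t, y)‖ * W (t, y) ^ hfr * P t ^ hfr) (G2 := fun y => ‖u (t', y)‖ * W (t', y) ^ hfr * P t' ^ hfr) fp fp
    (fun y => mul_nonneg (mul_nonneg (norm_nonneg _) (Real.rpow_nonneg (hW.z _) _)) (Real.rpow_nonneg (hP _) _)) (fun y => mul_nonneg (mul_nonneg (norm_nonneg _) (Real.rpow_nonneg (hW.z _) _)) (Real.rpow_nonneg (hP _) _)) β hβ0 hβ1 (tri t) (tri t')
    (g1 := (gW u W t).toReal * P t ^ hfr) (g2 := (gW u W t').toReal * P t' ^ hfr) (D1 := D t) (D2 := D t') (mul_nonneg ENNReal.toReal_nonneg (Real.rpow_nonneg (hP _) _)) (mul_nonneg ENNReal.toReal_nonneg (Real.rpow_nonneg (hP _) _)) (hD t) (hD t') (rr t) (rr t') (hK t)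
    (fun x => by
      refine le_trans (le_of_eq (ltgc fun y => ?_)) (hK t' x)
      rw [← Kz_even, neg_sub])
  rw [← onee]
  refine (ofReal_le_ofReal this).trans (le_of_eq ?_)
  have a1 := hD t; have a2 := hD t'; have a3 := hP t; have a4 := hP t'
  rw [show (gW u W t).toReal * P t ^ hfr * ((gW u W t').toReal * P t' ^ hfr) = (P t ^ hfr * P t' ^ hfr) * ((gW u W t).toReal * (gW u W t').toReal) by ring, ← mul_assoc, ofReal_mul ps]
  congr 1
  rw [ofReal_mul ENNReal.toReal_nonneg, ENNReal.ofReal_toReal (gW_fin u hW _), ENNReal.ofReal_toReal (gW_fin u hW _)]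

lemma HN_sq (s θ : ℝ) (u : RV → ℂ) : HN s θ u ^ 2 = ∫⁻ q : RV, ‖ftST u q.1 q.2‖ₑ^2 * (ofReal ((1 + |(|q.1| - ‖q.2‖)|) ^ (2 * θ)) * ofReal ((1 + ‖q.2‖^2) ^ s)) := by
  rw [HN, sq_half]
  refine ltgc fun q => ?_
  rw [mul_pow, mul_comm, ← ENNReal.ofReal_pow (by unfold wgt; positivity), wgt, mul_pow, mul_comm ((_ : ℝ) ^ 2), ofReal_mul ps]
  congr 3
  · rw [← rpow_natCast, ← rpow_mul ps]; congr 1; push_cast; ring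
  · rw [← rpow_natCast, ← rpow_mul ps]; congr 1; push_cast; ring

lemma om_HN {s θ : ℝ} (u : SW) {ω : V2 → ENN} {K : ENN} (h : ∀ ξ, ω ξ ≤ K * ofReal ((1 + ‖ξ‖^2) ^ s)) :
    ∫⁻ q : RV, ‖ftST u q.1 q.2‖ₑ^2 * (ofReal ((1 + |(|q.1| - ‖q.2‖)|) ^ (2 * θ)) * ω q.2) ≤ K * HN s θ u ^ 2 := by
  have um := ftST_meas u.continuous.measurable
  rw [HN_sq, ← lcmu _ fp]
  refine lintegral_mono fun q => ?_
  calc _ ≤ ‖ftST u q.1 q.2‖ₑ^2 * (ofReal ((1 + |(|q.1| - ‖q.2‖)|) ^ (2 * θ)) * (K * ofReal ((1 + ‖q.2‖^2) ^ s))) := by gcongr; exact h _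
    _ = _ := by ring

lemma gam {r : ℝ} (hr : 0 < r) {b : ℝ} (hb : 0 < b) : ∫⁻ ε in Ioi 0, ofReal (ε ^ (r - 1)) * ofReal (exp (-ε * b)) = ofReal (b ^ (-r) * Real.Gamma r) := by
  have := Real.integral_rpow_mul_exp_neg_mul_Ioi hr hb
  rw [one_div, inv_rpow hb.le, ← rpow_neg hb.le] at this
  have hi : IntegrableOn (fun t : ℝ => t ^ (r - 1) * exp (-(b * t))) (Ioi 0) := by
    by_contra h
    rw [integral_undef h] at this
    have : 0 < b ^ (-r) * Real.Gamma r := by have := Real.Gamma_pos_of_pos hr; positivity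
    linarith
  rw [← this, ofReal_integral_eq_lintegral_ofReal hi ((ae_restrict_mem measurableSet_Ioi).mono fun t ht => by have := mem_Ioi.1 ht; positivity)]
  refine setLIntegral_congr_fun measurableSet_Ioi fun t ht => ?_
  have := mem_Ioi.1 ht
  beta_reduce
  rw [← ofReal_mul ps]; congr 3; ring_nf

lemma L2I {s θ : ℝ} (hs : 0 < s) (hθ : 1/2 < θ) : ∃ C : ENN, C ≠ ⊤ ∧ ∀ u : SW, ∀ᵐ t, ∫⁻ y, ‖u (t, y)‖ₑ^2 ≤ C * HN s θ u ^ 2 := by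
  obtain ⟨C1, hC0, hC⟩ := K1
  obtain ⟨C2, hC2, HM⟩ := MAIN hθ le_rfl le_rfl (zero_lt_one (α := ℝ))
  have hG : 0 < Real.Gamma (2 * s) := Real.Gamma_pos_of_pos la
  set Λ : ENN := ofReal (Real.Gamma (2 * s)) * ofReal C1
  set K : ENN := ofReal (2 ^ s * (Real.Gamma (2 * s))⁻¹)
  refine ⟨C2 * Λ * K, by finiteness, fun u => ?_⟩
  have hu : Measurable u := u.continuous.measurable
  have um : Measurable fun p : RV => ‖u p‖ₑ^2 := by fun_prop
  refine ae_le_of_forall_setLIntegral_le_of_sigmaFinite₀ um.lintegral_prod_right'.aemeasurable fun S hS _ => ?_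
  rw [setLIntegral_const]
  set A : ℕ → Set RV := fun n => (S ∩ Icc (-n:ℝ) n) ×ˢ closedBall 0 n with hA
  have Am : ∀ n, MeasurableSet (A n) := fun n => (hS.inter measurableSet_Icc).prod Metric.isClosed_closedBall.measurableSet
  have hU : S ×ˢ univ = ⋃ n, A n := by
    ext p
    simp only [mem_prod, mem_univ, and_true, mem_iUnion, hA, mem_inter_iff, mem_Icc, mem_closedBall_zero_iff]
    constructor
    · intro h
      obtain ⟨n, hn⟩ := exists_nat_ge (max |p.1| ‖p.2‖)
      exact ⟨n, ⟨h, abs_le.1 ((le_max_left _ _).trans hn)⟩, (le_max_right _ _).trans hn⟩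
    · rintro ⟨n, h, _⟩; exact h.1
  have hd : Directed (· ⊆ ·) A := by
    refine (monotone_nat_of_le_succ fun n => ?_).directed_le
    refine prod_mono (inter_subset_inter_right _ (Icc_subset_Icc ?_ ?_)) (Metric.closedBall_subset_closedBall ?_) <;> push_cast <;> linarith
  have e1 : ∫⁻ t in S, ∫⁻ y, ‖u (t, y)‖ₑ^2 = ∫⁻ p in S ×ˢ univ, ‖u p‖ₑ^2 := by
    rw [volume_eq_prod, ← prod_restrict, Measure.restrict_univ, lintegral_prod _ um.aemeasurable]
  rw [e1, hU, setLIntegral_iUnion_of_directed _ hd]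
  refine iSup_le fun n => ?_
  set W : RV → ℝ := (A n).indicator fun _ => 1 with hW
  have Wk : Wok W := by
    refine ⟨measurable_const.indicator (Am n), fun p => indicator_nonneg (by simp) _, n + 1, fun p => ?_, fun p hp => indicator_of_notMem ?_ _⟩
    · refine (indicator_le_self' (by simp) p).trans ?_
      have : (0:ℝ) ≤ n := by positivity
      linarith
    · simp only [hA, mem_prod, mem_inter_iff, mem_Icc, mem_closedBall_zero_iff, ← abs_le]
      rintro ⟨⟨_, h1⟩, h2⟩
      rcases hp with h | h <;> linarith
  set P : ℝ → ℝ := S.indicator fun _ => 1 with hP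
  have hP0 : ∀ t, 0 ≤ P t := fun t => indicator_nonneg (by simp) _
  have hPm : Measurable P := measurable_const.indicator hS
  have M := HM u W Wk (fun ε => ofReal (ε ^ (2 * s - 1)) * ofReal (exp (-ε))) (fun ξ => ofReal ((1 + ‖ξ‖) ^ (2 * s) * (Real.Gamma (2 * s))⁻¹))
    (fun t => ofReal (P t)) Λ fp fp fp ?_ ?_
  · calc _ = ∫⁻ p, ‖u p‖ₑ^2 * ofReal (W p) := by
          rw [← lintegral_indicator (Am n)]
          refine ltgc fun p => ?_
          by_cases hp : p ∈ A n <;> simp [hW, hp]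
      _ ≤ _ := M
      _ ≤ C2 * (Λ * volume S) * (K * HN s θ u ^ 2) := by
          refine mul_le_mul' (le_of_eq ?_) (om_HN (s := s) (θ := θ) (K := K) (ω := fun ξ => ofReal ((1 + ‖ξ‖) ^ (2 * s) * (Real.Gamma (2 * s))⁻¹)) u fun ξ => ?_)
          · rw [sub_zero, LtR_one]
            congr 2
            rw [← lintegral_indicator_one hS]
            refine ltgc fun p => ?_
            by_cases hp : p ∈ S <;> simp [hP, hp]
          · rw [← ofReal_mul ps]
            apply ofReal_le_ofReal
            rw [mul_right_comm, rpow_mul ps, ← mul_rpow ps ps, Real.rpow_two]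
            gcongr
            nlinarith [sq_nonneg (1 - ‖ξ‖)]
      _ = _ := by ring
  · intro ξ _
    simp_rw [mul_assoc, ← ofReal_mul (Real.exp_nonneg _), ← exp_add, show ∀ ε : ℝ, -ε + -ε * ‖ξ‖ = -ε * (1 + ‖ξ‖) by intro ε; ring]
    rw [gam la ps, ← ofReal_mul ps, mul_mul_mul_comm, ← rpow_add ps, add_neg_cancel, rpow_zero, inv_mul_cancel₀ hG.ne']
    simp
  · intro t t' v hv hvt
    have e : ∫⁻ ε in Iop, ofReal (ε ^ (2 * s - 1)) * ofReal (exp (-ε)) = ofReal (Real.Gamma (2 * s)) := by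
      have := gam (r := 2 * s) la one_pos
      simpa using this
    simp only [neg_zero, ENNReal.rpow_zero, mul_one]
    rw [show Λ = ofReal (Real.Gamma (2 * s)) * ofReal C1 from rfl, ← e, mul_assoc, ← lintegral_mul_const _ fp]
    refine setLIntegral_mono' measurableSet_Ioi fun ε hε => ?_
    refine mul_le_mul_right ?_ _
    refine (SL hC0 hC (by simpa using hε) u Wk (Ω := fun _ => 0) measurable_const (fun _ => le_rfl) (M := 0) (fun _ => le_rfl) (P := P) (D := fun _ => 0) hP0 (fun _ => le_rfl) (β := 0) le_rfl zero_le_one ?_ (by simp) t t').trans (le_of_eq ?_)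
    · intro t y
      simp only [rpow_zero, mul_one, hW, hP]
      by_cases h : (t, y) ∈ A n
      · rw [indicator_of_mem h, indicator_of_mem h.1.1]
      · rw [indicator_of_notMem h]; exact indicator_nonneg (by simp) _
    · simp only [sub_zero, rpow_one, zero_div, rpow_zero, mul_one]
      rw [ofReal_mul hC0, ofReal_mul (Real.rpow_nonneg (hP0 _) _), ofReal_rpow_of_nonneg (hP0 _) nu, ofReal_rpow_of_nonneg (hP0 _) nu]
      ring

lemma TP {p l : ℝ} (hp : 0 < p) (hl : 0 < l) (A B : ENN) {R : ℝ} (F : ℝ → ENN)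
    (h1 : ∀ ε, 0 < ε → ε < R → F ε ≤ A * ofReal ε ^ (p - 1)) (h2 : ∀ ε, 0 < ε → R < ε → F ε ≤ B * ofReal ε ^ (-l - 1)) :
    ∫⁻ ε in Ioi 0, F ε ≤ A * (ofReal R ^ p * ofReal p⁻¹) + B * (ofReal R ^ (-l) * ofReal l⁻¹) := by
  have m1 : Measurable fun ε : ℝ => ofReal ε ^ (p - 1) * (if ofReal ε < ofReal R then 1 else 0) :=
    Measurable.mul fp (mitx)
  have m2 : Measurable fun ε : ℝ => ofReal ε ^ (-l - 1) * (if ofReal R < ofReal ε then 1 else 0) :=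
    Measurable.mul fp (mitx)
  rw [← pw_lt p hp, ← pw_gt l hl _ (by finiteness), ← lcmu _ m1, ← lcmu _ m2, ← lintegral_add_left (m1.const_mul _)]
  refine lintegral_mono_ae ?_
  filter_upwards [ae_restrict_mem measurableSet_Ioi, ae_restrict_of_ae (ae_ne volume R)] with ε hε hR
  have hε : 0 < ε := hε
  rcases lt_or_gt_of_ne hR with h | h
  · rw [if_pos ((ENNReal.ofReal_lt_ofReal_iff (hε.trans h)).2 h), mul_one]
    exact (h1 ε hε h).trans le_self_add
  · rw [if_pos ((ENNReal.ofReal_lt_ofReal_iff hε).2 h) (α := ENN), mul_one (ofReal ε ^ (-l - 1))]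
    exact (h2 ε hε h).trans le_add_self

def bI (g : RV → ENN) (R : ℝ) (p : RV) : ENN := ∫⁻ z, (if dist z p.2 < R then 1 else 0) * g (p.1, z)

lemma bI_eq (g : RV → ENN) (R : ℝ) (p : RV) : bI g R p = ∫⁻ z in Metric.ball p.2 R, g (p.1, z) := by
  rw [bI, ← lintegral_indicator isOpen_ball.measurableSet]
  refine ltgc fun z => ?_
  by_cases h : dist z p.2 < R <;> simp [h]

lemma bI_meas0 {g : RV → ENN} (hg : Measurable g) (R : ℝ) : Measurable fun z : RV × V2 => (if dist z.2 z.1.2 < R then (1:ENN) else 0) * g (z.1.1, z.2) := by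
  have h : Measurable fun z : RV × V2 => g (z.1.1, z.2) := by fun_prop
  exact Measurable.mul (mitx) h

lemma bI_meas {g : RV → ENN} (hg : Measurable g) (R : ℝ) : Measurable (bI g R) :=
  (bI_meas0 hg R).lintegral_prod_right'

lemma wfin {w : RV → ℝ} (hw : Wok w) {κ : ℝ} (hκ : 0 < κ) : ∃ M : ℝ, 0 ≤ M ∧ ∀ t, ∫⁻ z, ofReal (w (t, z)) ^ κ ≤ ofReal M := by
  obtain ⟨M, hM, hs⟩ := hw.b
  have hf : ofReal M ^ κ * volume (closedBall (0:V2) M) ≠ ⊤ := by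
    have : volume (closedBall (0:V2) M) ≠ ⊤ := measure_closedBall_lt_top.ne
    have := Ert hκ.le (ENNReal.ofReal_ne_top (r := M))
    finiteness
  refine ⟨(ofReal M ^ κ * volume (closedBall (0:V2) M)).toReal, ENNReal.toReal_nonneg, fun t => ?_⟩
  rw [ENNReal.ofReal_toReal hf, ← lintegral_indicator_const Metric.isClosed_closedBall.measurableSet]
  refine lintegral_mono fun y => ?_
  by_cases hy : y ∈ closedBall (0:V2) M
  · rw [indicator_of_mem hy]
    gcongr
    exact hM _
  · rw [hs (t, y) (inr (by simpa using hy))]; simp [hκ]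

lemma NK {N N' k Q α β : ℝ} (hN : 0 ≤ N) (hN' : 0 ≤ N') (hk : 0 ≤ k) (hQ : 0 ≤ Q) (hβ : 0 ≤ β) (hαβ : β ≤ α) :
    ((N * k) * (N' * k)) ^ (β/2) * ((Q * N ^ (α - β)) ^ hfr * (Q * N' ^ (α - β)) ^ hfr) = k ^ β * Q * ((N ^ α) ^ hfr * (N' ^ α) ^ hfr) := by
  have h : ∀ {N : ℝ}, 0 ≤ N → (N ^ α) ^ hfr = N ^ (β/2) * (N ^ (α - β)) ^ hfr := fun {N} hN => by
    rw [← rpow_mul hN, ← rpow_mul hN, ← rpow_add_of_nonneg hN la la]; congr 1; ring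
  rw [h hN, h hN', mul_rpow ps ps, mul_rpow ps ps, mul_rpow ps ps, mul_rpow ps ps, mul_rpow ps ps]
  have e1 : k ^ (β/2) * k ^ (β/2) = k ^ β := by rw [← rpow_add_of_nonneg hk la la]; congr 1; ring
  have e2 : Q ^ hfr * Q ^ hfr = Q := by rw [← rpow_add_of_nonneg hQ nu nu]; norm_num
  rw [← e1]; conv_rhs => rw [← e2]
  ring

def Nw (w : RV → ℝ) (y t : ℝ) : ENN := ∫⁻ z, ofReal (w (t, z)) ^ (1 - y)⁻¹

lemma SLR {C1 : ℝ} (hC0 : 0 ≤ C1) (hC : ∀ ε : ℝ, 0 < ε → ∫⁻ x : V2, ‖Kz ε x‖ₑ ≤ ofReal C1) {y : ℝ} (hy0 : 0 < y) (hy1 : y < 1) (u : SW) {w : RV → ℝ} (hw : Wok w) {R : ℝ} (hR : 0 < R) :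
    Wok (fun p => (bI (fun p => ofReal (w p)) R p).toReal) ∧ (∀ p, bI (fun p => ofReal (w p)) R p ≠ ⊤) ∧ ∀ z : ℂ, 0 < z.re → ∀ k : ℝ, 0 ≤ k → (∀ y0 : V2, ∫⁻ x in Metric.ball y0 R, ‖Kz z x‖ₑ ≤ ofReal k) →
    ∀ β, 0 ≤ β → β ≤ 1 - y → ∀ t t', ‖Bz z (fun x => uW u (fun p => (bI (fun p => ofReal (w p)) R p).toReal) (t, x)) (fun x => uW u (fun p => (bI (fun p => ofReal (w p)) R p).toReal) (t', x))‖ₑ ≤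
      ofReal (C1 ^ (1 - β) * (k ^ β * (π * R^2) ^ y)) * (((Nw w y t ^ (1 - y)) ^ hfr * gW u (fun p => (bI (fun p => ofReal (w p)) R p).toReal) t) * ((Nw w y t' ^ (1 - y)) ^ hfr * gW u (fun p => (bI (fun p => ofReal (w p)) R p).toReal) t')) := by
  have wm := hw.m
  have h1y : 0 < 1 - y := by linarith
  obtain ⟨M1, hM1, hb1⟩ := wfin hw one_pos
  obtain ⟨M2, hM2, hb2⟩ := wfin hw (inv_pos.2 h1y)
  have ble : ∀ (g : RV → ENN) p, bI g R p ≤ ∫⁻ z, g (p.1, z) := fun g p => by rw [bI_eq]; exact setLIntegral_le_lintegral _ _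
  have f1 : ∀ p, bI (fun p => ofReal (w p)) R p ≤ ofReal M1 := fun p => (ble _ p).trans (by simpa using hb1 p.1)
  have f2 : ∀ p, bI (fun p => ofReal (w p) ^ (1 - y)⁻¹) R p ≤ ofReal M2 := fun p => (ble _ p).trans (hb2 p.1)
  have n1 : ∀ p, bI (fun p => ofReal (w p)) R p ≠ ⊤ := fun p => ne_top_of_le_ne_top (by finiteness) (f1 p)
  have n2 : ∀ p, bI (fun p => ofReal (w p) ^ (1 - y)⁻¹) R p ≠ ⊤ := fun p => ne_top_of_le_ne_top (by finiteness) (f2 p)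
  have n3 : ∀ t, Nw w y t ≠ ⊤ := fun t => ne_top_of_le_ne_top (by finiteness) (hb2 t)
  have Wk : Wok (fun p => (bI (fun p => ofReal (w p)) R p).toReal) := by
    obtain ⟨M, hM, hs⟩ := hw.b
    have hM0 : 0 ≤ M := (hw.z 0).trans (hM 0)
    refine ⟨(bI_meas fp R).ennreal_toReal, fun p => ENNReal.toReal_nonneg, M1 + M + R, fun p => ?_, fun p hp => ?_⟩
    · exact (ENNReal.toReal_le_of_le_ofReal hM1 (f1 p)).trans la
    · rw [bI_eq, setLIntegral_congr_fun (g := fun _ => 0) isOpen_ball.measurableSet]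
      · simp
      · intro z hz
        have : w (p.1, z) = 0 := hs _ (by
          rcases hp with h | h
          · left; simp only; linarith
          · right
            have h1 : dist z p.2 < R := hz
            have h2 := norm_sub_norm_le p.2 z
            rw [dist_comm, dist_eq_norm] at h1
            simp only; linarith)
        simp [this]
  refine ⟨Wk, n1, fun z hz k hk hK β hβ hβy t t' => ?_⟩
  have hV : ∀ x : V2, volume (Metric.ball x R) = ofReal (π * R^2) := fun x => by
    rw [EuclideanSpace.volume_ball_fin_two, ofReal_mul pi_pos.le, ENNReal.ofReal_pow hR.le, mul_comm]
  have hN0 : ∀ t, 0 ≤ (Nw w y t).toReal := fun t => ENNReal.toReal_nonneg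
  refine (SL hC0 hC hz u Wk (Ω := fun p => (bI (fun p => ofReal (w p) ^ (1 - y)⁻¹) R p).toReal) (bI_meas fp R).ennreal_toReal (fun p => ENNReal.toReal_nonneg) (M := M2) (fun p => ENNReal.toReal_le_of_le_ofReal hM2 (f2 p))
    (P := fun t => (π * R^2) ^ y * (Nw w y t).toReal ^ ((1 - y) - β)) (D := fun t => (Nw w y t).toReal * k) (fun t => by positivity) (fun t => by positivity) hβ la ?_ ?_ t t').trans (le_of_eq ?_)
  · intro t x
    have h := lintegral_mul_norm_pow_le (μ := volume.restrict (Metric.ball x R)) (f := fun _ => (1:ENN)) (g := fun z => ofReal (w (t, z)) ^ (1 - y)⁻¹) (p := y) (q := 1 - y) fp fp hy0.le h1y.le (by ring)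
    simp only [ENNReal.one_rpow, one_mul, ← Erm, inv_mul_cancel₀ h1y.ne', ENNReal.rpow_one, lintegral_one, Measure.restrict_apply_univ, hV] at h
    have h' : bI (fun p => ofReal (w p)) R (t, x) ≤ ofReal (π * R^2) ^ y * bI (fun p => ofReal (w p) ^ (1 - y)⁻¹) R (t, x) ^ (1 - y) := by rw [bI_eq, bI_eq]; exact h
    have h2 := ENNReal.toReal_mono (ENNReal.mul_ne_top (Ert hy0.le (by finiteness)) (Ert h1y.le (n2 _))) h'
    rw [ENNReal.toReal_mul, ← ENNReal.toReal_rpow, ← ENNReal.toReal_rpow, toReal_ofReal ps] at h2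
    refine h2.trans ?_
    rw [mul_assoc]
    gcongr
    have e := rpow_add_of_nonneg (x := (bI (fun p => ofReal (w p) ^ (1 - y)⁻¹) R (t, x)).toReal) ENNReal.toReal_nonneg (by linarith : 0 ≤ (1 - y) - β) hβ
    rw [sub_add_cancel] at e
    rw [e]
    refine mul_le_mul_of_nonneg_right (Real.rpow_le_rpow ENNReal.toReal_nonneg (ENNReal.toReal_mono (n3 t) (ble _ (t, x))) la) ps
  · intro t x0
    simp only [ENNReal.ofReal_toReal (n2 _)]
    have km := Kz_meas z
    have gm : Measurable fun p : RV => ofReal (w p) ^ (1 - y)⁻¹ := by fun_prop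
    have k1 : Measurable fun x => ‖Kz z (x - x0)‖ₑ := by fun_prop
    have hm := bI_meas0 gm R
    set g : RV → ENN := fun p => ofReal (w p) ^ (1 - y)⁻¹ with hg
    have jm : Measurable fun q : V2 × V2 => ‖Kz z (q.1 - x0)‖ₑ * ((if dist q.2 q.1 < R then 1 else 0) * g (t, q.2)) :=
      (k1.comp measurable_fst).mul (hm.comp (g := fun q : RV × V2 => (if dist q.2 q.1.2 < R then (1:ENN) else 0) * g (q.1.1, q.2)) (f := fun q : V2 × V2 => ((t, q.1), q.2)) fp)
    calc _ = ∫⁻ x, ∫⁻ ζ, ‖Kz z (x - x0)‖ₑ * ((if dist ζ x < R then 1 else 0) * g (t, ζ)) := by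
          refine ltgc fun x => ?_
          have hk : Measurable fun ζ => (if dist ζ x < R then (1:ENN) else 0) * g (t, ζ) := hm.comp (g := fun q : RV × V2 => (if dist q.2 q.1.2 < R then (1:ENN) else 0) * g (q.1.1, q.2)) (f := fun ζ : V2 => ((t, x), ζ)) fp
          rw [bI, lcmu _ hk]
      _ = ∫⁻ ζ, ∫⁻ x, ‖Kz z (x - x0)‖ₑ * ((if dist ζ x < R then 1 else 0) * g (t, ζ)) := lintegral_lintegral_swap jm.aemeasurable
      _ ≤ ∫⁻ ζ, g (t, ζ) * ofReal k := by
          refine lintegral_mono fun ζ => ?_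
          refine le_trans (le_of_eq ?_) (mul_le_mul_right (hK (ζ - x0)) _)
          have hi := km.enorm.indicator (s := Metric.ball (ζ - x0) R) isOpen_ball.measurableSet
          have hk : Measurable fun x => (Metric.ball (ζ - x0) R).indicator (fun x => ‖Kz z x‖ₑ) (x - x0) := hi.comp (measurable_id.sub_const x0)
          rw [← lintegral_indicator isOpen_ball.measurableSet, ← lintegral_sub_right_eq_self ((Metric.ball (ζ - x0) R).indicator fun x => ‖Kz z x‖ₑ) x0, ← lcmu _ hk]
          refine ltgc fun x => ?_
          by_cases h : dist ζ x < R
          · rw [indicator_of_mem (by rw [Metric.mem_ball, dist_sub_right, dist_comm]; exact h), if_pos h]; ring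
          · rw [indicator_of_notMem (by rw [Metric.mem_ball, dist_sub_right, dist_comm]; exact h), if_neg h]; ring
      _ = _ := by rw [lintegral_mul_const _ fp, ofReal_mul (hN0 t), ENNReal.ofReal_toReal (n3 t)]; rfl
  · rw [mul_assoc (C1 ^ (1 - β)), NK (hN0 t) (hN0 t') hk ps hβ hβy, ← mul_assoc, ← mul_assoc (C1 ^ (1 - β)), ofReal_mul ps, ofReal_mul (by positivity : 0 ≤ ((Nw w y t).toReal ^ (1 - y)) ^ hfr)]
    have hr : ∀ t, ofReal (((Nw w y t).toReal ^ (1 - y)) ^ hfr) = (Nw w y t ^ (1 - y)) ^ hfr := fun t => by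
      rw [← ofReal_rpow_of_nonneg (Real.rpow_nonneg (hN0 t) _) nu, ← ofReal_rpow_of_nonneg (hN0 t) h1y.le, ENNReal.ofReal_toReal (n3 t)]
    rw [hr, hr]; ring

lemma RA {ε R v b δ x' y c C3 : ℝ} (hε : 0 < ε) (hεR : ε < R) (hv : 0 < v) (hδ : 0 < δ) (hc : 0 ≤ c) (h3 : 0 ≤ C3) :
    (R ^ δ * ε ^ (b - δ - 1) + R ^ (-δ) * ε ^ (b + δ - 1)) * (c * ((C3 * (R * (ε * v) ^ (-(1/2):ℝ))) ^ (2 * x') * (π * R^2) ^ y)) ≤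
      (2 * c * C3 ^ (2 * x') * π ^ y) * R ^ (δ + 2 * x' + 2 * y) * v ^ (-x') * ε ^ ((b - δ - x') - 1) := by
  have hR : 0 < R := hε.trans hεR
  have h1 : R ^ (-δ) * ε ^ (b + δ - 1) ≤ R ^ δ * ε ^ (b - δ - 1) := by
    rw [show b + δ - 1 = (b - 1) + δ by ring, show b - δ - 1 = (b - 1) + -δ by ring, rpow_add hε, rpow_add hε]
    have a1 : R ^ (-δ) ≤ ε ^ (-δ) := rpow_le_rpow_of_nonpos hε hεR.le la
    have a2 : ε ^ δ ≤ R ^ δ := Real.rpow_le_rpow hε.le hεR.le hδ.le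
    calc _ = ε ^ (b - 1) * (R ^ (-δ) * ε ^ δ) := by ring
      _ ≤ ε ^ (b - 1) * (ε ^ (-δ) * R ^ δ) := by gcongr
      _ = _ := by ring
  have e : (C3 * (R * (ε * v) ^ (-(1/2):ℝ))) ^ (2 * x') * (π * R^2) ^ y = C3 ^ (2 * x') * π ^ y * (R ^ (2 * x' + 2 * y)) * v ^ (-x') * ε ^ (-x') := by
    rw [mul_rpow h3 ps, mul_rpow hR.le ps, ← rpow_mul ps, mul_rpow hε.le hv.le, mul_rpow pi_pos.le ps, ← Real.rpow_two, ← rpow_mul hR.le, rpow_add hR, show -(1/2) * (2 * x') = -x' by ring]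
    ring
  rw [e, show δ + 2 * x' + 2 * y = δ + (2 * x' + 2 * y) by ring, rpow_add hR δ, show b - δ - x' - 1 = (b - δ - 1) + -x' by ring, rpow_add hε]
  calc _ ≤ (R ^ δ * ε ^ (b - δ - 1) + R ^ δ * ε ^ (b - δ - 1)) * (c * (C3 ^ (2 * x') * π ^ y * (R ^ (2 * x' + 2 * y)) * v ^ (-x') * ε ^ (-x'))) := by gcongr
    _ = _ := by ring

lemma RB {ε R v b δ x' y c : ℝ} (hR : 0 < R) (hεR : R < ε) (hv : 0 < v) (hδ : 0 < δ) (hc : 0 ≤ c) (hy : y < 1) :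
    (R ^ δ * ε ^ (b - δ - 1) + R ^ (-δ) * ε ^ (b + δ - 1)) * (c * ((2 * π * (ε ^ (-(1/2 - x' / (1 - y))) * v ^ (-(x' / (1 - y)))) * ε ^ mth * (π * R^2)) ^ (1 - y) * (π * R^2) ^ y)) ≤
      (2 * c * (2 * π) ^ (1 - y) * π) * R ^ (2 - δ) * v ^ (-x') * ε ^ ((b + δ - 2 * (1 - y) + x') - 1) := by
  have hε : 0 < ε := hR.trans hεR
  have h1y : 1 - y ≠ 0 := by linarith
  have h1 : R ^ δ * ε ^ (b - δ - 1) ≤ R ^ (-δ) * ε ^ (b + δ - 1) := by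
    rw [show b + δ - 1 = (b - 1) + δ by ring, show b - δ - 1 = (b - 1) + -δ by ring, rpow_add hε, rpow_add hε]
    have a1 : ε ^ (-δ) ≤ R ^ (-δ) := rpow_le_rpow_of_nonpos hR hεR.le la
    have a2 : R ^ δ ≤ ε ^ δ := Real.rpow_le_rpow hR.le hεR.le hδ.le
    calc _ = ε ^ (b - 1) * (ε ^ (-δ) * R ^ δ) := by ring
      _ ≤ ε ^ (b - 1) * (R ^ (-δ) * ε ^ δ) := by gcongr
      _ = _ := by ring
  have e : (2 * π * (ε ^ (-(1/2 - x' / (1 - y))) * v ^ (-(x' / (1 - y)))) * ε ^ mth * (π * R^2)) ^ (1 - y) * (π * R^2) ^ y = (2 * π) ^ (1 - y) * π * R^2 * v ^ (-x') * ε ^ (-(2 * (1 - y)) + x') := by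
    rw [mul_rpow ps ps, mul_assoc, ← rpow_add ps, sub_add_cancel, rpow_one, mul_rpow (y := ε ^ mth) ps ps, mul_rpow (x := 2 * π) ps ps, mul_rpow (x := ε ^ (-(1/2 - x' / (1 - y)))) ps ps,
      ← rpow_mul hε.le, ← rpow_mul hε.le, ← rpow_mul hv.le, show -(x' / (1 - y)) * (1 - y) = -x' by field_simp,
      show -(2 * (1 - y)) + x' = -(1/2 - x' / (1 - y)) * (1 - y) + -(3/2) * (1 - y) by field_simp; ring, rpow_add hε]
    ring
  rw [e, show 2 - δ = -δ + (2:ℕ) by push_cast; ring, rpow_add hR, rpow_natCast, show b + δ - 2 * (1 - y) + x' - 1 = (b + δ - 1) + (-(2 * (1 - y)) + x') by ring, rpow_add hε (b + δ - 1)]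
  calc _ ≤ (R ^ (-δ) * ε ^ (b + δ - 1) + R ^ (-δ) * ε ^ (b + δ - 1)) * (c * ((2 * π) ^ (1 - y) * π * R^2 * v ^ (-x') * ε ^ (-(2 * (1 - y)) + x'))) := by gcongr
    _ = _ := by ring

lemma K2' {ε v x' y : ℝ} (hε : 0 < ε) (hv : v ≠ 0) (hx' : 0 ≤ x') (hy : y < 1) (h2 : 2 * x' ≤ 1 - y) (x : V2) :
    ‖Kz (ε + v * IC) x‖ ≤ 2 * π * (ε ^ (-(1/2 - x' / (1 - y))) * |v| ^ (-(x' / (1 - y)))) * ε ^ mth := by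
  have h1y : 0 < 1 - y := by linarith
  have hz : (ε + v * IC : ℂ).re = ε := by simp
  have hi : (ε + v * IC : ℂ).im = v := by simp
  refine (K2 _ (by rw [hz]; exact hε) x).trans ?_
  rw [hz]
  gcongr
  have n1 : ε ≤ ‖(ε + v * IC : ℂ)‖ := by
    have := abs_re_le_norm (ε + v * IC : ℂ)
    rw [hz, abs_of_pos hε] at this; exact this
  have n2 : |v| ≤ ‖(ε + v * IC : ℂ)‖ := by
    have := abs_im_le_norm (ε + v * IC : ℂ)
    rwa [hi] at this
  have hv' := abs_pos.2 hv
  have h3 : x' / (1 - y) ≤ 1/2 := by rw [div_le_iff₀ h1y]; linarith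
  rw [show (-(1/2) : ℝ) = -(1/2 - x' / (1 - y)) + -(x' / (1 - y)) by ring, rpow_add (hε.trans_le n1)]
  exact mul_le_mul (rpow_le_rpow_of_nonpos hε n1 la) (rpow_le_rpow_of_nonpos hv' n2 (by have := div_nonneg hx' h1y.le; linarith)) ps ps

def omR (b δ R : ℝ) (ξ : V2) : ENN := ofReal (‖ξ‖ ^ b * min ((R * ‖ξ‖) ^ δ) ((R * ‖ξ‖) ^ (-δ)))

set_option maxHeartbeats 400000 in
lemma QR {θ a x x' y δ : ℝ} (hθ : 1/2 < θ) (hx' : 0 ≤ x') (hxx : x' ≤ x) (hx1 : x < 1) (hy0 : 0 < y) (hy1 : y < 1) (h2 : 2 * x' ≤ 1 - y) (hδ : 0 < δ)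
    (hδ1 : δ < 1 - a) (hδ2 : δ < 1 + a - 2 * y - 2 * x') : ∃ C : ENN, C ≠ ⊤ ∧ ∀ (u : SW) (w : RV → ℝ), Wok w → ∀ R, 0 < R →
    ∫⁻ p, ‖u p‖ₑ^2 * bI (fun p => ofReal (w p)) R p ≤ C * (ofReal R ^ (1 + a) * LtR (1 - x) (fun t => Nw w y t ^ (1 - y))) *
      ∫⁻ q : RV, ‖ftST u q.1 q.2‖ₑ^2 * (ofReal ((1 + |(|q.1| - ‖q.2‖)|) ^ (2 * θ)) * omR (1 + a - 2 * y - x') δ R q.2) := by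
  obtain ⟨C1, hC0, hC⟩ := K1
  obtain ⟨C3, hC30, hC3⟩ := K3
  obtain ⟨C2, hC2, HM⟩ := MAIN hθ hx' hxx hx1
  set b := 1 + a - 2 * y - x' with hb
  have g1 : 0 < Real.Gamma (b - δ) := Real.Gamma_pos_of_pos (by rw [hb]; linarith)
  have g2 : 0 < Real.Gamma (b + δ) := Real.Gamma_pos_of_pos (by rw [hb]; linarith)
  set c : ℝ := (Real.Gamma (b - δ))⁻¹ + (Real.Gamma (b + δ))⁻¹ with hc
  have hp : 0 < b - δ - x' := by rw [hb]; linarith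
  have hl : 0 < 1 - a - δ := by linarith
  set cA : ℝ := 2 * C1 ^ (1 - 2 * x') * C3 ^ (2 * x') * π ^ y with hcA
  set cB : ℝ := 2 * C1 ^ (1 - (1 - y)) * (2 * π) ^ (1 - y) * π with hcB
  set L : ℝ := cA * (b - δ - x')⁻¹ + cB * (1 - a - δ)⁻¹ with hL
  refine ⟨C2 * ofReal L * ofReal c, by finiteness, fun u w hw R hR => ?_⟩
  obtain ⟨Wk, Wf, S⟩ := SLR hC0 hC hy0 hy1 u hw hR
  have wm := hw.m
  set W : RV → ℝ := fun p => (bI (fun p => ofReal (w p)) R p).toReal with hW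
  have Nm : Measurable fun t => Nw w y t ^ (1 - y) := by
    have : Measurable fun p : RV => ofReal (w p) ^ (1 - y)⁻¹ := by fun_prop
    exact this.lintegral_prod_right'.pow_const _
  have om : Measurable (omR b δ R) := by unfold omR; fun_prop
  have M := HM u W Wk (fun ε => ofReal (R ^ δ * ε ^ (b - δ - 1) + R ^ (-δ) * ε ^ (b + δ - 1))) (fun ξ => ofReal c * omR b δ R ξ) (fun t => Nw w y t ^ (1 - y)) (ofReal (L * R ^ (1 + a)))
    fp fp Nm ?_ ?_
  · have um := ftST_meas u.continuous.measurable
    calc _ = ∫⁻ p, ‖u p‖ₑ^2 * ofReal (W p) := by simp only [hW, ENNReal.ofReal_toReal (Wf _)]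
      _ ≤ _ := M
      _ = _ := by
        rw [ofReal_mul' ps, ← ofReal_rpow_of_pos hR]
        have : ∀ q : RV, ‖ftST u q.1 q.2‖ₑ^2 * (ofReal ((1 + |(|q.1| - ‖q.2‖)|) ^ (2 * θ)) * (ofReal c * omR b δ R q.2)) = ofReal c * (‖ftST u q.1 q.2‖ₑ^2 * (ofReal ((1 + |(|q.1| - ‖q.2‖)|) ^ (2 * θ)) * omR b δ R q.2)) := fun q => by ring
        simp only [this]
        rw [lcmu _ fp]
        ring
  · intro ξ hξ
    have h0 : 0 < ‖ξ‖ := norm_pos_iff.2 hξ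
    have e : ∫⁻ ε in Iop, ofReal (R ^ δ * ε ^ (b - δ - 1) + R ^ (-δ) * ε ^ (b + δ - 1)) * ofReal (exp (-ε * ‖ξ‖)) =
        ofReal (R ^ δ * (‖ξ‖ ^ (-(b - δ)) * Real.Gamma (b - δ)) + R ^ (-δ) * (‖ξ‖ ^ (-(b + δ)) * Real.Gamma (b + δ))) := by
      rw [ofReal_add ps ps, ofReal_mul (p := R ^ δ) ps, ofReal_mul (p := R ^ (-δ)) ps, ← gam (by rw [hb]; linarith) h0, ← gam (by rw [hb]; linarith) h0,
        ← lcmu _ fp, ← lcmu _ fp, ← lintegral_add_left fp]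
      refine setLIntegral_congr_fun measurableSet_Ioi fun ε hε => ?_
      have hε : 0 < ε := hε
      beta_reduce
      rw [ofReal_add ps ps, ofReal_mul ps, ofReal_mul ps]
      ring
    rw [e, omR, ← ofReal_mul ps, ← ofReal_mul ps, ← ofReal_one]
    apply ofReal_le_ofReal
    have r0 : 0 < R * ‖ξ‖ := by positivity
    have k1 : R ^ δ * (‖ξ‖ ^ (-(b - δ)) * Real.Gamma (b - δ)) = (R * ‖ξ‖) ^ δ * ‖ξ‖ ^ (-b) * Real.Gamma (b - δ) := by
      rw [mul_rpow hR.le h0.le, show -(b - δ) = δ + -b by ring, rpow_add h0]; ring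
    have k2 : R ^ (-δ) * (‖ξ‖ ^ (-(b + δ)) * Real.Gamma (b + δ)) = (R * ‖ξ‖) ^ (-δ) * ‖ξ‖ ^ (-b) * Real.Gamma (b + δ) := by
      rw [mul_rpow hR.le h0.le, show -(b + δ) = -δ + -b by ring, rpow_add h0]; ring
    have k3 : (R * ‖ξ‖) ^ δ * (R * ‖ξ‖) ^ (-δ) = 1 := by rw [← rpow_add r0, add_neg_cancel, rpow_zero]
    have k4 : ‖ξ‖ ^ b * ‖ξ‖ ^ (-b) = 1 := by rw [← rpow_add h0, add_neg_cancel, rpow_zero]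
    rw [k1, k2]
    rcases min_choice ((R * ‖ξ‖) ^ δ) ((R * ‖ξ‖) ^ (-δ)) with h | h
    · rw [h]
      calc (1:ℝ) ≤ c * Real.Gamma (b + δ) := by rw [hc, add_mul, inv_mul_cancel₀ g2.ne']; exact le_add_of_nonneg_left ps
        _ = c * (‖ξ‖ ^ b * (R * ‖ξ‖) ^ δ) * (0 + (R * ‖ξ‖) ^ (-δ) * ‖ξ‖ ^ (-b) * Real.Gamma (b + δ)) := by linear_combination (-c * Real.Gamma (b + δ)) * (‖ξ‖ ^ b * ‖ξ‖ ^ (-b) * k3 + k4)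
        _ ≤ _ := by gcongr; positivity
    · rw [h]
      calc (1:ℝ) ≤ c * Real.Gamma (b - δ) := by rw [hc, add_mul, inv_mul_cancel₀ g1.ne']; exact le_add_of_nonneg_right ps
        _ = c * (‖ξ‖ ^ b * (R * ‖ξ‖) ^ (-δ)) * ((R * ‖ξ‖) ^ δ * ‖ξ‖ ^ (-b) * Real.Gamma (b - δ) + 0) := by linear_combination (-c * Real.Gamma (b - δ)) * (‖ξ‖ ^ b * ‖ξ‖ ^ (-b) * k3 + k4)
        _ ≤ _ := by gcongr; positivity
  · intro t t' v hv hvt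
    have hv' := abs_pos.2 hv
    set G := ((Nw w y t ^ (1 - y)) ^ hfr * gW u W t) * ((Nw w y t' ^ (1 - y)) ^ hfr * gW u W t') with hG
    refine (TP hp hl (ofReal (cA * R ^ (δ + 2 * x' + 2 * y) * |v| ^ (-x')) * G) (ofReal (cB * R ^ (2 - δ) * |v| ^ (-x')) * G) (R := R) _ ?_ ?_).trans (le_of_eq ?_)
    · intro ε hε hεR
      have hz : 0 < (ε + v * IC : ℂ).re := by simpa using hε
      have hi : (ε + v * IC : ℂ).im = v := by simp
      have hr : (ε + v * IC : ℂ).re = ε := by simp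
      have := S (ε + v * IC) hz (C3 * (R * (ε * |v|) ^ (-(1/2):ℝ))) ps (fun y0 => by
        have := hC3 (ε + v * IC) y0 R hz (by rw [hi]; exact hv) hR
        rwa [hi, hr] at this) (2 * x') la h2 t t'
      refine (mul_le_mul_right this _).trans ?_
      rw [← mul_assoc, ← ofReal_mul ps, mul_right_comm _ G, ofReal_rpow_of_pos hε, ← ofReal_mul ps]
      exact mul_le_mul_left (ofReal_le_ofReal (RA hε hεR hv' hδ ps hC30)) _
    · intro ε hε hεR
      have hz : 0 < (ε + v * IC : ℂ).re := by simpa using hε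
      have := S (ε + v * IC) hz (2 * π * (ε ^ (-(1/2 - x' / (1 - y))) * |v| ^ (-(x' / (1 - y)))) * ε ^ mth * (π * R^2)) ps (fun y0 => by
        refine (setLIntegral_mono' (g := fun _ => ofReal (2 * π * (ε ^ (-(1/2 - x' / (1 - y))) * |v| ^ (-(x' / (1 - y)))) * ε ^ mth)) isOpen_ball.measurableSet fun x _ => ?_).trans (le_of_eq ?_)
        · rw [← onee]; exact ofReal_le_ofReal (K2' hε hv hx' hy1 h2 x)
        · rw [setLIntegral_const, EuclideanSpace.volume_ball_fin_two, ofReal_mul (q := π * R^2) ps, ofReal_mul pi_pos.le, ENNReal.ofReal_pow hR.le, mul_comm (ofReal π)]) (1 - y) la le_rfl t t'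
      refine (mul_le_mul_right this _).trans ?_
      rw [← mul_assoc, ← ofReal_mul ps, mul_right_comm _ G, ofReal_rpow_of_pos hε, ← ofReal_mul ps]
      refine mul_le_mul_left (ofReal_le_ofReal ?_) _
      have := RB (b := b) (c := C1 ^ (1 - (1 - y))) (x' := x') hR hεR hv' hδ ps hy1
      rwa [show b + δ - 2 * (1 - y) + x' = -(1 - a - δ) by rw [hb]; ring] at this
    · have cA0 : 0 ≤ cA := by positivity
      have cB0 : 0 ≤ cB := by positivity
      rw [ofReal_rpow_of_pos hR, ofReal_rpow_of_pos hR, ofReal_rpow_of_pos hv', mul_right_comm, mul_right_comm _ G, ← add_mul]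
      congr 1
      rw [← ofReal_mul ps, ← ofReal_mul ps, ← ofReal_mul ps, ← ofReal_mul ps, ← ofReal_add ps ps, ← ofReal_mul ps]
      congr 1
      have e1 : R ^ (δ + 2 * x' + 2 * y) * R ^ (b - δ - x') = R ^ (1 + a) := by rw [← rpow_add hR]; congr 1; rw [hb]; ring
      have e2 : R ^ (2 - δ) * R ^ (-(1 - a - δ)) = R ^ (1 + a) := by rw [← rpow_add hR]; congr 1; ring
      rw [hL]; linear_combination (cA * |v| ^ (-x') * (b - δ - x')⁻¹) * e1 + (cB * |v| ^ (-x') * (1 - a - δ)⁻¹) * e2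

lemma bI_meas2 {g : RV → ENN} (hg : Measurable g) : Measurable fun z : RV × ℝ => bI g z.2 z.1 := by
  have h : Measurable fun z : (RV × ℝ) × V2 => g (z.1.1.1, z.2) := by fun_prop
  have : Measurable fun z : (RV × ℝ) × V2 => (if dist z.2 z.1.1.2 < z.1.2 then (1:ENN) else 0) * g (z.1.1.1, z.2) :=
    Measurable.mul (mitx) h
  exact this.lintegral_prod_right'

lemma bI_meas3 {g : RV → ENN} (hg : Measurable g) (p : RV) : Measurable fun R => bI g R p := by
  have h : Measurable fun z : RV => g (p.1, z.2) := by fun_prop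
  have : Measurable fun z : RV => (if dist z.2 p.2 < z.1 then (1:ENN) else 0) * g (p.1, z.2) :=
    Measurable.mul (mitx) h
  exact this.lintegral_prod_right'

lemma Jk {a : ℝ} (ha : 0 ≤ a) {w : RV → ENN} (hw : Measurable w) (p : RV) :
    ∫⁻ z, w (p.1, z) * edist p.2 z ^ (-(1 + a)) = ofReal (1 + a) * ∫⁻ R in Iop, ofReal R ^ (-(1 + a) - 1) * bI w R p := by
  have hwm : Measurable fun z => w (p.1, z) := by fun_prop
  have m0 : Measurable fun q : RV => ofReal q.1 ^ (-(1 + a) - 1) * ((if dist q.2 p.2 < q.1 then (1:ENN) else 0) * w (p.1, q.2)) :=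
    Measurable.mul fp (Measurable.mul (mitx) fp)
  have e1 : ∀ R : ℝ, ofReal R ^ (-(1 + a) - 1) * bI w R p = ∫⁻ z, ofReal R ^ (-(1 + a) - 1) * ((if dist z p.2 < R then (1:ENN) else 0) * w (p.1, z)) := fun R => by
    have hk : Measurable fun z => (if dist z p.2 < R then (1:ENN) else 0) * w (p.1, z) := Measurable.mul (mitx) hwm
    rw [bI, lcmu _ hk]
  simp only [e1]
  rw [lintegral_lintegral_swap m0.aemeasurable, ← lcmu _ (by exact m0.lintegral_prod_left')]
  refine ltgc fun z => ?_
  have m1 : Measurable fun R : ℝ => ofReal R ^ (-(1 + a) - 1) * (if edist p.2 z < ofReal R then 1 else 0) :=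
    Measurable.mul fp (mitx)
  calc _ = w (p.1, z) * (ofReal (1 + a) * (edist p.2 z ^ (-(1 + a)) * ofReal (1 + a)⁻¹)) := by
        rw [mul_comm (edist p.2 z ^ _), ← mul_assoc (ofReal (1 + a)), ← ofReal_mul ps, mul_inv_cancel₀ ps, ofReal_one, one_mul]
    _ = _ := by
        rw [← pw_gt (1 + a) ps _ (edist_ne_top _ _), mul_left_comm, ← lcmu _ m1]
        congr 1
        refine setLIntegral_congr_fun measurableSet_Ioi fun R hR => ?_
        have : (edist p.2 z < ofReal R) = (dist z p.2 < R) := by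
          rw [edist_dist, ENNReal.ofReal_lt_ofReal_iff hR, dist_comm]
        simp only [this]; ring

lemma omI {b δ s : ℝ} (hδ : 0 < δ) (hb : 0 < b) (hbs : b ≤ 2 * s) (ξ : V2) :
    ∫⁻ R in Iop, ofReal R ^ (-1:ℝ) * omR b δ R ξ ≤ ofReal (2 * δ⁻¹) * ofReal ((1 + ‖ξ‖^2) ^ s) := by
  rcases eq_or_ne ξ 0 with rfl | hξ
  · simp [omR, zero_rpow hb.ne']
  have h0 : 0 < ‖ξ‖ := norm_pos_iff.2 hξ
  have k : ‖ξ‖ ^ b ≤ (1 + ‖ξ‖^2) ^ s := by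
    have h1 : ‖ξ‖ ^ b = (‖ξ‖^2) ^ (b/2) := by rw [← Real.rpow_two, ← rpow_mul h0.le]; congr 1; ring
    rw [h1]
    calc _ ≤ (1 + ‖ξ‖^2) ^ (b/2) := by gcongr; linarith
      _ ≤ _ := rpow_le_rpow_of_exponent_le (by nlinarith) la
  have hi : (0:ℝ) < ‖ξ‖⁻¹ := by positivity
  refine (TP hδ hδ (R := ‖ξ‖⁻¹) (ofReal (‖ξ‖ ^ b * ‖ξ‖ ^ δ)) (ofReal (‖ξ‖ ^ b * ‖ξ‖ ^ (-δ))) _ ?_ ?_).trans ?_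
  · intro R hR _
    rw [omR, ofReal_rpow_of_pos hR, ofReal_rpow_of_pos hR, ← ofReal_mul ps, ← ofReal_mul ps]
    apply ofReal_le_ofReal
    calc _ ≤ R ^ (-1:ℝ) * (‖ξ‖ ^ b * (R * ‖ξ‖) ^ δ) := by gcongr; exact min_le_left _ _
      _ = _ := by rw [mul_rpow hR.le h0.le, sub_eq_add_neg, rpow_add hR]; ring
  · intro R hR _
    rw [omR, ofReal_rpow_of_pos hR, ofReal_rpow_of_pos hR, ← ofReal_mul ps, ← ofReal_mul ps]
    apply ofReal_le_ofReal
    calc _ ≤ R ^ (-1:ℝ) * (‖ξ‖ ^ b * (R * ‖ξ‖) ^ (-δ)) := by gcongr; exact min_le_right _ _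
      _ = _ := by rw [mul_rpow hR.le h0.le, sub_eq_add_neg, rpow_add hR]; ring
  · rw [ofReal_rpow_of_pos hi, ofReal_rpow_of_pos hi, ← ofReal_mul ps, ← ofReal_mul ps, ← ofReal_mul ps, ← ofReal_mul ps, ← ofReal_add ps ps, ← ofReal_mul ps]
    apply ofReal_le_ofReal
    rw [inv_rpow h0.le, inv_rpow h0.le, rpow_neg h0.le δ]
    have : 0 < ‖ξ‖ ^ δ := by positivity
    calc _ = 2 * δ⁻¹ * ‖ξ‖ ^ b := by field_simp; ring
      _ ≤ _ := by gcongr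

set_option maxHeartbeats 400000 in
lemma QF {s θ a x x' y : ℝ} (hθ : 1/2 < θ) (ha : 0 ≤ a) (ha1 : a < 1) (hx' : 0 ≤ x') (hxx : x' ≤ x) (hx1 : x < 1) (hy0 : 0 < y) (hy1 : y < 1) (h2 : 2 * x' ≤ 1 - y)
    (h3 : 2 * x' < 1 + a - 2 * y) (hs : 1 + a - 2 * y - x' ≤ 2 * s) : ∃ C : ENN, C ≠ ⊤ ∧ ∀ (u : SW) (w : RV → ℝ), Wok w →
    ∫⁻ p, ‖u p‖ₑ^2 * (∫⁻ z, ofReal (w (p.1, z)) * edist p.2 z ^ (-(1 + a))) ≤ C * LtR (1 - x) (fun t => Nw w y t ^ (1 - y)) * HN s θ u ^ 2 := by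
  obtain ⟨δ, hδ, hδ'⟩ : ∃ δ : ℝ, 0 < δ ∧ δ < min (1 - a) (1 + a - 2 * y - 2 * x') := exists_between (lt_min la la)
  rw [lt_min_iff] at hδ'
  obtain ⟨C, hC, H⟩ := QR hθ hx' hxx hx1 hy0 hy1 h2 hδ hδ'.1 hδ'.2
  refine ⟨ofReal (1 + a) * (C * ofReal (2 * δ⁻¹)), by finiteness, fun u w hw => ?_⟩
  have wm := hw.m
  set N := LtR (1 - x) (fun t => Nw w y t ^ (1 - y))
  set b := 1 + a - 2 * y - x' with hb
  have hg : Measurable fun p => ofReal (w p) := by fun_prop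
  have mB := bI_meas2 hg
  have mm : Measurable fun z : RV × ℝ => ‖u z.1‖ₑ^2 * (ofReal z.2 ^ (-(1 + a) - 1) * bI (fun p => ofReal (w p)) z.2 z.1) := by
    have := u.continuous.measurable
    fun_prop
  have um := ftST_meas u.continuous.measurable
  have mo : Measurable fun z : RV × ℝ => ‖ftST u z.1.1 z.1.2‖ₑ^2 * (ofReal ((1 + |(|z.1.1| - ‖z.1.2‖)|) ^ (2 * θ)) * (ofReal z.2 ^ (-1:ℝ) * omR b δ z.2 z.1.2)) := by
    unfold omR
    have h : Measurable fun z : RV × ℝ => ftST u z.1.1 z.1.2 := Measurable.comp (g := fun q : RV => ftST u q.1 q.2) um measurable_fst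
    fun_prop
  calc _ = ∫⁻ p, ofReal (1 + a) * ∫⁻ R in Iop, ‖u p‖ₑ^2 * (ofReal R ^ (-(1 + a) - 1) * bI (fun p => ofReal (w p)) R p) := by
        refine ltgc fun p => ?_
        have h5 : Measurable fun R => bI (fun p => ofReal (w p)) R p := bI_meas3 hg p
        rw [Jk ha hg p, lcmu _ fp, mul_left_comm]
    _ = ofReal (1 + a) * ∫⁻ R in Iop, ∫⁻ p, ‖u p‖ₑ^2 * (ofReal R ^ (-(1 + a) - 1) * bI (fun p => ofReal (w p)) R p) := by
        have h6 : Measurable fun p => ∫⁻ R in Iop, ‖u p‖ₑ^2 * (ofReal R ^ (-(1 + a) - 1) * bI (fun p => ofReal (w p)) R p) := mm.lintegral_prod_right'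
        rw [lcmu _ h6]
        congr 1
        exact lintegral_lintegral_swap mm.aemeasurable
    _ ≤ ofReal (1 + a) * ∫⁻ R in Iop, (C * N) * ∫⁻ q : RV, ‖ftST u q.1 q.2‖ₑ^2 * (ofReal ((1 + |(|q.1| - ‖q.2‖)|) ^ (2 * θ)) * (ofReal R ^ (-1:ℝ) * omR b δ R q.2)) := by
        refine mul_le_mul_right (setLIntegral_mono' measurableSet_Ioi fun R hR => ?_) _
        have hR : 0 < R := hR
        have m3 : Measurable fun p => ‖u p‖ₑ^2 * bI (fun p => ofReal (w p)) R p := by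
          have := u.continuous.measurable
          have := bI_meas hg R
          fun_prop
        have m4 : Measurable fun q : RV => ‖ftST u q.1 q.2‖ₑ^2 * (ofReal ((1 + |(|q.1| - ‖q.2‖)|) ^ (2 * θ)) * omR b δ R q.2) := by unfold omR; fun_prop
        have e2 : ofReal R ^ (-(1 + a) - 1) * ofReal R ^ (1 + a) = ofReal R ^ (-1:ℝ) := by
          rw [← ENNReal.rpow_add _ _ (by simpa using hR) (by simp)]; congr 1; ring
        calc _ = ofReal R ^ (-(1 + a) - 1) * ∫⁻ p, ‖u p‖ₑ^2 * bI (fun p => ofReal (w p)) R p := by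
              rw [← lcmu _ m3]; exact ltgc fun p => by ring
          _ ≤ _ := mul_le_mul_right (H u w hw R hR) _
          _ = (C * N) * (ofReal R ^ (-1:ℝ) * ∫⁻ q : RV, ‖ftST u q.1 q.2‖ₑ^2 * (ofReal ((1 + |(|q.1| - ‖q.2‖)|) ^ (2 * θ)) * omR b δ R q.2)) := by rw [← e2]; ring
          _ = _ := by
              rw [← lcmu _ m4]; congr 1; exact ltgc fun p => by ring
    _ = ofReal (1 + a) * ((C * N) * ∫⁻ q : RV, ∫⁻ R in Iop, ‖ftST u q.1 q.2‖ₑ^2 * (ofReal ((1 + |(|q.1| - ‖q.2‖)|) ^ (2 * θ)) * (ofReal R ^ (-1:ℝ) * omR b δ R q.2))) := by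
        have h6 : Measurable fun R => ∫⁻ q : RV, ‖ftST u q.1 q.2‖ₑ^2 * (ofReal ((1 + |(|q.1| - ‖q.2‖)|) ^ (2 * θ)) * (ofReal R ^ (-1:ℝ) * omR b δ R q.2)) := mo.lintegral_prod_left'
        rw [lcmu _ h6]
        congr 2
        exact (lintegral_lintegral_swap mo.aemeasurable).symm
    _ = ofReal (1 + a) * ((C * N) * ∫⁻ q : RV, ‖ftST u q.1 q.2‖ₑ^2 * (ofReal ((1 + |(|q.1| - ‖q.2‖)|) ^ (2 * θ)) * ∫⁻ R in Iop, (ofReal R ^ (-1:ℝ) * omR b δ R q.2))) := by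
        congr 2
        refine ltgc fun q => ?_
        rw [← lcmu _ (by unfold omR; fun_prop), ← lcmu _ (by unfold omR; fun_prop)]
    _ ≤ ofReal (1 + a) * ((C * N) * (ofReal (2 * δ⁻¹) * HN s θ u ^ 2)) := by
        gcongr
        exact om_HN u (fun ξ => omI hδ la hs ξ)
    _ = _ := by ring

lemma EXT {s θ x y : ℝ} (hx : 0 ≤ 1 - x) (hy : y < 1) {C : ENN} (J : (ℝ × V2 → ENN) → ℝ × V2 → ENN) (hJm : ∀ w, Measurable w → Measurable (J w))
    (hJ : ∀ w : ℕ → ℝ × V2 → ENN, (∀ n, Measurable (w n)) → Monotone w → J (⨆ n, w n) = ⨆ n, J (w n))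
    (H : ∀ (u : SW) (w : RV → ℝ), Wok w → ∫⁻ p, ‖u p‖ₑ^2 * J (fun p => ofReal (w p)) p ≤ C * LtR (1 - x) (fun t => Nw w y t ^ (1 - y)) * HN s θ u ^ 2)
    (u v : SW) (w : RV → ENN) (hw : Measurable w) :
    ∫⁻ p, ‖u p‖ₑ * ‖v p‖ₑ * J w p ≤ C * LtR (1 - x) (fun t => (∫⁻ z, w (t, z) ^ (1 - y)⁻¹) ^ (1 - y)) * (HN s θ u * HN s θ v) := by
  set N := LtR (1 - x) (fun t => (∫⁻ z, w (t, z) ^ (1 - y)⁻¹) ^ (1 - y)) with hN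
  have h1y : 0 < 1 - y := by linarith
  set W : ℕ → ℝ × V2 → ENN := fun n p => if |p.1| ≤ n ∧ ‖p.2‖ ≤ n then min (w p) n else 0 with hW
  have Wm : ∀ n, Measurable (W n) := fun n => by
    have h1 : MeasurableSet {p : RV | |p.1| ≤ n} := measurableSet_le fp fp
    have h2 : MeasurableSet {p : RV | ‖p.2‖ ≤ n} := measurableSet_le fp fp
    exact Measurable.ite (h1.inter h2) (hw.min measurable_const) measurable_const
  have Wmon : Monotone W := fun n m hnm p => by
    have : (n:ℝ) ≤ m := by exact_mod_cast hnm
    have h' : (n:ENN) ≤ m := by exact_mod_cast hnm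
    simp only [hW]
    by_cases h : |p.1| ≤ n ∧ ‖p.2‖ ≤ n
    · rw [if_pos h, if_pos ⟨h.1.trans this, h.2.trans this⟩]; exact min_le_min_left _ h'
    · rw [if_neg h]; exact bot_le
  have Wle : ∀ n p, W n p ≤ w p := fun n p => by
    simp only [hW]; split_ifs
    · exact min_le_left _ _
    · exact bot_le
  have Wtop : ∀ n p, W n p ≤ n := fun n p => by
    simp only [hW]; split_ifs
    · exact min_le_right _ _
    · exact bot_le
  have Wsup : ⨆ n, W n = w := by
    funext p
    rw [iSup_apply]
    refine le_antisymm (iSup_le fun n => Wle n p) ?_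
    obtain ⟨k, hk⟩ := exists_nat_ge (max |p.1| ‖p.2‖)
    refine le_of_forall_lt fun c hc => ?_
    obtain ⟨m, hm⟩ := ENNReal.exists_nat_gt hc.ne_top
    refine lt_iSup_iff.2 ⟨max k m, ?_⟩
    have hk' : (k:ℝ) ≤ (max k m : ℕ) := by exact_mod_cast le_max_left _ _
    have hm' : (m:ENN) ≤ (max k m : ℕ) := by exact_mod_cast le_max_right _ _
    simp only [hW]
    rw [if_pos ⟨(le_max_left _ _).trans (hk.trans hk'), (le_max_right _ _).trans (hk.trans hk')⟩]
    exact lt_min hc (hm.trans_le hm')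
  have Q : ∀ u : SW, ∫⁻ p, ‖u p‖ₑ^2 * J w p ≤ C * N * HN s θ u ^ 2 := by
    intro u
    have um := u.continuous.measurable
    rw [← Wsup, hJ W Wm Wmon]
    have : ∀ p, ‖u p‖ₑ^2 * (⨆ n, J (W n)) p = ⨆ n, ‖u p‖ₑ^2 * J (W n) p := fun p => by rw [iSup_apply, ENNReal.mul_iSup]
    simp only [this]
    have Jmon : Monotone fun n => J (W n) := fun n m hnm => by
      have h := hJ (fun k => if k = 0 then W n else W m) (fun k => by split_ifs; exacts [Wm n, Wm m]) (fun i j hij => by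
        dsimp only
        split_ifs
        · exact le_rfl
        · exact Wmon hnm
        · omega
        · exact le_rfl)
      have e : ⨆ k : ℕ, (if k = 0 then W n else W m) = W m := le_antisymm (iSup_le fun k => by split_ifs; exacts [Wmon hnm, le_rfl]) (le_iSup_of_le 1 (by simp))
      rw [e] at h
      dsimp only
      rw [h]
      exact le_iSup_of_le 0 (by simp)
    rw [lintegral_iSup (f := fun n p => ‖u p‖ₑ^2 * J (W n) p) (fun n => by have := hJm _ (Wm n); fun_prop) (fun n m hnm p => mul_le_mul_right (Jmon hnm p) _)]
    refine iSup_le fun n => ?_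
    have fin : ∀ p, W n p ≠ ⊤ := fun p => ne_top_of_le_ne_top (by simp) (Wtop n p)
    have e3 : (fun p => ofReal ((W n p).toReal)) = W n := funext fun p => ENNReal.ofReal_toReal (fin p)
    have h := H u (fun p => (W n p).toReal) ⟨(Wm n).ennreal_toReal, fun p => ENNReal.toReal_nonneg, n, fun p => ?_, fun p hp => ?_⟩
    · rw [e3] at h
      refine h.trans ?_
      gcongr
      refine LtR_mono hx fun t => ?_
      unfold Nw
      gcongr with z
      exact (ENNReal.ofReal_toReal (fin (t, z))).le.trans (Wle n _)
    · simpa using ENNReal.toReal_mono (by simp) (Wtop n p)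
    · have : ¬ (|p.1| ≤ n ∧ ‖p.2‖ ≤ n) := by rintro ⟨h1, h2⟩; rcases hp with h | h <;> linarith
      simp only [hW, if_neg this, ENNReal.toReal_zero]
  have um := u.continuous.measurable
  have vm := v.continuous.measurable
  have Jm := hJm w hw
  calc _ = ∫⁻ p, (‖u p‖ₑ * J w p ^ hfr) * (‖v p‖ₑ * J w p ^ hfr) := ltgc fun p => by
        rw [mul_mul_mul_comm, ← sq, sq_half]
    _ ≤ _ := CS2 volume fp fp
    _ = (∫⁻ p, ‖u p‖ₑ^2 * J w p) ^ hfr * (∫⁻ p, ‖v p‖ₑ^2 * J w p) ^ hfr := by simp only [mul_pow, sq_half]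
    _ ≤ (C * N * HN s θ u ^ 2) ^ hfr * (C * N * HN s θ v ^ 2) ^ hfr := by gcongr <;> exact Q _
    _ = _ := by
        rw [Emn _ _ nu, Emn (C * N) _ nu, ← ENNReal.rpow_two, ← ENNReal.rpow_two, ← Erm, ← Erm]
        rw [mul_mul_mul_comm, ← sq, sq_half]; norm_num

lemma KC {ε v : ℝ} (hε : 0 < ε) (hv : |v| ≤ ε) (x : V2) : ‖Kz (ε + v * IC) x‖ ≤ 60 * (ε * (ε^2 + ‖x‖^2) ^ mth) := by
  have hr : (ε + v * IC : ℂ).re = ε := by simp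
  have hi : (ε + v * IC : ℂ).im = v := by simp
  have h := Kz_norm _ (by rw [hr]; exact hε) x
  have hA := nsq (ε + v * IC) ‖x‖
  have hB := nsq' (ε + v * IC) ‖x‖
  have hz := nsq (ε + v * IC) 0
  simp only [hr, hi, ofReal_zero, mul_zero, add_zero] at hA hB hz
  have hv2 : v^2 ≤ ε^2 := sq_le_sq' (abs_le.1 hv).1 (abs_le.1 hv).2
  set A := ‖(ε + v * IC : ℂ) + IC * ‖x‖‖
  set B := ‖(ε + v * IC : ℂ) - IC * ‖x‖‖
  set q := ε^2 + ‖x‖^2 with hq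
  have q0 : 0 < q := by positivity
  have hA' : q / 3 ≤ A^2 := by rw [hA]; nlinarith [sq_nonneg (2 * v + ‖x‖)]
  have hB' : q / 3 ≤ B^2 := by rw [hB]; nlinarith [sq_nonneg (2 * v - ‖x‖)]
  have hAB : q / 3 ≤ A * B := by
    refine abs_le_of_sq_le_sq' ?_ ps |>.2
    rw [mul_pow, sq (q/3)]; gcongr
  have e : (q ^ mth)^2 * q^3 = 1 := by
    rw [← rpow_natCast, ← rpow_natCast, ← rpow_mul q0.le, ← rpow_add q0]; norm_num
  refine abs_le_of_sq_le_sq' ?_ ps |>.2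
  have h3 : ‖Kz (ε + v * IC) x‖^2 * (q/3)^3 ≤ 4 * π^2 * (2 * ε^2) := by
    calc _ ≤ ‖Kz (ε + v * IC) x‖^2 * (A * B)^3 := by gcongr
      _ = _ := h
      _ ≤ _ := by gcongr; rw [hz]; linarith
  have hpi : π^2 ≤ 3.15^2 := by have := Real.pi_lt_d2; gcongr
  have h4 : ‖Kz (ε + v * IC) x‖^2 * q^3 ≤ 3600 * ε^2 := by nlinarith [sq_nonneg ε, mul_le_mul_of_nonneg_right hpi (sq_nonneg ε)]
  calc _ = ‖Kz (ε + v * IC) x‖^2 * q^3 * (q ^ mth)^2 := by rw [mul_assoc, mul_comm (q^3), e, mul_one]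
    _ ≤ 3600 * ε^2 * (q ^ mth)^2 := by gcongr
    _ = _ := by ring

lemma kI {y : ℝ} (hy0 : 0 < y) (hy1 : y < 1) (x x' : V2) : ∫⁻ ε in Iop, ofReal (ε ^ (2 * (1 - y) - 1)) * ofReal (60 * (ε * (ε^2 + ‖x - x'‖^2) ^ mth)) ≤
    ofReal (60 * ((3 - 2 * y)⁻¹ + (2 * y)⁻¹)) * edist x x' ^ (-(2 * y)) := by
  have h3 : 0 < 3 - 2 * y := by linarith
  rcases eq_or_ne x x' with rfl | hx
  · rw [edist_self, zero_rpow_of_neg la, mul_top ps]; exact le_top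
  have r0 : 0 < ‖x - x'‖ := norm_pos_iff.2 (sub_ne_zero.2 hx)
  rw [edist_dist, dist_eq_norm]
  set r := ‖x - x'‖
  have e0 : ∀ s : ℝ, 0 < s → (s^2) ^ mth = s ^ (-3:ℝ) := fun s hs => by rw [← Real.rpow_two, ← rpow_mul hs.le]; norm_num
  refine (TP h3 (by linarith : 0 < 2 * y) (R := r) (ofReal (60 * r ^ (-3:ℝ))) (ofReal 60) _ ?_ ?_).trans (le_of_eq ?_)
  · intro ε hε _
    rw [ofReal_rpow_of_pos hε, ← ofReal_mul ps, ← ofReal_mul ps]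
    apply ofReal_le_ofReal
    rw [show 3 - 2 * y - 1 = (2 * (1 - y) - 1) + 1 by ring, rpow_add hε, rpow_one, ← e0 r r0]
    have : (ε^2 + r^2) ^ mth ≤ (r^2) ^ mth := rpow_le_rpow_of_nonpos ps (by nlinarith) nu
    calc _ ≤ ε ^ (2 * (1 - y) - 1) * (60 * (ε * (r^2) ^ mth)) := by gcongr
      _ = _ := by ring
  · intro ε hε _
    rw [ofReal_rpow_of_pos hε, ← ofReal_mul ps, ← ofReal_mul ps]
    apply ofReal_le_ofReal
    have : (ε^2 + r^2) ^ mth ≤ (ε^2) ^ mth := rpow_le_rpow_of_nonpos ps (by nlinarith) nu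
    calc _ ≤ ε ^ (2 * (1 - y) - 1) * (60 * (ε * (ε^2) ^ mth)) := by gcongr
      _ = _ := by
        rw [e0 ε hε, show -(2 * y) - 1 = (2 * (1 - y) - 1) + 1 + -3 by ring, rpow_add hε, rpow_add hε, rpow_one]; ring
  · rw [ofReal_rpow_of_pos r0, ofReal_rpow_of_pos r0, ← ofReal_mul ps, ← ofReal_mul ps, ← ofReal_mul ps, ← ofReal_mul ps, ← ofReal_add ps ps, ← ofReal_mul ps]
    rw [show -(2 * y) = -3 + (3 - 2 * y) by ring, rpow_add r0]
    congr 1; ring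

lemma LG {y : ℝ} (hy0 : 0 < y) (hy1 : y < 1) (v : ℝ) {H1 H2 : V2 → ℂ} (h1 : Nice H1) (h2 : Nice H2) :
    ∫⁻ ε in Iop, (if |v| ≤ ε then ofReal (ε ^ (2 * (1 - y) - 1)) * ‖Bz (ε + v * IC) H1 H2‖ₑ else 0) ≤
      ofReal (60 * ((3 - 2 * y)⁻¹ + (2 * y)⁻¹)) * ∫⁻ x, ‖H1 x‖ₑ * ∫⁻ x', ‖H2 x'‖ₑ * edist x x' ^ (-(2 * y)) := by
  have m1 := h1.m
  have m2 := h2.m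
  set k : ℝ → V2 → ENN := fun ε x => ofReal (ε ^ (2 * (1 - y) - 1)) * ofReal (60 * (ε * (ε^2 + ‖x‖^2) ^ mth)) with hk
  have mk : Measurable fun q : ℝ × (V2 × V2) => k q.1 (q.2.1 - q.2.2) * (‖H1 q.2.1‖ₑ * ‖H2 q.2.2‖ₑ) := by simp only [hk]; fun_prop
  calc _ ≤ ∫⁻ ε in Iop, ∫⁻ p : V2 × V2, k ε (p.1 - p.2) * (‖H1 p.1‖ₑ * ‖H2 p.2‖ₑ) := by
        refine setLIntegral_mono' measurableSet_Ioi fun ε hε => ?_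
        have hε : 0 < ε := hε
        split_ifs with hv
        · have m5 : Measurable fun p : V2 × V2 => ofReal (60 * (ε * (ε^2 + ‖p.1 - p.2‖^2) ^ mth)) * (‖H1 p.1‖ₑ * ‖H2 p.2‖ₑ) := by fun_prop
          rw [(Bz_kernel (ε + v * IC) (by simpa using hε) h1 h2).2]
          refine (mul_le_mul_right (eile _) _).trans ?_
          refine (mul_le_mul_right (lintegral_mono (g := fun p : V2 × V2 => ofReal (60 * (ε * (ε^2 + ‖p.1 - p.2‖^2) ^ mth)) * (‖H1 p.1‖ₑ * ‖H2 p.2‖ₑ)) fun p => ?_) _).trans (le_of_eq ?_)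
          · rw [enorm_mul, enorm_mul, enorm_conj, ← onee (Kz _ _)]
            exact mul_le_mul_left (ofReal_le_ofReal (KC hε hv _)) _
          · rw [← lcmu _ m5]
            exact ltgc fun p => by simp only [hk]; ring
        · exact bot_le
    _ = ∫⁻ p : V2 × V2, ∫⁻ ε in Iop, k ε (p.1 - p.2) * (‖H1 p.1‖ₑ * ‖H2 p.2‖ₑ) := lintegral_lintegral_swap mk.aemeasurable
    _ ≤ ∫⁻ p : V2 × V2, ofReal (60 * ((3 - 2 * y)⁻¹ + (2 * y)⁻¹)) * (‖H1 p.1‖ₑ * (‖H2 p.2‖ₑ * edist p.1 p.2 ^ (-(2 * y)))) := by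
        refine lintegral_mono fun p => ?_
        beta_reduce
        rw [lintegral_mul_const _ (by simp only [hk]; fun_prop)]
        refine (mul_le_mul_left (kI hy0 hy1 p.1 p.2) _).trans (le_of_eq (by ring))
    _ = _ := by
        have m6 : Measurable fun p : V2 × V2 => ‖H1 p.1‖ₑ * (‖H2 p.2‖ₑ * edist p.1 p.2 ^ (-(2 * y))) := by fun_prop
        have m7 : ∀ x, Measurable fun x' : V2 => ‖H2 x'‖ₑ * edist x x' ^ (-(2 * y)) := fun x => by fun_prop
        rw [lcmu _ m6, volume_eq_prod, lintegral_prod _ m6.aemeasurable]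
        congr 1
        exact ltgc fun x => lcmu ‖H1 x‖ₑ (m7 x)

lemma HW {y : ℝ} (hy1 : y < 1) (u : SW) {w : RV → ℝ} (hw : Wok w) (t : ℝ) :
    (∫⁻ x, ‖uW u w (t, x)‖ₑ ^ (2 / (2 - y))) ^ (1 / (2 / (2 - y))) ≤ (Nw w y t ^ (1 - y)) ^ hfr * gW u w t := by
  have h1 : 0 < 1 - y := by linarith
  have h2 : 0 < 2 - y := by linarith
  have wm := hw.m
  have um := u.continuous.measurable
  have key : ∫⁻ x, ‖uW u w (t, x)‖ₑ ^ (2 / (2 - y)) ≤ (∫⁻ x, ‖u (t, x)‖ₑ^2 * ofReal (w (t, x))) ^ (1 / (2 - y)) * (Nw w y t) ^ ((1 - y) / (2 - y)) := by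
    refine (lintegral_mono fun x => ?_).trans (lintegral_mul_norm_pow_le (f := fun x => ‖u (t, x)‖ₑ^2 * ofReal (w (t, x))) (g := fun z => ofReal (w (t, z)) ^ (1 - y)⁻¹) fp fp ps ps (by field_simp; ring))
    have e : ‖uW u w (t, x)‖ₑ = ‖u (t, x)‖ₑ * ofReal (w (t, x)) := by
      rw [uW, enorm_mul]; congr 1; rw [← onee, norm_real, norm_of_nonneg (hw.z _)]
    rw [e, Emn _ _ ps, Emn _ _ ps, mul_assoc, ← Erm, ← ENNReal.rpow_add_of_nonneg _ _ ps ps, ← ENNReal.rpow_two, ← Erm]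
    refine le_of_eq ?_
    congr 2 <;> (field_simp; try ring)
  rw [gW]
  calc _ ≤ ((∫⁻ x, ‖u (t, x)‖ₑ^2 * ofReal (w (t, x))) ^ (1 / (2 - y)) * (Nw w y t) ^ ((1 - y) / (2 - y))) ^ (1 / (2 / (2 - y))) := by gcongr
    _ = _ := by
      rw [Emn _ _ ps, ← Erm, ← Erm, ← Erm, mul_comm]
      congr 2 <;> field_simp

set_option maxHeartbeats 400000 in
lemma QF1 {s θ x x' y : ℝ} (hθ : 1/2 < θ) (hx' : 0 ≤ x') (hxx : x' ≤ x) (hx1 : x < 1) (hy0 : 0 < y) (hy1 : y < 1) (h2 : 2 * x' < 1 - y)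
    (hs : 2 - 2 * y - x' ≤ 2 * s) : ∃ C : ENN, C ≠ ⊤ ∧ ∀ (u : SW) (w : RV → ℝ), Wok w →
    ∫⁻ p, ‖u p‖ₑ^2 * ofReal (w p) ≤ C * LtR (1 - x) (fun t => Nw w y t ^ (1 - y)) * HN s θ u ^ 2 := by
  obtain ⟨C1, hC0, hC⟩ := K1
  obtain ⟨C2, hC2, HM⟩ := MAIN hθ hx' hxx hx1
  have h2y : 0 < 2 - y := by linarith
  obtain ⟨C3, hC3, HL⟩ := HLS (volume : Measure V2) 2 (2 * y) (2 / (2 - y)) (2 / (2 - y)) la la (by rw [lt_div_iff₀ h2y]; linarith) (by rw [lt_div_iff₀ h2y]; linarith) (by field_simp; ring) (ofReal π) (by finiteness) (fun x ρ hρ => by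
    rw [EuclideanSpace.volume_ball_fin_two, ENNReal.rpow_two]; exact (mul_comm _ _).le)
  set b := 2 - 2 * y - x' with hb
  have b0 : 0 < b := by linarith
  have g1 : 0 < Real.Gamma b := Real.Gamma_pos_of_pos b0
  have hp : 0 < (1 - y) / 2 - x' := by linarith
  set cA : ℝ := C1 ^ (1 - (1 - y)) * (2 * π) ^ (1 - y)
  set cB : ENN := ofReal (60 * ((3 - 2 * y)⁻¹ + (2 * y)⁻¹))
  refine ⟨C2 * (ofReal (cA * ((1 - y) / 2 - x')⁻¹) + cB * C3) * ofReal (Real.Gamma b)⁻¹, by finiteness, fun u w hw => ?_⟩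
  have wm := hw.m
  have um := u.continuous.measurable
  have Nm : Measurable fun t => Nw w y t ^ (1 - y) := by
    have : Measurable fun p : RV => ofReal (w p) ^ (1 - y)⁻¹ := by fun_prop
    exact this.lintegral_prod_right'.pow_const _
  obtain ⟨M0, hM0, hMf⟩ := wfin hw (κ := (1 - y)⁻¹) (by rw [inv_pos]; linarith)
  have Nf : ∀ t, Nw w y t ≠ ⊤ := fun t => ne_top_of_le_ne_top ENNReal.ofReal_ne_top (hMf t)
  refine (HM u w hw (fun ε => ofReal (ε ^ (b - 1))) (fun ξ => ofReal ((Real.Gamma b)⁻¹ * ‖ξ‖ ^ b)) (fun t => Nw w y t ^ (1 - y)) (ofReal (cA * ((1 - y) / 2 - x')⁻¹) + cB * C3) fp fp Nm ?_ ?_).trans ?_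
  · intro ξ hξ
    have h0 : 0 < ‖ξ‖ := norm_pos_iff.2 hξ
    rw [gam b0 h0, ← ofReal_mul ps, ← ofReal_one]
    refine ofReal_le_ofReal (le_of_eq ?_)
    have k4 : ‖ξ‖ ^ b * ‖ξ‖ ^ (-b) = 1 := by rw [← rpow_add h0, add_neg_cancel, rpow_zero]
    calc (1:ℝ) = (Real.Gamma b)⁻¹ * Real.Gamma b * (‖ξ‖ ^ b * ‖ξ‖ ^ (-b)) := by rw [k4, inv_mul_cancel₀ g1.ne', one_mul]
      _ = _ := by ring
  · intro t t' v hv _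
    have hv' := abs_pos.2 hv
    set G := ((Nw w y t ^ (1 - y)) ^ hfr * gW u w t) * ((Nw w y t' ^ (1 - y)) ^ hfr * gW u w t') with hG
    have n1 := (uW_nice u hw).2.2 t
    have n2 := (uW_nice u hw).2.2 t'
    have m1 : Measurable fun ε : ℝ => ofReal ε ^ ((1 - y) / 2 - x' - 1) * (if ofReal ε < ofReal |v| then 1 else 0) :=
      Measurable.mul fp (mitx)
    have vt : ofReal |v| ^ (-x') ≠ ⊤ := by rw [ofReal_rpow_of_pos hv']; finiteness
    calc _ ≤ ∫⁻ ε in Iop, ((ofReal (cA * |v| ^ (-((1 - y) / 2))) * G) * (ofReal ε ^ ((1 - y) / 2 - x' - 1) * (if ofReal ε < ofReal |v| then 1 else 0)) + ofReal |v| ^ (-x') * (if |v| ≤ ε then ofReal (ε ^ (2 * (1 - y) - 1)) * ‖Bz (ε + v * IC) (fun y => uW u w (t, y)) (fun y => uW u w (t', y))‖ₑ else 0)) := by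
          refine setLIntegral_mono' measurableSet_Ioi fun ε hε => ?_
          have hε : 0 < ε := hε
          rcases lt_or_ge ε |v| with h | h
          · rw [if_pos ((ENNReal.ofReal_lt_ofReal_iff hv').2 h), if_neg h.not_ge, mul_zero, add_zero, mul_one]
            set k : ℝ := 2 * π * |v| ^ (-(1/2):ℝ) * ε ^ mth with hk
            obtain ⟨M, hM, _⟩ := hw.b
            have hz : (ε + v * IC : ℂ).re = ε := by simp
            have hi : (ε + v * IC : ℂ).im = v := by simp
            have hKk : ∀ x : V2, ‖Kz (ε + v * IC) x‖ ≤ k := fun x => by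
              refine (K2 _ (by rw [hz]; exact hε) x).trans ?_
              rw [hz, hk]
              have := abs_im_le_norm (ε + v * IC : ℂ)
              rw [hi] at this
              gcongr ?_ * _
              gcongr _ * ?_
              exact rpow_le_rpow_of_nonpos hv' this nu
            have S := SL hC0 hC (z := ε + v * IC) (by rw [hz]; exact hε) u hw (Ω := fun p => w p ^ (1 - y)⁻¹) fp (fun p => by have := hw.z p; positivity) (M := M ^ (1 - y)⁻¹)
              (fun p => Real.rpow_le_rpow (hw.z p) (hM p) (by rw [inv_nonneg]; linarith)) (P := fun t => 1 * (Nw w y t).toReal ^ ((1 - y) - (1 - y))) (D := fun t => (Nw w y t).toReal * k) (fun t => by positivity) (fun t => by positivity) (β := 1 - y) la la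
              (fun t z => by rw [sub_self, rpow_zero, ← rpow_mul (hw.z _), inv_mul_cancel₀ la, rpow_one]; simp)
              (fun t z => by
                have m : Measurable fun x => ofReal (w (t, x)) ^ (1 - y)⁻¹ := by fun_prop
                rw [ofReal_mul ENNReal.toReal_nonneg, ENNReal.ofReal_toReal (Nf t), mul_comm (Nw w y t), Nw, ← lcmu _ m]
                refine lintegral_mono fun x => ?_
                rw [ofReal_rpow_of_nonneg (hw.z _) (by rw [inv_nonneg]; linarith), ← onee]
                exact mul_le_mul_left (ofReal_le_ofReal (hKk _)) _) t t'
            beta_reduce at S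
            rw [mul_assoc (C1 ^ _), NK ENNReal.toReal_nonneg ENNReal.toReal_nonneg ps zero_le_one la le_rfl] at S
            refine (mul_le_mul_right S _).trans (le_of_eq ?_)
            have e : ∀ t, ofReal (((Nw w y t).toReal ^ (1 - y)) ^ hfr) = (Nw w y t ^ (1 - y)) ^ hfr := fun t => by
              rw [← ofReal_rpow_of_nonneg ps nu, ← ofReal_rpow_of_nonneg ENNReal.toReal_nonneg la, ENNReal.ofReal_toReal (Nf t)]
            have ek : k ^ (1 - y) = (2 * π) ^ (1 - y) * |v| ^ (-((1 - y) / 2)) * ε ^ (-(3 / 2 * (1 - y))) := by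
              rw [hk, mul_rpow ps ps, mul_rpow ps ps, ← rpow_mul hv'.le, ← rpow_mul hε.le]
              congr 3 <;> ring
            have er : ε ^ (b - 1) * (C1 ^ (1 - (1 - y)) * (k ^ (1 - y) * 1)) = cA * |v| ^ (-((1 - y) / 2)) * ε ^ ((1 - y) / 2 - x' - 1) := by
              rw [ek, show (1 - y) / 2 - x' - 1 = (b - 1) + -(3 / 2 * (1 - y)) by rw [hb]; ring, rpow_add hε]; ring
            rw [← mul_assoc (C1 ^ _), ofReal_mul (p := C1 ^ _ * _) ps, ofReal_mul (p := _ ^ hfr) ps, e, e, mul_assoc, ← mul_assoc (ofReal (ε ^ _)), ← ofReal_mul ps, er, hG, ofReal_rpow_of_pos hε, ofReal_mul (p := cA * _) ps]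
            ring
          · rw [if_pos h]
            refine le_trans ?_ le_add_self
            rw [← mul_assoc]
            refine mul_le_mul_left ?_ _
            rw [ofReal_rpow_of_pos hv', ← ofReal_mul ps]
            apply ofReal_le_ofReal
            rw [show b - 1 = -x' + (2 * (1 - y) - 1) by rw [hb]; ring, rpow_add hε]
            exact mul_le_mul_of_nonneg_right (rpow_le_rpow_of_nonpos hv' h la) ps
      _ = (ofReal (cA * |v| ^ (-((1 - y) / 2))) * G) * (ofReal |v| ^ ((1 - y) / 2 - x') * ofReal ((1 - y) / 2 - x')⁻¹) + ofReal |v| ^ (-x') * ∫⁻ ε in Iop, (if |v| ≤ ε then ofReal (ε ^ (2 * (1 - y) - 1)) * ‖Bz (ε + v * IC) (fun y => uW u w (t, y)) (fun y => uW u w (t', y))‖ₑ else 0) := by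
          rw [lintegral_add_left (m1.const_mul _), lintegral_const_mul' _ _ vt, lcmu _ m1, pw_lt _ hp]
      _ ≤ ofReal (cA * ((1 - y) / 2 - x')⁻¹) * ofReal |v| ^ (-x') * G + ofReal |v| ^ (-x') * (cB * (C3 * G)) := by
          gcongr ?_ + ofReal |v| ^ (-x') * ?_
          · refine le_of_eq ?_
            rw [ofReal_rpow_of_pos hv', ofReal_rpow_of_pos hv', mul_right_comm, ← ofReal_mul ps, ← ofReal_mul ps, ← ofReal_mul ps]
            congr 2
            rw [show -x' = -((1 - y) / 2) + ((1 - y) / 2 - x') by ring, rpow_add hv']; ring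
          · refine (LG hy0 hy1 v n1 n2).trans (mul_le_mul_right ?_ _)
            refine (HL _ _ n1.m.enorm n2.m.enorm).trans (mul_le_mul_right ?_ _)
            exact mul_le_mul' (HW hy1 u hw t) (HW hy1 u hw t')
      _ = _ := by ring
  · have := om_HN (θ := θ) (s := s) u (ω := fun ξ => ofReal ((Real.Gamma b)⁻¹ * ‖ξ‖ ^ b)) (K := ofReal (Real.Gamma b)⁻¹) (fun ξ => by
      rw [← ofReal_mul ps]
      refine ofReal_le_ofReal (mul_le_mul_of_nonneg_left ?_ ps)
      have h1 : ‖ξ‖ ^ b = (‖ξ‖^2) ^ (b/2) := by rw [← Real.rpow_two, ← rpow_mul (norm_nonneg _)]; congr 1; ring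
      rw [h1]
      calc _ ≤ (1 + ‖ξ‖^2) ^ (b/2) := by gcongr; linarith
        _ ≤ _ := rpow_le_rpow_of_exponent_le (by nlinarith [norm_nonneg ξ]) la)
    refine (mul_le_mul_right this _).trans (le_of_eq ?_)
    ring

lemma CAL0 {q : ℝ} (h1 : 1 < q) (h2 : q < 2) : ∃ A B : ℝ, 0 ≤ A ∧ 0 ≤ B ∧ ∀ z : ℂ, 0 < z.re → ‖z‖ ^ q ≤ A * z.re ^ q - B * (z ^ (q:ℂ)).re := by
  have hpi := pi_pos
  obtain ⟨t, ht1, ht2⟩ : ∃ t, π / 2 / q < t ∧ t < π / 2 := exists_between (by rw [div_lt_iff₀ la]; nlinarith)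
  have t0 : 0 < t := lt_trans ps ht1
  rw [div_lt_iff₀ la] at ht1
  have hc : Real.cos (t * q) < 0 := Real.cos_neg_of_pi_div_two_lt_of_lt ht1 (by nlinarith)
  have hc' : 0 < Real.cos t := Real.cos_pos_of_mem_Ioo ⟨by linarith, ht2⟩
  set B := (-Real.cos (t * q))⁻¹ with hB
  have B0 : 0 < B := by rw [hB, inv_pos]; linarith
  refine ⟨(1 + B) / Real.cos t ^ q, B, by positivity, B0.le, fun z hz => ?_⟩
  have hz0 : 0 < ‖z‖ := norm_pos_iff.2 (by rintro rfl; simp at hz)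
  have ha := Complex.abs_arg_lt_pi_div_two_iff.2 (inl hz)
  have hre : (z ^ (q:ℂ)).re = ‖z‖ ^ q * Real.cos (|z.arg| * q) := by
    rw [Complex.cpow_ofReal, Complex.re_ofReal_mul, ← Real.cos_abs (z.arg * q), abs_mul, abs_of_pos (by linarith : 0 < q)]
    congr 1
    simp [-Complex.ofReal_cos, -Complex.ofReal_sin]
  have hr : z.re = ‖z‖ * Real.cos |z.arg| := by rw [Real.cos_abs, Complex.norm_mul_cos_arg]
  have hca : 0 ≤ Real.cos |z.arg| := by rw [Real.cos_abs]; exact (Real.cos_pos_of_mem_Ioo (abs_lt.1 ha)).le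
  rw [hre, hr, mul_rpow hz0.le hca]
  suffices 1 ≤ (1 + B) / Real.cos t ^ q * Real.cos |z.arg| ^ q - B * Real.cos (|z.arg| * q) by
    nlinarith [Real.rpow_pos_of_pos hz0 q]
  have h0 := abs_nonneg z.arg
  rcases le_total t |z.arg| with h | h
  · have k1 : Real.cos (|z.arg| * q) ≤ Real.cos (t * q) := Real.cos_le_cos_of_nonneg_of_le_pi ps (by nlinarith) (by gcongr)
    have k2 : 0 ≤ (1 + B) / Real.cos t ^ q * Real.cos |z.arg| ^ q := by positivity
    have k3 : B * -Real.cos (t * q) = 1 := by rw [hB]; exact inv_mul_cancel₀ la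
    nlinarith
  · have k1 : Real.cos t ≤ Real.cos |z.arg| := Real.cos_le_cos_of_nonneg_of_le_pi h0 la h
    have k2 : (1 + B) / Real.cos t ^ q * Real.cos t ^ q ≤ (1 + B) / Real.cos t ^ q * Real.cos |z.arg| ^ q := by gcongr
    rw [div_mul_cancel₀ _ ps] at k2
    nlinarith [Real.cos_le_one (|z.arg| * q)]

lemma CONT {g : ℂ → ℂ} {ε K q : ℝ} (hε : 0 < ε) (hq : 1 < q) (hd : DifferentiableOn ℂ g {z | 0 < z.im}) (hb : ∀ z : ℂ, ε ≤ z.im → ‖g z‖ ≤ K * (1 + ‖z‖^2) ^ (-q/2)) :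
    Integrable (fun x : ℝ => g (x + ε * IC)) ∧ ∫ x : ℝ, g (x + ε * IC) = 0 := by
  have K0 : 0 ≤ K := by
    have := (norm_nonneg _).trans (hb (ε * IC) (by simp))
    exact nonneg_of_mul_nonneg_left this ps
  have hi : Integrable (fun x : ℝ => g (x + ε * IC)) := by
    have := (integrable_rpow_neg_one_add_norm_sq (E := ℝ) (μ := volume) (r := q) (by simpa using hq)).const_mul K
    refine this.mono' (ContinuousOn.comp_continuous hd.continuousOn fp fun x => by simpa using hε).aestronglyMeasurable (of_forall fun x => ?_)
    refine (hb _ (by simp)).trans ?_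
    refine mul_le_mul_of_nonneg_left (rpow_le_rpow_of_nonpos ps ?_ la) K0
    have := abs_re_le_norm (x + ε * IC)
    simp at this
    rw [norm_eq_abs]; gcongr
  refine ⟨hi, ?_⟩
  have lim1 := intervalIntegral_tendsto_integral hi Filter.tendsto_neg_atTop_atBot Filter.tendsto_id
  refine tendsto_nhds_unique lim1 (squeeze_zero_norm' (a := fun R => 4 * K * R ^ (-(q - 1))) ?_ ?_)
  · filter_upwards [Filter.eventually_gt_atTop 0] with R hR
    have far : ∀ z : ℂ, ε ≤ z.im → R ≤ ‖z‖ → ‖g z‖ ≤ K * R ^ (-q) := fun z h1 h2 => by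
      refine (hb z h1).trans (mul_le_mul_of_nonneg_left ?_ K0)
      rw [show R ^ (-q) = (R^2) ^ (-q/2) by rw [← Real.rpow_two, ← rpow_mul hR.le]; congr 1; ring]
      exact rpow_le_rpow_of_nonpos ps (by nlinarith) la
    have H := Complex.integral_boundary_rect_eq_zero_of_differentiableOn g (-R + ε * IC) (R + (ε + R : ℝ) * IC) (hd.mono fun z hz => by
      have := hz.2
      simp at this
      rw [uIcc_of_le la] at this
      exact hε.trans_le this.1)
    simp only [Complex.add_re, Complex.add_im, Complex.neg_re, Complex.neg_im, ofReal_re, ofReal_im, mul_re, Complex.mul_im, Complex.I_re, Complex.I_im, mul_zero, mul_one, sub_zero, neg_zero, zero_add, add_zero] at H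
    have n1 : ‖∫ x in (-R)..R, g (x + (ε + R : ℝ) * IC)‖ ≤ K * R ^ (-q) * |R - -R| := intervalIntegral.norm_integral_le_of_norm_le_const fun x _ => far _ (by simp; linarith) (by
      have := abs_im_le_norm (x + (ε + R : ℝ) * IC)
      simp at this; rw [abs_of_pos la] at this; push_cast; linarith)
    have n2 : ‖∫ y in ε..(ε + R), g (R + y * IC)‖ ≤ K * R ^ (-q) * |ε + R - ε| := intervalIntegral.norm_integral_le_of_norm_le_const fun y hy => far _ (by
      rw [uIoc_of_le la] at hy; simpa using hy.1.le) (by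
      have := abs_re_le_norm (R + y * IC)
      simp at this; exact (le_abs_self _).trans this)
    have n3 : ‖∫ y in ε..(ε + R), g (-R + y * IC)‖ ≤ K * R ^ (-q) * |ε + R - ε| := intervalIntegral.norm_integral_le_of_norm_le_const fun y hy => far _ (by
      rw [uIoc_of_le la] at hy; simpa using hy.1.le) (by
      have := abs_re_le_norm (-R + y * IC)
      simp at this; exact (le_abs_self _).trans this)
    rw [show R - -R = 2 * R by ring, abs_of_pos la] at n1
    rw [add_sub_cancel_left, abs_of_pos hR] at n2 n3
    have e : R ^ (-(q - 1)) = R ^ (-q) * R := by rw [show -(q - 1) = -q + 1 by ring, rpow_add hR, rpow_one]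
    have H' : ∫ x in (-R)..R, g (x + ε * IC) = (∫ x in (-R)..R, g (x + (ε + R : ℝ) * IC)) - IC * (∫ y in ε..(ε + R), g (R + y * IC)) + IC * ∫ y in ε..(ε + R), g (-R + y * IC) := by
      simp only [Complex.ofReal_neg, smul_eq_mul] at H
      linear_combination H
    simp only [id]
    rw [H', e]
    refine (norm_add_le _ _).trans ?_
    have := norm_sub_le (∫ x in (-R)..R, g (x + (ε + R : ℝ) * IC)) (IC * (∫ y in ε..(ε + R), g (R + y * IC)))
    rw [norm_mul, norm_I, one_mul] at this ⊢
    linarith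
  · have := (tendsto_rpow_neg_atTop (y := q - 1) la).const_mul (4 * K)
    simpa using this

lemma JEN {α : Type*} [MeasurableSpace α] (μ : Measure α) {q : ℝ} (hq : 1 < q) {k h : α → ENN} (hk : AEMeasurable k μ) (hh : AEMeasurable h μ) :
    (∫⁻ x, k x * h x ∂μ) ^ q ≤ (∫⁻ x, k x ∂μ) ^ (q - 1) * ∫⁻ x, k x * h x ^ q ∂μ := by
  have q0 : 0 < q := by linarith
  have e := lintegral_mul_norm_pow_le (μ := μ) (f := fun x => k x * h x ^ q) (g := k) (p := 1 / q) (q := 1 - 1 / q) fp hk ps (by rw [sub_nonneg, div_le_one q0]; exact hq.le) (by ring)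
  have e2 : ∀ x, (k x * h x ^ q) ^ (1 / q) * k x ^ (1 - 1 / q) = k x * h x := fun x => by
    rw [Emn _ _ ps, ← Erm, mul_one_div_cancel q0.ne', ENNReal.rpow_one, mul_right_comm, ← ENNReal.rpow_add_of_nonneg _ _ ps (by rw [sub_nonneg, div_le_one q0]; exact hq.le), add_sub_cancel, ENNReal.rpow_one]
  simp only [e2] at e
  refine (ENNReal.rpow_le_rpow e q0.le).trans (le_of_eq ?_)
  rw [Emn _ _ q0.le, ← Erm, ← Erm, mul_comm]
  congr 2
  · field_simp
  · rw [div_mul_cancel₀ _ q0.ne', ENNReal.rpow_one]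

def Dc {E F : Type*} [NormedAddCommGroup E] [NormedAddCommGroup F] (f : E → F) : Prop := Continuous f ∧ ∃ M, ∀ u, ‖f u‖ ≤ M * ((1 + ‖u‖^2)⁻¹)^2

lemma Dc.int {F : Type*} [NormedAddCommGroup F] {f : ℝ → F} (h : Dc f) : Integrable (fun u => ‖f u‖ * (1 + |u|)) := by
  obtain ⟨hc, M, hM⟩ := h
  refine (integrable_inv_one_add_sq.const_mul (M * 2)).mono' fp (of_forall fun u => ?_)
  have h1 : (1 + ‖u‖^2)⁻¹ * (1 + |u|) ≤ 2 := by
    rw [inv_mul_le_iff₀ ps, norm_eq_abs]; nlinarith [sq_nonneg (|u| - 1), sq_nonneg |u|]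
  have M0 : 0 ≤ M * ((1 + ‖u‖^2)⁻¹)^2 := (norm_nonneg _).trans (hM u)
  have M1 : 0 ≤ M := nonneg_of_mul_nonneg_left M0 ps
  rw [norm_of_nonneg ps]
  calc _ ≤ M * ((1 + ‖u‖^2)⁻¹)^2 * (1 + |u|) := by gcongr; exact hM u
    _ = M * (1 + ‖u‖^2)⁻¹ * ((1 + ‖u‖^2)⁻¹ * (1 + |u|)) := by ring
    _ ≤ M * (1 + ‖u‖^2)⁻¹ * 2 := by gcongr
    _ = _ := by rw [norm_eq_abs, sq_abs]; ring

lemma Dc.int1 {F : Type*} [NormedAddCommGroup F] {f : ℝ → F} (h : Dc f) : Integrable f :=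
  h.int.mono' h.1.aestronglyMeasurable (of_forall fun u => le_mul_of_one_le_right (norm_nonneg _) (by linarith [abs_nonneg u]))

def Zf (f : ℝ → ℝ) (z : ℂ) : ℂ := IC * ∫ u, (f u : ℂ) / (z - u)

lemma im_le (z : ℂ) (u : ℝ) : z.im ≤ ‖z - u‖ := by
  have := abs_im_le_norm (z - u)
  simp at this
  exact (le_abs_self _).trans this

lemma Zi {f : ℝ → ℝ} (hf : Dc f) {z : ℂ} (hz : 0 < z.im) : Integrable fun u : ℝ => (f u : ℂ) / (z - u) := by
  have hc := hf.1
  have nz : ∀ u : ℝ, z - u ≠ 0 := fun u => norm_pos_iff.1 (hz.trans_le (im_le z u))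
  refine (hf.int1.norm.mul_const z.im⁻¹).mono' (aestronglyMeasurable (by fun_prop (disch := exact nz _))) (of_forall fun u => ?_)
  rw [norm_div, norm_real, div_eq_mul_inv]
  gcongr
  exact im_le z u

lemma Zd {f : ℝ → ℝ} (hf : Dc f) : DifferentiableOn ℂ (Zf f) {z | 0 < z.im} := by
  intro z0 hz
  have hz : 0 < z0.im := hz
  have hc := hf.1
  refine DifferentiableAt.differentiableWithinAt (DifferentiableAt.const_mul ?_ _)
  have near : ∀ x ∈ Metric.ball z0 (z0.im / 2), z0.im / 2 ≤ x.im := fun x hx => by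
    have h1 := abs_im_le_norm (x - z0)
    rw [Metric.mem_ball, dist_eq_norm] at hx
    have := (abs_le.1 (h1.trans hx.le)).1
    simp at this; linarith
  have nz : ∀ x ∈ Metric.ball z0 (z0.im / 2), ∀ u : ℝ, x - u ≠ 0 := fun x hx u => norm_pos_iff.1 (lt_of_lt_of_le (by linarith [near x hx]) (im_le x u))
  have hb := ball_mem_nhds z0 (by positivity : 0 < z0.im / 2)
  refine (hasDerivAt_integral_of_dominated_loc_of_deriv_le (bound := fun u => ‖f u‖ * ((z0.im / 2)^2)⁻¹) (F' := fun z u => -(f u : ℂ) / (z - u)^2) hb ?_ (Zi hf hz) ?_ (of_forall fun u x hx => ?_) (hf.int1.norm.mul_const _) (of_forall fun u x hx => ?_)).2.differentiableAt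
  · filter_upwards [hb] with x hx
    exact (Zi hf (lt_of_lt_of_le ps (near x hx))).aestronglyMeasurable
  · have := fun u => pow_ne_zero 2 (nz z0 (mem_of_mem_nhds hb) u)
    exact aestronglyMeasurable (by fun_prop (disch := exact this _))
  · rw [norm_div, norm_neg, norm_real, div_eq_mul_inv, norm_pow]
    gcongr
    exact (near x hx).trans (im_le x u)
  · have := (((hasDerivAt_id x).sub_const (u:ℂ)).inv (nz x hx u)).const_mul (f u : ℂ)
    exact this.congr_deriv (by simp only [id]; ring)

lemma Zb {f : ℝ → ℝ} (hf : Dc f) {ε : ℝ} (hε : 0 < ε) : ∃ K, 0 ≤ K ∧ ∀ z : ℂ, ε ≤ z.im → ‖Zf f z‖ ≤ K * (1 + ‖z‖^2) ^ (-(1/2) : ℝ) := by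
  refine ⟨(1 + 2 * ε⁻¹) * ∫ u, ‖f u‖ * (1 + |u|), mul_nonneg ps (integral_nonneg fun u => by positivity), fun z hz => ?_⟩
  rw [rpow_neg ps, ← sqrt_eq_rpow, ← div_eq_mul_inv, le_div_iff₀ ps, Zf, norm_mul, norm_I, one_mul]
  have h1 : √(1 + ‖z‖^2) ≤ 1 + ‖z‖ := sqrt_le_iff.2 ⟨by positivity, by nlinarith [norm_nonneg z]⟩
  refine (mul_le_mul (norm_integral_le_integral_norm _) h1 ps (integral_nonneg fun u => by positivity)).trans ?_
  rw [← integral_const_mul, ← integral_mul_const]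
  refine integral_mono ((Zi hf (hε.trans_le hz)).norm.mul_const _) (hf.int.const_mul _) fun u => ?_
  have h2 := hz.trans (im_le z u)
  have h3 : ‖z‖ ≤ ‖z - u‖ + |u| := by
    have := norm_add_le (z - u) u
    rwa [sub_add_cancel, norm_real] at this
  have h4 : 0 < ‖z - u‖ := hε.trans_le h2
  simp only [norm_div, norm_real]
  rw [div_mul_eq_mul_div, div_le_iff₀ h4]
  have h5 : 1 ≤ ε⁻¹ * ‖z - u‖ := by rwa [← div_eq_inv_mul, le_div_iff₀ hε, one_mul]
  have h6 : 1 + ‖z‖ ≤ (1 + 2 * ε⁻¹) * (1 + |u|) * ‖z - u‖ := by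
    nlinarith [mul_nonneg (abs_nonneg u) h4.le, mul_le_mul_of_nonneg_left h5 (abs_nonneg u)]
  calc _ ≤ ‖f u‖ * ((1 + 2 * ε⁻¹) * (1 + |u|) * ‖z - u‖) := by gcongr
    _ = _ := by ring

def Pk (ε r : ℝ) : ℝ := ε / (r^2 + ε^2)

lemma Pk_meas (ε : ℝ) : Measurable fun r => ofReal (Pk ε r) := by unfold Pk; fun_prop

lemma PB {q : ℝ} (hq : 1 < q) : ∃ C : ENN, C ≠ ⊤ ∧ ∀ ε : ℝ, 0 < ε → ∀ h : ℝ → ENN, Measurable h → ∫⁻ x, (∫⁻ r, ofReal (Pk ε r) * h (x - r)) ^ q ≤ C * ∫⁻ x, h x ^ q := by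
  obtain ⟨C, hC, H⟩ := scl ℝ volume 2 (by simp)
  have e : ∀ ε : ℝ, 0 < ε → ∫⁻ r, ofReal (Pk ε r) = ofReal C := fun ε hε => by
    calc _ = ∫⁻ r : ℝ, ofReal ε * ofReal ((ε^2 + ‖r‖^2) ^ (-2/2 : ℝ)) := ltgc fun r => by
          rw [← ofReal_mul hε.le, Pk, norm_eq_abs, sq_abs, show (-2/2 : ℝ) = -1 by norm_num, rpow_neg_one, div_eq_mul_inv, add_comm]
      _ = _ := by
          rw [lintegral_const_mul' _ _ (by finiteness), H ε hε, ← ofReal_mul hε.le]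
          congr 1
          simp only [Module.finrank_self, Nat.cast_one, show (1:ℝ) - 2 = -1 by norm_num, rpow_neg_one]
          field_simp
  refine ⟨ofReal C ^ (q - 1) * ofReal C, by have := Ert (by linarith : 0 ≤ q - 1) (ENNReal.ofReal_ne_top (r := C)); finiteness, fun ε hε h hh => ?_⟩
  have m1 : Measurable fun p : ℝ × ℝ => ofReal (Pk ε p.2) * h (p.1 - p.2) ^ q := by
    have : Measurable fun p : ℝ × ℝ => ofReal (Pk ε p.2) := by unfold Pk; fun_prop
    exact this.mul fp
  calc _ ≤ ∫⁻ x, ofReal C ^ (q - 1) * ∫⁻ r, ofReal (Pk ε r) * h (x - r) ^ q := lintegral_mono fun x => by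
        have := JEN volume hq (k := fun r => ofReal (Pk ε r)) (h := fun r => h (x - r)) (Pk_meas ε).aemeasurable fp
        rwa [e ε hε] at this
    _ = ofReal C ^ (q - 1) * ∫⁻ r, ∫⁻ x, ofReal (Pk ε r) * h (x - r) ^ q := by
        rw [lcmu _ m1.lintegral_prod_right']; congr 1; exact lintegral_lintegral_swap m1.aemeasurable
    _ = ofReal C ^ (q - 1) * ∫⁻ r, ofReal (Pk ε r) * ∫⁻ x, h x ^ q := by
        congr 1; refine ltgc fun r => ?_
        rw [lcmu _ fp, lintegral_sub_right_eq_self (fun x => h x ^ q)]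
    _ = _ := by rw [lintegral_mul_const _ (Pk_meas ε), e ε hε, mul_assoc]

lemma Zre {f : ℝ → ℝ} (hf : Dc f) {z : ℂ} (hz : 0 < z.im) : Integrable (fun u => f u * (z.im / ‖z - u‖^2)) ∧ (Zf f z).re = ∫ u, f u * (z.im / ‖z - u‖^2) := by
  have e : ∀ u : ℝ, (IC * ((f u : ℂ) / (z - u))).re = f u * (z.im / ‖z - u‖^2) := fun u => by
    rw [← normSq_eq_norm_sq]
    simp [Complex.div_re, Complex.div_im, mul_re]
    ring
  have i := (Zi hf hz).const_mul IC
  simp only [← e]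
  refine ⟨i.re, ?_⟩
  rw [Zf, ← integral_const_mul]
  exact (integral_re i).symm

lemma CAL {q : ℝ} (hq : 1 < q) (hq2 : q < 2) : ∃ C : ENN, C ≠ ⊤ ∧ ∀ ε : ℝ, 0 < ε → ∀ f : ℝ → ℝ, Dc f → (∀ u, 0 ≤ f u) →
    ∫⁻ x : ℝ, ‖Zf f (x + ε * IC)‖ₑ ^ q ≤ C * ∫⁻ x, ofReal (f x) ^ q := by
  obtain ⟨A, B, A0, B0, H⟩ := CAL0 hq hq2
  obtain ⟨C, hC, HP⟩ := PB hq
  have q0 : 0 < q := by linarith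
  refine ⟨ofReal A * C, by finiteness, fun ε hε f hf f0 => ?_⟩
  by_cases hz : f = 0
  · subst hz; simp [Zf, q0]
  have hc := hf.1
  have im : ∀ x : ℝ, (x + ε * IC : ℂ).im = ε := fun x => by simp
  have rp : ∀ z : ℂ, 0 < z.im → 0 < (Zf f z).re := fun z h => by
    rw [(Zre hf h).2, integral_pos_iff_support_of_nonneg (fun u => by have := f0 u; have := h.le; positivity) (Zre hf h).1]
    have : Function.support (fun u : ℝ => f u * (z.im / ‖z - u‖^2)) = Function.support f := by
      ext u
      have := (h.trans_le (im_le z u)).ne'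
      simp [h.ne', norm_ne_zero_iff.1 this]
    rw [this]
    exact (hc.isOpen_support).measure_pos _ (Function.support_nonempty_iff.2 hz)
  obtain ⟨K, K0, hK⟩ := Zb hf hε
  obtain ⟨gi, g0⟩ := CONT (g := fun z => Zf f z ^ (q:ℂ)) (K := K ^ q) hε hq ((Zd hf).cpow_const fun z h => inl (rp z h)) fun z h => by
    rw [Complex.norm_cpow_real]
    refine (Real.rpow_le_rpow (norm_nonneg _) (hK z h) q0.le).trans (le_of_eq ?_)
    rw [mul_rpow K0 ps, ← rpow_mul ps]
    congr 2; ring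
  have rp' := fun x : ℝ => rp (x + ε * IC) (by rw [im]; exact hε)
  have cR : Continuous fun x : ℝ => Zf f (x + ε * IC) := (Zd hf).continuousOn.comp_continuous fp fun x => by simpa using hε
  have rI : Integrable fun x : ℝ => (Zf f (x + ε * IC)).re ^ q := by
    refine gi.norm.mono' (aestronglyMeasurable ((Complex.continuous_re.comp cR).rpow_const fun x => inr q0.le)) (of_forall fun x => ?_)
    rw [Complex.norm_cpow_real, norm_of_nonneg (Real.rpow_nonneg (rp' x).le _)]
    exact Real.rpow_le_rpow (rp' x).le (re_le_norm _) q0.le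
  have m : ∫ x : ℝ, ‖Zf f (x + ε * IC) ^ (q:ℂ)‖ ≤ A * ∫ x : ℝ, (Zf f (x + ε * IC)).re ^ q := by
    have : ∫ x : ℝ, (Zf f (x + ε * IC) ^ (q:ℂ)).re = 0 := by
      have := integral_re gi
      rw [g0] at this; simpa using this
    calc _ ≤ ∫ x : ℝ, (A * (Zf f (x + ε * IC)).re ^ q - B * (Zf f (x + ε * IC) ^ (q:ℂ)).re) := 
          integral_mono gi.norm ((rI.const_mul A).sub (gi.re.const_mul B)) fun x => by
            simp only [Complex.norm_cpow_real]; exact H _ (rp' x)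
      _ = _ := by
          have h := integral_sub (rI.const_mul A) (gi.re.const_mul B)
          simp only [RCLike.re_to_complex] at h
          rw [h, integral_const_mul, integral_const_mul, this]; ring
  calc _ = ofReal (∫ x : ℝ, ‖Zf f (x + ε * IC) ^ (q:ℂ)‖) := by
        rw [ofReal_integral_norm_eq_lintegral_enorm gi]
        refine ltgc fun x => ?_
        rw [← onee, ← onee, Complex.norm_cpow_real, ofReal_rpow_of_nonneg (norm_nonneg _) q0.le]
    _ ≤ ofReal A * ∫⁻ x : ℝ, ofReal (Zf f (x + ε * IC)).re ^ q := by
        refine (ofReal_le_ofReal m).trans (le_of_eq ?_)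
        rw [ofReal_mul A0, ofReal_integral_eq_lintegral_ofReal rI (of_forall fun x => Real.rpow_nonneg (rp' x).le _)]
        simp only [ofReal_rpow_of_nonneg (rp' _).le q0.le]
    _ = ofReal A * ∫⁻ x : ℝ, (∫⁻ r, ofReal (Pk ε r) * ofReal (f (x - r))) ^ q := by
        congr 1; refine ltgc fun x => ?_
        have h := Zre hf (z := x + ε * IC) (by rw [im]; exact hε)
        rw [h.2, ofReal_integral_eq_lintegral_ofReal h.1 (of_forall fun u => mul_nonneg (f0 u) (by rw [im]; positivity)), ← lintegral_sub_left_eq_self _ x]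
        congr 1; refine ltgc fun r => ?_
        rw [im, ofReal_mul (f0 _), mul_comm, Pk, ← normSq_eq_norm_sq, normSq_apply]
        simp [sq]
    _ ≤ _ := by
        rw [mul_assoc]; gcongr; exact HP ε hε _ fp

def hk (ε r : ℝ) : ℝ := r * |r| * (ε^2 + r^2) ^ mth

lemma hk_cont {ε : ℝ} (hε : 0 < ε) : Continuous (hk ε) := by
  unfold hk
  exact (by fun_prop : Continuous fun r : ℝ => r * |r|).mul ((by fun_prop : Continuous fun r : ℝ => ε^2 + r^2).rpow_const fun r => inl ps)

lemma hk_le {ε : ℝ} (hε : 0 < ε) (r : ℝ) : ‖(hk ε r : ℂ) - 1 / (r + ε * IC)‖ ≤ 2 * Pk ε r := by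
  have hD : 0 < ε^2 + r^2 := by positivity
  set s := √(ε^2 + r^2) with hs
  have s2 : s^2 = ε^2 + r^2 := sq_sqrt hD.le
  have s0 : 0 < s := sqrt_pos.2 hD
  have e1 : (ε^2 + r^2) ^ mth = (s^3)⁻¹ := by
    rw [rpow_neg hD.le, hs, sqrt_eq_rpow, ← rpow_natCast ((ε^2 + r^2) ^ hfr), ← rpow_mul hD.le]; norm_num
  have e2 : (1 / (r + ε * IC) : ℂ) = ((r / s^2 : ℝ) : ℂ) - (Pk ε r : ℝ) * IC := by
    have : (r + ε * IC : ℂ) ≠ 0 := fun h => by have := congrArg Complex.im h; simp at this; exact hε.ne' this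
    have t : ((r:ℂ)^2 + (ε:ℂ)^2) ≠ 0 := by norm_cast; rw [add_comm]; exact hD.ne'
    rw [s2, Pk]; push_cast; rw [add_comm ((ε:ℂ)^2)]
    field_simp
    ring_nf; rw [I_sq]; ring
  have P0 : 0 ≤ Pk ε r := by unfold Pk; positivity
  have h1 : |hk ε r - r / s^2| ≤ Pk ε r := by
    have : hk ε r - r / s^2 = -(r * (s - |r|) / s^3) := by rw [hk, e1]; field_simp; ring
    have hr : |r| ≤ s := Real.abs_le_sqrt (by linarith [sq_nonneg ε])
    have hb : (s - |r|) ≤ ε := by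
      have : s ≤ ε + |r| := sqrt_le_iff.2 ⟨by positivity, by nlinarith [sq_abs r, mul_nonneg hε.le (abs_nonneg r)]⟩
      linarith
    rw [this, abs_neg, abs_div, abs_mul, abs_of_nonneg (sub_nonneg.2 hr), abs_of_pos (pow_pos s0 3), Pk, add_comm, ← s2, div_le_div_iff₀ ps ps]
    calc |r| * (s - |r|) * s^2 ≤ s * ε * s^2 := by gcongr
      _ = _ := by ring
  calc _ = ‖((hk ε r - r / s^2 : ℝ) : ℂ) + (Pk ε r : ℝ) * IC‖ := by rw [e2]; push_cast; ring_nf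
    _ ≤ |hk ε r - r / s^2| + Pk ε r := by
        refine (norm_add_le _ _).trans (le_of_eq ?_)
        rw [norm_real, norm_mul, norm_real, norm_I, mul_one, norm_of_nonneg P0, norm_eq_abs]
    _ ≤ _ := by linarith

lemma R1 {q : ℝ} (hq : 1 < q) (hq2 : q < 2) : ∃ C : ENN, C ≠ ⊤ ∧ ∀ ε : ℝ, 0 < ε → ∀ f : ℝ → ℂ, Dc f →
    ∫⁻ x : ℝ, ‖∫ r, f (x - r) * (hk ε r : ℂ)‖ₑ ^ q ≤ C * ∫⁻ x, ‖f x‖ₑ ^ q := by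
  obtain ⟨C, hC, H⟩ := CAL hq hq2
  obtain ⟨D, hD, HP⟩ := PB hq
  have q0 : 0 < q := by linarith
  have t1 : (2:ENN) ^ (q - 1) ≠ ⊤ := Ert la (by simp)
  have t2 : (4:ENN) ^ (q - 1) ≠ ⊤ := Ert la (by simp)
  have t3 : (2:ENN) ^ q ≠ ⊤ := Ert q0.le (by simp)
  refine ⟨2 ^ (q - 1) * (2 ^ q * D + 4 ^ (q - 1) * (4 * C)), by finiteness, fun ε hε f hf => ?_⟩
  obtain ⟨hc, M, hM⟩ := hf
  have hc' := hc
  let d : Fin 4 → ℂ := ![1, -1, IC, -IC]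
  let F : Fin 4 → ℝ → ℝ := fun i u => max ((starRingEnd ℂ (d i) * f u).re) 0
  have F0 : ∀ i u, 0 ≤ F i u := fun i u => le_max_right _ _
  have dn : ∀ i, ‖d i‖ = 1 := fun i => by fin_cases i <;> simp [d]
  have Fle : ∀ i u, F i u ≤ ‖f u‖ := fun i u => max_le ((re_le_norm _).trans (by rw [norm_mul, norm_conj, dn, one_mul])) (norm_nonneg _)
  have Fd : ∀ i, Dc (F i) := fun i => ⟨by fun_prop, M, fun u => by rw [norm_of_nonneg (F0 i u)]; exact (Fle i u).trans (hM u)⟩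
  have fs : ∀ u, f u = ∑ i, d i * (F i u : ℂ) := fun u => by
    have m : ∀ t : ℝ, ((max t 0 : ℝ) : ℂ) - ((max (-t) 0 : ℝ) : ℂ) = t := fun t => by
      norm_cast; rcases le_total t 0 with h | h
      · rw [max_eq_right h, max_eq_left la]; ring
      · rw [max_eq_left h, max_eq_right la]; ring
    have m1 := m (f u).re
    have m2 := m (f u).im
    simp [Fin.sum_univ_four, d, F]
    conv_lhs => rw [← Complex.re_add_im (f u), ← m1, ← m2]
    ring
  have nz : ∀ r : ℝ, (r + ε * IC : ℂ) ≠ 0 := fun r h => by have := congrArg Complex.im h; simp at this; exact hε.ne' this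
  have im : ∀ x : ℝ, 0 < (x + ε * IC : ℂ).im := fun x => by simpa using hε
  have zi : ∀ i (x : ℝ), Integrable (fun r : ℝ => (F i (x - r) : ℂ) / (r + ε * IC)) ∧ ∫ r : ℝ, (F i (x - r) : ℂ) / (r + ε * IC) = -IC * Zf (F i) (x + ε * IC) := fun i x => by
    have a1 := Zi (Fd i) (im x)
    have a2 := a1.comp_sub_left x
    have a3 := integral_sub_left_eq_self (fun u : ℝ => (F i u : ℂ) / (x + ε * IC - u)) volume x
    have e : ∀ r : ℝ, (x + ε * IC - ((x - r : ℝ) : ℂ)) = r + ε * IC := fun r => by push_cast; ring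
    simp only [e] at a2 a3
    refine ⟨a2, ?_⟩
    rw [a3, Zf, ← mul_assoc, neg_mul, Complex.I_mul_I]; simp
  have key : ∀ x : ℝ, ‖∫ r, f (x - r) * (hk ε r : ℂ)‖ₑ ≤ 2 * (∫⁻ r, ofReal (Pk ε r) * ‖f (x - r)‖ₑ) + ∑ i, ‖Zf (F i) (x + ε * IC)‖ₑ := fun x => by
    have fe : ∀ r, f (x - r) * (hk ε r : ℂ) = f (x - r) * ((hk ε r : ℂ) - 1 / (r + ε * IC)) + ∑ i, d i * ((F i (x - r) : ℂ) / (r + ε * IC)) := fun r => by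
      have : ∑ i, d i * ((F i (x - r) : ℂ) / (r + ε * IC)) = f (x - r) * (1 / (r + ε * IC)) := by
        rw [fs, Finset.sum_mul]; exact Finset.sum_congr rfl fun i _ => by ring
      rw [this]; ring
    have fi : Integrable fun r => f (x - r) * ((hk ε r : ℂ) - 1 / (r + ε * IC)) := by
      have kc := hk_cont hε
      refine ((Dc.int1 ⟨hc', M, hM⟩).comp_sub_left x |>.norm.mul_const (2 * ε⁻¹)).mono' (aestronglyMeasurable (by fun_prop (disch := exact nz _))) (of_forall fun r => ?_)
      rw [norm_mul]; gcongr
      refine (hk_le hε r).trans ?_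
      gcongr
      rw [Pk, div_le_iff₀ ps, ← div_eq_inv_mul, le_div_iff₀ hε]; nlinarith [sq_nonneg r]
    rw [integral_congr_ae (of_forall fe), integral_add fi (integrable_finsetSum _ fun i _ => (zi i x).1.const_mul _), integral_finsetSum _ fun i _ => (zi i x).1.const_mul _]
    refine (enorm_add_le _ _).trans (add_le_add ?_ ((enorm_sum_le _ _).trans (Finset.sum_le_sum fun i _ => ?_)))
    · refine (eile _).trans ?_
      rw [← lintegral_const_mul' _ _ (by simp)]
      refine lintegral_mono fun r => ?_
      beta_reduce
      rw [enorm_mul, ← onee (_ - _), mul_comm, ← mul_assoc]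
      gcongr
      refine (ofReal_le_ofReal (hk_le hε r)).trans (le_of_eq ?_)
      rw [ofReal_mul nu]; simp
    · rw [integral_const_mul, (zi i x).2, ← onee, ← onee, norm_mul, norm_mul, dn, norm_neg, norm_I, one_mul, one_mul]
  have cz : ∀ i, Continuous fun x : ℝ => Zf (F i) (x + ε * IC) := fun i => (Zd (Fd i)).continuousOn.comp_continuous fp im
  have mz : ∀ i, Measurable fun x : ℝ => ‖Zf (F i) (x + ε * IC)‖ₑ ^ q := fun i => (cz i).enorm.measurable.pow_const _
  calc _ ≤ ∫⁻ x : ℝ, 2 ^ (q - 1) * (2 ^ q * (∫⁻ r, ofReal (Pk ε r) * ‖f (x - r)‖ₑ) ^ q + 4 ^ (q - 1) * ∑ i, ‖Zf (F i) (x + ε * IC)‖ₑ ^ q) := lintegral_mono fun x => by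
        refine (ENNReal.rpow_le_rpow (key x) q0.le).trans ((ENNReal.rpow_add_le_mul_rpow_add_rpow _ _ hq.le).trans ?_)
        gcongr
        · rw [Emn _ _ q0.le]
        · have := ENNReal.rpow_sum_le_const_mul_sum_rpow Finset.univ (fun i => ‖Zf (F i) (x + ε * IC)‖ₑ) hq.le
          simpa using this
    _ = 2 ^ (q - 1) * (2 ^ q * (∫⁻ x : ℝ, (∫⁻ r, ofReal (Pk ε r) * ‖f (x - r)‖ₑ) ^ q) + 4 ^ (q - 1) * ∑ i, ∫⁻ x : ℝ, ‖Zf (F i) (x + ε * IC)‖ₑ ^ q) := by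
        rw [lintegral_const_mul' _ _ t1, lintegral_add_right _ ((Finset.measurable_fun_sum _ fun i _ => mz i).const_mul _), lintegral_const_mul' _ _ t3, lintegral_const_mul' _ _ t2, lintegral_finsetSum _ fun i _ => mz i]
    _ ≤ 2 ^ (q - 1) * (2 ^ q * (D * ∫⁻ x, ‖f x‖ₑ ^ q) + 4 ^ (q - 1) * ∑ i : Fin 4, C * ∫⁻ x, ‖f x‖ₑ ^ q) := by
        gcongr with i _
        · exact HP ε hε _ fp
        · refine (H ε hε _ (Fd i) (F0 i)).trans ?_
          gcongr with x
          rw [← onee]; exact ofReal_le_ofReal (Fle i x)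
    _ = _ := by simp only [Finset.sum_const, Finset.card_univ, Fintype.card_fin, nsmul_eq_mul]; push_cast; ring

def om (φ : ℝ) : V2 := !₂[cos φ, sin φ]

lemma om_norm (φ : ℝ) : ‖om φ‖ = 1 := by simp [om, norm_eq]

lemma om_cont : Continuous om := by
  refine (PiLp.continuous_toLp 2 _).comp (continuous_pi fun i => ?_)
  fin_cases i
  · exact continuous_cos
  · exact continuous_sin

def rk (ε : ℝ) (j : Fin 2) (y : V2) : ℝ := y j * (ε^2 + ‖y‖^2) ^ mth

lemma rk_cont {ε : ℝ} (hε : 0 < ε) (j : Fin 2) : Continuous (rk ε j) := by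
  unfold rk
  exact (by fun_prop : Continuous fun y : V2 => y j).mul ((by fun_prop : Continuous fun y : V2 => ε^2 + ‖y‖^2).rpow_const fun r => inl ps)

lemma cle (y : V2) (j : Fin 2) : |y j| ≤ ‖y‖ := by simpa using norm_apply_le y j

lemma rk_le {ε : ℝ} (hε : 0 < ε) (j : Fin 2) (y : V2) : |rk ε j y| ≤ (ε^2 + ‖y‖^2)⁻¹ ∧ |rk ε j y| ≤ (ε^2)⁻¹ := by
  have h : |rk ε j y| ≤ (ε^2 + ‖y‖^2)⁻¹ := by
    have hD : 0 < ε^2 + ‖y‖^2 := by positivity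
    have : (ε^2 + ‖y‖^2)⁻¹ = (ε^2 + ‖y‖^2) ^ hfr * (ε^2 + ‖y‖^2) ^ mth := by rw [← rpow_add hD, ← rpow_neg_one]; norm_num
    rw [rk, abs_mul, abs_of_pos (Real.rpow_pos_of_pos hD _), this, ← sqrt_eq_rpow]
    gcongr
    exact (cle y j).trans (le_sqrt_of_sq_le (by linarith [sq_nonneg ε]))
  exact ⟨h, h.trans (by gcongr; linarith [sq_nonneg ‖y‖])⟩

lemma Dc.int2 {F : V2 → ℂ} (h : Dc F) : Integrable F := by
  obtain ⟨hc, M, hM⟩ := h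
  refine ((integrable_rpow_neg_one_add_norm_sq (E := V2) (μ := volume) (r := 4) (by simp; norm_num)).const_mul M).mono' hc.aestronglyMeasurable (of_forall fun u => (hM u).trans (le_of_eq ?_))
  rw [show (-4/2 : ℝ) = -(2:ℕ) by norm_num, rpow_neg ps, rpow_natCast, inv_pow]

lemma peet (x y : V2) : (1 + ‖x - y‖^2)⁻¹ ≤ 2 * (1 + ‖x‖^2) * (1 + ‖y‖^2)⁻¹ := by
  rw [← div_eq_mul_inv, le_div_iff₀ ps, inv_mul_le_iff₀ ps]
  have : ‖y‖ ≤ ‖x‖ + ‖x - y‖ := by have := norm_sub_le x (x - y); simpa using this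
  nlinarith [sq_nonneg (‖x‖ - ‖x - y‖), norm_nonneg y, norm_nonneg x, norm_nonneg (x - y), mul_nonneg (sq_nonneg ‖x‖) (sq_nonneg ‖x - y‖), mul_le_mul this this (norm_nonneg _) ps]

lemma hk_abs {ε : ℝ} (hε : 0 < ε) (r : ℝ) : |hk ε r| ≤ ε⁻¹ := by
  have hD : 0 < ε^2 + r^2 := by positivity
  have e : (ε^2 + r^2) ^ (3/2 : ℝ) = (ε^2 + r^2) * √(ε^2 + r^2) := by
    rw [sqrt_eq_rpow, ← Real.rpow_one_add' hD.le nu]; norm_num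
  have h : ε ≤ √(ε^2 + r^2) := le_sqrt_of_sq_le (by linarith [sq_nonneg r])
  rw [hk, abs_mul, abs_of_pos (Real.rpow_pos_of_pos hD _), abs_mul, abs_abs, abs_mul_abs_self, rpow_neg hD.le, ← div_eq_mul_inv, div_le_iff₀ ps, e, ← div_eq_inv_mul, le_div_iff₀ hε]
  exact mul_le_mul (by nlinarith [sq_nonneg ε]) h hε.le hD.le

lemma POL {ε : ℝ} (hε : 0 < ε) (j : Fin 2) {F : V2 → ℂ} (hF : Dc F) (x : V2) :
    ∫ y, F (x - y) * (rk ε j y : ℂ) = (1/2) * ∫ φ in Ioo (-π) π, ((om φ j : ℝ) : ℂ) * ∫ r, F (x - r • om φ) * (hk ε r : ℂ) := by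
  obtain ⟨hc, M, hM⟩ := id hF
  have M0 : 0 ≤ M := by have := (norm_nonneg _).trans (hM 0); simpa using this
  have kc := rk_cont hε j
  have kc1 := hk_cont hε
  have oc := om_cont
  have i1 : Integrable fun y => F (x - y) * (rk ε j y : ℂ) := by
    refine ((hF.int2.comp_sub_left x).norm.mul_const (ε^2)⁻¹).mono' fp (of_forall fun y => ?_)
    rw [norm_mul, norm_real]; gcongr; exact (rk_le hε j y).2
  have e1 : ∫ y, F (x - y) * (rk ε j y : ℂ) = (1/2) * ∫ y, (F (x - y) - F (x + y)) * (rk ε j y : ℂ) := by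
    have h1 := integral_neg_eq_self (fun y => F (x - y) * (rk ε j y : ℂ)) volume
    have h2 := i1.comp_neg
    have h3 : ∀ y : V2, rk ε j (-y) = - rk ε j y := fun y => by simp [rk]
    simp only [h3, sub_neg_eq_add] at h1 h2
    have : ∀ y, (F (x - y) - F (x + y)) * (rk ε j y : ℂ) = F (x - y) * (rk ε j y : ℂ) + F (x + y) * ((-rk ε j y : ℝ) : ℂ) := fun y => by push_cast; ring
    simp only [this]
    rw [integral_add i1 h2, h1]; ring
  have pt : ∀ r φ : ℝ, (!₂[r * cos φ, r * sin φ] : V2) = r • om φ := fun r φ => by ext i; fin_cases i <;> simp [om]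
  have bd : ∀ r φ, ‖F (x - r • om φ)‖ ≤ M * (2 * (1 + ‖x‖^2)) * (1 + r^2)⁻¹ := fun r φ => by
    have h1 := peet x (r • om φ)
    rw [norm_smul, om_norm, mul_one, norm_eq_abs, sq_abs] at h1
    calc _ ≤ M * ((1 + ‖x - r • om φ‖^2)⁻¹)^2 := hM _
      _ ≤ M * ((1 + ‖x - r • om φ‖^2)⁻¹) := by
          gcongr; exact pow_le_of_le_one ps (inv_le_one_of_one_le₀ (by linarith [sq_nonneg ‖x - r • om φ‖])) nu
      _ ≤ _ := by rw [mul_assoc M]; gcongr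
  have gi : ∀ φ, Integrable fun r : ℝ => F (x - r • om φ) * (hk ε r : ℂ) := fun φ => by
    refine (integrable_inv_one_add_sq.const_mul (M * (2 * (1 + ‖x‖^2))) |>.mul_const ε⁻¹).mono' fp (of_forall fun r => ?_)
    rw [norm_mul, norm_real]
    exact mul_le_mul (bd r φ) (hk_abs hε r) (abs_nonneg _) ps
  have hko : ∀ r, hk ε (-r) = -hk ε r := fun r => by simp [hk]
  have inner : ∀ φ, ∫ r in Iop, ((om φ j : ℝ) : ℂ) * ((F (x - r • om φ) - F (x + r • om φ)) * (hk ε r : ℂ)) = ((om φ j : ℝ) : ℂ) * ∫ r, F (x - r • om φ) * (hk ε r : ℂ) := fun φ => by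
    rw [integral_const_mul]
    congr 1
    have h1 := integral_comp_neg_Ioi 0 (fun r => F (x - r • om φ) * (hk ε r : ℂ))
    have h2 := (gi φ).comp_neg
    rw [← intervalIntegral.integral_Iic_add_Ioi (gi φ).integrableOn (gi φ).integrableOn (b := 0)]
    simp only [hko, neg_smul, sub_neg_eq_add, neg_zero] at h1 h2
    rw [← h1, ← integral_add h2.integrableOn (gi φ).integrableOn]
    congr 1; ext r; push_cast; ring
  rw [e1, V2_integral, polarCoord_target]
  congr 1
  rw [setIntegral_congr_fun (g := fun p : ℝ × ℝ => ((om p.2 j : ℝ) : ℂ) * ((F (x - p.1 • om p.2) - F (x + p.1 • om p.2)) * (hk ε p.1 : ℂ))) (measurableSet_Ioi.prod measurableSet_Ioo) fun p hp => ?_, volume_eq_prod, ← setIntegral_prod_swap]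
  · simp only [fst_swap, snd_swap]
    rw [setIntegral_prod]
    · exact setIntegral_congr_fun measurableSet_Ioo fun φ _ => inner φ
    · rw [IntegrableOn, ← prod_restrict]
      have b := Integrable.mul_prod (μ := volume.restrict (Ioo (-π) π)) (ν := volume.restrict (Iop)) (f := fun _ => ε⁻¹) (integrable_const _) (integrable_inv_one_add_sq.const_mul (2 * (M * (2 * (1 + ‖x‖^2))))).integrableOn
      refine b.mono' (aestronglyMeasurable fp) (of_forall fun p => ?_)
      have h1 := bd p.2 p.1
      have h2 := bd (-p.2) p.1
      rw [neg_smul, sub_neg_eq_add, neg_sq] at h2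
      have h3 := norm_sub_le (F (x - p.2 • om p.1)) (F (x + p.2 • om p.1))
      rw [norm_mul, norm_mul, norm_real, norm_real, mul_comm ε⁻¹]
      refine (mul_le_of_le_one_left ps ((cle _ _).trans (om_norm _).le)).trans (mul_le_mul la (hk_abs hε _) (abs_nonneg _) ps)
  · have h0 : 0 < p.1 := hp.1
    simp only [pt]
    have : rk ε j (p.1 • om p.2) = p.1 * om p.2 j * (ε^2 + p.1^2) ^ mth := by
      rw [rk, norm_smul, om_norm, mul_one, norm_eq_abs, sq_abs]; simp
    rw [this, hk, abs_of_pos h0]; push_cast; ring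

def HT (F : V2 → ℂ) (ε : ℝ) (x : V2) (φ : ℝ) : ℂ := ∫ r, F (x - r • om φ) * (hk ε r : ℂ)

lemma R2 {q : ℝ} (hq : 1 < q) (hq2 : q < 2) : ∃ C : ENN, C ≠ ⊤ ∧ ∀ ε : ℝ, 0 < ε → ∀ (j : Fin 2) (F : V2 → ℂ), Dc F →
    ∫⁻ x, ‖∫ y, F (x - y) * (rk ε j y : ℂ)‖ₑ ^ q ≤ C * ∫⁻ x, ‖F x‖ₑ ^ q := by
  obtain ⟨C, hC, H⟩ := R1 hq hq2
  have q0 : 0 < q := by linarith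
  set m := volume.restrict (Ioo (-π) π) with hm
  have hv : (∫⁻ φ, 1 ∂m) ≠ ⊤ := by simp [hm]
  refine ⟨(∫⁻ φ, 1 ∂m) ^ (q - 1) * (C * ∫⁻ φ, 1 ∂m), by have := Ert (by linarith : 0 ≤ q - 1) hv; finiteness, fun ε hε j F hF => ?_⟩
  obtain ⟨hc, M, hM⟩ := id hF
  have kc1 := hk_cont hε
  have oc := om_cont
  have ms : StronglyMeasurable fun p : V2 × ℝ => HT F ε p.1 p.2 :=
    StronglyMeasurable.integral_prod_right' (f := fun z : (V2 × ℝ) × ℝ => F (z.1.1 - z.2 • om z.1.2) * (hk ε z.2 : ℂ)) (stronglyMeasurable fp)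
  have ml : ∀ φ, Measurable fun x : V2 => ‖HT F ε x φ‖ₑ ^ q := fun φ => (ms.measurable.comp (g := fun p : V2 × ℝ => HT F ε p.1 p.2) (f := fun x => (x, φ)) fp).enorm.pow_const _
  have mr : ∀ x, Measurable fun φ => ‖HT F ε x φ‖ₑ := fun x => (ms.measurable.comp (g := fun p : V2 × ℝ => HT F ε p.1 p.2) (f := fun φ => (x, φ)) fp).enorm
  have mq : Measurable fun p : V2 × ℝ => ‖HT F ε p.1 p.2‖ₑ ^ q := ms.measurable.enorm.pow_const _
  have lin : ∀ φ, ∫⁻ x : V2, ‖HT F ε x φ‖ₑ ^ q ≤ C * ∫⁻ x, ‖F x‖ₑ ^ q := fun φ => by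
    set e2 : V2 := EuclideanSpace.single 1 1
    have hr : ‖e2‖ = ‖om φ‖ := by rw [om_norm]; simp [e2]
    set ρ := (ℝ ∙ (e2 - om φ))ᗮ.reflection
    have hρ : ρ e2 = om φ := Submodule.reflection_sub hr
    have hm2 := ml φ
    have cp : ∀ a : ℝ, Continuous fun b : ℝ => (!₂[a, b] : V2) := fun a => (PiLp.continuous_toLp 2 _).comp (continuous_pi fun i => by fin_cases i <;> simp <;> fun_prop)
    rw [← ρ.measurePreserving.lintegral_comp hm2, ← ρ.measurePreserving.lintegral_comp (f := fun x => ‖F x‖ₑ ^ q) fp, V2_lint (fun x => ‖HT F ε (ρ x) φ‖ₑ ^ q) (hm2.comp (g := fun x => ‖HT F ε x φ‖ₑ ^ q) (f := ρ) ρ.measurePreserving.measurable), V2_lint (fun x => ‖F (ρ x)‖ₑ ^ q) ((hc.comp ρ.continuous).enorm.measurable.pow_const q), ← lintegral_const_mul' _ _ hC]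
    refine lintegral_mono fun a => ?_
    have := H ε hε (fun b => F (ρ !₂[a, b])) ⟨by have := cp a; fun_prop, M, fun b => (hM _).trans ?_⟩
    · refine le_trans (le_of_eq (ltgc fun b => ?_)) this
      rw [HT]; congr 3; ext r
      rw [← hρ, ← map_smul, ← map_sub]
      congr 3
      ext i; fin_cases i <;> simp [e2]
    · have M0 : 0 ≤ M := by have := (norm_nonneg _).trans (hM 0); simpa using this
      rw [ρ.norm_map]; gcongr
      simpa using cle !₂[a, b] 1
  calc _ ≤ ∫⁻ x : V2, (∫⁻ φ, 1 ∂m) ^ (q - 1) * ∫⁻ φ, ‖HT F ε x φ‖ₑ ^ q ∂m := lintegral_mono fun x => by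
        have h1 := JEN m hq (k := fun _ => 1) (h := fun φ => ‖HT F ε x φ‖ₑ) fp (mr x).aemeasurable
        simp only [one_mul] at h1
        refine le_trans (ENNReal.rpow_le_rpow ?_ q0.le) h1
        rw [POL hε j hF x, enorm_mul]
        refine (mul_le_of_le_one_left bot_le ?_).trans ((eile _).trans (lintegral_mono fun φ => ?_))
        · rw [← onee]; norm_num
        · change _ ≤ ‖∫ r, F (x - r • om φ) * (hk ε r : ℂ)‖ₑ
          rw [enorm_mul]
          refine mul_le_of_le_one_left bot_le ?_
          rw [← onee, norm_real]
          exact ofReal_le_one.2 ((cle _ _).trans (om_norm _).le)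
    _ = (∫⁻ φ, 1 ∂m) ^ (q - 1) * ∫⁻ φ, ∫⁻ x : V2, ‖HT F ε x φ‖ₑ ^ q ∂volume ∂m := by
        rw [lcmu _ mq.lintegral_prod_right']; congr 1; exact lintegral_lintegral_swap mq.aemeasurable
    _ ≤ (∫⁻ φ, 1 ∂m) ^ (q - 1) * ∫⁻ φ, C * (∫⁻ x, ‖F x‖ₑ ^ q) * 1 ∂m := by
        gcongr with φ; rw [mul_one]; exact lin φ
    _ = _ := by rw [lcmu _ measurable_const]; ring

def sd {E : Type*} [NormedAddCommGroup E] [NormedSpace ℝ E] (v : E) (h : SchwartzMap E ℂ) : SchwartzMap E ℂ := LineDeriv.lineDerivOp v h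

lemma sd_apply {E : Type*} [NormedAddCommGroup E] [NormedSpace ℝ E] (v : E) (h : SchwartzMap E ℂ) (x : E) : sd v h x = fderiv ℝ h x v := SchwartzMap.lineDerivOp_apply_eq_fderiv v h x

def bv (j : Fin 2) : V2 := EuclideanSpace.single j 1

lemma bv_inner (j : Fin 2) (ξ : V2) : ⟪bv j, ξ⟫ = ξ j := by
  rw [bv, EuclideanSpace.inner_single_left]; simp

lemma SDc {E : Type*} [NormedAddCommGroup E] [NormedSpace ℝ E] (h : SchwartzMap E ℂ) : Dc h := by
  refine ⟨h.continuous, 2^4 * ((Finset.Iic (4, 0)).sup fun m => SchwartzMap.seminorm ℝ m.1 m.2) h, fun u => ?_⟩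
  have h1 := SchwartzMap.one_add_le_sup_seminorm_apply (𝕜 := ℝ) (m := (4, 0)) le_rfl le_rfl h u
  rw [norm_iteratedFDeriv_zero] at h1
  rw [inv_pow, ← div_eq_mul_inv, le_div_iff₀ ps, mul_comm]
  refine (mul_le_mul_of_nonneg_right ?_ (norm_nonneg _)).trans h1
  rw [show (1 + ‖u‖)^4 = ((1 + ‖u‖)^2)^2 by ring]
  gcongr; nlinarith [norm_nonneg u]

lemma IBP {K : V2 → ℂ} (hK : Differentiable ℝ K) {B B' : ℝ} (hB : ∀ x, ‖K x‖ ≤ B) {v : V2} (hB' : ∀ x, ‖fderiv ℝ K x v‖ ≤ B') (hm : Continuous fun x => fderiv ℝ K x v) (h : SchwartzMap V2 ℂ) :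
    ∫ x, K x * sd v h x = -∫ x, fderiv ℝ K x v * h x := by
  have hc := hK.continuous
  simp only [sd_apply]
  refine integral_mul_fderiv_eq_neg_fderiv_mul_of_integrable ?_ ?_ ?_ (fun x _ => hK x) (fun x _ => h.differentiableAt)
  · exact h.integrable.bdd_mul hm.aestronglyMeasurable (of_forall hB')
  · simp only [← sd_apply]; exact (sd v h).integrable.bdd_mul hc.aestronglyMeasurable (of_forall hB)
  · exact h.integrable.bdd_mul hc.aestronglyMeasurable (of_forall hB)

lemma ft2D (h : SchwartzMap V2 ℂ) (j : Fin 2) (ξ : V2) : ft2 (sd (bv j) h) ξ = IC * (ξ j : ℂ) * ft2 h ξ := by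
  have d : ∀ x, HasFDerivAt (fun x : V2 => Complex.exp (-IC * ((⟪x, ξ⟫ : ℝ) : ℂ))) (Complex.exp (-IC * ((⟪x, ξ⟫ : ℝ) : ℂ)) • (-IC) • (ofRealCLM.comp (innerSL ℝ ξ))) x := fun x => by
    have h1 : HasFDerivAt (fun x : V2 => ((⟪x, ξ⟫ : ℝ) : ℂ)) (ofRealCLM.comp (innerSL ℝ ξ)) x := by
      have := (ofRealCLM.comp (innerSL ℝ ξ)).hasFDerivAt (x := x)
      refine this.congr_of_eventuallyEq (of_forall fun y => ?_)
      simp [real_inner_comm]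
    exact (h1.const_mul _).cexp
  have e : ∀ x, fderiv ℝ (fun x : V2 => Complex.exp (-IC * ((⟪x, ξ⟫ : ℝ) : ℂ))) x (bv j) = -(IC * (ξ j : ℂ)) * Complex.exp (-IC * ((⟪x, ξ⟫ : ℝ) : ℂ)) := fun x => by
    rw [(d x).fderiv]; simp [← bv_inner j ξ, real_inner_comm]; ring
  have := IBP (fun x => (d x).differentiableAt) (B := 1) (fun x => (norm_cexp_I _).le) (v := bv j) (B' := |ξ j|) (fun x => by rw [e, norm_mul, norm_neg, norm_mul, norm_cexp_I]; simp) (by simp only [e]; fun_prop) h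
  rw [ft2, this, ft2, ← integral_neg, ← integral_const_mul]
  congr 1; ext x; rw [e]; ring

lemma ft2_lap (G : SchwartzMap V2 ℂ) (F : Fin 2 → SchwartzMap V2 ℂ)
    (hE : ∀ x, sd (bv 0) (sd (bv 0) G) x + sd (bv 1) (sd (bv 1) G) x = sd (bv 0) (F 0) x + sd (bv 1) (F 1) x) (ξ : V2) :
    ((‖ξ‖^2 : ℝ) : ℂ) * ft2 G ξ = -(ft2 (sd (bv 0) (F 0) + sd (bv 1) (F 1) : SchwartzMap V2 ℂ) ξ) := by
  have e : sd (bv 0) (F 0) + sd (bv 1) (F 1) = sd (bv 0) (sd (bv 0) G) + sd (bv 1) (sd (bv 1) G) := by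
    ext x; exact (hE x).symm
  have add : ∀ u v : SchwartzMap V2 ℂ, ft2 (u + v : SchwartzMap V2 ℂ) ξ = ft2 u ξ + ft2 v ξ := fun u v => by
    have i : ∀ u : SchwartzMap V2 ℂ, Integrable fun x : V2 => Complex.exp (-IC * ((⟪x, ξ⟫ : ℝ) : ℂ)) * u x := fun u =>
      u.integrable.bdd_mul (c := 1) fp (of_forall fun x => (norm_cexp_I _).le)
    rw [ft2, ft2, ft2, ← integral_add (i u) (i v)]; congr 1; ext x; rw [SchwartzMap.add_apply]; ring
  rw [e, add, ft2D, ft2D, ft2D, ft2D, norm_sq_eq]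
  simp only [sum_univ_two, norm_eq_abs, sq_abs]
  push_cast
  linear_combination (((ξ 0 : ℂ)^2 + (ξ 1 : ℂ)^2) * ft2 G ξ) * I_sq

lemma ft2_dc (G : SchwartzMap V2 ℂ) : Dc (ft2 G) ∧ ∀ x, ift2 (ft2 G) x = G x := by
  have e : ∀ ξ, ft2 G ξ = FourierTransform.fourier G ((2 * π)⁻¹ • ξ) := fun ξ => by
    rw [fourier_coe, fourier_eq', ft2]
    congr 1; ext x
    rw [smul_eq_mul, inner_smul_right]; congr 2
    push_cast; field_simp
  obtain ⟨hc, M, hM⟩ := SDc (FourierTransform.fourier G)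
  have M0 : 0 ≤ M := by have := (norm_nonneg _).trans (hM 0); simpa using this
  constructor
  · refine ⟨by simp only [funext e]; fun_prop, M * ((1 + (2 * π)^2)^2), fun u => ?_⟩
    rw [e, mul_assoc]
    refine (hM _).trans ?_
    rw [norm_smul, norm_of_nonneg ps, ← mul_pow]
    gcongr
    rw [← div_eq_mul_inv, le_div_iff₀ ps, inv_mul_le_iff₀ ps]
    have : ((2 * π)⁻¹ * ‖u‖)^2 * (2 * π)^2 = ‖u‖^2 := by field_simp
    nlinarith [sq_nonneg ((2 * π)⁻¹ * ‖u‖), sq_nonneg (2 * π)]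
  · intro x
    have := congrArg (fun h : SchwartzMap V2 ℂ => h x) (FourierTransform.fourierInv_fourier_eq (F := SchwartzMap V2 ℂ) G)
    simp only [fourierInv_coe] at this
    rw [← this, fourierInv_eq', ift2]
    have s := integral_comp_smul (volume : Measure V2) (fun ξ => Complex.exp (IC * ((⟪x, ξ⟫ : ℝ) : ℂ)) * ft2 G ξ) (2 * π)
    have e2 : |((2 * π) ^ Module.finrank ℝ V2)⁻¹| = ((2 * π)^2)⁻¹ := by rw [abs_of_pos ps]; simp
    rw [e2, real_smul] at s
    rw [← s]
    congr 1; ext w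
    rw [e, smul_smul, inv_mul_cancel₀ ps, one_smul, smul_eq_mul, inner_smul_right, real_inner_comm]
    congr 2; push_cast; ring

lemma KzR {η : ℝ} (hη : 0 < η) (y : V2) : Kz η y = ((2 * π * η * (η^2 + ‖y‖^2) ^ mth : ℝ) : ℂ) := by
  set g : V2 → ℂ := fun y => ((2 * π * η * (η^2 + ‖y‖^2) ^ mth : ℝ) : ℂ) with hg
  have D : ∀ y : V2, 0 < η^2 + ‖y‖^2 := fun y => by positivity
  have cf : Continuous (Kz η) := by
    unfold Kz
    refine continuous_of_dominated (bound := fun ξ => ‖Complex.exp (-(η:ℂ) * (‖ξ‖ : ℂ))‖) (fun y => by fun_prop) (fun y => of_forall fun ξ => ?_) (Kz_integrable _ (by simpa using hη)).norm (of_forall fun ξ => by fun_prop)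
    rw [norm_mul, norm_cexp_I, one_mul]
  have cg : Continuous g := by
    refine Complex.continuous_ofReal.comp (continuous_const.mul ((by fun_prop : Continuous fun y : V2 => η^2 + ‖y‖^2).rpow_const fun r => inl (D r).ne'))
  have sq : ∀ y, Kz η y ^ 2 = g y ^ 2 := fun y => by
    have h := KM η (by simpa using hη) (y 0) (y 1)
    rw [← Kz_eq η (by simpa using hη)] at h
    have n : y 0 ^ 2 + y 1 ^ 2 = ‖y‖^2 := by rw [norm_sq_eq]; simp [sum_univ_two]
    rw [n] at h
    have e : ((η^2 + ‖y‖^2) ^ mth)^2 = ((η^2 + ‖y‖^2)^3)⁻¹ := by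
      rw [← rpow_natCast, ← rpow_mul (D y).le, ← rpow_natCast _ 3, ← rpow_neg (D y).le]; norm_num
    have nz : ((η:ℂ)^2 + ((‖y‖^2 : ℝ) : ℂ))^3 ≠ 0 := by norm_cast; exact (pow_pos (D y) 3).ne'
    refine mul_right_cancel₀ nz (h.trans ?_)
    simp only [hg]
    norm_cast
    rw [mul_pow, e]; field_simp [(D y).ne']; ring
  rcases isPreconnected_univ.eq_or_eq_neg_of_sq_eq cf.continuousOn cg.continuousOn (fun y _ => sq y) (fun {y} _ => by
    simp only [hg]; norm_cast; have := D y; positivity) with h | h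
  · exact h (mem_univ y)
  · exfalso
    have h0 := congrArg Complex.re (h (mem_univ 0))
    have h1 : 0 ≤ (Kz η 0).re := by
      rw [Kz]
      have : ∫ ξ : V2, Complex.exp (-IC * ((⟪(0:V2), ξ⟫ : ℝ) : ℂ)) * Complex.exp (-(η:ℂ) * (‖ξ‖ : ℂ)) = ((∫ ξ : V2, exp (-η * ‖ξ‖) : ℝ) : ℂ) := by
        rw [← integral_complex_ofReal]; congr 1; ext ξ; simp
      rw [this, ofReal_re]
      exact integral_nonneg fun ξ => (exp_pos _).le
    rw [h0] at h1
    simp only [hg, Pi.neg_apply, Complex.neg_re, ofReal_re] at h1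
    have : 0 < 2 * π * η * (η^2 + ‖(0:V2)‖^2) ^ mth := by have := D 0; positivity
    linarith

lemma POIS (h : SchwartzMap V2 ℂ) {η : ℝ} (hη : 0 < η) (x : V2) :
    ift2 (fun ξ => ((exp (-η * ‖ξ‖) : ℝ) : ℂ) * ft2 h ξ) x = ((((2 * π) ^ 2)⁻¹ : ℝ) : ℂ) * ∫ y, Kz η (y - x) * h y := by
  rw [ift2]; congr 1
  have i : Integrable (fun p : V2 × V2 => (Complex.exp (IC * ((⟪x, p.1⟫ : ℝ) : ℂ)) * Complex.exp (-IC * ((⟪p.2, p.1⟫ : ℝ) : ℂ))) * (((exp (-η * ‖p.1‖) : ℝ) : ℂ) * h p.2)) (volume.prod volume) := by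
    refine ((exp_norm_integrable _ hη).ofReal.mul_prod h.integrable).bdd_mul (c := 1) fp (of_forall fun p => ?_)
    rw [norm_mul, norm_cexp_I, ← neg_neg IC, neg_mul]
    rw [show -(-IC * ((⟪x, p.1⟫ : ℝ) : ℂ)) = -IC * ((-⟪x, p.1⟫ : ℝ) : ℂ) by push_cast; ring, norm_cexp_I]; norm_num
  rw [show (∫ y, Kz η (y - x) * h y) = ∫ y, ∫ ξ, (Complex.exp (IC * ((⟪x, ξ⟫ : ℝ) : ℂ)) * Complex.exp (-IC * ((⟪y, ξ⟫ : ℝ) : ℂ))) * (((exp (-η * ‖ξ‖) : ℝ) : ℂ) * h y) from ?_, ← integral_integral_swap i]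
  · congr 1; ext ξ; rw [ft2, ← integral_const_mul, ← integral_const_mul]; congr 1; ext y; ring
  · congr 1; ext y; rw [Kz, ← integral_mul_const]; congr 1; ext ξ
    rw [inner_sub_left]; push_cast
    rw [show -IC * ((⟪y, ξ⟫ : ℝ) - (⟪x, ξ⟫ : ℝ) : ℂ) = IC * (⟪x, ξ⟫ : ℝ) + -IC * (⟪y, ξ⟫ : ℝ) by ring, Complex.exp_add]; ring

def Qk (η : ℝ) (j : Fin 2) (y : V2) : ℝ := 3 * η * y j * (η^2 + ‖y‖^2) ^ (-(5/2) : ℝ)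

lemma Qk_cont {η : ℝ} (hη : 0 < η) (j : Fin 2) : Continuous (Qk η j) := by
  unfold Qk
  exact (by fun_prop : Continuous fun y : V2 => 3 * η * y j).mul ((by fun_prop : Continuous fun y : V2 => η^2 + ‖y‖^2).rpow_const fun r => inl ps)

lemma Qk_le {η : ℝ} (hη : 0 < η) (j : Fin 2) (y : V2) : |Qk η j y| ≤ 3 * (η^2 + ‖y‖^2) ^ mth := by
  have D : 0 < η^2 + ‖y‖^2 := by positivity
  rw [Qk, abs_mul, abs_mul, abs_of_pos (by positivity : 0 < 3 * η), abs_of_pos (by positivity : 0 < (η^2 + ‖y‖^2) ^ (-(5/2) : ℝ)), mul_assoc, mul_assoc, show mth = 1 + -(5/2) by norm_num, rpow_add D, rpow_one, ← mul_assoc η]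
  gcongr
  nlinarith [cle y j, sq_nonneg (η - |y j|), abs_nonneg (y j), norm_nonneg y]

lemma Qk_bd {η : ℝ} (hη : 0 < η) (j : Fin 2) (y : V2) : |Qk η j y| ≤ 3 * (η^2) ^ mth := by
  refine (Qk_le hη j y).trans ?_
  gcongr ?_ * ?_
  exact rpow_le_rpow_of_nonpos ps (by nlinarith [sq_nonneg ‖y‖]) nu

lemma KzIBP (h : SchwartzMap V2 ℂ) {η : ℝ} (hη : 0 < η) (x : V2) (j : Fin 2) :
    ∫ y, Kz η (y - x) * sd (bv j) h y = -(2 * π * ∫ y, h (x - y) * (Qk η j y : ℂ)) := by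
  have D : ∀ y : V2, 0 < η^2 + ‖y - x‖^2 := fun y => by positivity
  have d : ∀ y : V2, HasFDerivAt (fun y : V2 => Kz η (y - x)) (ofRealCLM.comp ((2 * π * η) • (mth * (η^2 + ‖y - x‖^2) ^ (-(3/2) - 1 : ℝ)) • (2 : ℝ) • innerSL ℝ (y - x))) y := fun y => by
    simp only [fun y => KzR hη (y - x)]
    refine ofRealCLM.hasFDerivAt.comp y ?_
    have h1 : HasFDerivAt (fun y : V2 => η^2 + ‖y - x‖^2) ((2 : ℝ) • innerSL ℝ (y - x)) y := by
      have := (((hasFDerivAt_id y).sub_const x).norm_sq).const_add (η^2)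
      refine this.congr_fderiv ?_
      ext v; simp
    exact (h1.rpow_const (inl (D y).ne')).const_mul _
  have e : ∀ y, fderiv ℝ (fun y : V2 => Kz η (y - x)) y (bv j) = ((-(2 * π) * Qk η j (y - x) : ℝ) : ℂ) := fun y => by
    rw [(d y).fderiv]; 
    simp only [ContinuousLinearMap.comp_apply, ContinuousLinearMap.smul_apply, smul_eq_mul, innerSL_apply_apply, Complex.ofRealCLM_apply]
    rw [real_inner_comm, bv_inner, Qk, show (-(3/2) - 1 : ℝ) = -(5/2) by norm_num]; congr 1; ring
  have b : ∀ y, ‖Kz η (y - x)‖ ≤ 2 * π * η * (η^2) ^ mth := fun y => by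
    rw [KzR hη, norm_real, norm_of_nonneg (by have := D y; positivity)]
    gcongr ?_ * ?_
    exact rpow_le_rpow_of_nonpos ps (by nlinarith [sq_nonneg ‖y - x‖]) nu
  rw [IBP (fun y => (d y).differentiableAt) b (B' := 2 * π * (3 * (η^2) ^ mth)) (fun y => by
    rw [e, norm_real, norm_mul, norm_neg, norm_of_nonneg (by positivity : 0 ≤ 2 * π)]; gcongr; exact Qk_bd hη j _) (by
    simp only [e]; exact Complex.continuous_ofReal.comp (continuous_const.mul ((Qk_cont hη j).comp fp))) h]
  simp only [e]
  rw [← integral_sub_left_eq_self _ volume x, ← integral_const_mul]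
  congr 2; ext y
  rw [show x - y - x = -y by abel]; simp only [Qk, norm_neg, PiLp.neg_apply]; push_cast; ring

def Wp (G : V2 → ℂ) (x : V2) (η : ℝ) : ℂ := ift2 (fun ξ => ((‖ξ‖^2 * exp (-η * ‖ξ‖) : ℝ) : ℂ) * ft2 G ξ) x

lemma WREP (G : SchwartzMap V2 ℂ) (F : Fin 2 → SchwartzMap V2 ℂ)
    (hE : ∀ x, sd (bv 0) (sd (bv 0) G) x + sd (bv 1) (sd (bv 1) G) x = sd (bv 0) (F 0) x + sd (bv 1) (F 1) x) {η : ℝ} (hη : 0 < η) (x : V2) :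
    Wp G x η = (2 * π : ℂ)⁻¹ * ∑ j, ∫ y, F j (x - y) * (Qk η j y : ℂ) := by
  have e : Wp G x η = -ift2 (fun ξ => ((exp (-η * ‖ξ‖) : ℝ) : ℂ) * ft2 (sd (bv 0) (F 0) + sd (bv 1) (F 1) : SchwartzMap V2 ℂ) ξ) x := by
    rw [Wp, ift2, ift2, ← mul_neg, ← integral_neg]; congr 2; ext ξ
    have := ft2_lap G F hE ξ
    push_cast at this ⊢
    linear_combination Complex.exp (IC * (⟪x, ξ⟫ : ℝ)) * Complex.exp (-η * ‖ξ‖) * this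
  have i : ∀ h : SchwartzMap V2 ℂ, Integrable fun y => Kz η (y - x) * h y := fun h => by
    refine h.integrable.bdd_mul (c := ∫ ξ : V2, exp (-η * ‖ξ‖)) ((Kz_meas _).comp (measurable_id.sub_const x)).aestronglyMeasurable (of_forall fun y => ?_)
    refine (norm_integral_le_integral_norm _).trans (le_of_eq ?_)
    congr 1; ext ξ; rw [norm_mul, norm_cexp_I, one_mul, norm_exp]; simp
  rw [e, POIS _ hη]
  simp only [SchwartzMap.add_apply, mul_add]
  rw [integral_add (i _) (i _), KzIBP _ hη, KzIBP _ hη, sum_univ_two]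
  push_cast; field_simp; ring

lemma Dint (G : SchwartzMap V2 ℂ) {a : ℝ} (ha : 0 ≤ a) (ha1 : a ≤ 1) : Integrable fun ξ : V2 => ‖ξ‖ ^ a * ‖ft2 G ξ‖ := by
  obtain ⟨⟨hc, M, hM⟩, -⟩ := ft2_dc G
  have I := (integrable_one_add_norm (E := V2) (μ := volume) (r := 3) (by simp; norm_num)).const_mul (M * 4)
  refine I.mono' (((continuous_norm.rpow_const fun _ => inr ha).mul hc.norm).aestronglyMeasurable) (of_forall fun ξ => ?_)
  have M0 : 0 ≤ M := by have := (norm_nonneg _).trans (hM 0); simpa using this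
  have n := norm_nonneg ξ
  have h1 : ‖ξ‖ ^ a ≤ 1 + ‖ξ‖ := by
    calc ‖ξ‖ ^ a ≤ (1 + ‖ξ‖) ^ a := by gcongr; linarith
      _ ≤ (1 + ‖ξ‖) ^ (1:ℝ) := by gcongr; linarith
      _ = _ := rpow_one _
  rw [norm_of_nonneg ps]
  refine (mul_le_mul h1 (hM ξ) (norm_nonneg _) ps).trans ?_
  rw [show (-3 : ℝ) = -((3:ℕ):ℝ) by norm_num, rpow_neg ps, rpow_natCast, ← div_eq_mul_inv _ ((1 + ‖ξ‖)^3), le_div_iff₀ ps]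
  have : (1 + ‖ξ‖) * (M * ((1 + ‖ξ‖^2)⁻¹)^2) * (1 + ‖ξ‖)^3 = M * ((1 + ‖ξ‖)^2 * (1 + ‖ξ‖^2)⁻¹)^2 := by ring
  rw [this]
  have h2 : (1 + ‖ξ‖)^2 * (1 + ‖ξ‖^2)⁻¹ ≤ 2 := by
    rw [← div_eq_mul_inv, div_le_iff₀ ps]; nlinarith [sq_nonneg (‖ξ‖ - 1)]
  have h3 : ((1 + ‖ξ‖)^2 * (1 + ‖ξ‖^2)⁻¹)^2 ≤ 2^2 := by gcongr
  nlinarith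

lemma DREP (G : SchwartzMap V2 ℂ) {a : ℝ} (ha : 0 ≤ a) (ha1 : a ≤ 1) (x : V2) :
    IntegrableOn (fun η => ((η ^ (1 - a) : ℝ) : ℂ) * Wp G x η) (Ioi 0) ∧
    (Real.Gamma (2 - a) : ℂ) * ift2 (fun ξ => ((‖ξ‖ ^ a : ℝ) : ℂ) * ft2 G ξ) x = ∫ η in Iop, ((η ^ (1 - a) : ℝ) : ℂ) * Wp G x η := by
  have hc := (ft2_dc G).1.1
  set e : V2 → ℂ := fun ξ => Complex.exp (IC * ((⟪x, ξ⟫ : ℝ) : ℂ)) * ft2 G ξ with he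
  have en : ∀ ξ, ‖e ξ‖ = ‖ft2 G ξ‖ := fun ξ => by
    rw [he]; simp only []
    rw [norm_mul, show IC * ((⟪x, ξ⟫ : ℝ) : ℂ) = -IC * ((-⟪x, ξ⟫ : ℝ) : ℂ) by push_cast; ring, norm_cexp_I, one_mul]
  have g0 : 0 < Real.Gamma (2 - a) := Real.Gamma_pos_of_pos la
  have V : ∀ ξ : V2, ξ ≠ 0 → ∫ η in Iop, η ^ (1 - a) * (‖ξ‖^2 * exp (-η * ‖ξ‖)) = Real.Gamma (2 - a) * ‖ξ‖ ^ a := fun ξ hξ => by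
    have n : 0 < ‖ξ‖ := norm_pos_iff.2 hξ
    have := Real.integral_rpow_mul_exp_neg_mul_Ioi (a := 2 - a) la n
    have e1 : ∀ η : ℝ, η ^ (1 - a) * (‖ξ‖^2 * exp (-η * ‖ξ‖)) = ‖ξ‖^2 * (η ^ (2 - a - 1) * exp (-(‖ξ‖ * η))) := fun η => by
      rw [show 2 - a - 1 = 1 - a by ring, show -η * ‖ξ‖ = -(‖ξ‖ * η) by ring]; ring
    simp only [e1]
    rw [integral_const_mul, this, one_div, inv_rpow n.le, ← rpow_neg n.le, ← mul_assoc, ← rpow_natCast, ← rpow_add n, mul_comm]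
    norm_num
  have ne : ∀ᵐ ξ : V2, ξ ≠ 0 := by simp [ae_iff]
  have m : Measurable fun p : RV => p.1 ^ (1 - a) * (‖p.2‖^2 * exp (-p.1 * ‖p.2‖)) := by fun_prop
  have em : Continuous e := by rw [he]; fun_prop
  have I : Integrable (fun p : V2 × ℝ => e p.1 * ((p.2 ^ (1 - a) * (‖p.1‖^2 * exp (-p.2 * ‖p.1‖)) : ℝ) : ℂ)) (volume.prod (volume.restrict (Ioi 0))) := by
    have mm : Measurable fun p : V2 × ℝ => e p.1 * ((p.2 ^ (1 - a) * (‖p.1‖^2 * exp (-p.2 * ‖p.1‖)) : ℝ) : ℂ) := (em.measurable.comp measurable_fst).mul (measurable_ofReal.comp (m.comp measurable_swap))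
    rw [integrable_prod_iff mm.aestronglyMeasurable]
    constructor
    · filter_upwards [ne] with ξ hξ
      refine Integrable.const_mul (Integrable.ofReal (Integrable.of_integral_ne_zero ?_)) _
      refine (V ξ hξ).trans_ne ?_; have n : 0 < ‖ξ‖ := norm_pos_iff.2 hξ; positivity
    · refine ((Dint G ha ha1).const_mul (Real.Gamma (2 - a))).congr ?_
      filter_upwards [ne] with ξ hξ
      rw [show ∫ η in Iop, ‖e ξ * ((η ^ (1 - a) * (‖ξ‖^2 * exp (-η * ‖ξ‖)) : ℝ) : ℂ)‖ = ∫ η in Iop, ‖ft2 G ξ‖ * (η ^ (1 - a) * (‖ξ‖^2 * exp (-η * ‖ξ‖))) from setIntegral_congr_fun measurableSet_Ioi fun η hη => ?_, integral_const_mul, V ξ hξ]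
      · ring
      · have : (0:ℝ) < η := hη
        rw [norm_mul, en, norm_real, norm_of_nonneg ps]
  have eW : (fun η => ((η ^ (1 - a) : ℝ) : ℂ) * Wp G x η) = fun η => ((((2 * π) ^ 2)⁻¹ : ℝ) : ℂ) * ∫ ξ, e ξ * ((η ^ (1 - a) * (‖ξ‖^2 * exp (-η * ‖ξ‖)) : ℝ) : ℂ) := by
    ext η; rw [Wp, ift2, mul_left_comm, ← integral_const_mul]; congr 2; ext ξ; rw [he]; push_cast; ring
  rw [eW]
  refine ⟨I.swap.integral_prod_left.const_mul _, ?_⟩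
  rw [integral_const_mul, ← integral_integral_swap I, ift2, mul_left_comm, ← integral_const_mul]
  congr 1; refine integral_congr_ae ?_
  filter_upwards [ne] with ξ hξ
  rw [integral_const_mul, integral_complex_ofReal, V ξ hξ, he]; push_cast; ring

def LEq (G : SchwartzMap V2 ℂ) (F : Fin 2 → SchwartzMap V2 ℂ) : Prop :=
  ∀ x, sd (bv 0) (sd (bv 0) G) x + sd (bv 1) (sd (bv 1) G) x = sd (bv 0) (F 0) x + sd (bv 1) (F 1) x

lemma tp1 : ‖(2 * π : ℂ)⁻¹‖ₑ ≤ 1 := by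
  rw [← onee, norm_inv, norm_mul, norm_real, Complex.norm_ofNat, norm_of_nonneg pi_pos.le]
  refine ofReal_le_one.2 (inv_le_one_of_one_le₀ ?_)
  nlinarith [pi_gt_three]

lemma Wle (G : SchwartzMap V2 ℂ) (F : Fin 2 → SchwartzMap V2 ℂ) (hE : LEq G F) {η : ℝ} (hη : 0 < η) (x : V2) :
    ‖Wp G x η‖ₑ ≤ ∫⁻ y, (‖F 0 y‖ₑ + ‖F 1 y‖ₑ) * ofReal (3 * (η^2 + ‖x - y‖^2) ^ mth) := by
  have h : ∀ j, ‖∫ y, F j (x - y) * (Qk η j y : ℂ)‖ₑ ≤ ∫⁻ y, ‖F j y‖ₑ * ofReal (3 * (η^2 + ‖x - y‖^2) ^ mth) := fun j => by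
    rw [← lintegral_sub_left_eq_self _ x]
    refine (eile _).trans (lintegral_mono fun y => ?_)
    rw [enorm_mul, sub_sub_cancel]
    refine mul_le_mul_right ?_ _
    rw [← onee, norm_real]
    exact ofReal_le_ofReal (Qk_le hη j y)
  rw [WREP G F hE hη, enorm_mul, sum_univ_two]
  refine (mul_le_mul_left tp1 _).trans ?_
  rw [one_mul]
  refine (enorm_add_le _ _).trans ((add_le_add (h 0) (h 1)).trans ?_)
  have m : Measurable fun y => ‖F 0 y‖ₑ * ofReal (3 * (η^2 + ‖x - y‖^2) ^ mth) := (F 0).continuous.measurable.enorm.mul fp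
  rw [← lintegral_add_left m]
  simp only [add_mul, le_refl]

lemma DL {a : ℝ} (ha : 0 ≤ a) (ha1 : a < 1) : ∃ C : ENN, C ≠ ⊤ ∧ ∀ G F, LEq G F → ∀ x,
    ‖ift2 (fun ξ => ((‖ξ‖ ^ a : ℝ) : ℂ) * ft2 G ξ) x‖ₑ ≤ C * ∫⁻ y, (‖F 0 y‖ₑ + ‖F 1 y‖ₑ) * edist x y ^ (-(1 + a)) := by
  have g0 : 0 < Real.Gamma (2 - a) := Real.Gamma_pos_of_pos la
  set c := ofReal (60 * ((3 - 2 * ((1 + a)/2))⁻¹ + (2 * ((1 + a)/2))⁻¹)) with hc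
  set g := ofReal (Real.Gamma (2 - a)) with hg
  have gn : g ≠ 0 := (ENNReal.ofReal_pos.2 g0).ne'
  refine ⟨g⁻¹ * c, ENNReal.mul_ne_top (ENNReal.inv_ne_top.2 gn) ENNReal.ofReal_ne_top, fun G F hE x => ?_⟩
  rw [mul_assoc, ← ENNReal.mul_le_iff_le_inv gn ENNReal.ofReal_ne_top]
  have h := congrArg enorm (DREP G ha ha1.le x).2
  rw [enorm_mul, ← onee, norm_real, norm_of_nonneg g0.le] at h
  rw [h]
  refine (eile _).trans ?_
  have m : Measurable fun y => ‖F 0 y‖ₑ + ‖F 1 y‖ₑ := (F 0).continuous.measurable.enorm.add (F 1).continuous.measurable.enorm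
  have mk : Measurable fun p : RV => ofReal (p.1 ^ (-a)) * ofReal (60 * (p.1 * (p.1^2 + ‖x - p.2‖^2) ^ mth)) := by fun_prop
  have mm : Measurable fun p : RV => (‖F 0 p.2‖ₑ + ‖F 1 p.2‖ₑ) * (ofReal (p.1 ^ (-a)) * ofReal (60 * (p.1 * (p.1^2 + ‖x - p.2‖^2) ^ mth))) := (m.comp measurable_snd).mul mk
  calc _ ≤ ∫⁻ η in Iop, ∫⁻ y, (‖F 0 y‖ₑ + ‖F 1 y‖ₑ) * (ofReal (η ^ (-a)) * ofReal (60 * (η * (η^2 + ‖x - y‖^2) ^ mth))) := by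
        refine setLIntegral_mono' measurableSet_Ioi fun η hη => ?_
        have p : 0 < η := hη
        rw [enorm_mul]
        refine (mul_le_mul_right (Wle G F hE p x) _).trans ?_
        rw [← lintegral_const_mul' _ _ enorm_ne_top]
        refine lintegral_mono fun y => ?_
        rw [mul_left_comm]
        refine mul_le_mul_right ?_ _
        have D : 0 < η^2 + ‖x - y‖^2 := by positivity
        rw [← onee, norm_real, norm_of_nonneg ps, ← ofReal_mul ps, ← ofReal_mul ps]
        refine ofReal_le_ofReal ?_
        rw [show 1 - a = -a + 1 by ring, rpow_add p, rpow_one]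
        have : 0 ≤ η ^ (-a) * η * (η^2 + ‖x - y‖^2) ^ mth := by positivity
        nlinarith
    _ = ∫⁻ y, ∫⁻ η in Iop, (‖F 0 y‖ₑ + ‖F 1 y‖ₑ) * (ofReal (η ^ (-a)) * ofReal (60 * (η * (η^2 + ‖x - y‖^2) ^ mth))) := lintegral_lintegral_swap mm.aemeasurable
    _ ≤ ∫⁻ y, c * ((‖F 0 y‖ₑ + ‖F 1 y‖ₑ) * edist x y ^ (-(1 + a))) := by
        refine lintegral_mono fun y => ?_
        beta_reduce
        rw [lintegral_const_mul' _ _ (by finiteness), mul_left_comm]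
        refine mul_le_mul_right ?_ _
        have := kI (y := (1 + a)/2) la la x y
        rw [show 2 * (1 - (1 + a)/2) - 1 = -a by ring, show -(2 * ((1 + a)/2)) = -(1 + a) by ring] at this
        exact this
    _ = _ := lintegral_const_mul' _ _ ENNReal.ofReal_ne_top

lemma QI {ε : ℝ} (hε : 0 < ε) : IntegrableOn (fun η : ℝ => 3 * η ^ (-3 : ℝ)) (Ioi ε) :=
  (integrableOn_Ioi_rpow_of_lt nu hε).const_mul 3

lemma Qk_le3 {η : ℝ} (hη : 0 < η) (j : Fin 2) (y : V2) : |Qk η j y| ≤ 3 * η ^ (-3 : ℝ) := by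
  have := Qk_bd hη j y
  rwa [← rpow_natCast, ← rpow_mul hη.le, show ((2:ℕ):ℝ) * -(3/2) = -3 by norm_num] at this

lemma Qk_meas (j : Fin 2) : Measurable fun p : RV => Qk p.1 j p.2 := by unfold Qk; fun_prop

lemma Qint {ε : ℝ} (hε : 0 < ε) (j : Fin 2) (y : V2) : ∫ η in Ioi ε, Qk η j y = rk ε j y := by
  have D : ∀ η ∈ Ici ε, 0 < η^2 + ‖y‖^2 := fun η h => by have : 0 < η := hε.trans_le h; positivity
  have hd : ∀ η ∈ Ici ε, HasDerivAt (fun η => -(y j * (η^2 + ‖y‖^2) ^ mth)) (Qk η j y) η := fun η h => by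
    have := ((((hasDerivAt_pow 2 η).add_const (‖y‖^2)).rpow_const (p := -(3/2)) (inl (D η h).ne')).const_mul (y j)).neg
    refine this.congr_deriv ?_
    rw [Qk, show (-(3/2) - 1 : ℝ) = -(5/2) by norm_num]; push_cast; ring
  have i : IntegrableOn (fun η => Qk η j y) (Ioi ε) := by
    refine Integrable.mono' (QI hε) ((Qk_meas j).comp (measurable_id.prodMk measurable_const)).aestronglyMeasurable ?_
    filter_upwards [ae_restrict_mem measurableSet_Ioi] with η h
    exact Qk_le3 (hε.trans h) j y
  have t : Tendsto (fun η : ℝ => -(y j * (η^2 + ‖y‖^2) ^ mth)) atTop (nhds (-(y j * 0))) := by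
    refine (((tendsto_rpow_neg_atTop nu).comp ?_).const_mul _).neg
    exact Filter.tendsto_atTop_add_const_right _ _ (Filter.tendsto_pow_atTop nu)
  rw [integral_Ioi_of_hasDerivAt_of_tendsto' hd i t, rk]; ring

lemma Wtr (G : SchwartzMap V2 ℂ) (F : Fin 2 → SchwartzMap V2 ℂ) (hE : LEq G F) {ε : ℝ} (hε : 0 < ε) (x : V2) :
    ∫ η in Ioi ε, Wp G x η = (2 * π : ℂ)⁻¹ * ∑ j, ∫ y, F j (x - y) * (rk ε j y : ℂ) := by
  have I : ∀ j, Integrable (fun p : RV => F j (x - p.2) * (Qk p.1 j p.2 : ℂ)) ((volume.restrict (Ioi ε)).prod volume) := fun j => by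
    refine ((QI hε).mul_prod ((F j).integrable.comp_sub_left x).norm).mono' (((F j).continuous.measurable.comp (measurable_const.sub measurable_snd)).mul (measurable_ofReal.comp (Qk_meas j))).aestronglyMeasurable ?_
    have : ∀ᵐ p ∂((volume.restrict (Ioi ε)).prod (volume : Measure V2)), p.1 ∈ Ioi ε :=
      Measure.quasiMeasurePreserving_fst.ae (ae_restrict_mem measurableSet_Ioi)
    filter_upwards [this] with p h
    rw [norm_mul, mul_comm, norm_real]
    gcongr
    exact Qk_le3 (hε.trans h) j _
  rw [setIntegral_congr_fun measurableSet_Ioi fun η hη => WREP G F hE (hε.trans hη) x, integral_const_mul, integral_finsetSum _ fun j _ => (I j).integral_prod_left]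
  congr 1; refine Finset.sum_congr rfl fun j _ => ?_
  rw [integral_integral_swap (I j)]
  congr 1; ext y
  dsimp only
  rw [integral_const_mul, integral_complex_ofReal, Qint hε]

lemma D1 {q : ℝ} (hq : 1 < q) (hq2 : q < 2) : ∃ C : ENN, C ≠ ⊤ ∧ ∀ G F, LEq G F →
    ∫⁻ x, ‖ift2 (fun ξ => ((‖ξ‖ ^ (1:ℝ) : ℝ) : ℂ) * ft2 G ξ) x‖ₑ ^ q ≤ C * ∫⁻ x, (‖F 0 x‖ₑ + ‖F 1 x‖ₑ) ^ q := by
  obtain ⟨C, hC, R⟩ := R2 hq hq2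
  refine ⟨2 ^ (q - 1) * (C + C), by finiteness, fun G F hE => ?_⟩
  set e : ℕ → ℝ := fun n => 1 / ((n:ℝ) + 1) with he
  have e0 : ∀ n, 0 < e n := fun n => by simp only [he]; positivity
  set T : ℕ → V2 → ℂ := fun n x => ∫ η in Ioi (e n), Wp G x η with hT
  have lim : ∀ x, Tendsto (fun n => T n x) atTop (nhds (ift2 (fun ξ => ((‖ξ‖ ^ (1:ℝ) : ℝ) : ℂ) * ft2 G ξ) x)) := fun x => by
    obtain ⟨i, h⟩ := DREP G (a := 1) nu le_rfl x
    simp only [sub_self, rpow_zero, Complex.ofReal_one, one_mul] at i h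
    rw [show (2 - 1 : ℝ) = 1 by norm_num, Real.Gamma_one, Complex.ofReal_one, one_mul] at h
    rw [h]
    have U : ⋃ n, Ioi (e n) = Ioi 0 := by
      ext r; simp only [mem_iUnion, mem_Ioi]
      exact ⟨fun ⟨n, h⟩ => (e0 n).trans h, fun h => exists_nat_one_div_lt h⟩
    have := tendsto_setIntegral_of_monotone (μ := volume) (f := Wp G x) (s := fun n => Ioi (e n)) (fun n => measurableSet_Ioi) (fun m n h => Ioi_subset_Ioi (Nat.one_div_le_one_div h)) (by rw [U]; exact i)
    rwa [U] at this
  have Te : ∀ n x, T n x = (2 * π : ℂ)⁻¹ * ∑ j, ∫ y, F j (x - y) * (rk (e n) j y : ℂ) := fun n x => Wtr G F hE (e0 n) x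
  have mJ : ∀ n j, Measurable fun x => ∫ y, F j (x - y) * (rk (e n) j y : ℂ) := fun n j => by
    have c : Continuous fun p : V2 × V2 => F j (p.1 - p.2) * (rk (e n) j p.2 : ℂ) :=
      ((F j).continuous.comp fp).mul (Complex.continuous_ofReal.comp ((rk_cont (e0 n) j).comp continuous_snd))
    exact c.stronglyMeasurable.integral_prod_right.measurable
  have mT : ∀ n, Measurable (T n) := fun n => by
    rw [funext (Te n)]; exact (Finset.measurable_fun_sum _ fun j _ => mJ n j).const_mul _
  have B : ∀ n, ∫⁻ x, ‖T n x‖ₑ ^ q ≤ 2 ^ (q - 1) * (C + C) * ∫⁻ x, (‖F 0 x‖ₑ + ‖F 1 x‖ₑ) ^ q := fun n => by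
    have mj : ∀ j, Measurable fun x => ‖∫ y, F j (x - y) * (rk (e n) j y : ℂ)‖ₑ ^ q := fun j => (mJ n j).enorm.pow_const q
    calc _ ≤ ∫⁻ x, 2 ^ (q - 1) * (‖∫ y, F 0 (x - y) * (rk (e n) 0 y : ℂ)‖ₑ ^ q + ‖∫ y, F 1 (x - y) * (rk (e n) 1 y : ℂ)‖ₑ ^ q) := by
          refine lintegral_mono fun x => ?_
          rw [Te, enorm_mul, sum_univ_two]
          refine (ENNReal.rpow_le_rpow ((mul_le_mul_left tp1 _).trans ((one_mul _).le.trans (enorm_add_le _ _))) la).trans ?_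
          exact ENNReal.rpow_add_le_mul_rpow_add_rpow _ _ hq.le
      _ ≤ 2 ^ (q - 1) * (C * ∫⁻ x, ‖F 0 x‖ₑ ^ q) + 2 ^ (q - 1) * (C * ∫⁻ x, ‖F 1 x‖ₑ ^ q) := by
          rw [lintegral_const_mul' _ _ (by finiteness), lintegral_add_left (mj 0), ← mul_add]
          gcongr <;> exact R _ (e0 n) _ _ (SDc _)
      _ ≤ _ := by
          rw [mul_assoc, ← mul_add, add_mul]
          gcongr <;> simp
  calc _ = ∫⁻ x, Filter.liminf (fun n => ‖T n x‖ₑ ^ q) atTop := by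
        congr 1; ext x
        exact ((ENNReal.continuous_rpow_const.tendsto _).comp ((continuous_enorm.tendsto _).comp (lim x))).liminf_eq.symm
    _ ≤ _ := (lintegral_liminf_le fun n => (mT n).enorm.pow_const q).trans (Filter.liminf_le_of_le (by isBoundedDefault) fun b hb => by
        obtain ⟨n, hn⟩ := hb.exists; exact hn.trans (B n))

lemma sl_tg (t : ℝ) : (fun y : V2 => (t, y)).HasTemperateGrowth := by
  have h := (Function.HasTemperateGrowth.const ((t, 0) : RV)).add (ContinuousLinearMap.inr ℝ ℝ V2).hasTemperateGrowth
  refine (congrArg Function.HasTemperateGrowth (funext fun y => ?_)).mp h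
  simp

def sl (t : ℝ) (u : SW) : SchwartzMap V2 ℂ :=
  SchwartzMap.compCLM ℝ (sl_tg t) ⟨1, 1, fun y => by
    have : ‖y‖ ≤ ‖(t, y)‖ := le_max_right _ _
    linarith⟩ u

lemma sl_apply (t : ℝ) (u : SW) (y : V2) : sl t u y = u (t, y) := rfl

def px (j : Fin 2) (u : SW) : SW := sd ((0:ℝ), bv j) u

lemma px_eq (j : Fin 2) (u : SW) : ⇑(px j u) = pdx j u := funext fun p => sd_apply _ u p

lemma sl_px (t : ℝ) (j : Fin 2) (u : SW) : sd (bv j) (sl t u) = sl t (px j u) := by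
  ext y
  rw [sd_apply, sl_apply, px, sd_apply]
  have h1 : HasFDerivAt (fun y : V2 => (t, y)) (ContinuousLinearMap.inr ℝ ℝ V2) y := hasFDerivAt_prodMk_right t y
  have : HasFDerivAt (sl t u) _ y := (u.differentiableAt (x := (t, y))).hasFDerivAt.comp y h1
  rw [this.fderiv]; simp

def sm (u v : SW) : SW :=
  SchwartzMap.bilinLeftCLM (ContinuousLinearMap.mul ℝ ℂ) v.hasTemperateGrowth u

lemma sm_apply (u v : SW) (p : RV) : sm u v p = u p * v p := rfl

def mc {n : ℕ} (U V : Fin n → Fin n → SW) (i k : Fin n) : SW :=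
  (∑ l, sm (U i l) (V l k)) - ∑ l, sm (V i l) (U l k)

lemma mc_eq {n : ℕ} (U V : Fin n → Fin n → SW) (i k : Fin n) : ⇑(mc U V i k) = mcomm (cF U) (cF V) i k := by
  ext p; rw [mc, mcomm, SchwartzMap.sub_apply, sum_apply, sum_apply]; rfl

def pm {n : ℕ} (j : Fin 2) (f : Fin n → Fin n → SW) : Fin n → Fin n → SW := fun i k => px j (f i k)

lemma pm_eq {n : ℕ} (j : Fin 2) (f : Fin n → Fin n → SW) : pdf j f = cF (pm j f) := by
  ext i k p; exact (congrFun (px_eq j (f i k)) p).symm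

def FF {n : ℕ} (A f φ : Fin n → Fin n → SW) (i k : Fin n) : Fin 2 → SW :=
  ![mc (pm 0 f) φ i k - mc A (pm 1 f) i k, mc A (pm 0 f) i k + mc (pm 1 f) φ i k]

lemma FF_LEq {n : ℕ} {A f φ : Fin n → Fin n → SW} (h : EllipticEq A f φ) (i k : Fin n) (t : ℝ) :
    LEq (sl t (A i k)) (fun j => sl t (FF A f φ i k j)) := by
  intro x
  have h := h i k (t, x)
  simp only [sl_px, sl_apply]
  simp only [pm_eq, ← mc_eq, ← px_eq] at h
  rw [h]
  simp only [FF, px, sd_apply, Matrix.cons_val_zero, Matrix.cons_val_one]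
  have d : ∀ u : SW, DifferentiableAt ℝ u (t, x) := fun u => u.differentiableAt
  have e1 : fderiv ℝ ⇑(mc (pm 0 f) φ i k - mc A (pm 1 f) i k) (t, x) = _ := fderiv_sub (d (mc (pm 0 f) φ i k)) (d (mc A (pm 1 f) i k))
  have e2 : fderiv ℝ ⇑(mc A (pm 0 f) i k + mc (pm 1 f) φ i k) (t, x) = _ := fderiv_add (d (mc A (pm 0 f) i k)) (d (mc (pm 1 f) φ i k))
  rw [e1, e2, ContinuousLinearMap.sub_apply, ContinuousLinearMap.add_apply]
  ring

lemma mE_mul {n : ℕ} (U V : Fin n → Fin n → SW) (i k : Fin n) (p : RV) : ‖mc U V i k p‖ₑ ≤ 2 * (mE (cF U) p * mE (cF V) p) := by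
  have e : ∀ (W : Fin n → Fin n → SW) i k, ‖W i k p‖ₑ ≤ mE (cF W) p := fun W i k =>
    (Finset.single_le_sum (f := fun k => ‖W i k p‖ₑ) (fun _ _ => bot_le) (Finset.mem_univ k)).trans (Finset.single_le_sum (f := fun i => ∑ k, ‖W i k p‖ₑ) (fun _ _ => bot_le) (Finset.mem_univ i))
  have key : ∀ U V : Fin n → Fin n → SW, ‖∑ l, U i l p * V l k p‖ₑ ≤ mE (cF U) p * mE (cF V) p := fun U V => by
    refine (enorm_sum_le _ _).trans ?_
    calc _ ≤ ∑ l, ‖U i l p‖ₑ * mE (cF V) p := Finset.sum_le_sum fun l _ => by rw [enorm_mul]; exact mul_le_mul_right (e V l k) _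
      _ = (∑ l, ‖U i l p‖ₑ) * mE (cF V) p := by rw [Finset.sum_mul]
      _ ≤ _ := mul_le_mul_left (Finset.single_le_sum (f := fun i => ∑ k, ‖U i k p‖ₑ) (fun _ _ => bot_le) (Finset.mem_univ i)) _
  rw [mc_eq, mcomm, two_mul]
  refine (enorm_sub_le).trans (add_le_add (key U V) ?_)
  rw [mul_comm]; exact key V U

def Sg {n : ℕ} (f : Fin n → Fin n → SW) (p : RV) : ENN := mE (cF (pm 0 f)) p + mE (cF (pm 1 f)) p

def Hs {n : ℕ} (A f φ : Fin n → Fin n → SW) (p : RV) : ENN := 2 * (mE (cF A) p * Sg f p) + 2 * (Sg f p * mE (cF φ) p)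

lemma FF_le {n : ℕ} (A f φ : Fin n → Fin n → SW) (i k : Fin n) (p : RV) : ‖FF A f φ i k 0 p‖ₑ + ‖FF A f φ i k 1 p‖ₑ ≤ Hs A f φ p := by
  simp only [FF, Matrix.cons_val_zero, Matrix.cons_val_one, SchwartzMap.sub_apply, SchwartzMap.add_apply]
  refine (add_le_add ((enorm_sub_le).trans (add_le_add (mE_mul _ _ i k p) (mE_mul _ _ i k p))) ((enorm_add_le _ _).trans (add_le_add (mE_mul _ _ i k p) (mE_mul _ _ i k p)))).trans (le_of_eq ?_)
  rw [Hs, Sg]; ring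

lemma mE_meas {n : ℕ} (A : Fin n → Fin n → SW) : Measurable (mE (cF A)) :=
  Finset.measurable_fun_sum _ fun i _ => Finset.measurable_fun_sum _ fun k _ => (A i k).continuous.measurable.enorm

lemma Sg_meas {n : ℕ} (f : Fin n → Fin n → SW) : Measurable (Sg f) := (mE_meas _).add (mE_meas _)

lemma Hs_meas {n : ℕ} (A f φ : Fin n → Fin n → SW) : Measurable (Hs A f φ) :=
  (((mE_meas _).mul (Sg_meas _)).const_mul 2).add (((Sg_meas _).mul (mE_meas _)).const_mul 2)

def Ia (a : ℝ) (w : V2 → ENN) (z : V2) : ENN := if a < 1 then ∫⁻ z', w z' * edist z z' ^ (-(1 + a)) else w z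

lemma KEY {a y : ℝ} (n : ℕ) (ha : 0 ≤ a) (ha1 : a ≤ 1) (hy : a / 2 < y) (hy1 : y < 1) : ∃ C : ENN, C ≠ ⊤ ∧ ∀ A f φ : Fin n → Fin n → SW, EllipticEq A f φ → ∀ t,
    LqAt y⁻¹ (DxU a (cF A)) t ≤ C * (∫⁻ x, Ia a (fun z => Hs A f φ (t, z)) x ^ y⁻¹) ^ y := by
  have y0 : 0 < y := by linarith
  have q1 : 1 < y⁻¹ := (one_lt_inv₀ y0).2 hy1
  rcases ha1.lt_or_eq with h | rfl
  · obtain ⟨C, hC, H⟩ := DL ha h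
    refine ⟨n * (n * C), by finiteness, fun A f φ hE t => ?_⟩
    have key : ∀ x, mE (DxU a (cF A)) (t, x) ≤ n * (n * C) * Ia a (fun z => Hs A f φ (t, z)) x := fun x => by
      have b : ∀ i k, ‖DxA a (A i k) (t, x)‖ₑ ≤ C * Ia a (fun z => Hs A f φ (t, z)) x := fun i k => by
        refine (H _ _ (FF_LEq hE i k t) x).trans ?_
        rw [Ia, if_pos h]
        gcongr with z
        exact FF_le A f φ i k (t, z)
      refine (Finset.sum_le_sum fun i _ => Finset.sum_le_sum fun k _ => b i k).trans ?_
      simp [mul_assoc]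
    calc _ ≤ (∫⁻ x, (n * (n * C)) ^ y⁻¹ * Ia a (fun z => Hs A f φ (t, z)) x ^ y⁻¹) ^ y := by
          rw [LqAt, inv_inv]
          gcongr with x
          exact (ENNReal.rpow_le_rpow (key x) ps).trans (Emn _ _ ps).le
      _ = _ := by
          rw [lintegral_const_mul' _ _ (by finiteness), Emn _ _ y0.le, ← Erm, inv_mul_cancel₀ y0.ne', ENNReal.rpow_one]
  · obtain ⟨C, hC, H⟩ := D1 q1 (inv_lt_of_inv_lt₀ nu la)
    set c : ENN := (n ^ (y⁻¹ - 1) * (n * (n ^ (y⁻¹ - 1) * (n * C)))) with hc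
    have nn : ((n : ENN) ^ (y⁻¹ - 1)) ≠ ⊤ := Ert la (by simp)
    refine ⟨c ^ y, Ert y0.le (by finiteness), fun A f φ hE t => ?_⟩
    rw [LqAt, inv_inv, ← Emn _ _ y0.le]
    refine ENNReal.rpow_le_rpow ?_ y0.le
    have b : ∀ i k, ∫⁻ x, ‖DxA 1 (A i k) (t, x)‖ₑ ^ y⁻¹ ≤ C * ∫⁻ x, Ia 1 (fun z => Hs A f φ (t, z)) x ^ y⁻¹ := fun i k => by
      refine (H _ _ (FF_LEq hE i k t)).trans ?_
      simp only [Ia, lt_irrefl, if_false]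
      gcongr with z
      exact FF_le A f φ i k (t, z)
    have m : ∀ i k, Measurable fun x => ‖DxA 1 (A i k) (t, x)‖ₑ ^ y⁻¹ := fun i k => by
      refine Measurable.pow_const (Measurable.enorm ?_) _
      have c : Continuous fun p : V2 × V2 => Complex.exp (IC * ((⟪p.1, p.2⟫ : ℝ) : ℂ)) * (((‖p.2‖ ^ (1:ℝ) : ℝ) : ℂ) * ft2 (sl t (A i k)) p.2) := by
        have := (ft2_dc (sl t (A i k))).1.1
        simp only [rpow_one]; fun_prop
      exact c.stronglyMeasurable.integral_prod_right.measurable.const_mul _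
    calc _ ≤ ∫⁻ x, n ^ (y⁻¹ - 1) * ∑ i, n ^ (y⁻¹ - 1) * ∑ k, ‖DxA 1 (A i k) (t, x)‖ₑ ^ y⁻¹ := by
          refine lintegral_mono fun x => ?_
          have r := fun g : Fin n → ENN => ENNReal.rpow_sum_le_const_mul_sum_rpow Finset.univ g q1.le
          simp only [Finset.card_univ, Fintype.card_fin] at r
          refine (r _).trans ?_
          gcongr with i
          exact r _
      _ = n ^ (y⁻¹ - 1) * ∑ i, n ^ (y⁻¹ - 1) * ∑ k, ∫⁻ x, ‖DxA 1 (A i k) (t, x)‖ₑ ^ y⁻¹ := by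
          rw [lintegral_const_mul' _ _ nn, lintegral_finsetSum _ fun i _ => (Finset.measurable_fun_sum _ fun k _ => m i k).const_mul _]
          congr 1; refine Finset.sum_congr rfl fun i _ => ?_
          rw [lintegral_const_mul' _ _ nn, lintegral_finsetSum _ fun k _ => m i k]
      _ ≤ n ^ (y⁻¹ - 1) * ∑ i : Fin n, n ^ (y⁻¹ - 1) * ∑ k : Fin n, C * ∫⁻ x, Ia 1 (fun z => Hs A f φ (t, z)) x ^ y⁻¹ := by
          gcongr with i _ k; exact b i k
      _ = _ := by simp [hc, mul_assoc]

lemma ed_meas (l : ℝ) : Measurable fun p : V2 × V2 => edist p.1 p.2 ^ l := (measurable_fst.edist measurable_snd).pow_const l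

lemma Ia_meas (a : ℝ) {w : RV → ENN} (hw : Measurable w) : Measurable fun p : RV => Ia a (fun z => w (p.1, z)) p.2 := by
  unfold Ia
  split_ifs
  · have : Measurable fun q : RV × V2 => w (q.1.1, q.2) * edist q.1.2 q.2 ^ (-(1 + a)) :=
      (hw.comp ((measurable_fst.comp measurable_fst).prodMk measurable_snd)).mul (((measurable_snd.comp measurable_fst).edist measurable_snd).pow_const _)
    exact this.lintegral_prod_right'
  · exact hw

lemma Ia_symm (a : ℝ) {h w : V2 → ENN} (hh : Measurable h) (hw : Measurable w) : ∫⁻ z, Ia a h z * w z = ∫⁻ z, h z * Ia a w z := by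
  unfold Ia
  split_ifs
  · have e := ed_meas (-(1 + a))
    have m : Measurable fun p : V2 × V2 => h p.2 * edist p.1 p.2 ^ (-(1 + a)) * w p.1 := ((hh.comp measurable_snd).mul e).mul (hw.comp measurable_fst)
    calc _ = ∫⁻ z, ∫⁻ z', h z' * edist z z' ^ (-(1 + a)) * w z := by
          congr 1; ext z; rw [lintegral_mul_const]
          exact hh.mul (measurable_const.edist measurable_id |>.pow_const _)
      _ = ∫⁻ z', ∫⁻ z, h z' * edist z z' ^ (-(1 + a)) * w z := lintegral_lintegral_swap m.aemeasurable
      _ = _ := by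
          congr 1; ext z'
          have : Measurable fun z => w z * edist z' z ^ (-(1 + a)) := hw.mul (measurable_const.edist measurable_id |>.pow_const _)
          rw [← lcmu _ this]
          congr 1; ext z; rw [edist_comm]; ring
  · rfl

lemma HL {a y : ℝ} (ha : 0 ≤ a) (ha1 : a ≤ 1) (hy0 : 0 < y) (hy1 : y < 1) (hya : y < (1 + a) / 2) : ∃ C : ENN, C ≠ ⊤ ∧ ∀ h w : V2 → ENN, Measurable h → Measurable w →
    ∫⁻ z, h z * Ia a w z ≤ C * ((∫⁻ z, h z ^ (y + (1 - a) / 2)⁻¹) ^ (y + (1 - a) / 2) * (∫⁻ z, w z ^ (1 - y)⁻¹) ^ (1 - y)) := by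
  have r0 : 0 < y + (1 - a) / 2 := by linarith
  rcases ha1.lt_or_eq with h | rfl
  · obtain ⟨C, hC, H⟩ := HLS (E := V2) (μ := volume) 2 (1 + a) (y + (1 - a) / 2)⁻¹ (1 - y)⁻¹ la la ((one_lt_inv₀ r0).2 la) ((one_lt_inv₀ la).2 la) (by simp only [one_div, inv_inv]; ring) (ofReal π) ENNReal.ofReal_ne_top (fun x ρ _ => by rw [EuclideanSpace.volume_ball_fin_two, ENNReal.rpow_two]; exact (mul_comm _ _).le)
    refine ⟨C, hC, fun f w hf hw => ?_⟩
    have := H f w hf hw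
    simp only [one_div, inv_inv] at this
    simpa only [Ia, if_pos h] using this
  · refine ⟨1, by simp, fun f w hf hw => ?_⟩
    have c : (y⁻¹).HolderConjugate ((1 - y)⁻¹) := by
      rw [Real.holderConjugate_iff]; exact ⟨(one_lt_inv₀ hy0).2 hy1, by rw [inv_inv, inv_inv]; ring⟩
    have := lintegral_mul_le_Lp_mul_Lq volume c hf.aemeasurable hw.aemeasurable
    simpa [Ia] using this

lemma HOL {a y : ℝ} (hy : a / 2 < y) {g h : V2 → ENN} (hg : Measurable g) (hh : Measurable h) :
    (∫⁻ z, (g z * h z) ^ (y + (1 - a) / 2)⁻¹) ^ (y + (1 - a) / 2) ≤ (∫⁻ z, g z ^ (y - a / 2)⁻¹) ^ (y - a / 2) * (∫⁻ z, h z ^ 2) ^ ((1:ℝ)/2) := by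
  have := ENNReal.lintegral_Lp_mul_le_Lq_mul_Lr (p := (y + (1 - a) / 2)⁻¹) (q := (y - a / 2)⁻¹) (r := 2) (inv_pos.2 la) (by gcongr <;> linarith) (by simp only [one_div, inv_inv]; ring) (volume : Measure V2) hg.aemeasurable hh.aemeasurable
  simpa only [one_div, inv_inv, ENNReal.rpow_two, Pi.mul_apply] using this

lemma BIL {s θ a x x' y : ℝ} (hθ : 1/2 < θ) (ha : 0 ≤ a) (ha1 : a ≤ 1) (hx' : 0 ≤ x') (hxx : x' ≤ x) (hx1 : x < 1) (hy0 : 0 < y) (hy1 : y < 1) (h2 : 2 * x' < 1 - y)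
    (h3 : 2 * x' < 1 + a - 2 * y) (hs : 1 + a - 2 * y - x' ≤ 2 * s) : ∃ C : ENN, C ≠ ⊤ ∧ ∀ (u v : SW) (w : RV → ENN), Measurable w →
    ∫⁻ p, ‖u p‖ₑ * ‖v p‖ₑ * Ia a (fun z => w (p.1, z)) p.2 ≤ C * LtR (1 - x) (fun t => (∫⁻ z, w (t, z) ^ (1 - y)⁻¹) ^ (1 - y)) * (HN s θ u * HN s θ v) := by
  have main : ∃ C : ENN, C ≠ ⊤ ∧ ∀ (u : SW) (w : RV → ℝ), Wok w →
    ∫⁻ p, ‖u p‖ₑ^2 * Ia a (fun z => ofReal (w (p.1, z))) p.2 ≤ C * LtR (1 - x) (fun t => Nw w y t ^ (1 - y)) * HN s θ u ^ 2 := by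
    rcases ha1.lt_or_eq with h | rfl
    · simp only [Ia, if_pos h]; exact QF hθ ha h hx' hxx hx1 hy0 hy1 h2.le h3 hs
    · simp only [Ia, lt_irrefl, if_false]; exact QF1 hθ hx' hxx hx1 hy0 hy1 h2 la
  obtain ⟨C, hC, H⟩ := main
  refine ⟨C, hC, EXT la hy1 (fun w p => Ia a (fun z => w (p.1, z)) p.2) (fun w hw => Ia_meas a hw) (fun w hw hm => ?_) H⟩
  ext p
  simp only [Ia, iSup_apply]
  split_ifs
  · rw [← lintegral_iSup]
    · congr 1; ext z; rw [ENNReal.iSup_mul]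
    · exact fun n => ((hw n).comp fp).mul (measurable_const.edist measurable_id |>.pow_const _)
    · exact fun n m h z => mul_le_mul_left (hm h _) _
  · rfl

lemma BILM {J : RV → ENN} (hJ : Measurable J) {s θ : ℝ} {K : ENN} (H : ∀ u v : SW, ∫⁻ p, ‖u p‖ₑ * ‖v p‖ₑ * J p ≤ K * (HN s θ u * HN s θ v))
    {n : ℕ} (U V : Fin n → Fin n → SW) : ∫⁻ p, mE (cF U) p * mE (cF V) p * J p ≤ K * (HNM s θ (cF U) * HNM s θ (cF V)) := by
  have m : ∀ u : SW, Measurable fun p => ‖u p‖ₑ := fun u => u.continuous.measurable.enorm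
  have h1 : ∀ v : SW, ∫⁻ p, mE (cF U) p * ‖v p‖ₑ * J p ≤ K * (HNM s θ (cF U) * HN s θ v) := fun v => by
    simp only [HNM, mE, Finset.sum_mul, Finset.mul_sum]
    have M : ∀ i k, Measurable fun p => (‖cF U i k p‖₊ : ENN) * ‖v p‖ₑ * J p := fun i k => ((m (U i k)).mul (m v)).mul hJ
    rw [lintegral_finsetSum _ fun i _ => Finset.measurable_fun_sum _ fun k _ => M i k]
    refine Finset.sum_le_sum fun i _ => ?_
    rw [lintegral_finsetSum _ fun k _ => M i k]
    exact Finset.sum_le_sum fun k _ => H (U i k) v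
  have e : ∀ p, mE (cF U) p * mE (cF V) p * J p = ∑ i, ∑ k, mE (cF U) p * ‖V i k p‖ₑ * J p := fun p => by
    rw [mE.eq_def (cF V)]; simp only [Finset.sum_mul, Finset.mul_sum]; rfl
  have e2 : K * (HNM s θ (cF U) * HNM s θ (cF V)) = ∑ i, ∑ k, K * (HNM s θ (cF U) * HN s θ (V i k)) := by
    rw [HNM.eq_def s θ (cF V)]; simp only [Finset.mul_sum]; rfl
  simp only [e, e2]
  have M : ∀ i k, Measurable fun p => mE (cF U) p * ‖V i k p‖ₑ * J p := fun i k => ((mE_meas U).mul (m (V i k))).mul hJ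
  rw [lintegral_finsetSum _ fun i _ => Finset.measurable_fun_sum _ fun k _ => M i k]
  refine Finset.sum_le_sum fun i _ => ?_
  rw [lintegral_finsetSum _ fun k _ => M i k]
  exact Finset.sum_le_sum fun k _ => h1 (V i k)

lemma gN_le {n : ℕ} (s θ : ℝ) (j : Fin 2) (f : Fin n → Fin n → SW) : HNM s θ (cF (pm j f)) ≤ gradN s θ f := by
  have e : ∀ b : ENN, b = (b^2) ^ ((1:ℝ)/2) := fun b => by
    rw [← ENNReal.rpow_two, ← Erm]; norm_num
  rw [gradN, e (HNM s θ (cF (pm j f))), pm_eq, pm_eq]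
  gcongr
  fin_cases j
  · exact le_self_add
  · exact le_add_self

lemma SQ {ι : Type*} [Fintype ι] {g : ι → V2 → ENN} (hg : ∀ i, Measurable (g i)) {B : ENN} (h : ∀ i, ∫⁻ z, g i z ^ 2 ≤ B) : ∫⁻ z, (∑ i, g i z) ^ 2 ≤ Fintype.card ι * (Fintype.card ι * B) := by
  calc _ ≤ ∫⁻ z, Fintype.card ι * ∑ i, g i z ^ 2 := by
        refine lintegral_mono fun z => ?_
        have := ENNReal.rpow_sum_le_const_mul_sum_rpow Finset.univ (fun i => g i z) (p := 2) nu
        rw [show (2 - 1 : ℝ) = 1 by norm_num, ENNReal.rpow_one] at this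
        simpa only [ENNReal.rpow_two, Finset.card_univ] using this
    _ = Fintype.card ι * ∑ i, ∫⁻ z, g i z ^ 2 := by
        rw [lintegral_const_mul' _ _ (by simp), lintegral_finsetSum _ fun i _ => (hg i).pow_const 2]
    _ ≤ _ := by
        gcongr
        refine (Finset.sum_le_sum fun i _ => h i).trans ?_
        simp

lemma SgL2 {s θ : ℝ} (hs : 0 < s) (hθ : 1/2 < θ) (n : ℕ) : ∃ C : ENN, C ≠ ⊤ ∧ ∀ f : Fin n → Fin n → SW, ∀ᵐ t, (∫⁻ y, Sg f (t, y) ^ 2) ^ ((1:ℝ)/2) ≤ C * gradN s θ f := by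
  obtain ⟨C, hC, H⟩ := L2I hs hθ
  set c : ENN := 2 * (2 * (n * (n * (n * (n * C))))) with hc
  refine ⟨c ^ ((1:ℝ)/2), Ert nu (by finiteness), fun f => ?_⟩
  have := ae_all_iff.2 fun j => ae_all_iff.2 fun i => ae_all_iff.2 fun k => H (pm j f i k)
  filter_upwards [this] with t ht
  have m : ∀ u : SW, Measurable fun z => ‖u (t, z)‖ₑ := fun u => (sl t u).continuous.measurable.enorm
  have b : ∀ j i k, ∫⁻ y, ‖pm j f i k (t, y)‖ₑ^2 ≤ C * gradN s θ f ^ 2 := fun j i k => by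
    refine (ht j i k).trans ?_
    gcongr
    refine le_trans ?_ (gN_le s θ j f)
    exact (Finset.single_le_sum (f := fun k => HN s θ (pm j f i k)) (fun _ _ => bot_le) (Finset.mem_univ k)).trans (Finset.single_le_sum (f := fun i => ∑ k, HN s θ (pm j f i k)) (fun _ _ => bot_le) (Finset.mem_univ i))
  have := SQ (fun j => Finset.measurable_fun_sum _ fun i _ => Finset.measurable_fun_sum _ fun k _ => m (pm j f i k)) fun j => SQ (fun i => Finset.measurable_fun_sum _ fun k _ => m (pm j f i k)) fun i => SQ (fun k => m (pm j f i k)) fun k => b j i k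
  simp only [sum_univ_two, Fintype.card_fin] at this
  calc _ ≤ (c * gradN s θ f ^ 2) ^ ((1:ℝ)/2) := by
        gcongr
        refine this.trans (le_of_eq ?_)
        rw [hc]; push_cast; ring
    _ = _ := by
        rw [Emn _ _ nu, ← ENNReal.rpow_two, ← Erm]; norm_num

lemma Lq_meas {w : RV → ENN} (hw : Measurable w) (q r : ℝ) : Measurable fun t => (∫⁻ z, w (t, z) ^ q) ^ r :=
  ((hw.pow_const q).lintegral_prod_right').pow_const r

lemma ABS {s θ a x x' y : ℝ} (n : ℕ) (hs0 : 0 < s) (hθ : 1/2 < θ) (ha : 0 ≤ a) (ha1 : a ≤ 1) (hx' : 0 ≤ x') (hxx : x' ≤ x) (hx1 : x < 1) (hy0 : 0 < y) (hy1 : y < 1) (hya : a / 2 < y) (hya2 : y < (1 + a) / 2) (h2 : 2 * x' < 1 - y)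
    (h3 : 2 * x' < 1 + a - 2 * y) (hs : 1 + a - 2 * y - x' ≤ 2 * s) : ∃ C : ENN, C ≠ ⊤ ∧ ∀ A f φ : Fin n → Fin n → SW,
    LtR x (fun t => (∫⁻ z, Ia a (fun z => Hs A f φ (t, z)) z ^ y⁻¹) ^ y) ≤ C * (gradN s θ f * LtR x (LqAt (y - a / 2)⁻¹ (cF A)) + HNM s θ (cF φ) * gradN s θ f) := by
  obtain ⟨C1, hC1, H1⟩ := HL ha ha1 hy0 hy1 hya2
  obtain ⟨C2, hC2, H2⟩ := BIL hθ ha ha1 hx' hxx hx1 hy0 hy1 h2 h3 hs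
  obtain ⟨C3, hC3, H3⟩ := SgL2 hs0 hθ n
  refine ⟨2 * (C1 * C3) + 4 * C2, by finiteness, fun A f φ => ?_⟩
  have x0 := hx'.trans hxx
  refine DUAL x y x0 hx1 hy0 hy1 (fun p => Ia a (fun z => Hs A f φ (p.1, z)) p.2) (Ia_meas a (Hs_meas A f φ)) _ fun w hw => ?_
  set N := LtR (1 - x) (fun t => (∫⁻ z, w (t, z) ^ (1 - y)⁻¹) ^ (1 - y)) with hN
  set J : RV → ENN := fun p => Ia a (fun z => w (p.1, z)) p.2 with hJ
  have mJ : Measurable J := Ia_meas a hw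
  set Y := LtR x (LqAt (y - a / 2)⁻¹ (cF A))
  set g := gradN s θ f
  have mt : ∀ {v : RV → ENN} (t : ℝ), Measurable v → Measurable fun z => v (t, z) := fun t hv => hv.comp fp
  have m1 : Measurable fun p => mE (cF A) p * Sg f p * J p := ((mE_meas A).mul (Sg_meas f)).mul mJ
  have m2 : Measurable fun p => Sg f p * mE (cF φ) p * J p := ((Sg_meas f).mul (mE_meas φ)).mul mJ
  have T1 : ∫⁻ t, ∫⁻ z, mE (cF A) (t, z) * Sg f (t, z) * J (t, z) ≤ C1 * C3 * (g * Y) * N := by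
    calc _ ≤ ∫⁻ t, C1 * (C3 * g) * (LqAt (y - a / 2)⁻¹ (cF A) t * (∫⁻ z, w (t, z) ^ (1 - y)⁻¹) ^ (1 - y)) := by
          refine lintegral_mono_ae ?_
          filter_upwards [H3 f] with t ht
          refine (H1 (fun z => mE (cF A) (t, z) * Sg f (t, z)) (fun z => w (t, z)) (mt t ((mE_meas A).mul (Sg_meas f))) (mt t hw)).trans ?_
          rw [mul_assoc]
          refine mul_le_mul_right ?_ _
          rw [← mul_assoc]
          refine mul_le_mul_left ((HOL hya (mt t (mE_meas A)) (mt t (Sg_meas f))).trans ?_) _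
          rw [mul_comm, LqAt, inv_inv]
          exact mul_le_mul_left ht _
      _ = C1 * (C3 * g) * ∫⁻ t, LqAt (y - a / 2)⁻¹ (cF A) t * (∫⁻ z, w (t, z) ^ (1 - y)⁻¹) ^ (1 - y) :=
          lcmu _ ((Lq_meas (mE_meas A) _ _).mul (Lq_meas hw _ _))
      _ ≤ C1 * (C3 * g) * (Y * N) := mul_le_mul_right (HOLDT x0 hx1 (Lq_meas (mE_meas A) _ _) (Lq_meas hw _ _)) _
      _ = _ := by ring
  have T2 : ∫⁻ t, ∫⁻ z, Sg f (t, z) * mE (cF φ) (t, z) * J (t, z) ≤ 2 * C2 * (HNM s θ (cF φ) * g) * N := by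
    rw [← lintegral_prod _ m2.aemeasurable]
    have b := fun j => (BILM mJ (fun u v => H2 u v w hw) (pm j f) φ).trans (mul_le_mul_right (mul_le_mul_left (gN_le s θ j f) _) _)
    calc _ = (∫⁻ p, mE (cF (pm 0 f)) p * mE (cF φ) p * J p) + ∫⁻ p, mE (cF (pm 1 f)) p * mE (cF φ) p * J p := by
          have : Measurable fun p => mE (cF (pm 0 f)) p * mE (cF φ) p * J p := ((mE_meas (pm 0 f)).mul (mE_meas φ)).mul mJ
          rw [← lintegral_add_left this]
          congr 1; ext p; simp only [Sg]; ring
      _ ≤ _ := (add_le_add (b 0) (b 1)).trans (le_of_eq (by ring))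
  calc _ = ∫⁻ t, ∫⁻ z, 2 * (mE (cF A) (t, z) * Sg f (t, z) * J (t, z)) + 2 * (Sg f (t, z) * mE (cF φ) (t, z) * J (t, z)) := by
        congr 1; ext t
        rw [Ia_symm a (mt t (Hs_meas A f φ)) (mt t hw)]
        congr 1; ext z; simp only [Hs, hJ]; ring
    _ = 2 * (∫⁻ t, ∫⁻ z, mE (cF A) (t, z) * Sg f (t, z) * J (t, z)) + 2 * ∫⁻ t, ∫⁻ z, Sg f (t, z) * mE (cF φ) (t, z) * J (t, z) := by
        rw [← lcmu _ m1.lintegral_prod_right', ← lcmu _ m2.lintegral_prod_right', ← lintegral_add_left (m1.lintegral_prod_right'.const_mul 2)]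
        congr 1; ext t
        rw [lintegral_add_left ((mt t m1).const_mul 2), lcmu _ (mt t m1), lcmu _ (mt t m2)]
    _ ≤ 2 * (C1 * C3 * (g * Y) * N) + 2 * (2 * C2 * (HNM s θ (cF φ) * g) * N) := by gcongr
    _ = (2 * (C1 * C3) * (g * Y) + 4 * C2 * (HNM s θ (cF φ) * g)) * N := by ring
    _ ≤ _ := by
        refine mul_le_mul_left ?_ _
        rw [mul_add]
        gcongr
        · exact le_self_add
        · exact le_add_self

lemma dom {n : ℕ} (A : Fin n → Fin n → SW) : ∃ M : ENN, M ≠ ⊤ ∧ ∀ t z, mE (cF A) (t, z) ≤ M * (ofReal ((1 + t^2)⁻¹) * ofReal ((1 + ‖z‖^2)⁻¹)) := by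
  have h : ∀ i k, ∃ M : ℝ, ∀ u, ‖A i k u‖ ≤ M * ((1 + ‖u‖^2)⁻¹)^2 := fun i k => (SDc (A i k)).2
  choose M hM using h
  refine ⟨∑ i, ∑ k, ofReal (M i k), ENNReal.sum_ne_top.2 fun i _ => ENNReal.sum_ne_top.2 fun k _ => ENNReal.ofReal_ne_top, fun t z => ?_⟩
  rw [mE, Finset.sum_mul]
  refine Finset.sum_le_sum fun i _ => ?_
  rw [Finset.sum_mul]
  refine Finset.sum_le_sum fun k _ => ?_
  have hb := hM i k (t, z)
  have h0 : 0 ≤ M i k := by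
    have := (norm_nonneg _).trans (hM i k 0)
    simpa using this
  rw [← ofReal_mul ps, ← ofReal_mul h0]
  change ‖A i k (t, z)‖ₑ ≤ _
  rw [← ofReal_norm]
  refine ofReal_le_ofReal (hb.trans ?_)
  rw [pow_two]
  have h1 : |t| ≤ ‖(t, z)‖ := norm_fst_le (t, z)
  have h2 : ‖z‖ ≤ ‖(t, z)‖ := norm_snd_le (t, z)
  rw [← sq_abs t]
  gcongr

lemma FIN {x y : ℝ} (hx0 : 0 ≤ x) (hx1 : x < 1) (hy0 : 0 < y) (hy1 : y < 1) {n : ℕ} (A : Fin n → Fin n → SW) : LtR x (LqAt y⁻¹ (cF A)) ≠ ⊤ := by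
  obtain ⟨M, hM, H⟩ := dom A
  have yi : 1 < y⁻¹ := (one_lt_inv₀ hy0).2 hy1
  set I := ∫⁻ z : V2, ofReal ((1 + ‖z‖^2)⁻¹) ^ y⁻¹ with hI
  have hIf : I ≠ ⊤ := by
    have := (integrable_rpow_neg_one_add_norm_sq (E := V2) (μ := volume) (r := 2 * y⁻¹) (by simp; linarith)).lintegral_lt_top
    refine ne_of_lt (lt_of_eq_of_lt ?_ this)
    rw [hI]
    congr 1; ext z
    rw [ofReal_rpow_of_nonneg ps ps, inv_rpow ps, ← rpow_neg ps]
    congr 2; ring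
  have b : ∀ t, LqAt y⁻¹ (cF A) t ≤ M * I ^ y * ofReal ((1 + t^2)⁻¹) := fun t => by
    rw [LqAt, inv_inv]
    calc _ ≤ (∫⁻ z : V2, (M * ofReal ((1 + t^2)⁻¹)) ^ y⁻¹ * ofReal ((1 + ‖z‖^2)⁻¹) ^ y⁻¹) ^ y := by
          gcongr with z
          rw [← Emn _ _ ps, mul_assoc]
          gcongr
          exact H t z
      _ = M * ofReal ((1 + t^2)⁻¹) * I ^ y := by
          rw [lintegral_const_mul' _ _ (Ert ps (by finiteness)), Emn _ _ hy0.le, ← Erm, inv_mul_cancel₀ hy0.ne', ENNReal.rpow_one]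
      _ = _ := by ring
  have c : M * I ^ y ≠ ⊤ := ENNReal.mul_ne_top hM (Ert hy0.le hIf)
  refine ne_top_of_le_ne_top ?_ (LtR_mono hx0 b)
  rw [LtR_const_mul x hx0 _ fp]
  refine ENNReal.mul_ne_top c ?_
  have l1 : ∀ t : ℝ, ofReal ((1 + t^2)⁻¹) ≤ 1 := fun t => by
    rw [ofReal_le_one]
    exact inv_le_one_of_one_le₀ (by nlinarith [sq_nonneg t])
  rw [LtR]
  split_ifs with h
  · exact ne_top_of_le_ne_top ENNReal.one_ne_top (essSup_le_of_ae_le 1 (of_forall l1))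
  · refine Ert hx0 (ne_top_of_le_ne_top integrable_inv_one_add_sq.lintegral_lt_top.ne (lintegral_mono fun t => ?_))
    have xi : 1 < x⁻¹ := (one_lt_inv₀ (lt_of_le_of_ne hx0 (Ne.symm h))).2 hx1
    exact (ENNReal.rpow_le_rpow_of_exponent_ge (l1 t) xi.le).trans_eq (ENNReal.rpow_one _)

lemma DxU0 {n : ℕ} (A : Fin n → Fin n → SW) : DxU 0 (cF A) = cF A := by
  ext i k p
  have := (ft2_dc (sl p.1 (A i k))).2 p.2
  simp only [DxU, DxA, rpow_zero, Complex.ofReal_one, one_mul]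
  exact this

lemma STP {s θ a x x' y : ℝ} (n : ℕ) (hs0 : 0 < s) (hθ : 1/2 < θ) (ha : 0 ≤ a) (ha1 : a ≤ 1) (hx' : 0 ≤ x') (hxx : x' ≤ x) (hx1 : x < 1) (hy1 : y < 1) (hya : a / 2 < y) (hya2 : y < (1 + a) / 2) (h2 : 2 * x' < 1 - y)
    (h3 : 2 * x' < 1 + a - 2 * y) (hs : 1 + a - 2 * y - x' ≤ 2 * s) : ∃ C : ENN, C ≠ ⊤ ∧ ∀ A f φ : Fin n → Fin n → SW, EllipticEq A f φ →
    LtR x (LqAt y⁻¹ (DxU a (cF A))) ≤ C * (gradN s θ f * LtR x (LqAt (y - a / 2)⁻¹ (cF A)) + HNM s θ (cF φ) * gradN s θ f) := by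
  obtain ⟨C1, h1, H1⟩ := KEY n ha ha1 hya hy1
  obtain ⟨C2, hC2, H2⟩ := ABS n hs0 hθ ha ha1 hx' hxx hx1 la hy1 hya hya2 h2 h3 hs
  refine ⟨C1 * C2, by finiteness, fun A f φ h => ?_⟩
  refine (LtR_mono (hx'.trans hxx) (H1 A f φ h)).trans ?_
  rw [LtR_const_mul x (hx'.trans hxx) _ (Lq_meas (Ia_meas a (Hs_meas A f φ)) _ _), mul_assoc]
  exact mul_le_mul_right (H2 A f φ) _

lemma END {C D g Y P : ENN} (hC : C ≠ ⊤) (hD : D ≠ ⊤) (hY : Y ≠ ⊤) (h : Y ≤ C * (g * Y + P)) (hg : g ≤ ofReal (2 * (C.toReal + 1))⁻¹) : D * (g * Y + P) ≤ ofReal (2 * D.toReal + 1) * P := by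
  have c : C = ofReal C.toReal := (ENNReal.ofReal_toReal hC).symm
  have hp := ENNReal.toReal_nonneg (a := C)
  have gf : g ≠ ⊤ := ne_top_of_le_ne_top ENNReal.ofReal_ne_top hg
  rcases eq_or_ne P ⊤ with rfl | hP
  · rw [mul_top]
    · exact le_top
    · simp; positivity
  lift C to NNReal using hC
  lift D to NNReal using hD
  lift Y to NNReal using hY
  lift P to NNReal using hP
  lift g to NNReal using gf
  have hg' : (g:ℝ) ≤ (2 * ((C:ℝ) + 1))⁻¹ := by
    have := ENNReal.toReal_mono ENNReal.ofReal_ne_top hg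
    rwa [toReal_ofReal ps] at this
  have h' : (Y:ℝ) ≤ C * (g * Y + P) := by exact_mod_cast h
  have k : (C + 1) * (g:ℝ) ≤ 1 / 2 := by
    calc _ ≤ (C + 1) * (2 * ((C:ℝ) + 1))⁻¹ := by gcongr
      _ = _ := by field_simp
  have k2 : ((C:ℝ) + 1) * (g * Y) ≤ 1/2 * Y := by rw [← mul_assoc]; gcongr
  have k1 : (g:ℝ) * Y ≤ P := by
    have : 0 ≤ (C:ℝ) := C.2
    have : 0 ≤ (g:ℝ) * Y := by positivity
    have : 0 ≤ (P:ℝ) := P.2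
    nlinarith
  calc _ ≤ (D:ENN) * (P + P) := by
        gcongr
        exact_mod_cast k1
    _ = 2 * D * P := by ring
    _ ≤ _ := by
        gcongr
        rw [ofReal_add ps one_pos.le, ofReal_mul nu]
        simp

lemma MAINX (n : ℕ)
    (s θ a rp rq : ℝ) (hs : 0 < s) (hθ : 1 / 2 < θ)
    (ha0 : 0 ≤ a) (ha1 : a ≤ 1)
    (hp0 : 0 ≤ rp) (hq1 : rq < 1)
    (hq2 : max (max ((1 + 2 * a - 4 * s) / 3) ((1 + a - 4 * s) / 2)) (min a 1 / 2) < rq)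
    (hq3 : rq < (1 + a) / 2)
    (hp2 : 1 - 2 * rq + a - 2 * s ≤ rp) (hp3 : rp ≤ (1 / 2) * (1 - rq)) :
    ∃ ε₀ C : ℝ, 0 < ε₀ ∧ 0 < C ∧
      ∀ A0 f φ : Fin n → Fin n → SW,
        EllipticEq A0 f φ →
        gradN s θ f ≤ ofReal ε₀ →
        LtR rp (LqAt rq⁻¹ (DxU a (cF A0))) ≤
          ofReal C * (HNM s θ (cF φ) * gradN s θ f) := by
  rw [min_eq_left ha1, max_lt_iff, max_lt_iff] at hq2
  obtain ⟨⟨q1, q2⟩, q3⟩ := hq2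
  set x' := max 0 (1 + a - 2 * rq - 2 * s) with hx
  have x0 : 0 ≤ x' := le_max_left _ _
  have x1 : 1 + a - 2 * rq - 2 * s ≤ x' := le_max_right _ _
  have x2 : x' ≤ rp := max_le hp0 la
  have x3 : x' < (1 - rq) / 2 := max_lt la la
  have x4 : x' < (1 + a - 2 * rq) / 2 := max_lt la la
  have hr : rp < 1 := by linarith
  obtain ⟨D, hD, HD⟩ := STP n hs hθ ha0 ha1 x0 x2 hr hq1 q3 hq3 la la la
  obtain ⟨C, hC, HC⟩ := STP (a := 0) (y := rq - a / 2) n hs hθ le_rfl zero_le_one x0 x2 hr la la la la la la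
  refine ⟨(2 * (C.toReal + 1))⁻¹, 2 * D.toReal + 1, by positivity, by positivity, fun A f φ h hg => ?_⟩
  have e := HC A f φ h
  rw [DxU0, zero_div, sub_zero] at e
  exact (HD A f φ h).trans (END hC hD (FIN hp0 hr la la A) e hg)

end

/-- Homogeneous elliptic estimate for `A₀` (Theorem 5.1, part i):
for `s > 0`, `θ > 1/2`, `0 ≤ a ≤ 1`, and exponents `p ∈ [1,∞]`, `q ∈ (1,∞)`
(written via `rp = 1/p`, `rq = 1/q`) with
`max((1+2a-4s)/3, (1+a-4s)/2, min(a,1)/2) < 1/q < (1+a)/2`,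
`1 - 2/q + a - 2s ≤ 1/p ≤ (1/2)(1-1/q)` and `1/p < 1 - 2/q + a`,
there exist `ε₀ > 0` and `C` such that any Schwartz matrix-valued solution of
`△A₀ = -∂₁[A₀,∂₂f] + ∂₂[A₀,∂₁f] + ∂₁[∂₁f,φ] + ∂₂[∂₂f,φ]` with
`‖∇f‖_{H^{s,θ}} ≤ ε₀` satisfies `‖A₀‖_{L^p_t Ẇ^{a,q}_x} ≤ C ‖φ‖_{H^{s,θ}} ‖∇f‖_{H^{s,θ}}`. -/
theorem elliptic_homogeneous_estimate_low (n : ℕ) (hn : 1 ≤ n)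
    (s θ a rp rq : ℝ) (hs : 0 < s) (hθ : 1 / 2 < θ)
    (ha0 : 0 ≤ a) (ha1 : a ≤ 1)
    (hp0 : 0 ≤ rp) (hp1 : rp ≤ 1) (hq0 : 0 < rq) (hq1 : rq < 1)
    (hq2 : max (max ((1 + 2 * a - 4 * s) / 3) ((1 + a - 4 * s) / 2)) (min a 1 / 2) < rq)
    (hq3 : rq < (1 + a) / 2)
    (hp2 : 1 - 2 * rq + a - 2 * s ≤ rp) (hp3 : rp ≤ (1 / 2) * (1 - rq))
    (hp4 : rp < 1 - 2 * rq + a) :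
    ∃ ε₀ C : ℝ, 0 < ε₀ ∧ 0 < C ∧
      ∀ A0 f φ : Fin n → Fin n → SchwartzMap (ℝ × V2) ℂ,
        EllipticEq A0 f φ →
        gradN s θ f ≤ ENNReal.ofReal ε₀ →
        LtR rp (LqAt rq⁻¹ (DxU a (cF A0))) ≤
          ENNReal.ofReal C * (HNM s θ (cF φ) * gradN s θ f) := by
  exact MAINX n s θ a rp rq hs hθ ha0 ha1 hp0 hq1 hq2 hq3 hp2 hp3
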